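/- Let d be a positive integer and q a prime power with q > 56 d^2. Then there exists an elliptic curve over F_q with exactly q + 1 + floor(2 sqrt(q)) − d rational points if and only if q is coprime to floor(2 sqrt(q)) − d. -/

import Mathlib

set_option linter.unusedSectionVars false
set_option linter.unusedSimpArgs false

namespace WC
open WeierstrassCurve WeierstrassCurve.Affine Polynomial

section basics
variable {F : Type*} [Field F] {W : WeierstrassCurve F}

/-- x-coordinate (junk value 0 at infinity). -/
def xc : W.toAffine.Point → F
  | .zero => 0
  | .some x _ _ => x

/-- y-coordinate (junk value 0 at infinity). -/
def yc : W.toAffine.Point → F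
  | .zero => 0
  | .some _ y _ => y

@[simp] lemma xc_some {x y : F} (h : W.toAffine.Nonsingular x y) : xc (Point.some x y h) = x := rfl
@[simp] lemma yc_some {x y : F} (h : W.toAffine.Nonsingular x y) : yc (Point.some x y h) = y := rfl

lemma exists_some {P : W.toAffine.Point} (hP : P ≠ 0) :
    ∃ h : W.toAffine.Nonsingular (xc P) (yc P), P = Point.some (xc P) (yc P) h := by
  rcases P with _ | ⟨x, y, h⟩
  · exact absurd rfl hP
  · exact ⟨h, rfl⟩

lemma nonsing {P : W.toAffine.Point} (hP : P ≠ 0) : W.toAffine.Nonsingular (xc P) (yc P) :=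
  (exists_some hP).1

lemma eqn {P : W.toAffine.Point} (hP : P ≠ 0) :
    yc P ^ 2 + W.a₁ * xc P * yc P + W.a₃ * yc P =
      xc P ^ 3 + W.a₂ * xc P ^ 2 + W.a₄ * xc P + W.a₆ :=
  (W.toAffine.equation_iff _ _).1 (nonsing hP).1

lemma point_ext {P Q : W.toAffine.Point} (hP : P ≠ 0) (hQ : Q ≠ 0) (hx : xc P = xc Q)
    (hy : yc P = yc Q) : P = Q := by
  rcases P with _ | ⟨x, y, h⟩
  · exact absurd rfl hP
  rcases Q with _ | ⟨x', y', h'⟩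
  · exact absurd rfl hQ
  simp only [xc_some, yc_some] at hx hy
  subst hx; subst hy; rfl

@[simp] lemma xc_neg (P : W.toAffine.Point) : xc (-P) = xc P := by
  rcases P with _ | ⟨x, y, h⟩ <;> rfl

lemma yc_neg {P : W.toAffine.Point} (hP : P ≠ 0) : yc (-P) = -yc P - W.a₁ * xc P - W.a₃ := by
  rcases P with _ | ⟨x, y, h⟩
  · exact absurd rfl hP
  · rfl

variable [DecidableEq F]

lemma xc_eq_iff {P Q : W.toAffine.Point} (hP : P ≠ 0) (hQ : Q ≠ 0) :
    xc P = xc Q ↔ P = Q ∨ P = -Q := by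
  rcases P with _ | ⟨x, y, h⟩
  · exact absurd rfl hP
  rcases Q with _ | ⟨x', y', h'⟩
  · exact absurd rfl hQ
  exact Point.X_eq_iff

lemma ne_of_xc_ne {P Q : W.toAffine.Point} (hP : P ≠ 0) (hQ : Q ≠ 0) (h : xc P ≠ xc Q) :
    P + Q ≠ 0 ∧ P - Q ≠ 0 := by
  rw [Ne, Ne, sub_eq_zero, add_eq_zero_iff_eq_neg]
  exact ⟨fun e => h ((xc_eq_iff hP hQ).2 (Or.inr e)), fun e => h ((xc_eq_iff hP hQ).2 (Or.inl e))⟩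

lemma add_formula {P Q : W.toAffine.Point} (hP : P ≠ 0) (hQ : Q ≠ 0) (h : xc P ≠ xc Q)
    {l : F} (hl : l * (xc P - xc Q) = yc P - yc Q) :
    xc (P + Q) = l ^ 2 + W.a₁ * l - W.a₂ - xc P - xc Q ∧
    yc (P + Q) = -(l * (xc (P + Q) - xc P) + yc P) - W.a₁ * xc (P + Q) - W.a₃ := by
  rcases P with _ | ⟨x, y, h1⟩
  · exact absurd rfl hP
  rcases Q with _ | ⟨x', y', h2⟩
  · exact absurd rfl hQ
  simp only [xc_some, yc_some] at h hl
  rw [Point.add_of_X_ne h]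
  have : W.toAffine.slope x x' y y' = l := by
    rw [slope_of_X_ne h, div_eq_iff (sub_ne_zero.2 h), hl]
  simp only [xc_some, yc_some, this, addX, addY, negAddY, negY]
  exact ⟨trivial, trivial⟩

lemma addsub {P Q : W.toAffine.Point} (hP : P ≠ 0) (hQ : Q ≠ 0) (h : xc P ≠ xc Q) :
    xc (P + Q) * xc (P - Q) * (xc P - xc Q) ^ 2 =
      (xc P * xc Q) ^ 2 - W.b₄ * (xc P * xc Q) - W.b₆ * (xc P + xc Q) - W.b₈ ∧
    (xc (P + Q) + xc (P - Q)) * (xc P - xc Q) ^ 2 =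
      2 * (xc P + xc Q) * (xc P * xc Q) + W.b₂ * (xc P * xc Q) + W.b₄ * (xc P + xc Q) + W.b₆ := by
  have hQ' : -Q ≠ 0 := neg_ne_zero.2 hQ
  have hd : xc P - xc Q ≠ 0 := sub_ne_zero.2 h
  have e1 := (add_formula hP hQ h (l := (yc P - yc Q) / (xc P - xc Q)) (by field_simp)).1
  have e2 := (add_formula hP hQ' (by simpa using h)
    (l := (yc P - yc (-Q)) / (xc P - xc Q)) (by rw [xc_neg]; field_simp)).1
  rw [← sub_eq_add_neg, xc_neg, yc_neg hQ] at e2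
  have p1 := eqn hP
  have p2 := eqn hQ
  generalize xc (P + Q) = x3 at *
  generalize xc (P - Q) = x4 at *
  generalize xc P = x at *
  generalize xc Q = x' at *
  generalize yc P = y at *
  generalize yc Q = y' at *
  have f1 : x3 * (x - x') ^ 2 = (y - y') ^ 2 + W.a₁ * (y - y') * (x - x')
    - (W.a₂ + x + x') * (x - x') ^ 2 := by rw [e1]; field_simp; ring
  have f2 : x4 * (x - x') ^ 2 = (y - (-y' - W.a₁ * x' - W.a₃)) ^ 2
    + W.a₁ * (y - (-y' - W.a₁ * x' - W.a₃)) * (x - x')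
    - (W.a₂ + x + x') * (x - x') ^ 2 := by rw [e2]; field_simp; ring
  constructor
  · apply mul_right_cancel₀ (pow_ne_zero 2 hd)
    have : x3 * x4 * (x - x') ^ 2 * (x - x') ^ 2 = (x3 * (x - x') ^ 2) * (x4 * (x - x') ^ 2) := by
      ring
    rw [this, f1, f2]
    simp only [b₂, b₄, b₆, b₈]
    linear_combination ( -2 * x' * y' * W.a₁ - x' * W.a₁ * W.a₃ + x' * W.a₁ ^ 2 * x + 4 * x' *
      W.a₂ * x + 2 * x' * x ^ 2 - x' ^ 2 * W.a₁ ^ 2 - 2 * x' ^ 2 * W.a₂ + 2 * x' ^ 2 * x - 2 *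
      x' ^ 3 - 2 * y' * W.a₃ - 2 * y' ^ 2 + W.a₁ * W.a₃ * x + W.a₁ * x * y - W.a₂ * x ^ 2 + W.a₃
      * y + W.a₄ * x + W.a₆ - x ^ 3 + y ^ 2 ) * p1 + ( x' * y' * W.a₁ + x' * W.a₁ * W.a₃ + x' *
      W.a₁ ^ 2 * x + 4 * x' * W.a₂ * x + x' * W.a₄ + 2 * x' * x ^ 2 - x' ^ 2 * W.a₂ + 2 * x' ^ 2
      * x - x' ^ 3 + y' * W.a₃ + y' ^ 2 - W.a₁ * W.a₃ * x - W.a₁ ^ 2 * x ^ 2 - 4 * W.a₂ * x ^ 2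
      - 2 * W.a₄ * x - W.a₆ - 4 * x ^ 3 ) * p2
  · rw [add_mul, f1, f2]
    simp only [b₂, b₄, b₆, b₈]
    linear_combination 2 * p1 + 2 * p2

lemma two_smul_eq_zero_iff {P : W.toAffine.Point} (hP : P ≠ 0) :
    P + P = 0 ↔ 4 * xc P ^ 3 + W.b₂ * xc P ^ 2 + 2 * W.b₄ * xc P + W.b₆ = 0 := by
  have p1 := eqn hP
  have : 4 * xc P ^ 3 + W.b₂ * xc P ^ 2 + 2 * W.b₄ * xc P + W.b₆ =
     (2 * yc P + W.a₁ * xc P + W.a₃) ^ 2 := by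
    simp only [b₂, b₄, b₆]; linear_combination -4 * p1
  rw [this, sq_eq_zero_iff, add_eq_zero_iff_eq_neg]
  constructor
  · intro h
    have := congrArg yc h
    rw [yc_neg hP] at this
    linear_combination this
  · intro h
    refine point_ext hP (neg_ne_zero.2 hP) (xc_neg P).symm ?_
    rw [yc_neg hP]; linear_combination h

lemma dup {P : W.toAffine.Point} (hP : P ≠ 0) (h : P + P ≠ 0) :
    xc (P + P) * (4 * xc P ^ 3 + W.b₂ * xc P ^ 2 + 2 * W.b₄ * xc P + W.b₆) =
      xc P ^ 4 - W.b₄ * xc P ^ 2 - 2 * W.b₆ * xc P - W.b₈ := by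
  have p1 := eqn hP
  have h' := mt (two_smul_eq_zero_iff hP).2 h
  rcases P with _ | ⟨x, y, h1⟩
  · exact absurd rfl hP
  have hy : y ≠ W.toAffine.negY x y := by
    intro e
    exact h (Point.add_self_of_Y_eq e)
  rw [Point.add_self_of_Y_ne hy]
  simp only [xc_some, yc_some] at p1 h' ⊢
  rw [addX, slope_of_Y_ne rfl hy]
  have hd : y - W.toAffine.negY x y ≠ 0 := sub_ne_zero.2 hy
  have hd2 : 4 * x ^ 3 + W.b₂ * x ^ 2 + 2 * W.b₄ * x + W.b₆ = (y - W.toAffine.negY x y) ^ 2 := by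
    simp only [b₂, b₄, b₆, negY]; linear_combination -4 * p1
  rw [hd2]
  field_simp
  simp only [b₂, b₄, b₆, b₈, negY]
  grind

lemma exists_xc [IsAlgClosed F] [W.IsElliptic] (x : F) : ∃ P : W.toAffine.Point, P ≠ 0 ∧ xc P = x := by
  obtain ⟨y, hy⟩ := IsAlgClosed.exists_root
    (X ^ 2 + C (W.a₁ * x + W.a₃) * X - C (x ^ 3 + W.a₂ * x ^ 2 + W.a₄ * x + W.a₆) : F[X]) (by
      have : (X ^ 2 + C (W.a₁ * x + W.a₃) * X - C (x ^ 3 + W.a₂ * x ^ 2 + W.a₄ * x + W.a₆)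
        : F[X]).degree = 2 := by compute_degree!
      rw [this]; decide)
  have he : W.toAffine.Equation x y := by
    rw [equation_iff]
    simp [IsRoot] at hy
    linear_combination hy
  exact ⟨Point.some x y (equation_iff_nonsingular.1 he), Point.some_ne_zero _, rfl⟩

/-- finitely many points have `x`-coordinate in a finite set -/
lemma finite_xc_mem {S : Set F} (hS : S.Finite) : {P : W.toAffine.Point | xc P ∈ S}.Finite := by
  have : {P : W.toAffine.Point | xc P ∈ S} ⊆ {0} ∪ ⋃ x ∈ S, {P | P ≠ 0 ∧ xc P = x} := by
    intro P hP
    by_cases h : P = 0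
    · left; exact h
    · right; simp only [Set.mem_iUnion]; exact ⟨xc P, hP, h, rfl⟩
  refine Set.Finite.subset ((Set.finite_singleton 0).union (hS.biUnion fun x _ => ?_)) this
  by_cases hx : ∃ P : W.toAffine.Point, P ≠ 0 ∧ xc P = x
  · obtain ⟨P, hP, rfl⟩ := hx
    refine Set.Finite.subset (Set.toFinite {P, -P}) ?_
    rintro Q ⟨hQ, e⟩
    rcases (xc_eq_iff hQ hP).1 e with h | h <;> simp [h]
  · convert Set.finite_empty
    ext P; simp; intro h1 h2; exact hx ⟨P, h1, h2⟩

lemma infinite_points [IsAlgClosed F] [W.IsElliptic] : Infinite W.toAffine.Point := by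
  have : Function.Surjective (xc : W.toAffine.Point → F) := fun x => by
    obtain ⟨P, _, h⟩ := exists_xc (W := W) x; exact ⟨P, h⟩
  have := IsAlgClosed.instInfinite (K := F)
  exact Infinite.of_surjective _ ‹_›

end basics

section maps
variable {F K : Type*} [Field F] [Field K] {W : WeierstrassCurve F}

lemma vc_equation (C : VariableChange F) {x y : F} (h : (C • W).toAffine.Equation x y) :
    W.toAffine.Equation ((C.u : F) ^ 2 * x + C.r)
      ((C.u : F) ^ 3 * y + (C.u : F) ^ 2 * C.s * x + C.t) := by
  rw [equation_iff] at h ⊢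
  simp only [variableChange_a₁, variableChange_a₂, variableChange_a₃, variableChange_a₄,
    variableChange_a₆, Units.val_inv_eq_inv_val] at h
  have hu : (C.u : F) ≠ 0 := C.u.ne_zero
  generalize (C.u : F) = u at *
  field_simp at h
  linear_combination h

/-- variable change on points -/
noncomputable def vcFun [W.IsElliptic] (C : VariableChange F) :
    (C • W).toAffine.Point → W.toAffine.Point
  | .zero => .zero
  | .some x y h => .some ((C.u : F) ^ 2 * x + C.r) ((C.u : F) ^ 3 * y + (C.u : F) ^ 2 * C.s * x + C.t)
      (equation_iff_nonsingular.1 (vc_equation C h.1))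

variable [DecidableEq F] [DecidableEq K]

lemma vc_slope (C : VariableChange F) {x y x' y' : F} (h : ¬(x = x' ∧ y = (C • W).toAffine.negY x' y'))
    (h1 : (C • W).toAffine.Equation x y) (h2 : (C • W).toAffine.Equation x' y') :
    W.toAffine.slope ((C.u : F) ^ 2 * x + C.r) ((C.u : F) ^ 2 * x' + C.r)
      ((C.u : F) ^ 3 * y + (C.u : F) ^ 2 * C.s * x + C.t)
      ((C.u : F) ^ 3 * y' + (C.u : F) ^ 2 * C.s * x' + C.t) =
    C.u * (C • W).toAffine.slope x x' y y' + C.s := by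
  have hu : (C.u : F) ≠ 0 := C.u.ne_zero
  by_cases hx : x = x'
  · subst hx
    have hy : y ≠ (C • W).toAffine.negY x y' := fun e => h ⟨rfl, e⟩
    have hyy : y = y' := (Y_eq_of_X_eq h1 h2 rfl).resolve_right hy
    subst hyy
    have hy' : ((C.u : F) ^ 3 * y + (C.u : F) ^ 2 * C.s * x + C.t) ≠
      W.toAffine.negY ((C.u : F) ^ 2 * x + C.r)
        ((C.u : F) ^ 3 * y + (C.u : F) ^ 2 * C.s * x + C.t) := by
      intro e
      apply hy
      simp only [negY, variableChange_a₁, variableChange_a₃, Units.val_inv_eq_inv_val] at e ⊢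
      generalize (C.u : F) = u at *
      field_simp
      linear_combination e
    rw [slope_of_Y_ne rfl hy', slope_of_Y_ne rfl hy]
    rw [← sub_ne_zero] at hy hy'
    simp only [negY, variableChange_a₁, variableChange_a₂, variableChange_a₃, variableChange_a₄,
      Units.val_inv_eq_inv_val] at hy hy' ⊢
    generalize (C.u : F) = u at *
    rw [div_eq_iff hy', ← sub_eq_zero]
    have : u * ((3 * x ^ 2 + 2 * (u⁻¹ ^ 2 * (W.a₂ - C.s * W.a₁ + 3 * C.r - C.s ^ 2)) * x +
            u⁻¹ ^ 4 * (W.a₄ - C.s * W.a₃ + 2 * C.r * W.a₂ - (C.t + C.r * C.s) * W.a₁ + 3 * C.r ^ 2 -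
                2 * C.s * C.t) - u⁻¹ * (W.a₁ + 2 * C.s) * y) /
          (y - (-y - u⁻¹ * (W.a₁ + 2 * C.s) * x - u⁻¹ ^ 3 * (W.a₃ + C.r * W.a₁ + 2 * C.t)))) =
        (u ^ 4 * (3 * x ^ 2 + 2 * (u⁻¹ ^ 2 * (W.a₂ - C.s * W.a₁ + 3 * C.r - C.s ^ 2)) * x +
            u⁻¹ ^ 4 * (W.a₄ - C.s * W.a₃ + 2 * C.r * W.a₂ - (C.t + C.r * C.s) * W.a₁ + 3 * C.r ^ 2 -
                2 * C.s * C.t) - u⁻¹ * (W.a₁ + 2 * C.s) * y)) /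
          (u ^ 3 * (y - (-y - u⁻¹ * (W.a₁ + 2 * C.s) * x -
            u⁻¹ ^ 3 * (W.a₃ + C.r * W.a₁ + 2 * C.t)))) := by
      field_simp
    rw [this]
    have e2 : (u ^ 3 * (y - (-y - u⁻¹ * (W.a₁ + 2 * C.s) * x -
            u⁻¹ ^ 3 * (W.a₃ + C.r * W.a₁ + 2 * C.t)))) = u ^ 3 * y + u ^ 2 * C.s * x + C.t -
      (-(u ^ 3 * y + u ^ 2 * C.s * x + C.t) - W.a₁ * (u ^ 2 * x + C.r) - W.a₃) := by
      field_simp; ring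
    rw [e2, add_mul, div_mul_cancel₀ _ hy']
    field_simp
    ring
  · have hx' : (C.u : F) ^ 2 * x + C.r ≠ (C.u : F) ^ 2 * x' + C.r := by
      intro e
      apply hx
      have := add_right_cancel e
      exact mul_left_cancel₀ (pow_ne_zero 2 hu) this
    rw [slope_of_X_ne hx, slope_of_X_ne hx']
    have : x - x' ≠ 0 := sub_ne_zero.2 hx
    rw [div_eq_iff (sub_ne_zero.2 hx')]
    field_simp
    ring

/-- variable change as a homomorphism -/
noncomputable def vcHom [W.IsElliptic] (C : VariableChange F) :
    (C • W).toAffine.Point →+ W.toAffine.Point where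
  toFun := vcFun C
  map_zero' := rfl
  map_add' := by
    have hu : (C.u : F) ≠ 0 := C.u.ne_zero
    rintro (_ | ⟨x₁, y₁, h₁⟩) (_ | ⟨x₂, y₂, h₂⟩)
    any_goals rfl
    by_cases hxy : x₁ = x₂ ∧ y₁ = (C • W).toAffine.negY x₂ y₂
    · rw [Point.add_of_Y_eq hxy.1 hxy.2]
      symm
      apply Point.add_of_Y_eq
      · rw [hxy.1]
      · rw [hxy.1, hxy.2]
        simp only [negY, variableChange_a₁, variableChange_a₃, Units.val_inv_eq_inv_val]
        field_simp
        ring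
    · have hxy' : ¬ ((C.u : F) ^ 2 * x₁ + C.r = (C.u : F) ^ 2 * x₂ + C.r ∧
        ((C.u : F) ^ 3 * y₁ + (C.u : F) ^ 2 * C.s * x₁ + C.t) =
        W.toAffine.negY ((C.u : F) ^ 2 * x₂ + C.r)
          ((C.u : F) ^ 3 * y₂ + (C.u : F) ^ 2 * C.s * x₂ + C.t)) := by
        rintro ⟨e1, e2⟩
        apply hxy
        have e3 : x₁ = x₂ := mul_left_cancel₀ (pow_ne_zero 2 hu) (add_right_cancel e1)
        refine ⟨e3, ?_⟩
        subst e3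
        simp only [negY, variableChange_a₁, variableChange_a₃, Units.val_inv_eq_inv_val] at e2 ⊢
        generalize (C.u : F) = u at *
        field_simp
        linear_combination e2
      rw [Point.add_some hxy]
      simp only [vcFun]
      rw [Point.add_some hxy']
      have hsl := vc_slope C hxy h₁.1 h₂.1
      simp only [Point.some.injEq, addX, addY, negAddY, negY, hsl]
      generalize (C • W).toAffine.slope x₁ x₂ y₁ y₂ = l
      simp only [variableChange_a₁, variableChange_a₂, variableChange_a₃, Units.val_inv_eq_inv_val]
      generalize (C.u : F) = u at *
      constructor
      · field_simp
        ring
      · field_simp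
        ring

lemma vcHom_ne_zero [W.IsElliptic] (C : VariableChange F) {P : (C • W).toAffine.Point}
    (hP : P ≠ 0) : vcHom C P ≠ 0 := by
  rcases P with _ | ⟨x, y, h⟩
  · exact absurd rfl hP
  · exact Point.some_ne_zero _

lemma xc_vcHom [W.IsElliptic] (C : VariableChange F) {P : (C • W).toAffine.Point}
    (hP : P ≠ 0) : xc (vcHom C P) = (C.u : F) ^ 2 * xc P + C.r := by
  rcases P with _ | ⟨x, y, h⟩
  · exact absurd rfl hP
  · rfl

lemma yc_vcHom [W.IsElliptic] (C : VariableChange F) {P : (C • W).toAffine.Point}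
    (hP : P ≠ 0) : yc (vcHom C P) = (C.u : F) ^ 3 * yc P + (C.u : F) ^ 2 * C.s * xc P + C.t := by
  rcases P with _ | ⟨x, y, h⟩
  · exact absurd rfl hP
  · rfl

lemma vcHom_bijective [W.IsElliptic] (C : VariableChange F) :
    Function.Bijective (vcHom (W := W) C) := by
  have hu : (C.u : F) ≠ 0 := C.u.ne_zero
  constructor
  · rw [injective_iff_map_eq_zero]
    intro P hP
    by_contra h
    exact vcHom_ne_zero C h hP
  · intro P
    by_cases hP : P = 0
    · exact ⟨0, by rw [hP, map_zero]⟩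
    have hE := eqn hP
    have he : (C • W).toAffine.Equation ((xc P - C.r) / (C.u : F) ^ 2)
       ((yc P - C.s * (xc P - C.r) - C.t) / (C.u : F) ^ 3) := by
      rw [equation_iff]
      simp only [variableChange_a₁, variableChange_a₂, variableChange_a₃, variableChange_a₄,
        variableChange_a₆, Units.val_inv_eq_inv_val]
      generalize (C.u : F) = u at *
      field_simp
      linear_combination hE
    refine ⟨Point.some _ _ (equation_iff_nonsingular.1 he), ?_⟩
    refine point_ext (vcHom_ne_zero C (Point.some_ne_zero _)) hP ?_ ?_
    · rw [xc_vcHom C (Point.some_ne_zero _), xc_some]; field_simp; ring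
    · rw [yc_vcHom C (Point.some_ne_zero _), xc_some, yc_some]; field_simp; ring

/-- variable change as an additive equivalence -/
noncomputable def vcEquiv [W.IsElliptic] (C : VariableChange F) :
    (C • W).toAffine.Point ≃+ W.toAffine.Point :=
  AddEquiv.ofBijective (vcHom C) (vcHom_bijective C)

/-- point map along a field homomorphism -/
noncomputable def pmap (f : F →+* K) : W.toAffine.Point →+ (W.map f).toAffine.Point where
  toFun P := match P with
    | .zero => .zero
    | .some _ _ h => .some _ _ ((W.toAffine.map_nonsingular f.injective ..).mpr h)
  map_zero' := rfl
  map_add' := by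
    rintro (_ | ⟨x₁, y₁, h₁⟩) (_ | ⟨x₂, y₂, h₂⟩)
    any_goals rfl
    by_cases hxy : x₁ = x₂ ∧ y₁ = W.toAffine.negY x₂ y₂
    · rw [Point.add_of_Y_eq hxy.left hxy.right]
      symm
      apply Point.add_of_Y_eq (congr_arg _ hxy.left)
      rw [hxy.right]; exact (map_negY ..).symm
    · have hxy' : ¬ (f x₁ = f x₂ ∧ f y₁ = (W.map f).toAffine.negY (f x₂) (f y₂)) := by
        rintro ⟨e1, e2⟩
        rw [map_negY] at e2
        exact hxy ⟨f.injective e1, f.injective e2⟩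
      rw [Point.add_some hxy]
      refine Eq.trans ?_ (Point.add_some hxy').symm
      simp only [Point.some.injEq, map_slope, map_addX, map_addY, true_and]

lemma pmap_ne_zero (f : F →+* K) {P : W.toAffine.Point} (hP : P ≠ 0) : pmap f P ≠ 0 := by
  rcases P with _ | ⟨x, y, h⟩
  · exact absurd rfl hP
  · exact Point.some_ne_zero _

lemma pmap_eq_zero (f : F →+* K) {P : W.toAffine.Point} : pmap f P = 0 ↔ P = 0 :=
  ⟨fun h => by by_contra h'; exact pmap_ne_zero f h' h, fun h => by rw [h, map_zero]⟩

@[simp] lemma xc_pmap (f : F →+* K) (P : W.toAffine.Point) : xc (pmap f P) = f (xc P) := by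
  rcases P with _ | ⟨x, y, h⟩
  · exact (map_zero f).symm
  · rfl

@[simp] lemma yc_pmap (f : F →+* K) (P : W.toAffine.Point) : yc (pmap f P) = f (yc P) := by
  rcases P with _ | ⟨x, y, h⟩
  · exact (map_zero f).symm
  · rfl

end maps
end WC

set_option linter.unusedSectionVars false
namespace WC
open WeierstrassCurve WeierstrassCurve.Affine Polynomial

/-- the solutions of `x^q = x` are the elements of `Fq` -/
lemma fix_pow_card {k : Type*} [Field k] {Fq : Type*} [Field Fq] [Fintype Fq] (f : Fq →+* k) {x : k}
    (hx : x ^ Fintype.card Fq = x) : ∃ z, f z = x := by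
  classical
  have h0 := FiniteField.X_pow_card_sub_X_ne_zero k (p := Fintype.card Fq) Fintype.one_lt_card
  have h1 : Finset.univ.image f ⊆ (X ^ Fintype.card Fq - X : k[X]).roots.toFinset := by
    intro y hy
    obtain ⟨z, -, rfl⟩ := Finset.mem_image.1 hy
    rw [Multiset.mem_toFinset, mem_roots h0]
    simp [← map_pow, FiniteField.pow_card]
  have h2 : (X ^ Fintype.card Fq - X : k[X]).roots.toFinset.card ≤ (Finset.univ.image f).card := by
    rw [Finset.card_image_of_injective _ f.injective, Finset.card_univ]
    refine (Multiset.toFinset_card_le _).trans ((card_roots' _).trans ?_)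
    rw [FiniteField.X_pow_card_sub_X_natDegree_eq k Fintype.one_lt_card]
  have h3 := Finset.eq_of_subset_of_card_le h1 h2
  have : x ∈ (X ^ Fintype.card Fq - X : k[X]).roots.toFinset := by
    rw [Multiset.mem_toFinset, mem_roots h0]
    simp [hx]
  rw [← h3] at this
  obtain ⟨z, -, hz⟩ := Finset.mem_image.1 this
  exact ⟨z, hz⟩

section count
variable {k : Type*} [Field k] [DecidableEq k] [IsAlgClosed k] {W : WeierstrassCurve k} [W.IsElliptic]

lemma card_Spm (Fr : W.toAffine.Point →+ W.toAffine.Point) (q : ℕ)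
    (hFr : ∀ P, P ≠ 0 → Fr P ≠ 0 ∧ xc (Fr P) = xc P ^ q)
    (S : Finset k) (hS : ∀ x, x ∈ S ↔ x ^ q = x) (hSc : S.card = q) :
    {P | Fr P = P}.Finite ∧ {P | Fr P = -P}.Finite ∧
    Set.ncard {P | Fr P = P} + Set.ncard {P | Fr P = -P} = 2 * q + 2 := by
  have hx : ∀ P, P ≠ 0 → (Fr P = P ∨ Fr P = -P ↔ xc P ∈ S) := by
    intro P hP
    rw [hS, ← (hFr P hP).2, xc_eq_iff (hFr P hP).1 hP]
  have hfin : {P : W.toAffine.Point | xc P ∈ insert 0 S}.Finite :=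
    (finite_xc_mem (insert 0 S).finite_toSet)
  have key : ∀ P, Fr P = P ∨ Fr P = -P → xc P ∈ insert 0 S := by
    intro P h
    by_cases hP : P = 0
    · subst hP; exact Finset.mem_insert_self _ _
    · exact Finset.mem_insert_of_mem ((hx P hP).1 h)
  have f1 : {P | Fr P = P}.Finite := hfin.subset fun P h => key P (Or.inl h)
  have f2 : {P | Fr P = -P}.Finite := hfin.subset fun P h => key P (Or.inr h)
  refine ⟨f1, f2, ?_⟩
  classical
  -- pass to `Finset`s with map `xo : Point → Option k`
  let xo : W.toAffine.Point → Option k := fun P => if P = 0 then none else some (xc P)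
  rw [Set.ncard_eq_toFinset_card _ f1, Set.ncard_eq_toFinset_card _ f2]
  have m1 : ∀ P ∈ f1.toFinset, xo P ∈ Finset.insertNone S := by
    intro P h
    simp only [xo]
    split_ifs with hP
    · simp
    · simp only [Finset.some_mem_insertNone]
      exact (hx P hP).1 (Or.inl (by simpa using h))
  have m2 : ∀ P ∈ f2.toFinset, xo P ∈ Finset.insertNone S := by
    intro P h
    simp only [xo]
    split_ifs with hP
    · simp
    · simp only [Finset.some_mem_insertNone]
      exact (hx P hP).1 (Or.inr (by simpa using h))
  rw [Finset.card_eq_sum_card_fiberwise m1, Finset.card_eq_sum_card_fiberwise m2,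
    ← Finset.sum_add_distrib]
  have : ∀ b ∈ Finset.insertNone S, (f1.toFinset.filter (fun P => xo P = b)).card +
      (f2.toFinset.filter (fun P => xo P = b)).card = 2 := by
    intro b hb
    rcases b with _ | x
    · have e1 : f1.toFinset.filter (fun P => xo P = none) = {0} := by
        ext P; simp [xo]; rintro rfl; simp
      have e2 : f2.toFinset.filter (fun P => xo P = none) = {0} := by
        ext P; simp [xo]; rintro rfl; simp
      rw [e1, e2]; rfl
    · obtain ⟨P, hP, rfl⟩ := exists_xc (W := W) x
      have hxo : ∀ Q, xo Q = some (xc P) ↔ Q = P ∨ Q = -P := by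
        intro Q
        simp only [xo]
        split_ifs with hQ
        · subst hQ
          simp [eq_comm, hP]
        · rw [Option.some_inj, xc_eq_iff hQ hP]
      have hb' : xc P ∈ S := by simpa using hb
      have h := (hx P hP).2 hb'
      have hnn : ∀ Q : W.toAffine.Point, -Q = Q → Q = -Q := fun Q h => h.symm
      by_cases h2 : P = -P
      · have hp : Fr P = P := by
          rcases h with h | h
          · exact h
          · rw [h, ← h2]
        have e1 : f1.toFinset.filter (fun Q => xo Q = some (xc P)) = {P} := by
          ext Q; simp only [Finset.mem_filter, hxo, ← h2]; simp
          rintro rfl; exact hp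
        have e2 : f2.toFinset.filter (fun Q => xo Q = some (xc P)) = {P} := by
          ext Q; simp only [Finset.mem_filter, hxo, ← h2]; simp
          rintro rfl; rw [hp]; exact h2
        rw [e1, e2]; rfl
      · rcases h with h | h
        · have e1 : f1.toFinset.filter (fun Q => xo Q = some (xc P)) = {P, -P} := by
            ext Q; simp only [Finset.mem_filter, hxo]; simp
            rintro (rfl | rfl)
            · exact h
            · rw [map_neg, h]
          have e2 : f2.toFinset.filter (fun Q => xo Q = some (xc P)) = ∅ := by
            ext Q; simp only [Finset.mem_filter, hxo]; simp
            intro h3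
            constructor
            · rintro rfl; rw [h] at h3; exact h2 h3
            · rintro rfl; rw [map_neg, h, neg_neg] at h3; exact h2 h3.symm
          rw [e1, e2, Finset.card_pair h2]; rfl
        · have e1 : f1.toFinset.filter (fun Q => xo Q = some (xc P)) = ∅ := by
            ext Q; simp only [Finset.mem_filter, hxo]; simp
            intro h3
            constructor
            · rintro rfl; rw [h] at h3; exact h2 h3.symm
            · rintro rfl; rw [map_neg, h, neg_neg] at h3; exact h2 h3
          have e2 : f2.toFinset.filter (fun Q => xo Q = some (xc P)) = {P, -P} := by
            ext Q; simp only [Finset.mem_filter, hxo]; simp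
            rintro (rfl | rfl)
            · exact h
            · rw [map_neg, h]
          rw [e1, e2, Finset.card_pair h2]; rfl
  rw [Finset.sum_congr rfl this, Finset.sum_const, Finset.card_insertNone, hSc]
  simp; ring

/-- the points over the finite field are the Frobenius-fixed points -/
lemma card_points_finite {Fq : Type*} [Field Fq] [Fintype Fq] [DecidableEq Fq] (f : Fq →+* k)
    (E : WeierstrassCurve Fq) :
    Nat.card E.toAffine.Point = Set.ncard {P : (E.map f).toAffine.Point |
      xc P ^ Fintype.card Fq = xc P ∧ yc P ^ Fintype.card Fq = yc P} := by
  have hfix : ∀ x : k, x ^ Fintype.card Fq = x → ∃ z, f z = x := by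
    intro x hx
    exact fix_pow_card f hx
  have hfix' : ∀ z : Fq, f z ^ Fintype.card Fq = f z := by
    intro z; rw [← map_pow, FiniteField.pow_card]
  rw [← Nat.card_coe_set_eq]
  refine Nat.card_congr (Equiv.ofBijective (fun P => ⟨pmap f P, ?_⟩) ⟨?_, ?_⟩)
  · simp [hfix']
  · intro P Q h
    have h' : pmap f P = pmap f Q := congrArg Subtype.val h
    have : pmap f (P - Q) = 0 := by rw [map_sub, h', sub_self]
    rw [pmap_eq_zero] at this
    exact sub_eq_zero.1 this
  · rintro ⟨P, h1, h2⟩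
    by_cases hP : P = 0
    · exact ⟨0, by simp [hP]⟩
    obtain ⟨x, hx⟩ := hfix _ h1
    obtain ⟨y, hy⟩ := hfix _ h2
    have hn := nonsing hP
    rw [← hx, ← hy] at hn
    have hn' := (E.toAffine.map_nonsingular f.injective x y).1 hn
    refine ⟨Point.some x y hn', Subtype.ext ?_⟩
    exact point_ext (pmap_ne_zero f (Point.some_ne_zero _)) hP (by simp [hx]) (by simp [hy])

end count
end WC

set_option linter.unusedSectionVars false
namespace WC
open WeierstrassCurve WeierstrassCurve.Affine Polynomial

section asub
/-- explicit form of Mathlib's `addSubMap` -/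
def asub {R : Type*} [CommRing R] (W : WeierstrassCurve R) (s : Fin 3 → R) : Fin 3 → R :=
  ![s 0 ^ 2 - W.b₄ * s 0 * s 2 - W.b₆ * s 1 * s 2 - W.b₈ * s 2 ^ 2,
    2 * s 1 * s 0 + W.b₂ * s 0 * s 2 + W.b₄ * s 1 * s 2 + W.b₆ * s 2 ^ 2,
    s 1 ^ 2 - 4 * s 0 * s 2]

lemma asub_eq {R : Type*} [CommRing R] (W : WeierstrassCurve R) (s : Fin 3 → R) (i : Fin 3) :
    asub W s i = (addSubMap W i).eval s := by
  fin_cases i <;> simp [asub, addSubMap]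

lemma asub_ne_zero {F : Type*} [Field F] (W : WeierstrassCurve F) [W.IsElliptic] {s : Fin 3 → F}
    (h : ∃ i, s i ≠ 0) : ∃ i, asub W s i ≠ 0 := by
  have h1 : s ≠ 0 := by rintro rfl; simp at h
  have h2 := addSubMap_ne_zero W h1
  by_contra! h3
  exact h2 (funext fun i => by rw [← asub_eq]; exact h3 i)

lemma map_asub {R S : Type*} [CommRing R] [CommRing S] (f : R →+* S) (W : WeierstrassCurve R)
    (s : Fin 3 → R) (i : Fin 3) : f (asub W s i) = asub (W.map f) (fun i => f (s i)) i := by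
  fin_cases i <;> simp [asub, map_ofNat]

lemma asub_smul {R : Type*} [CommRing R] (W : WeierstrassCurve R) (s : Fin 3 → R) (c : R)
    (i : Fin 3) : asub W (fun i => c * s i) i = c ^ 2 * asub W s i := by
  fin_cases i <;> simp [asub] <;> ring

/-- symmetric square -/
def sm {R : Type*} [CommRing R] (u v : Fin 2 → R) : Fin 3 → R :=
  ![u 0 * v 0, u 0 * v 1 + u 1 * v 0, u 1 * v 1]

lemma map_sm {R S : Type*} [CommRing R] [CommRing S] (f : R →+* S) (u v : Fin 2 → R) (i : Fin 3) :
    f (sm u v i) = sm (fun i => f (u i)) (fun i => f (v i)) i := by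
  fin_cases i <;> simp [sm]

lemma sm_smul {R : Type*} [CommRing R] (u v : Fin 2 → R) (a b : R) (i : Fin 3) :
    sm (fun i => a * u i) (fun i => b * v i) i = a * b * sm u v i := by
  fin_cases i <;> simp [sm] <;> ring

lemma sm_ne_zero {F : Type*} [Field F] {u v : Fin 2 → F} (hu : ∃ i, u i ≠ 0) (hv : ∃ i, v i ≠ 0) :
    ∃ i, sm u v i ≠ 0 := by
  by_contra! h
  have h0 := h 0
  have h1 := h 1
  have h2 := h 2
  simp only [sm, Matrix.cons_val] at h0 h1 h2
  simp only [Fin.exists_fin_two] at hu hv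
  grind

/-- `(x : 1)` or `(1 : 0)` -/
noncomputable def xr {F : Type*} [Field F] {W : WeierstrassCurve F} (P : W.toAffine.Point) : Fin 2 → F :=
  P.xRep

variable {F : Type*} [Field F] {W : WeierstrassCurve F}
lemma xr_zero : xr (0 : W.toAffine.Point) = ![1, 0] := Point.xRep_zero
lemma xr_of_ne {P : W.toAffine.Point} (hP : P ≠ 0) : xr P = ![xc P, 1] := by
  rcases P with _ | ⟨x, y, h⟩
  · exact absurd rfl hP
  · rfl
lemma xr_ne_zero (P : W.toAffine.Point) : ∃ i, xr P i ≠ 0 := by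
  by_cases hP : P = 0
  · exact ⟨0, by simp [hP, xr_zero]⟩
  · exact ⟨1, by simp [xr_of_ne hP]⟩

variable [DecidableEq F] [W.IsElliptic]

lemma asub_xr (P Q : W.toAffine.Point) :
    ∃ c, c ≠ 0 ∧ ∀ i, asub W (sm (xr P) (xr Q)) i = c * sm (xr (P + Q)) (xr (P - Q)) i := by
  suffices h : ∃ c, ∀ i, asub W (sm (xr P) (xr Q)) i = c * sm (xr (P + Q)) (xr (P - Q)) i by
    obtain ⟨c, hc⟩ := h
    refine ⟨c, ?_, hc⟩
    rintro rfl
    obtain ⟨i, hi⟩ := asub_ne_zero W (sm_ne_zero (xr_ne_zero P) (xr_ne_zero Q))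
    exact hi (by rw [hc, zero_mul])
  by_cases hP : P = 0
  · subst hP
    by_cases hQ : Q = 0
    · subst hQ
      refine ⟨1, fun i => ?_⟩
      fin_cases i <;> simp [asub, sm, xr_zero]
    · refine ⟨1, fun i => ?_⟩
      have : -Q ≠ 0 := by simpa using hQ
      fin_cases i <;> simp [asub, sm, xr_zero, xr_of_ne hQ, xr_of_ne this, xc_neg] <;> ring
  by_cases hQ : Q = 0
  · subst hQ
    refine ⟨1, fun i => ?_⟩
    fin_cases i <;> simp [asub, sm, xr_zero, xr_of_ne hP] <;> ring
  by_cases hx : xc P = xc Q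
  · have key : ∀ P : W.toAffine.Point, P ≠ 0 → ∃ c, ∀ i, asub W (sm (xr P) (xr P)) i =
        c * sm (xr (P + P)) (xr (0 : W.toAffine.Point)) i := by
      intro P hP
      by_cases h2 : P + P = 0
      · have h3 := (two_smul_eq_zero_iff hP).1 h2
        rw [h2]
        refine ⟨(xc P) ^ 4 - W.b₄ * xc P ^ 2 - 2 * W.b₆ * xc P - W.b₈, fun i => ?_⟩
        fin_cases i <;> simp [asub, sm, xr_zero, xr_of_ne hP] 
        · ring
        · linear_combination h3
        · ring
      · have h3 := dup hP h2
        refine ⟨4 * xc P ^ 3 + W.b₂ * xc P ^ 2 + 2 * W.b₄ * xc P + W.b₆, fun i => ?_⟩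
        fin_cases i <;> simp [asub, sm, xr_zero, xr_of_ne hP, xr_of_ne h2]
        · linear_combination -h3
        · ring
        · ring
    rcases (xc_eq_iff hP hQ).1 hx with h | h
    · subst h
      obtain ⟨c, hc⟩ := key P hP
      refine ⟨c, fun i => ?_⟩
      rw [sub_self]; exact hc i
    · subst h
      have e : xr (-Q) = xr Q := by rw [xr_of_ne hP, xr_of_ne hQ, xc_neg]
      have e2 : xr (-Q - Q) = xr (Q + Q) := by
        unfold xr; rw [← Point.xRep_neg]; congr 1; abel
      obtain ⟨c, hc⟩ := key Q hQ
      refine ⟨c, fun i => ?_⟩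
      rw [e, hc i, neg_add_cancel, e2]
      congr 1
      fin_cases i <;> simp [sm] <;> ring
  · obtain ⟨h1, h2⟩ := addsub hP hQ hx
    obtain ⟨n1, n2⟩ := ne_of_xc_ne hP hQ hx
    refine ⟨(xc P - xc Q) ^ 2, fun i => ?_⟩
    fin_cases i <;> simp [asub, sm, xr_of_ne hP, xr_of_ne hQ, xr_of_ne n1, xr_of_ne n2]
    · linear_combination -h1
    · linear_combination -h2
    · ring
end asub
end WC

set_option linter.unusedSectionVars false
namespace WC
open WeierstrassCurve WeierstrassCurve.Affine Polynomial

section nm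
variable {k : Type*} [Field k] (Ω : Type*) [Field Ω] [IsAlgClosed Ω] [Algebra k Ω]

/-- no common zero -/
def NZ {n : ℕ} (v : Fin n → k[X]) : Prop := ∀ ρ : Ω, ∃ i, aeval ρ (v i) ≠ 0

/-- maximal degree -/
def nm {n : ℕ} (v : Fin n → k[X]) : ℕ := Finset.univ.sup fun i => (v i).natDegree

variable {Ω}
lemma natDegree_le_nm {n : ℕ} (v : Fin n → k[X]) (i : Fin n) : (v i).natDegree ≤ nm v :=
  Finset.le_sup (f := fun i => (v i).natDegree) (Finset.mem_univ i)

lemma nm_eq {n m : ℕ} {v : Fin n → k[X]} (h : ∀ i, (v i).natDegree ≤ m)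
    (h' : ∃ i, (v i).coeff m ≠ 0) : nm v = m := by
  apply le_antisymm
  · exact Finset.sup_le fun i _ => h i
  · obtain ⟨i, hi⟩ := h'
    exact (le_natDegree_of_ne_zero hi).trans (natDegree_le_nm v i)

lemma NZ.exists_top {n : ℕ} {v : Fin n → k[X]} (h : NZ Ω v) : ∃ i, (v i).coeff (nm v) ≠ 0 := by
  obtain ⟨i, hi⟩ := h 0
  have hi' : v i ≠ 0 := by rintro h; simp [h] at hi
  by_cases h0 : nm v = 0
  · refine ⟨i, ?_⟩
    have h1 : (v i).natDegree = 0 := by have := natDegree_le_nm v i; omega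
    rw [h0, ← h1]
    exact leadingCoeff_ne_zero.2 hi'
  · have : (Finset.univ : Finset (Fin n)).Nonempty := ⟨i, Finset.mem_univ i⟩
    obtain ⟨j, -, hj⟩ := Finset.exists_mem_eq_sup _ this (fun i => (v i).natDegree)
    refine ⟨j, ?_⟩
    have hj' : nm v = (v j).natDegree := hj
    rw [hj']
    refine leadingCoeff_ne_zero.2 ?_
    intro h; rw [hj', h] at h0; simp at h0

lemma NZ.span {n : ℕ} {v : Fin n → k[X]} (h : NZ Ω v) : ∃ c : Fin n → k[X], ∑ i, c i * v i = 1 := by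
  have h1 : Ideal.span (Set.range v) = ⊤ := by
    obtain ⟨g, hg⟩ := IsPrincipalIdealRing.principal (Ideal.span (Set.range v))
    have hg' : Ideal.span (Set.range v) = Ideal.span {g} := hg
    have hd : ∀ i, g ∣ v i := fun i => by
      rw [← Ideal.mem_span_singleton, ← hg']
      exact Ideal.subset_span ⟨i, rfl⟩
    by_contra hne
    have hu : ¬ IsUnit g := by
      intro hu; rw [hg', Ideal.span_singleton_eq_top.2 hu] at hne; exact hne rfl
    have : ∃ ρ : Ω, aeval ρ g = 0 := by
      by_cases h0 : g = 0
      · exact ⟨0, by simp [h0]⟩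
      · refine IsAlgClosed.exists_aeval_eq_zero Ω g ?_
        intro hdeg
        exact hu (isUnit_iff_degree_eq_zero.2 hdeg)
    obtain ⟨ρ, hρ⟩ := this
    obtain ⟨i, hi⟩ := h ρ
    obtain ⟨w, hw⟩ := hd i
    rw [hw, map_mul, hρ, zero_mul] at hi
    exact hi rfl
  have h2 : (1 : k[X]) ∈ Ideal.span (Set.range v) := by rw [h1]; trivial
  obtain ⟨c, hc⟩ := (Ideal.mem_span_range_iff_exists_fun).1 h2
  exact ⟨c, hc⟩

lemma prop_of_cross {n : ℕ} {u v : Fin n → k[X]} (hu : NZ Ω u)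
    (h : ∀ i j, u i * v j = u j * v i) : ∃ w, ∀ j, v j = u j * w := by
  obtain ⟨c, hc⟩ := hu.span
  refine ⟨∑ i, c i * v i, fun j => ?_⟩
  calc v j = (∑ i, c i * u i) * v j := by rw [hc, one_mul]
    _ = _ := by
      rw [Finset.sum_mul, Finset.mul_sum]
      exact Finset.sum_congr rfl fun i _ => by rw [mul_assoc, h i j]; ring

lemma nm_of_cross {n : ℕ} {u v : Fin n → k[X]} (hu : NZ Ω u) (hv : NZ Ω v)
    (h : ∀ i j, u i * v j = u j * v i) : ∃ w : k, w ≠ 0 ∧ ∀ j, v j = u j * C w := by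
  obtain ⟨w, hw⟩ := prop_of_cross hu h
  obtain ⟨w', hw'⟩ := prop_of_cross hv (u := v) (v := u) fun i j => by
    rw [mul_comm, h j i, mul_comm]
  obtain ⟨i, hi⟩ := hu 0
  have hi' : u i ≠ 0 := by rintro h; simp [h] at hi
  have h1 : w * w' = 1 := by
    have := hw' i
    rw [hw, mul_assoc] at this
    exact (mul_left_cancel₀ hi' (by rw [mul_one]; exact this)).symm
  have hu : IsUnit w := IsUnit.of_mul_eq_one _ h1
  obtain ⟨c, hc, rfl⟩ := Polynomial.isUnit_iff.1 hu
  exact ⟨c, hc.ne_zero, hw⟩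

lemma nm_mul_C {n : ℕ} {u v : Fin n → k[X]} {w : k} (hw : w ≠ 0) (h : ∀ j, v j = u j * C w) :
    nm v = nm u := by
  unfold nm
  congr 1
  ext i
  rw [h i, natDegree_mul_C hw]

lemma NZ_sm {u v : Fin 2 → k[X]} (hu : NZ Ω u) (hv : NZ Ω v) : NZ Ω (sm u v) := by
  intro ρ
  obtain ⟨i, hi⟩ := sm_ne_zero (hu ρ) (hv ρ)
  refine ⟨i, ?_⟩
  have := map_sm (aeval ρ : k[X] →ₐ[k] Ω).toRingHom u v i
  rw [show aeval ρ (sm u v i) = _ from this]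
  exact hi

lemma nm_sm {u v : Fin 2 → k[X]} (hu : NZ Ω u) (hv : NZ Ω v) : nm (sm u v) = nm u + nm v := by
  have h1 : ∀ i j, (u i * v j).natDegree ≤ nm u + nm v := fun i j =>
    natDegree_mul_le.trans (add_le_add (natDegree_le_nm u i) (natDegree_le_nm v j))
  have h2 : ∀ i j, (u i * v j).coeff (nm u + nm v) = (u i).coeff (nm u) * (v j).coeff (nm v) :=
    fun i j => coeff_mul_add_eq_of_natDegree_le (natDegree_le_nm u i) (natDegree_le_nm v j)
  apply nm_eq
  · intro i
    fin_cases i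
    · exact h1 _ _
    · exact natDegree_add_le_of_degree_le (h1 _ _) (h1 _ _)
    · exact h1 _ _
  · obtain ⟨i, hi⟩ := sm_ne_zero hu.exists_top hv.exists_top
    refine ⟨i, ?_⟩
    convert hi using 1
    fin_cases i <;> simp [sm, h2]

variable (E : WeierstrassCurve k) [E.IsElliptic]

lemma NZ_asub {s : Fin 3 → k[X]} (hs : NZ Ω s) : NZ Ω (asub (E.map C) s) := by
  intro ρ
  have e : (E.map C).map (aeval ρ : k[X] →ₐ[k] Ω).toRingHom = E.map (algebraMap k Ω) := by
    rw [WeierstrassCurve.map_map]; congr 1; ext x; simp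
  obtain ⟨i, hi⟩ := asub_ne_zero (E.map (algebraMap k Ω)) (hs ρ)
  refine ⟨i, ?_⟩
  have := map_asub (aeval ρ : k[X] →ₐ[k] Ω).toRingHom (E.map C) s i
  rw [show aeval ρ (asub (E.map C) s i) = _ from this, e]
  exact hi

lemma nm_asub {s : Fin 3 → k[X]} (hs : NZ Ω s) : nm (asub (E.map C) s) = 2 * nm s := by
  have h1 : ∀ i j, (s i * s j).natDegree ≤ 2 * nm s := fun i j => by
    rw [two_mul]
    exact natDegree_mul_le.trans (add_le_add (natDegree_le_nm s i) (natDegree_le_nm s j))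
  have h2 : ∀ i j, (s i * s j).coeff (2 * nm s) = (s i).coeff (nm s) * (s j).coeff (nm s) :=
    fun i j => by
      rw [two_mul]; exact coeff_mul_add_eq_of_natDegree_le (natDegree_le_nm s i) (natDegree_le_nm s j)
  have h3 : ∀ (c : k) i j, (C c * (s i * s j)).natDegree ≤ 2 * nm s := fun c i j =>
    (natDegree_C_mul_le _ _).trans (h1 i j)
  have e : asub (E.map C) s = ![s 0 * s 0 - C E.b₄ * (s 0 * s 2) - C E.b₆ * (s 1 * s 2) - C E.b₈ * (s 2 * s 2),
    C 2 * (s 1 * s 0) + C E.b₂ * (s 0 * s 2) + C E.b₄ * (s 1 * s 2) + C E.b₆ * (s 2 * s 2),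
    s 1 * s 1 - C 4 * (s 0 * s 2)] := by
    funext i
    have c2 : (C 2 : k[X]) = 2 := map_ofNat _ 2
    have c4 : (C 4 : k[X]) = 4 := map_ofNat _ 4
    fin_cases i <;> simp [asub, c2, c4] <;> ring
  apply nm_eq
  · rw [e]
    intro i
    have t : ∀ {p q : k[X]}, p.natDegree ≤ 2 * nm s → q.natDegree ≤ 2 * nm s →
      (p - q).natDegree ≤ 2 * nm s := fun hp hq => (natDegree_sub_le_of_le hp hq).trans (max_self _).le
    fin_cases i
    · exact t (t (t (h1 _ _) (h3 _ _ _)) (h3 _ _ _)) (h3 _ _ _)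
    · exact natDegree_add_le_of_degree_le (natDegree_add_le_of_degree_le
        (natDegree_add_le_of_degree_le (h3 _ _ _) (h3 _ _ _)) (h3 _ _ _)) (h3 _ _ _)
    · exact t (h1 _ _) (h3 _ _ _)
  · obtain ⟨i, hi⟩ := asub_ne_zero E hs.exists_top
    refine ⟨i, ?_⟩
    convert hi using 1
    rw [e]
    fin_cases i <;> simp [asub, h2] <;> ring
end nm
end WC

set_option linter.unusedSectionVars false
namespace WC
open WeierstrassCurve WeierstrassCurve.Affine Polynomial

section hh
variable {k : Type*} [Field k] {Ω : Type*} [Field Ω] [IsAlgClosed Ω] [Algebra k Ω]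

/-- homogenized evaluation -/
noncomputable def hh {A : Type*} [CommRing A] [Algebra k A] (n : ℕ) (f : k[X]) (u : Fin 2 → A) : A :=
  ∑ j ∈ Finset.range (n + 1), algebraMap k A (f.coeff j) * (u 0 ^ j * u 1 ^ (n - j))

lemma map_hh {A B : Type*} [CommRing A] [Algebra k A] [CommRing B] [Algebra k B] (φ : A →ₐ[k] B)
    (n : ℕ) (f : k[X]) (u : Fin 2 → A) : φ (hh n f u) = hh n f (fun i => φ (u i)) := by
  simp [hh]

lemma hh_one {A : Type*} [CommRing A] [Algebra k A] {n : ℕ} {f : k[X]} (hf : f.natDegree ≤ n)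
    (x : A) : hh n f ![x, 1] = aeval x f := by
  simp [hh, aeval_eq_sum_range' (Nat.lt_succ_of_le hf), Algebra.smul_def]

lemma hh_smul {A : Type*} [CommRing A] [Algebra k A] (n : ℕ) (f : k[X]) (u : Fin 2 → A) (c : A) :
    hh n f (fun i => c * u i) = c ^ n * hh n f u := by
  unfold hh
  rw [Finset.mul_sum]
  refine Finset.sum_congr rfl fun j hj => ?_
  have : c ^ n = c ^ j * c ^ (n - j) := by
    rw [← pow_add]; congr 1; have := Finset.mem_range.1 hj; omega
  rw [this, mul_pow, mul_pow]; ring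

lemma hh_inf {A : Type*} [CommRing A] [Algebra k A] (n : ℕ) (f : k[X]) (x : A) :
    hh n f ![x, 0] = algebraMap k A (f.coeff n) * x ^ n := by
  unfold hh
  rw [Finset.sum_eq_single n]
  · simp
  · intro b hb hbn
    have : n - b ≠ 0 := by have := Finset.mem_range.1 hb; omega
    simp [this]
  · simp

lemma hh_ne_zero {v : Fin 2 → k[X]} (hv : NZ Ω v) {u : Fin 2 → Ω} (hu : ∃ i, u i ≠ 0) :
    ∃ i, hh (nm v) (v i) u ≠ 0 := by
  by_cases h : u 1 = 0
  · have h0 : u 0 ≠ 0 := by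
      obtain ⟨i, hi⟩ := hu
      fin_cases i
      · exact hi
      · exact absurd h hi
    obtain ⟨i, hi⟩ := hv.exists_top
    refine ⟨i, ?_⟩
    have : u = ![u 0, 0] := by ext i; fin_cases i <;> simp [h]
    rw [this, hh_inf]
    exact mul_ne_zero (by simpa using hi) (pow_ne_zero _ h0)
  · obtain ⟨i, hi⟩ := hv (u 0 / u 1)
    refine ⟨i, ?_⟩
    have : u = fun i => u 1 * (![u 0 / u 1, 1] : Fin 2 → Ω) i := by
      ext i; fin_cases i <;> simp [mul_div_cancel₀ _ h]
    rw [this, hh_smul, hh_one (natDegree_le_nm v i)]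
    exact mul_ne_zero (pow_ne_zero _ h) hi

lemma NZ_hh {u v : Fin 2 → k[X]} (hu : NZ Ω u) (hv : NZ Ω v) :
    NZ Ω (fun i => hh (nm v) (v i) u) := by
  intro ρ
  obtain ⟨i, hi⟩ := hh_ne_zero hv (hu ρ)
  exact ⟨i, by rw [map_hh]; exact hi⟩

lemma coeff_pow_top {p : k[X]} {m : ℕ} (hp : p.natDegree ≤ m) (j : ℕ) :
    (p ^ j).natDegree ≤ j * m ∧ (p ^ j).coeff (j * m) = p.coeff m ^ j := by
  induction j with
  | zero => simp
  | succ j ih =>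
    rw [pow_succ, add_mul, one_mul, pow_succ]
    exact ⟨natDegree_mul_le.trans (add_le_add ih.1 hp), by
      rw [coeff_mul_add_eq_of_natDegree_le ih.1 hp, ih.2]⟩

lemma nm_hh {u v : Fin 2 → k[X]} (hu : NZ Ω u) (hv : NZ Ω v) :
    nm (fun i => hh (nm v) (v i) u) = nm v * nm u := by
  have key : ∀ j ∈ Finset.range (nm v + 1), (u 0 ^ j * u 1 ^ (nm v - j)).natDegree ≤ nm v * nm u ∧
     (u 0 ^ j * u 1 ^ (nm v - j)).coeff (nm v * nm u) =
      (u 0).coeff (nm u) ^ j * (u 1).coeff (nm u) ^ (nm v - j) := by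
    intro j hj
    have e : nm v * nm u = j * nm u + (nm v - j) * nm u := by
      rw [← add_mul]; congr 1; have := Finset.mem_range.1 hj; omega
    obtain ⟨a1, a2⟩ := coeff_pow_top (natDegree_le_nm u 0) j
    obtain ⟨b1, b2⟩ := coeff_pow_top (natDegree_le_nm u 1) (nm v - j)
    rw [e]
    exact ⟨natDegree_mul_le.trans (add_le_add a1 b1), by
      rw [coeff_mul_add_eq_of_natDegree_le a1 b1, a2, b2]⟩
  apply nm_eq
  · intro i
    refine natDegree_sum_le_of_forall_le _ _ fun j hj => ?_
    exact (natDegree_C_mul_le _ _).trans (key j hj).1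
  · obtain ⟨i0, hi0⟩ := hu.exists_top
    obtain ⟨i, hi⟩ := hh_ne_zero hv (u := fun i => algebraMap k Ω ((u i).coeff (nm u)))
      ⟨i0, by simpa using hi0⟩
    refine ⟨i, fun h => hi ?_⟩
    have h1 := map_hh (Algebra.ofId k Ω) (nm v) (v i) (fun i => (u i).coeff (nm u))
    have h2 : hh (nm v) (v i) (fun i => (u i).coeff (nm u)) = 0 := by
      rw [← h]
      unfold hh
      rw [finset_sum_coeff]
      refine Finset.sum_congr rfl fun j hj => ?_
      rw [algebraMap_eq, coeff_C_mul, (key j hj).2]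
      rfl
    rw [h2, map_zero] at h1
    exact h1.symm
end hh
end WC

set_option linter.unusedSectionVars false
set_option linter.style.haveILetI false
namespace WC
open WeierstrassCurve WeierstrassCurve.Affine Polynomial

section emap
variable {F K : Type*} [Field F] [Field K] [DecidableEq F] [DecidableEq K]
  {W : WeierstrassCurve F} {W' : WeierstrassCurve K}

/-- point map along a field homomorphism, with specified target curve -/
noncomputable def emap (f : F →+* K) (h : W.map f = W') : W.toAffine.Point →+ W'.toAffine.Point := by
  subst h; exact pmap f

lemma xc_emap (f : F →+* K) (h : W.map f = W') (P : W.toAffine.Point) :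
    xc (emap f h P) = f (xc P) := by
  subst h; exact xc_pmap f P
lemma yc_emap (f : F →+* K) (h : W.map f = W') (P : W.toAffine.Point) :
    yc (emap f h P) = f (yc P) := by
  subst h; exact yc_pmap f P
lemma emap_eq_zero (f : F →+* K) (h : W.map f = W') {P : W.toAffine.Point} :
    emap f h P = 0 ↔ P = 0 := by
  subst h; exact pmap_eq_zero f
lemma emap_inj (f : F →+* K) (h : W.map f = W') : Function.Injective (emap f h) :=
  (injective_iff_map_eq_zero _).2 fun _ h' => (emap_eq_zero f h).1 h'

lemma mem_emap_range (f : F →+* K) (h : W.map f = W') (P : W'.toAffine.Point) :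
    P ∈ (emap f h).range ↔ xc P ∈ f.range ∧ yc P ∈ f.range := by
  constructor
  · rintro ⟨Q, rfl⟩
    rw [xc_emap, yc_emap]
    exact ⟨⟨_, rfl⟩, ⟨_, rfl⟩⟩
  · rintro ⟨⟨x, hx⟩, ⟨y, hy⟩⟩
    by_cases hP : P = 0
    · subst hP; exact zero_mem _
    subst h
    have hn := nonsing hP
    rw [← hx, ← hy] at hn
    have hn' := (W.toAffine.map_nonsingular f.injective x y).1 hn
    refine ⟨Point.some x y hn', ?_⟩
    exact point_ext (mt (emap_eq_zero f rfl).1 (Point.some_ne_zero _)) hP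
      (by rw [xc_emap]; exact hx) (by rw [yc_emap]; exact hy)

lemma emap_comm (f g : F →+* F) (W : WeierstrassCurve F) (hf : W.map f = W) (hg : W.map g = W)
    (h : ∀ x, f (g x) = g (f x)) (P : W.toAffine.Point) :
    emap f hf (emap g hg P) = emap g hg (emap f hf P) := by
  by_cases hP : P = 0
  · simp [hP]
  · have h1 := mt (emap_eq_zero f hf).1 hP
    have h2 := mt (emap_eq_zero g hg).1 hP
    refine point_ext (mt (emap_eq_zero f hf).1 h2) (mt (emap_eq_zero g hg).1 h1) ?_ ?_
    · simp [xc_emap, h]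
    · simp [yc_emap, h]

end emap

lemma exists_lift {K S M : Type*} [Field K] [Field S] [Field M] [Algebra K S]
    [Algebra.IsAlgebraic K S] [IsAlgClosed M] (φ : K →+* M) :
    ∃ ψ : S →+* M, ∀ x, ψ (algebraMap K S x) = φ x := by
  letI := φ.toAlgebra
  exact ⟨(IsAlgClosed.lift : S →ₐ[K] M).toRingHom, fun x => (IsAlgClosed.lift : S →ₐ[K] M).commutes x⟩

/-- fixed by all automorphisms and separable implies in the ground field -/
lemma mem_of_fixed {K S : Type*} [Field K] [Field S] [Algebra K S] [IsAlgClosed S]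
    [Algebra.IsAlgebraic K S] {x : S} (hs : IsSeparable K x)
    (h : ∀ σ : S ≃ₐ[K] S, σ x = x) : x ∈ (algebraMap K S).range := by
  by_contra hx
  haveI : IsAlgClosure K S := ⟨inferInstance, inferInstance⟩
  haveI : Normal K S := IsAlgClosure.normal K S
  have h1 : x ∉ (⊥ : Subalgebra K S) := by rwa [Algebra.mem_bot]
  obtain ⟨y, hy, hc⟩ := (notMem_iff_exists_ne_and_isConjRoot hs (IsAlgClosed.splits _)).1 h1
  obtain ⟨σ, hσ⟩ := (isConjRoot_iff_exists_algEquiv).1 hc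
  apply hy
  apply σ.injective
  rw [h σ, hσ]

/-- a simple root of a polynomial over `K` is separable -/
lemma separable_of_simple_root {K S : Type*} [Field K] [Field S] [Algebra K S] {x : S} {f : K[X]}
    (h0 : aeval x f = 0) (h1 : aeval x (derivative f) ≠ 0) : IsSeparable K x := by
  have hf : f ≠ 0 := by rintro rfl; simp at h1
  have hnt : IsIntegral K x := isAlgebraic_iff_isIntegral.1 ⟨f, hf, h0⟩
  obtain ⟨g, hg⟩ := minpoly.dvd K x h0
  unfold IsSeparable
  rw [separable_iff_derivative_ne_zero (minpoly.irreducible hnt)]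
  intro hd
  apply h1
  rw [hg, derivative_mul, hd, zero_mul, zero_add, map_mul, minpoly.aeval, zero_mul]

lemma separable_yc {K S : Type*} [Field K] [Field S] [DecidableEq S] [Algebra K S]
    {E : WeierstrassCurve K} {W : WeierstrassCurve S} (hW : E.map (algebraMap K S) = W)
    {P : W.toAffine.Point} (hP : P ≠ 0) (h2 : P + P ≠ 0) (hx : xc P ∈ (algebraMap K S).range) :
    IsSeparable K (yc P) := by
  subst hW
  obtain ⟨x, hx⟩ := hx
  have he := eqn hP
  rw [← hx] at he
  refine separable_of_simple_root (f := X ^ 2 + C (E.a₁ * x + E.a₃) * X -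
    C (x ^ 3 + E.a₂ * x ^ 2 + E.a₄ * x + E.a₆)) ?_ ?_
  · simp at he ⊢
    linear_combination he
  · have h3 := mt (two_smul_eq_zero_iff hP).2 h2
    simp [derivative_pow, map_ofNat]
    intro h4
    apply h3
    rw [← hx]
    simp [b₂, b₄, b₆] at he ⊢
    generalize yc P = y at *
    generalize algebraMap K S x = x at *
    generalize algebraMap K S E.a₁ = a₁ at *
    generalize algebraMap K S E.a₂ = a₂ at *
    generalize algebraMap K S E.a₃ = a₃ at *
    generalize algebraMap K S E.a₄ = a₄ at *
    generalize algebraMap K S E.a₆ = a₆ at *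
    linear_combination -4 * he + (2*y + a₁*x+a₃) * h4

section quad
variable {G : Type*} [AddCommGroup G]
lemma quad_cube {f : G → ℤ} {S : AddSubgroup G}
    (h : ∀ x ∈ S, ∀ y ∈ S, f (x + y) + f (x - y) = 2 * f x + 2 * f y) {x y z : G}
    (hx : x ∈ S) (hy : y ∈ S) (hz : z ∈ S) :
    f (x + y + z) = f (x + y) + f (y + z) + f (x + z) - f x - f y - f z := by
  have h0 : f 0 = 0 := by have := h 0 S.zero_mem 0 S.zero_mem; simp at this; omega
  have hneg : ∀ x ∈ S, f (-x) = f x := by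
    intro x hx
    have := h 0 S.zero_mem x hx
    simp [h0] at this; omega
  have a1 := h (x + y) (add_mem hx hy) z hz
  have a2 := h x hx (y - z) (sub_mem hy hz)
  have a3 := h (x + z) (add_mem hx hz) y hy
  have a4 := h y hy z hz
  have e1 : x + (y - z) = x + y - z := by abel
  have e2 : x - (y - z) = x + z - y := by abel
  have e3 : x + z + y = x + y + z := by abel
  rw [e1, e2] at a2
  rw [e3] at a3
  omega
end quad
end WC

set_option linter.unusedSectionVars false
set_option linter.style.haveILetI false
namespace WC
open WeierstrassCurve WeierstrassCurve.Affine Polynomial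

section setup
variable {k : Type*} [Field k] {Ω : Type*} [Field Ω] [DecidableEq Ω] [IsAlgClosed Ω]
  [Algebra k Ω] [Algebra (RatFunc k) Ω] [IsScalarTower k (RatFunc k) Ω]
  [Algebra.IsAlgebraic (RatFunc k) Ω] (E : WeierstrassCurve k) [E.IsElliptic]

variable (Ω) in
/-- base change -/
abbrev bc : WeierstrassCurve Ω := E.map (algebraMap k Ω)

variable (k Ω) in
/-- the generic element -/
noncomputable def TT : Ω := algebraMap (RatFunc k) Ω RatFunc.X

lemma aeval_TT (f : k[X]) : aeval (TT k Ω) f =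
    algebraMap (RatFunc k) Ω (algebraMap k[X] (RatFunc k) f) := by
  have : (aeval (TT k Ω) : k[X] →ₐ[k] Ω) =
    (IsScalarTower.toAlgHom k (RatFunc k) Ω).comp (IsScalarTower.toAlgHom k k[X] (RatFunc k)) := by
    ext; simp [TT]
  rw [this]; rfl

lemma aeval_TT_inj {f g : k[X]} (h : aeval (TT k Ω) f = aeval (TT k Ω) g) : f = g := by
  rw [aeval_TT, aeval_TT] at h
  exact RatFunc.algebraMap_injective k ((algebraMap (RatFunc k) Ω).injective h)

lemma bc_map (f : Ω →ₐ[k] Ω) : (bc Ω E).map f.toRingHom = bc Ω E := by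
  rw [WeierstrassCurve.map_map]; congr 1; ext x; simp

variable {E}
/-- action of endomorphisms on points -/
noncomputable def act (f : Ω →ₐ[k] Ω) : (bc Ω E).toAffine.Point →+ (bc Ω E).toAffine.Point :=
  emap f.toRingHom (bc_map E f)

lemma xc_act (f : Ω →ₐ[k] Ω) (P : (bc Ω E).toAffine.Point) : xc (act f P) = f (xc P) := xc_emap _ _ _
lemma yc_act (f : Ω →ₐ[k] Ω) (P : (bc Ω E).toAffine.Point) : yc (act f P) = f (yc P) := yc_emap _ _ _
lemma act_eq_zero (f : Ω →ₐ[k] Ω) {P : (bc Ω E).toAffine.Point} : act f P = 0 ↔ P = 0 :=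
  emap_eq_zero _ _
lemma act_inj (f : Ω →ₐ[k] Ω) : Function.Injective (act (E := E) f) := emap_inj _ _

/-- `x`-coordinate representation by coprime polynomials -/
def Rep (P : (bc Ω E).toAffine.Point) (v : Fin 2 → k[X]) : Prop :=
  NZ Ω v ∧ ∃ c : Ω, c ≠ 0 ∧ ∀ i, aeval (TT k Ω) (v i) = c * xr P i

lemma exists_Rep {P : (bc Ω E).toAffine.Point} (h : xc P ∈ (algebraMap (RatFunc k) Ω).range) :
    ∃ v, Rep P v := by
  by_cases hP : P = 0
  · subst hP
    refine ⟨![1, 0], fun ρ => ⟨0, by simp⟩, 1, one_ne_zero, fun i => ?_⟩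
    rw [xr_zero]
    fin_cases i <;> simp
  · obtain ⟨r, hr⟩ := h
    refine ⟨![r.num, r.denom], ?_, aeval (TT k Ω) r.denom, ?_, ?_⟩
    · intro ρ
      by_contra! h
      obtain ⟨a, b, hab⟩ := RatFunc.isCoprime_num_denom r
      have h0 := h 0
      have h1 := h 1
      simp at h0 h1
      have := congrArg (aeval ρ) hab
      simp [h0, h1] at this
    · intro h
      exact r.denom_ne_zero (aeval_TT_inj (by rw [h, map_zero]))
    · intro i
      rw [xr_of_ne hP, ← hr]
      fin_cases i
      · simp only [aeval_TT]
        have := RatFunc.num_div_denom r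
        have hd : algebraMap k[X] (RatFunc k) r.denom ≠ 0 := by
          simpa using r.denom_ne_zero
        rw [div_eq_iff hd] at this
        simp only [Fin.zero_eta, Matrix.cons_val_zero]
        rw [this, map_mul, mul_comm]
      · simp

lemma nm_eq_of_prop {n : ℕ} {u v : Fin n → k[X]} (hu : NZ Ω u) (hv : NZ Ω v) {x : Fin n → Ω} {c c' : Ω}
    (h : ∀ i, aeval (TT k Ω) (u i) = c * x i) (h' : ∀ i, aeval (TT k Ω) (v i) = c' * x i) :
    ∃ w : k, w ≠ 0 ∧ ∀ j, v j = u j * C w := by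
  refine nm_of_cross hu hv fun i j => aeval_TT_inj (Ω := Ω) ?_
  rw [map_mul, map_mul, h, h, h', h']; ring

lemma Rep_unique {P : (bc Ω E).toAffine.Point} {u v : Fin 2 → k[X]} (hu : Rep P u) (hv : Rep P v) :
    nm u = nm v := by
  obtain ⟨c, -, hc⟩ := hu.2
  obtain ⟨c', -, hc'⟩ := hv.2
  obtain ⟨w, hw, h⟩ := nm_eq_of_prop hu.1 hv.1 hc hc'
  exact (nm_mul_C hw h).symm

open Classical in
/-- degree -/
noncomputable def dg (P : (bc Ω E).toAffine.Point) : ℕ :=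
  if h : ∃ v, Rep P v then nm h.choose else 0

lemma Rep.dg {P : (bc Ω E).toAffine.Point} {u : Fin 2 → k[X]} (hu : Rep P u) : dg P = nm u := by
  unfold WC.dg
  have h : ∃ v, Rep P v := ⟨u, hu⟩
  rw [dif_pos h]
  exact Rep_unique h.choose_spec hu

lemma dg_parallel {P Q : (bc Ω E).toAffine.Point} {u v w z : Fin 2 → k[X]} (hu : Rep P u) (hv : Rep Q v)
    (hw : Rep (P + Q) w) (hz : Rep (P - Q) z) :
    dg (P + Q) + dg (P - Q) = 2 * dg P + 2 * dg Q := by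
  rw [hu.dg, hv.dg, hw.dg, hz.dg]
  have n1 := NZ_sm hu.1 hv.1
  have n2 := NZ_asub E n1
  have n3 := NZ_sm hw.1 hz.1
  have := nm_asub E n1
  rw [nm_sm hu.1 hv.1] at this
  rw [← nm_sm hw.1 hz.1, ← mul_add, ← this]
  obtain ⟨c1, c1n, h1⟩ := hu.2
  obtain ⟨c2, c2n, h2⟩ := hv.2
  obtain ⟨c3, c3n, h3⟩ := hw.2
  obtain ⟨c4, c4n, h4⟩ := hz.2
  obtain ⟨c5, c5n, h5⟩ := asub_xr P Q
  obtain ⟨d, hd, h⟩ := nm_eq_of_prop (x := sm (xr (P + Q)) (xr (P - Q))) (c := (c1 * c2) ^ 2 * c5)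
     (c' := c3 * c4) n2 n3 (by
      intro i
      have e : (E.map C).map (aeval (TT k Ω) : k[X] →ₐ[k] Ω).toRingHom = bc Ω E := by
        rw [WeierstrassCurve.map_map]; congr 1; ext x; simp
      have := map_asub (aeval (TT k Ω) : k[X] →ₐ[k] Ω).toRingHom (E.map C) (sm u v) i
      rw [show aeval (TT k Ω) (asub (E.map C) (sm u v) i) = _ from this, e]
      have e2 : (fun i => (aeval (TT k Ω) : k[X] →ₐ[k] Ω).toRingHom (sm u v i)) =
          fun i => (c1 * c2) * sm (xr P) (xr Q) i := by
        funext i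
        rw [map_sm]
        rw [← sm_smul]
        congr 1
        · funext i; exact h1 i
        · funext i; exact h2 i
      rw [e2, asub_smul, h5, mul_assoc]) (by
      intro i
      have := map_sm (aeval (TT k Ω) : k[X] →ₐ[k] Ω).toRingHom w z i
      rw [show aeval (TT k Ω) (sm w z i) = _ from this, ← sm_smul]
      congr 1
      · funext i; exact h3 i
      · funext i; exact h4 i)
  exact nm_mul_C hd h

/-- composition -/
lemma Rep_comp {P Q : (bc Ω E).toAffine.Point} {u v : Fin 2 → k[X]} (hP : P ≠ 0) (hu : Rep P u)
    (hv : Rep Q v) (f : Ω →ₐ[k] Ω) (hf : f (TT k Ω) = xc P) : dg (act f Q) = dg Q * dg P := by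
  have : Rep (act f Q) (fun i => hh (nm v) (v i) u) := by
    refine ⟨NZ_hh hu.1 hv.1, ?_⟩
    obtain ⟨c, cn, hc⟩ := hu.2
    obtain ⟨c', cn', hc'⟩ := hv.2
    refine ⟨c ^ nm v * f c', mul_ne_zero (pow_ne_zero _ cn) (by simpa using cn'), fun i => ?_⟩
    have e : (fun i => aeval (TT k Ω) (u i)) = fun i => c * (![xc P, 1] : Fin 2 → Ω) i := by
      funext i; rw [hc, xr_of_ne hP]
    rw [map_hh, e, hh_smul, hh_one (natDegree_le_nm v i), ← hf, aeval_algHom_apply, hc', map_mul,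
      mul_assoc]
    congr 2
    by_cases hQ : Q = 0
    · subst hQ
      rw [map_zero, xr_zero]
      fin_cases i <;> simp
    · rw [xr_of_ne hQ, xr_of_ne (mt (act_eq_zero f).1 hQ), xc_act]
      fin_cases i <;> simp
  rw [this.dg, nm_hh hu.1 hv.1, hu.dg, hv.dg]

lemma exists_iota {x : Ω} (hx : Transcendental k x) : ∃ f : Ω →ₐ[k] Ω, f (TT k Ω) = x := by
  have hinj : Function.Injective (aeval x : k[X] →ₐ[k] Ω) := transcendental_iff_injective.1 hx
  let φ : RatFunc k →ₐ[k] Ω := RatFunc.liftAlgHom (aeval x) (by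
    intro p hp
    rw [Submonoid.mem_comap, mem_nonZeroDivisors_iff_ne_zero]
    rw [mem_nonZeroDivisors_iff_ne_zero] at hp
    exact fun h => hp (hinj (by simpa using h)))
  obtain ⟨ψ, hψ⟩ := exists_lift (S := Ω) φ.toRingHom
  refine ⟨⟨ψ, fun a => ?_⟩, ?_⟩
  · rw [IsScalarTower.algebraMap_apply k (RatFunc k) Ω]
    have := hψ (algebraMap k (RatFunc k) a)
    refine this.trans ?_
    rw [← IsScalarTower.algebraMap_apply]
    exact φ.commutes a
  · refine (hψ _).trans ?_
    have : RatFunc.X = algebraMap k[X] (RatFunc k) X := by simp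
    rw [this]
    change φ _ = _
    rw [RatFunc.liftAlgHom_apply]
    simp
end setup
end WC

set_option linter.unusedSectionVars false
set_option linter.style.haveILetI false
namespace WC
open WeierstrassCurve WeierstrassCurve.Affine Polynomial

section setup
variable {k : Type*} [Field k] {Ω : Type*} [Field Ω] [DecidableEq Ω] [IsAlgClosed Ω]
  [Algebra k Ω] [Algebra (RatFunc k) Ω] [IsScalarTower k (RatFunc k) Ω]
  [Algebra.IsAlgebraic (RatFunc k) Ω] {E : WeierstrassCurve k} [E.IsElliptic]

lemma trans_TT : Transcendental k (TT k Ω) :=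
  transcendental_iff_injective.2 fun _ _ h => aeval_TT_inj h

lemma const_of_alg {r : RatFunc k} (h : IsAlgebraic k (algebraMap (RatFunc k) Ω r)) :
    ∃ c : k, r = RatFunc.C c := by
  by_contra hc
  have h1 := RatFunc.isAlgebraic_adjoin_simple_X r hc
  have h2 : IsAlgebraic k r := (isAlgebraic_algebraMap_iff (algebraMap (RatFunc k) Ω).injective).1 h
  have : Algebra.IsAlgebraic k (IntermediateField.adjoin k {r}) :=
    IntermediateField.isAlgebraic_adjoin_simple h2.isIntegral
  have h3 : IsAlgebraic k (RatFunc.X : RatFunc k) := h1.restrictScalars k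
  exact trans_TT (k := k) (Ω := Ω) (h3.algebraMap)

/-- algebraic points -/
noncomputable def algPts : AddSubgroup (bc Ω E).toAffine.Point :=
  (emap (W := E.map (algebraMap k (algebraicClosure k Ω))) (algebraMap (algebraicClosure k Ω) Ω)
    (by rw [WeierstrassCurve.map_map]; rfl)).range

lemma mem_algPts {P : (bc Ω E).toAffine.Point} : P ∈ algPts (E := E) (Ω := Ω) ↔ IsAlgebraic k (xc P) := by
  unfold algPts
  rw [mem_emap_range]
  have hr : ∀ x : Ω, x ∈ (algebraMap (algebraicClosure k Ω) Ω).range ↔ IsAlgebraic k x := by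
    intro x
    rw [← mem_algebraicClosure_iff]
    constructor
    · rintro ⟨y, rfl⟩; exact y.2
    · intro h; exact ⟨⟨x, h⟩, rfl⟩
  rw [hr, hr]
  refine ⟨fun h => h.1, fun h => ⟨h, ?_⟩⟩
  by_cases hP : P = 0
  · subst hP; exact isAlgebraic_zero
  have hx := mem_algebraicClosure_iff.2 h
  let x : algebraicClosure k Ω := ⟨_, hx⟩
  have hxx : algebraMap (algebraicClosure k Ω) Ω x = xc P := rfl
  let a : k → algebraicClosure k Ω := algebraMap k _
  have ha : ∀ z, algebraMap (algebraicClosure k Ω) Ω (a z) = algebraMap k Ω z := fun z => rfl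
  have h1 : IsAlgebraic (algebraicClosure k Ω) (yc P) := by
    refine IsIntegral.isAlgebraic ⟨X ^ 2 + (C (a E.a₁ * x + a E.a₃) * X -
      C (x ^ 3 + a E.a₂ * x ^ 2 + a E.a₄ * x + a E.a₆)), ?_, ?_⟩
    · apply monic_X_pow_add
      refine lt_of_le_of_lt (degree_sub_le _ _) (max_lt ?_ ?_)
      · exact lt_of_le_of_lt (degree_C_mul_X_le _) (by norm_num)
      · exact lt_of_le_of_lt degree_C_le (by norm_num)
    · have he := eqn hP
      simp only [eval₂_add, eval₂_sub, eval₂_mul, eval₂_pow, eval₂_X, eval₂_C, map_add, map_mul,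
        map_pow, ha, hxx]
      simp only [map_a₁, map_a₂, map_a₃, map_a₄, map_a₆] at he
      linear_combination he
  exact h1.restrictScalars k

lemma not_mem_algPts {P : (bc Ω E).toAffine.Point} (h : P ∉ algPts (E := E) (Ω := Ω)) :
    P ≠ 0 ∧ ∃ f : Ω →ₐ[k] Ω, f (TT k Ω) = xc P := by
  refine ⟨fun h' => h (by rw [h']; exact zero_mem _), ?_⟩
  rw [mem_algPts] at h
  exact exists_iota h

/-- separable points -/
noncomputable def sepPts : AddSubgroup (bc Ω E).toAffine.Point :=
  (emap (W := E.map ((algebraMap (RatFunc k) (separableClosure (RatFunc k) Ω)).comp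
    (algebraMap k (RatFunc k)))) (algebraMap (separableClosure (RatFunc k) Ω) Ω)
    (by
      rw [WeierstrassCurve.map_map]; congr 1; ext x
      exact (IsScalarTower.algebraMap_apply k (RatFunc k) Ω x).symm)).range

lemma mem_sepPts {P : (bc Ω E).toAffine.Point} : P ∈ sepPts (E := E) (Ω := Ω) ↔
    xc P ∈ separableClosure (RatFunc k) Ω ∧ yc P ∈ separableClosure (RatFunc k) Ω := by
  unfold sepPts
  rw [mem_emap_range]
  have hr : ∀ x : Ω, x ∈ (algebraMap (separableClosure (RatFunc k) Ω) Ω).range ↔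
      x ∈ separableClosure (RatFunc k) Ω := by
    intro x
    constructor
    · rintro ⟨y, rfl⟩; exact y.2
    · intro h; exact ⟨⟨x, h⟩, rfl⟩
  rw [hr, hr]

/-- Galois action -/
noncomputable def gal (σ : Ω ≃ₐ[RatFunc k] Ω) : Ω →ₐ[k] Ω := (σ : Ω →ₐ[RatFunc k] Ω).restrictScalars k

/-- the points of the function field that are odd -/
noncomputable def SS (g : (bc Ω E).toAffine.Point) : AddSubgroup (bc Ω E).toAffine.Point where
  carrier := {P | P ∈ sepPts (E := E) (Ω := Ω) ∧ ∀ σ : Ω ≃ₐ[RatFunc k] Ω,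
    (act (gal σ) g = g → act (gal σ) P = P) ∧ (act (gal σ) g = -g → act (gal σ) P = -P)}
  zero_mem' := ⟨zero_mem _, by simp⟩
  add_mem' := by
    rintro P Q ⟨h1, h2⟩ ⟨h3, h4⟩
    refine ⟨add_mem h1 h3, fun σ => ⟨fun h => ?_, fun h => ?_⟩⟩
    · rw [map_add, (h2 σ).1 h, (h4 σ).1 h]
    · rw [map_add, (h2 σ).2 h, (h4 σ).2 h]; abel
  neg_mem' := by
    rintro P ⟨h1, h2⟩
    refine ⟨neg_mem h1, fun σ => ⟨fun h => ?_, fun h => ?_⟩⟩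
    · rw [map_neg, (h2 σ).1 h]
    · rw [map_neg, (h2 σ).2 h]

variable {g : (bc Ω E).toAffine.Point}

lemma gal_sign (hg : g ≠ 0) (hgx : xc g ∈ (algebraMap (RatFunc k) Ω).range) (σ : Ω ≃ₐ[RatFunc k] Ω) :
    act (gal σ) g = g ∨ act (gal σ) g = -g := by
  rw [← xc_eq_iff (mt (act_eq_zero _).1 hg) hg, xc_act]
  obtain ⟨r, hr⟩ := hgx
  rw [← hr]
  exact σ.commutes r

lemma SS_rational (hg : g ≠ 0) (hgx : xc g ∈ (algebraMap (RatFunc k) Ω).range)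
    {P : (bc Ω E).toAffine.Point} (hP : P ∈ SS g) : xc P ∈ (algebraMap (RatFunc k) Ω).range := by
  refine mem_of_fixed ((mem_sepPts.1 hP.1).1) fun σ => ?_
  change gal σ _ = _
  rw [← xc_act]
  rcases gal_sign hg hgx σ with h | h
  · rw [(hP.2 σ).1 h]
  · rw [(hP.2 σ).2 h, xc_neg]

lemma mem_sepPts_of {P : (bc Ω E).toAffine.Point} (hP : P ≠ 0) (h2 : P + P ≠ 0)
    (hx : xc P ∈ (algebraMap (RatFunc k) Ω).range) : P ∈ sepPts (E := E) (Ω := Ω) := by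
  rw [mem_sepPts]
  constructor
  · obtain ⟨r, hr⟩ := hx
    rw [← hr]; exact (separableClosure (RatFunc k) Ω).algebraMap_mem r
  · refine separable_yc (K := RatFunc k) (E := E.map (algebraMap k (RatFunc k))) ?_ hP h2 hx
    rw [WeierstrassCurve.map_map]; congr 1; ext x
    exact (IsScalarTower.algebraMap_apply k (RatFunc k) Ω x).symm

lemma dg_one_of (hg : g ≠ 0) (hgx : xc g = TT k Ω) : dg g = 1 := by
  have : Rep g ![X, 1] := by
    refine ⟨fun ρ => ⟨1, by simp⟩, 1, one_ne_zero, fun i => ?_⟩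
    rw [xr_of_ne hg, hgx]
    fin_cases i <;> simp
  rw [this.dg]
  apply nm_eq
  · intro i; fin_cases i <;> simp
  · exact ⟨0, by simp⟩

lemma g_not_alg (hgx : xc g = TT k Ω) : g ∉ algPts (E := E) (Ω := Ω) := by
  rw [mem_algPts, hgx]; exact trans_TT

lemma two_torsion_alg {P : (bc Ω E).toAffine.Point} (h : P + P = 0) : P ∈ algPts (E := E) (Ω := Ω) := by
  by_cases hP : P = 0
  · subst hP; exact zero_mem _
  rw [mem_algPts]
  have h1 := (two_smul_eq_zero_iff hP).1 h
  refine ⟨C 4 * X ^ 3 + C E.b₂ * X ^ 2 + C (2 * E.b₄) * X + C E.b₆, ?_, ?_⟩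
  · intro h0
    obtain ⟨i, hi⟩ := asub_ne_zero E (s := ![0, 0, 1]) ⟨2, by simp⟩
    have c3 := congrArg (fun p => coeff p 3) h0
    have c2 := congrArg (fun p => coeff p 2) h0
    have c1 := congrArg (fun p => coeff p 1) h0
    have c0 := congrArg (fun p => coeff p 0) h0
    simp [coeff_X, coeff_C] at c3 c2 c1 c0
    have hΔ : E.Δ ≠ 0 := E.isUnit_Δ.ne_zero
    apply hΔ
    have h2 : (2 : k) = 0 := by
      have : (2 : k) ^ 2 = 0 := by linear_combination c3
      exact pow_eq_zero_iff (by norm_num) |>.1 this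
    rw [Δ, c2, c0]
    linear_combination (-4 * E.b₄ ^ 3) * h2
  · simp [map_ofNat] at h1 ⊢
    linear_combination h1

lemma g_mem (hg : g ≠ 0) (hgx : xc g = TT k Ω) : g ∈ SS g := by
  refine ⟨mem_sepPts_of hg (fun h => g_not_alg hgx (two_torsion_alg h)) ⟨_, hgx.symm⟩, fun σ => ?_⟩
  exact ⟨fun h => h, fun h => h⟩

lemma SS_alg (hg : g ≠ 0) (hgx : xc g ∈ (algebraMap (RatFunc k) Ω).range)
    {P : (bc Ω E).toAffine.Point} (hP : P ∈ SS g) (h : P ∈ algPts (E := E) (Ω := Ω)) :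
    ∃ c : k, xc P = algebraMap k Ω c := by
  obtain ⟨r, hr⟩ := SS_rational hg hgx hP
  rw [mem_algPts, ← hr] at h
  obtain ⟨c, rfl⟩ := const_of_alg h
  exact ⟨c, by rw [← hr, IsScalarTower.algebraMap_apply k (RatFunc k) Ω]; rfl⟩

lemma dg_zero_iff (hg : g ≠ 0) (hgx : xc g ∈ (algebraMap (RatFunc k) Ω).range)
    {P : (bc Ω E).toAffine.Point} (hP : P ∈ SS g) : dg P = 0 ↔ P ∈ algPts (E := E) (Ω := Ω) := by
  obtain ⟨v, hv⟩ := exists_Rep (SS_rational hg hgx hP)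
  by_cases h0 : P = 0
  · subst h0
    have : Rep (0 : (bc Ω E).toAffine.Point) ![1, 0] := by
      refine ⟨fun ρ => ⟨0, by simp⟩, 1, one_ne_zero, fun i => ?_⟩
      rw [xr_zero]; fin_cases i <;> simp
    refine ⟨fun _ => zero_mem _, fun _ => ?_⟩
    rw [this.dg]
    apply nm_eq
    · intro i; fin_cases i <;> simp
    · exact ⟨0, by simp⟩
  constructor
  · intro h
    rw [hv.dg] at h
    obtain ⟨c, cn, hc⟩ := hv.2
    have hn : ∀ i, (v i).natDegree = 0 := fun i => by have := natDegree_le_nm v i; omega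
    have h1 := hc 0
    have h2 := hc 1
    rw [eq_C_of_natDegree_eq_zero (hn _), xr_of_ne h0, aeval_C] at h1 h2
    simp at h1 h2
    rw [mem_algPts]
    have : xc P = algebraMap k Ω ((v 0).coeff 0 / (v 1).coeff 0) := by
      rw [map_div₀, h1, h2]; field_simp
    rw [this]; exact isAlgebraic_algebraMap _
  · intro h
    obtain ⟨c, hc⟩ := SS_alg hg hgx hP h
    have : Rep P ![C c, 1] := by
      refine ⟨fun ρ => ⟨1, by simp⟩, 1, one_ne_zero, fun i => ?_⟩
      rw [xr_of_ne h0, hc]; fin_cases i <;> simp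
    rw [this.dg]
    apply nm_eq
    · intro i; fin_cases i <;> simp
    · exact ⟨1, by simp⟩

/-- the generic point maps anywhere -/
lemma act_g (hg : g ≠ 0) (hgx : xc g = TT k Ω) {P : (bc Ω E).toAffine.Point} (hP : P ≠ 0)
    {f : Ω →ₐ[k] Ω} (hf : f (TT k Ω) = xc P) : act f g = P ∨ act f g = -P := by
  rw [← xc_eq_iff (mt (act_eq_zero _).1 hg) hP, xc_act, hgx, hf]

end setup
end WC

set_option linter.unusedSectionVars false
set_option linter.style.haveILetI false
namespace WC
open WeierstrassCurve WeierstrassCurve.Affine Polynomial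

section quad
variable {G : Type*} [AddCommGroup G] {f : G → ℤ} {S : AddSubgroup G}
lemma quad_zero (h : ∀ x ∈ S, ∀ y ∈ S, f (x + y) + f (x - y) = 2 * f x + 2 * f y) : f 0 = 0 := by
  have := h 0 S.zero_mem 0 S.zero_mem; simp at this; omega

lemma quad_lin (h : ∀ x ∈ S, ∀ y ∈ S, f (x + y) + f (x - y) = 2 * f x + 2 * f y)
    {x y : G} (hx : x ∈ S) (hy : y ∈ S) (n : ℤ) :
    f (x + n • y) = f x + n * (f (x + y) - f x - f y) + n ^ 2 * f y := by
  have step : ∀ n : ℤ, f (x + (n + 1) • y) + f (x + (n - 1) • y) = 2 * f (x + n • y) + 2 * f y := by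
    intro n
    have := h (x + n • y) (add_mem hx (zsmul_mem hy n)) y hy
    have e1 : x + n • y + y = x + (n + 1) • y := by rw [add_smul, one_smul, add_assoc]
    have e2 : x + n • y - y = x + (n - 1) • y := by rw [sub_smul, one_smul, add_sub_assoc]
    rwa [e1, e2] at this
  have main : ∀ n : ℕ, f (x + (n : ℤ) • y) = f x + n * (f (x + y) - f x - f y) + n ^ 2 * f y ∧
     f (x + (-n : ℤ) • y) = f x + (-n) * (f (x + y) - f x - f y) + n ^ 2 * f y := by
    intro n
    induction n using Nat.strong_induction_on with
    | _ n ih =>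
      rcases n with _ | _ | n
      · simp
      · have h0 := step 0
        simp at h0 ⊢
        have : f (x + -y) = 2 * f x + 2 * f y - f (x + y) := by omega
        rw [this]; constructor <;> ring
      · have i1 := ih (n + 1) (by omega)
        have i0 := ih n (by omega)
        have s1 := step (n + 1)
        have s2 := step (-(n + 1))
        have e1 : ((n : ℤ) + 1 + 1) = ((n + 1 + 1 : ℕ) : ℤ) := by push_cast; ring
        have e2 : ((n : ℤ) + 1 - 1) = ((n : ℕ) : ℤ) := by ring
        have e3 : (-((n : ℤ) + 1) + 1) = (-(n : ℕ) : ℤ) := by ring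
        have e4 : (-((n : ℤ) + 1) - 1) = (-(n + 1 + 1 : ℕ) : ℤ) := by push_cast; ring
        rw [e1, e2] at s1
        rw [e3, e4] at s2
        rw [i0.1] at s1
        rw [i0.2] at s2
        have j1 := i1.1
        have j2 := i1.2
        push_cast at j1 j2 s1 s2 ⊢
        rw [j1] at s1
        rw [j2] at s2
        constructor
        · linear_combination s1
        · linear_combination s2
  rcases Int.eq_nat_or_neg n with ⟨m, rfl | rfl⟩
  · exact (main m).1
  · rw [(main m).2]; ring

lemma quad_smul (h : ∀ x ∈ S, ∀ y ∈ S, f (x + y) + f (x - y) = 2 * f x + 2 * f y)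
    {y : G} (hy : y ∈ S) (n : ℤ) : f (n • y) = n ^ 2 * f y := by
  have := quad_lin h S.zero_mem hy n
  simp [quad_zero h] at this
  exact this

lemma quad_lin2 (h : ∀ x ∈ S, ∀ y ∈ S, f (x + y) + f (x - y) = 2 * f x + 2 * f y)
    {x y : G} (hx : x ∈ S) (hy : y ∈ S) (m n : ℤ) :
    f (m • x + n • y) = m ^ 2 * f x + m * n * (f (x + y) - f x - f y) + n ^ 2 * f y := by
  rw [quad_lin h (zsmul_mem hx m) hy n, add_comm (m • x), quad_lin h hy hx m, quad_smul h hx,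
    add_comm y x]
  ring
end quad

section setup
variable {k : Type*} [Field k] {Ω : Type*} [Field Ω] [DecidableEq Ω] [IsAlgClosed Ω]
  [Algebra k Ω] [Algebra (RatFunc k) Ω] [IsScalarTower k (RatFunc k) Ω]
  [Algebra.IsAlgebraic (RatFunc k) Ω] {E : WeierstrassCurve k} [E.IsElliptic]
  {g : (bc Ω E).toAffine.Point}

lemma SS_par (hg : g ≠ 0) (hgx : xc g = TT k Ω) : ∀ x ∈ SS g, ∀ y ∈ SS g,
    (dg (x + y) : ℤ) + (dg (x - y) : ℤ) = 2 * (dg x : ℤ) + 2 * (dg y : ℤ) := by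
  intro x hx y hy
  have R : ∀ {P}, P ∈ SS g → ∃ v, Rep P v := fun h => exists_Rep (SS_rational hg ⟨_, hgx.symm⟩ h)
  obtain ⟨a, ha⟩ := R hx
  obtain ⟨b, hb⟩ := R hy
  obtain ⟨c, hc⟩ := R (add_mem hx hy)
  obtain ⟨d, hd⟩ := R (sub_mem hx hy)
  exact_mod_cast dg_parallel ha hb hc hd

lemma const_zero (hg : g ≠ 0) (hgx : xc g = TT k Ω) (φ : (bc Ω E).toAffine.Point →+ (bc Ω E).toAffine.Point)
    (hφ : ∀ (f : Ω →ₐ[k] Ω) P, act f (φ P) = φ (act f P)) (hS : φ g ∈ SS g) (h : dg (φ g) = 0) :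
    φ g = 0 := by
  by_contra h0
  have ha := (dg_zero_iff hg ⟨_, hgx.symm⟩ hS).1 h
  obtain ⟨c, hc⟩ := SS_alg hg ⟨_, hgx.symm⟩ hS ha
  have key : ∀ n : ℤ, n ≠ 0 → n • φ g = φ g ∨ n • φ g = - φ g := by
    intro n hn
    have hm : n • g ∈ SS g := zsmul_mem (g_mem hg hgx) n
    have h1 : n • g ∉ algPts (E := E) (Ω := Ω) := by
      rw [← dg_zero_iff hg ⟨_, hgx.symm⟩ hm]
      have : (dg (n • g) : ℤ) = n ^ 2 * (dg g : ℤ) := quad_smul (f := fun P => (dg P : ℤ)) (SS_par hg hgx) (g_mem hg hgx) n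
      intro h2
      rw [h2, dg_one_of hg hgx] at this
      simp at this
      exact pow_ne_zero 2 hn this.symm
    obtain ⟨hn0, f, hf⟩ := not_mem_algPts h1
    have h2 : act f (φ g) = φ g ∨ act f (φ g) = - φ g := by
      rw [← xc_eq_iff (mt (act_eq_zero _).1 h0) h0, xc_act, hc, f.commutes]
    rcases act_g hg hgx hn0 hf with h3 | h3
    · rw [hφ, h3, map_zsmul] at h2; exact h2
    · rw [hφ, h3, map_neg, map_zsmul] at h2
      rcases h2 with h2 | h2
      · right; exact neg_eq_iff_eq_neg.1 h2
      · left; exact neg_injective h2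
  have k2 := key 2 (by norm_num)
  have k3 := key 3 (by norm_num)
  have e2 : (2 : ℤ) • φ g = φ g + φ g := two_zsmul _
  have e3 : (3 : ℤ) • φ g = φ g + φ g + φ g := by
    rw [show (3 : ℤ) = 2 + 1 by norm_num, add_smul, e2, one_smul]
  rw [e2] at k2
  rw [e3] at k3
  rcases k2 with k2 | k2
  · exact h0 (by simpa using k2)
  · rw [k2] at k3
    rcases k3 with k3 | k3
    · rw [neg_add_cancel] at k3; exact h0 k3.symm
    · rw [neg_add_cancel] at k3; exact h0 (neg_eq_zero.1 k3.symm)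

/-- the fibre polynomial -/
lemma fibre (hg : g ≠ 0) (hgx : xc g = TT k Ω) (φ : (bc Ω E).toAffine.Point →+ (bc Ω E).toAffine.Point)
    (hφ : ∀ (f : Ω →ₐ[k] Ω) P, act f (φ P) = φ (act f P)) (hS : φ g ∈ SS g) (h0 : φ g ≠ 0)
    {v : Fin 2 → k[X]} (hv : Rep (φ g) v) :
    ∃ p : Polynomial Ω, p = (v 0).map (algebraMap k Ω) - C (xc (φ g)) * (v 1).map (algebraMap k Ω) ∧
      p.natDegree = nm v ∧ p ≠ 0 ∧ Transcendental k (xc (φ g)) ∧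
      (∀ P, P ∉ algPts (E := E) (Ω := Ω) →
        (p.IsRoot (xc P) ↔ φ P = φ g ∨ φ P = - φ g)) := by
  have htr : Transcendental k (xc (φ g)) := by
    intro h
    exact h0 (const_zero hg hgx φ hφ hS ((dg_zero_iff hg ⟨_, hgx.symm⟩ hS).2 (mem_algPts.2 h)))
  refine ⟨_, rfl, ?_⟩
  set p := (v 0).map (algebraMap k Ω) - C (xc (φ g)) * (v 1).map (algebraMap k Ω) with hp
  have hco : ∀ j, p.coeff j = 0 → (v 0).coeff j = 0 ∧ (v 1).coeff j = 0 := by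
    intro j hj
    simp [hp] at hj
    have h1 : (v 1).coeff j = 0 := by
      by_contra h1
      apply htr
      have : xc (φ g) = algebraMap k Ω ((v 0).coeff j / (v 1).coeff j) := by
        rw [map_div₀, eq_div_iff (by simpa using h1)]
        linear_combination -hj
      rw [this]; exact isAlgebraic_algebraMap _
    rw [h1] at hj
    simp at hj
    exact ⟨hj, h1⟩
  have htop : p.coeff (nm v) ≠ 0 := by
    intro h
    obtain ⟨i, hi⟩ := hv.1.exists_top
    apply hi
    fin_cases i
    · exact (hco _ h).1
    · exact (hco _ h).2
  have hdeg : p.natDegree ≤ nm v := by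
    refine (natDegree_sub_le_of_le (m := nm v) (n := nm v) ?_ ?_).trans (max_self _).le
    · exact natDegree_map_le.trans (natDegree_le_nm v 0)
    · exact (natDegree_C_mul_le _ _).trans (natDegree_map_le.trans (natDegree_le_nm v 1))
  have hpd : p.natDegree = nm v := le_antisymm hdeg (le_natDegree_of_ne_zero htop)
  refine ⟨hpd, fun h => htop (by rw [h, coeff_zero]), htr, fun P hP => ?_⟩
  obtain ⟨hP0, f, hf⟩ := not_mem_algPts hP
  have hφP : φ P = act f (φ g) ∨ φ P = - act f (φ g) := by
    rw [hφ]
    rcases act_g hg hgx hP0 hf with h | h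
    · left; rw [h]
    · right; rw [h, map_neg, neg_neg]
  have hne : φ P ≠ 0 := by
    have := mt (act_eq_zero f).1 h0
    rcases hφP with h | h
    · rw [h]; exact this
    · rw [h]; simpa using this
  have hx : xc (φ P) = f (xc (φ g)) := by
    rw [← xc_act]
    rcases hφP with h | h
    · rw [h]
    · rw [h, xc_neg]
  rw [← xc_eq_iff hne h0, hx]
  obtain ⟨c, cn, hc⟩ := hv.2
  have c0 := hc 0
  have c1 := hc 1
  rw [xr_of_ne h0] at c0 c1
  simp at c0 c1
  have d0 : aeval (xc P) (v 0) = f c * f (xc (φ g)) := by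
    rw [← hf, aeval_algHom_apply, c0, map_mul]
  have d1 : aeval (xc P) (v 1) = f c := by
    rw [← hf, aeval_algHom_apply, c1]
  have fc : f c ≠ 0 := by simpa using cn
  simp only [hp, IsRoot, eval_sub, eval_mul, eval_C, eval_map_algebraMap, d0, d1]
  constructor
  · intro h
    have : f c * (f (xc (φ g)) - xc (φ g)) = 0 := by linear_combination h
    exact sub_eq_zero.1 ((mul_eq_zero.1 this).resolve_left fc)
  · intro h; rw [h]; ring

lemma ker_card_le (hg : g ≠ 0) (hgx : xc g = TT k Ω) (φ : (bc Ω E).toAffine.Point →+ (bc Ω E).toAffine.Point)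
    (hφ : ∀ (f : Ω →ₐ[k] Ω) P, act f (φ P) = φ (act f P)) (hS : φ g ∈ SS g) (h0 : φ g ≠ 0)
    (hker : ∀ P, φ P = 0 → P ∈ algPts (E := E) (Ω := Ω)) :
    Set.ncard {P | φ P = 0} ≤ dg (φ g) := by
  obtain ⟨v, hv⟩ := exists_Rep (SS_rational hg ⟨_, hgx.symm⟩ hS)
  obtain ⟨p, -, hpd, hp0, -, hroot⟩ := fibre hg hgx φ hφ hS h0 hv
  rw [hv.dg, ← hpd]
  have hga := g_not_alg hgx
  have hna : ∀ κ, φ κ = 0 → g + κ ∉ algPts (E := E) (Ω := Ω) := by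
    intro κ hκ h
    have := sub_mem h (hker κ hκ)
    rw [add_sub_cancel_right] at this
    exact hga this
  have h1 : Set.ncard {P | φ P = 0} ≤ Set.ncard (p.roots.toFinset : Set Ω) := by
    refine Set.ncard_le_ncard_of_injOn (fun κ => xc (g + κ)) ?_ ?_ (Finset.finite_toSet _)
    · intro κ hκ
      have hκ' : φ κ = 0 := hκ
      rw [Finset.mem_coe, Multiset.mem_toFinset, mem_roots hp0, hroot _ (hna κ hκ')]
      left; rw [map_add, hκ', add_zero]
    · intro κ hκ κ' hκ' h
      have n1 := (not_mem_algPts (hna κ hκ)).1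
      have n2 := (not_mem_algPts (hna κ' hκ')).1
      rcases (xc_eq_iff n1 n2).1 h with h | h
      · exact add_left_cancel h
      · exfalso
        have h2 : g + g = -(κ + κ') := by
          have : g + κ + (g + κ') = 0 := by rw [h]; simp
          rw [eq_neg_iff_add_eq_zero, ← this]; abel
        have h3 : g + g ∈ algPts (E := E) (Ω := Ω) := by
          rw [h2]; exact neg_mem (add_mem (hker _ hκ) (hker _ hκ'))
        have hm := add_mem (g_mem hg hgx) (g_mem hg hgx)
        rw [← dg_zero_iff hg ⟨_, hgx.symm⟩ hm] at h3
        have : (dg ((2:ℤ) • g) : ℤ) = 2 ^ 2 * (dg g : ℤ) := quad_smul (f := fun P => (dg P : ℤ)) (SS_par hg hgx) (g_mem hg hgx) 2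
        rw [two_zsmul, h3, dg_one_of hg hgx] at this
        norm_num at this
  refine h1.trans ?_
  rw [Set.ncard_coe_finset]
  exact (Multiset.toFinset_card_le _).trans (card_roots' _)
end setup
end WC

set_option linter.unusedSectionVars false
set_option linter.style.haveILetI false
namespace WC
open WeierstrassCurve WeierstrassCurve.Affine Polynomial

section setup
variable {k : Type*} [Field k] [Fintype k] {Ω : Type*} [Field Ω] [DecidableEq Ω] [IsAlgClosed Ω]
  [Algebra k Ω] [Algebra (RatFunc k) Ω] [IsScalarTower k (RatFunc k) Ω]
  [Algebra.IsAlgebraic (RatFunc k) Ω] {E : WeierstrassCurve k} [E.IsElliptic]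
  {g : (bc Ω E).toAffine.Point}

variable (E Ω) in
/-- Frobenius -/
noncomputable def Fb : (bc Ω E).toAffine.Point →+ (bc Ω E).toAffine.Point :=
  act (FiniteField.frobeniusAlgHom k Ω)

lemma xc_Fb (P : (bc Ω E).toAffine.Point) : xc (Fb Ω E P) = xc P ^ Fintype.card k := by
  rw [Fb, xc_act, FiniteField.frobeniusAlgHom_apply]
lemma yc_Fb (P : (bc Ω E).toAffine.Point) : yc (Fb Ω E P) = yc P ^ Fintype.card k := by
  rw [Fb, yc_act, FiniteField.frobeniusAlgHom_apply]
lemma Fb_eq_zero {P : (bc Ω E).toAffine.Point} : Fb Ω E P = 0 ↔ P = 0 := act_eq_zero _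

lemma act_Fb (f : Ω →ₐ[k] Ω) (P : (bc Ω E).toAffine.Point) : act f (Fb Ω E P) = Fb Ω E (act f P) := by
  unfold Fb act
  apply emap_comm
  intro x
  change f (FiniteField.frobeniusAlgHom k Ω x) = FiniteField.frobeniusAlgHom k Ω (f x)
  simp [FiniteField.frobeniusAlgHom_apply]

lemma Fb_mem {P : (bc Ω E).toAffine.Point} (h : P ∈ SS g) : Fb Ω E P ∈ SS g := by
  refine ⟨?_, fun σ => ⟨fun hs => ?_, fun hs => ?_⟩⟩
  · have := mem_sepPts.1 h.1
    rw [mem_sepPts, xc_Fb, yc_Fb]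
    exact ⟨pow_mem this.1 _, pow_mem this.2 _⟩
  · rw [act_Fb, (h.2 σ).1 hs]
  · rw [act_Fb, (h.2 σ).2 hs, map_neg]

lemma dg_neg (P : (bc Ω E).toAffine.Point) : dg (-P) = dg P := by
  have : Rep (-P) = Rep P := by
    funext v
    have : xr (-P) = xr P := by
      by_cases h : P = 0
      · simp [h]
      · rw [xr_of_ne h, xr_of_ne (neg_ne_zero.2 h), xc_neg]
    unfold Rep; rw [this]
  by_cases h : ∃ v, Rep P v
  · obtain ⟨v, hv⟩ := h
    rw [hv.dg, Rep.dg (this ▸ hv)]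
  · unfold dg
    rw [dif_neg h, dif_neg (this ▸ h)]

lemma dg_Fb {P : (bc Ω E).toAffine.Point} {v : Fin 2 → k[X]} (hv : Rep P v) :
    dg (Fb Ω E P) = Fintype.card k * dg P := by
  have q0 : 0 < Fintype.card k := Fintype.card_pos
  have : Rep (Fb Ω E P) (fun i => v i ^ Fintype.card k) := by
    refine ⟨fun ρ => ?_, ?_⟩
    · obtain ⟨i, hi⟩ := hv.1 ρ
      exact ⟨i, by rw [map_pow]; exact pow_ne_zero _ hi⟩
    · obtain ⟨c, cn, hc⟩ := hv.2
      refine ⟨c ^ Fintype.card k, pow_ne_zero _ cn, fun i => ?_⟩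
      rw [map_pow, hc, mul_pow]
      congr 1
      by_cases h : P = 0
      · subst h; rw [map_zero, xr_zero]; fin_cases i <;> simp [q0.ne']
      · rw [xr_of_ne h, xr_of_ne (mt Fb_eq_zero.1 h), xc_Fb]
        fin_cases i <;> simp
  rw [this.dg, hv.dg]
  unfold nm
  have e : ∀ i, (v i ^ Fintype.card k).natDegree = Fintype.card k * (v i).natDegree := fun i => natDegree_pow _ _
  simp only [e]
  simp [Fin.univ_succ, Nat.mul_max_mul_left]

lemma SS_Rep (hg : g ≠ 0) (hgx : xc g = TT k Ω) {P} (h : P ∈ SS g) : ∃ v, Rep P v :=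
  exists_Rep (SS_rational hg ⟨_, hgx.symm⟩ h)

variable (g) in
/-- the trace -/
noncomputable def tr : ℤ := dg (g + Fb Ω E g) - 1 - Fintype.card k

lemma dg_lin (hg : g ≠ 0) (hgx : xc g = TT k Ω) (m n : ℤ) :
    (dg (m • g + n • Fb Ω E g) : ℤ) = m ^ 2 + m * n * tr g + n ^ 2 * Fintype.card k := by
  have hgm := g_mem hg hgx
  obtain ⟨v, hv⟩ := SS_Rep hg hgx hgm
  have e1 := dg_one_of hg hgx
  have e2 := dg_Fb hv
  rw [e1, mul_one] at e2
  have := quad_lin2 (f := fun P => (dg P : ℤ)) (SS_par hg hgx) hgm (Fb_mem hgm) m n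
  simp only [e1, e2] at this
  rw [this, tr]; push_cast; ring

lemma dg_F2 (hg : g ≠ 0) (hgx : xc g = TT k Ω) :
    (dg (g + Fb Ω E (Fb Ω E g)) : ℤ) = 1 + (tr g ^ 2 - 2 * Fintype.card k) + (Fintype.card k) ^ 2 := by
  have hgm := g_mem hg hgx
  have hF := Fb_mem hgm
  have hFF := Fb_mem hF
  have par := SS_par hg hgx
  set F := Fb Ω E
  set q : ℤ := ((Fintype.card k : ℕ) : ℤ) with hq
  obtain ⟨v, hv⟩ := SS_Rep hg hgx hgm
  obtain ⟨v1, hv1⟩ := SS_Rep hg hgx hF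
  have e1 := dg_one_of hg hgx
  have eF : (dg (F g) : ℤ) = q := by rw [dg_Fb hv, e1]; simp [hq]
  have eFF : (dg (F (F g)) : ℤ) = q ^ 2 := by
    rw [dg_Fb hv1]; push_cast; rw [eF, ← hq]; ring
  set h := g + F g with hh
  have hhm : h ∈ SS g := add_mem hgm hF
  have hD : (dg h : ℤ) = 1 + tr g + q := by
    have := dg_lin hg hgx 1 1
    simp only [one_smul] at this
    rw [hh, this]; ring
  have key : (dg (h + F h) : ℤ) = (dg h) ^ 2 := by
    by_cases ha : h ∈ algPts (E := E) (Ω := Ω)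
    · have h1 : h = 0 := const_zero hg hgx (AddMonoidHom.id _ + F)
        (fun f P => by simp [F, act_Fb]) hhm ((dg_zero_iff hg ⟨_, hgx.symm⟩ hhm).2 ha)
      have h0 : dg h = 0 := (dg_zero_iff hg ⟨_, hgx.symm⟩ hhm).2 ha
      rw [h0]
      rw [h1] at h0 ⊢
      simp [h0]
    · obtain ⟨h0, f, hf⟩ := not_mem_algPts ha
      obtain ⟨w, hw⟩ := SS_Rep hg hgx hhm
      have := Rep_comp h0 hw hw f hf
      have e : act f h = act f g + F (act f g) := by rw [hh, map_add, act_Fb]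
      rw [e] at this
      rcases act_g hg hgx h0 hf with h2 | h2
      · rw [h2] at this; rw [this]; push_cast; ring
      · rw [h2] at this
        have e3 : -h + F (-h) = -(h + F h) := by rw [map_neg]; abel
        rw [e3, dg_neg] at this; rw [this]; push_cast; ring
  have e4 : h + F h = g + (2 : ℤ) • F g + F (F g) := by
    rw [hh, map_add, two_zsmul]; abel
  have e5 := quad_cube (f := fun P => (dg P : ℤ)) par hgm (zsmul_mem hF 2) hFF
  have e6 := dg_lin hg hgx 1 2
  rw [one_smul] at e6
  have e7 : (dg ((2 : ℤ) • F g + F (F g)) : ℤ) = q * (4 + 2 * tr g + q) := by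
    have : (2 : ℤ) • F g + F (F g) = F ((2 : ℤ) • g + (1 : ℤ) • F g) := by simp
    obtain ⟨w, hw⟩ := SS_Rep hg hgx (add_mem (zsmul_mem hgm 2) (zsmul_mem hF 1))
    rw [this, dg_Fb hw]; push_cast; rw [dg_lin hg hgx, ← hq]; ring
  have e8 : (dg ((2 : ℤ) • F g) : ℤ) = 4 * q := by
    have := dg_lin hg hgx 0 2
    simp only [zero_smul, zero_add] at this
    rw [this, ← hq]; ring
  rw [← e4, key, hD, e6, e7, e1, e8, eFF] at e5
  linear_combination -e5

lemma dg_F2n (hg : g ≠ 0) (hgx : xc g = TT k Ω) (n : ℤ) :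
    (dg (n • g + Fb Ω E (Fb Ω E g)) : ℤ) =
      n ^ 2 + n * (tr g ^ 2 - 2 * Fintype.card k) + (Fintype.card k) ^ 2 := by
  have hgm := g_mem hg hgx
  have hF := Fb_mem hgm
  have hFF := Fb_mem hF
  have par := SS_par hg hgx
  obtain ⟨v, hv⟩ := SS_Rep hg hgx hgm
  obtain ⟨v1, hv1⟩ := SS_Rep hg hgx hF
  have e1 := dg_one_of hg hgx
  have eFF : (dg (Fb Ω E (Fb Ω E g)) : ℤ) = (Fintype.card k) ^ 2 := by
    rw [dg_Fb hv1, dg_Fb hv, e1]; push_cast; ring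
  have := quad_lin2 (f := fun P => (dg P : ℤ)) par hgm hFF n 1
  simp only [one_smul] at this
  rw [this, dg_F2 hg hgx, eFF, e1]; push_cast; ring

lemma char_g (hg : g ≠ 0) (hgx : xc g = TT k Ω) :
    Fb Ω E (Fb Ω E g) - tr g • Fb Ω E g + Fintype.card k • g = 0 := by
  have hgm := g_mem hg hgx
  have hF := Fb_mem hgm
  have hFF := Fb_mem hF
  have par := SS_par hg hgx
  obtain ⟨v, hv⟩ := SS_Rep hg hgx hgm
  obtain ⟨v1, hv1⟩ := SS_Rep hg hgx hF
  have e1 := dg_one_of hg hgx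
  set F := Fb Ω E
  have eFF : (dg (F (F g)) : ℤ) = (Fintype.card k) ^ 2 := by
    rw [dg_Fb hv1, dg_Fb hv, e1]; push_cast; ring
  set q : ℤ := ((Fintype.card k : ℕ) : ℤ) with hq
  set b := tr g
  have e : ∀ P : (bc Ω E).toAffine.Point, F (F P) - b • F P + Fintype.card k • P
      = F (F P) + (-b) • F P + q • P := by
    intro P; rw [hq, neg_smul, natCast_zsmul]; abel
  have hm : F (F g) + (-b) • F g + q • g ∈ SS g :=
    add_mem (add_mem hFF (zsmul_mem hF _)) (zsmul_mem hgm _)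
  rw [e]
  have h0 : (dg (F (F g) + (-b) • F g + q • g) : ℤ) = 0 := by
    have e5 := quad_cube (f := fun P => (dg P : ℤ)) par hFF (zsmul_mem hF (-b)) (zsmul_mem hgm q)
    have a1 : (dg (F (F g) + (-b) • F g) : ℤ) = q * q := by
      have : F (F g) + (-b) • F g = F ((-b) • g + (1 : ℤ) • F g) := by simp [add_comm]
      obtain ⟨w, hw⟩ := SS_Rep hg hgx (add_mem (zsmul_mem hgm (-b)) (zsmul_mem hF 1))
      rw [this, dg_Fb hw]; push_cast; rw [dg_lin hg hgx, ← hq]; ring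
    have a2 : (dg ((-b) • F g + q • g) : ℤ) = q ^ 2 := by
      rw [add_comm, dg_lin hg hgx, ← hq]; ring
    have a3 := dg_F2n hg hgx q
    rw [add_comm] at a3
    have a4 : (dg ((-b) • F g) : ℤ) = b ^ 2 * q := by
      have := dg_lin hg hgx 0 (-b)
      simp only [zero_smul, zero_add] at this
      rw [this, ← hq]; ring
    have a5 : (dg (q • g) : ℤ) = q ^ 2 := by
      have := dg_lin hg hgx q 0
      simp only [zero_smul, add_zero] at this
      rw [this]; ring
    rw [a1, a2, a3, a4, a5, eFF, ← hq] at e5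
    rw [e5]; ring
  have := const_zero hg hgx (F.comp F + (-b) • F + q • AddMonoidHom.id _)
    (fun f P => by simp [F, act_Fb]) (by simpa using hm)
  simp only [AddMonoidHom.add_apply, AddMonoidHom.comp_apply, AddMonoidHom.smul_apply,
    AddMonoidHom.id_apply] at this
  exact this (by exact_mod_cast h0)

lemma char_all (hg : g ≠ 0) (hgx : xc g = TT k Ω) (P : (bc Ω E).toAffine.Point) :
    Fb Ω E (Fb Ω E P) - tr g • Fb Ω E P + Fintype.card k • P = 0 := by
  have h1 : ∀ P : (bc Ω E).toAffine.Point, P ∉ algPts (E := E) (Ω := Ω) →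
    Fb Ω E (Fb Ω E P) - tr g • Fb Ω E P + Fintype.card k • P = 0 := by
    intro P hP
    obtain ⟨h0, f, hf⟩ := not_mem_algPts hP
    have := congrArg (act f) (char_g hg hgx)
    simp only [map_add, map_sub, map_zsmul, map_nsmul, act_Fb, map_zero] at this
    rcases act_g hg hgx h0 hf with h2 | h2
    · rwa [h2] at this
    · rw [h2] at this
      rw [← neg_eq_zero, ← this]
      simp only [map_neg, smul_neg]; abel
  by_cases hP : P ∈ algPts (E := E) (Ω := Ω)
  · have h2 := h1 (P + g) (fun h => g_not_alg hgx (by simpa using sub_mem h hP))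
    have h3 := char_g hg hgx
    simp only [map_add, smul_add] at h2
    have h4 := congrArg₂ (· - ·) h2 h3
    simp only [sub_zero] at h4
    rw [← h4]; abel
  · exact h1 P hP
end setup
end WC

set_option linter.unusedSectionVars false
set_option linter.style.haveILetI false
namespace WC
open WeierstrassCurve WeierstrassCurve.Affine Polynomial

section setup
variable {k : Type*} [Field k] [Fintype k] {Ω : Type*} [Field Ω] [DecidableEq Ω] [IsAlgClosed Ω]
  [Algebra k Ω] [Algebra (RatFunc k) Ω] [IsScalarTower k (RatFunc k) Ω]
  [Algebra.IsAlgebraic (RatFunc k) Ω] {E : WeierstrassCurve k} [E.IsElliptic]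
  {g : (bc Ω E).toAffine.Point}

lemma alg_of_pow {x : Ω} (h : x ^ Fintype.card k = x) : IsAlgebraic k x := by
  refine ⟨X ^ Fintype.card k - X, ?_, by simp [h]⟩
  exact FiniteField.X_pow_card_sub_X_ne_zero _ Fintype.one_lt_card

lemma alg_of_Fb {P : (bc Ω E).toAffine.Point} (h : Fb Ω E P = P ∨ Fb Ω E P = -P) :
    P ∈ algPts (E := E) (Ω := Ω) := by
  rw [mem_algPts]
  apply alg_of_pow
  rw [← xc_Fb]
  rcases h with h | h
  · rw [h]
  · rw [h, xc_neg]

lemma card_E [DecidableEq k] (hg : g ≠ 0) (hgx : xc g = TT k Ω) :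
    (Nat.card E.toAffine.Point : ℤ) = 1 + Fintype.card k - tr g := by
  have hgm := g_mem hg hgx
  have hF := Fb_mem hgm
  have k1 : ∀ ε : ℤ, (ε = 1 ∨ ε = -1) →
      ((Set.ncard {P | Fb Ω E P = ε • P} : ℕ) : ℤ) ≤ 1 + Fintype.card k - ε * tr g := by
    intro ε hε
    have hsq : ε * ε = 1 := by rcases hε with rfl | rfl <;> norm_num
    have e0 : ∀ P, (ε • AddMonoidHom.id (bc Ω E).toAffine.Point - Fb Ω E) P = ε • P + (-1 : ℤ) • Fb Ω E P := by
      intro P; simp [sub_eq_add_neg]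
    have e1 : ∀ P, (ε • AddMonoidHom.id (bc Ω E).toAffine.Point - Fb Ω E) P = 0 ↔ Fb Ω E P = ε • P := by
      intro P; rw [AddMonoidHom.sub_apply, sub_eq_zero]; exact eq_comm
    have e2 : ∀ P, Fb Ω E P = ε • P → P ∈ algPts (E := E) (Ω := Ω) := by
      intro P h
      apply alg_of_Fb
      rcases hε with rfl | rfl
      · left; simpa using h
      · right; simpa using h
    have := ker_card_le hg hgx (ε • AddMonoidHom.id _ - Fb Ω E) (fun f P => by simp [act_Fb])
      (by rw [e0]; exact add_mem (zsmul_mem hgm _) (zsmul_mem hF _))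
      (fun h => g_not_alg hgx (e2 g ((e1 g).1 h)))
      (fun P h => e2 P ((e1 P).1 h))
    rw [e0] at this
    simp only [e1] at this
    calc ((Set.ncard {P | Fb Ω E P = ε • P} : ℕ) : ℤ) ≤ (dg (ε • g + (-1 : ℤ) • Fb Ω E g) : ℤ) := by
          exact_mod_cast this
      _ = _ := by rw [dg_lin hg hgx]; linear_combination hsq
  have k2 := k1 1 (Or.inl rfl)
  have k3 := k1 (-1) (Or.inr rfl)
  simp only [one_smul, neg_smul, one_mul] at k2 k3
  have hS := card_Spm (Fb Ω E) (Fintype.card k) (fun P hP => ⟨mt Fb_eq_zero.1 hP, xc_Fb P⟩)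
    (Finset.univ.image (algebraMap k Ω)) (by
      intro x
      simp only [Finset.mem_image, Finset.mem_univ, true_and]
      constructor
      · rintro ⟨z, rfl⟩; rw [← map_pow, FiniteField.pow_card]
      · intro h; exact fix_pow_card (algebraMap k Ω) h) (by
      rw [Finset.card_image_of_injective _ (algebraMap k Ω).injective]; rfl)
  have hc : Nat.card E.toAffine.Point = Set.ncard {P | Fb Ω E P = P} := by
    rw [card_points_finite (algebraMap k Ω) E]
    congr 1
    ext P
    simp only [Set.mem_ofPred_eq]
    by_cases hP : P = 0
    · subst hP; simp [xc, yc, Fintype.card_ne_zero]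
    constructor
    · rintro ⟨h1, h2⟩
      exact point_ext (mt Fb_eq_zero.1 hP) hP (by rw [xc_Fb, h1]) (by rw [yc_Fb, h2])
    · intro h
      rw [← xc_Fb, ← yc_Fb, h]; exact ⟨rfl, rfl⟩
  rw [hc]
  have := hS.2.2
  omega

lemma ss_key (hg : g ≠ 0) (hgx : xc g = TT k Ω) {p : ℕ} [hp : Fact p.Prime] [CharP k p]
    (h : (p : ℤ) ∣ tr g) : (Fintype.card k : ℤ) ∣ tr g ^ 2 := by
  have hgm := g_mem hg hgx
  have hF := Fb_mem hgm
  haveI : CharP Ω p := charP_of_injective_algebraMap (algebraMap k Ω).injective p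
  obtain ⟨n, -, hn⟩ := FiniteField.card k p
  set q := Fintype.card k with hq
  obtain ⟨b', hb'⟩ := h
  have pt : ∀ P : (bc Ω E).toAffine.Point, p • P = 0 → P = 0 := by
    intro P hP
    have h1 := char_all hg hgx P
    have h2 : tr g • Fb Ω E P = 0 := by
      rw [hb', mul_comm, mul_smul, natCast_zsmul, ← map_nsmul, hP]; simp
    have h3 : Fintype.card k • P = 0 := by
      obtain ⟨m, hm⟩ : ∃ m, (n : ℕ) = m + 1 := ⟨n - 1, by have := n.pos; omega⟩
      rw [← hq, hn, hm, pow_succ, mul_smul, hP, smul_zero]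
    rw [h2, h3, sub_zero, add_zero] at h1
    exact Fb_eq_zero.1 (Fb_eq_zero.1 h1)
  have pt2 : ∀ (m : ℕ) (P : (bc Ω E).toAffine.Point), p ^ m • P = 0 → P = 0 := by
    intro m
    induction m with
    | zero => intro P h; simpa using h
    | succ m ih => intro P h; rw [pow_succ, mul_smul] at h; exact pt _ (ih _ h)
  have qt : ∀ P : (bc Ω E).toAffine.Point, q • P = 0 → P = 0 := by rw [hn]; exact pt2 n
  have hqg : q • g ∈ SS g := nsmul_mem hgm q
  have hqg0 : q • g ≠ 0 := fun h => hg (qt g h)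
  obtain ⟨v, hv⟩ := SS_Rep hg hgx hqg
  have hN : nm v = q ^ 2 := by
    have := dg_lin hg hgx q 0
    simp only [zero_smul, add_zero, natCast_zsmul] at this
    rw [hv.dg] at this
    have h2 : (nm v : ℤ) = (q : ℤ) ^ 2 := by rw [this]; ring
    exact_mod_cast h2
  obtain ⟨P, hPd, hPn, hP0, htr, hroot⟩ := fibre hg hgx (q • AddMonoidHom.id _)
    (fun f P => by simp) hqg hqg0 hv
  have er : ((q • AddMonoidHom.id _ : (bc Ω E).toAffine.Point →+ _) g) = q • g := rfl
  rw [er] at htr hPd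
  have hroots : ∀ ρ ∈ P.roots, ρ = TT k Ω := by
    intro ρ hρ
    rw [mem_roots hP0] at hρ
    by_cases ha : IsAlgebraic k ρ
    · exfalso
      have h1 : aeval ρ (v 0) = xc (q • g) * aeval ρ (v 1) := by
        rw [hPd] at hρ
        simp only [IsRoot, eval_sub, eval_mul, eval_C, eval_map_algebraMap] at hρ
        linear_combination hρ
      have al : ∀ f : k[X], IsAlgebraic k (aeval ρ f) := fun f => by
        rw [← mem_algebraicClosure_iff] at ha ⊢
        exact Algebra.adjoin_le (S := (algebraicClosure k Ω).toSubalgebra) (Set.singleton_subset_iff.2 ha)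
          (aeval_mem_adjoin_singleton k ρ)
      by_cases h2 : aeval ρ (v 1) = 0
      · obtain ⟨i, hi⟩ := hv.1 ρ
        fin_cases i
        · exact hi (by change aeval ρ (v 0) = 0; rw [h1, h2, mul_zero])
        · exact hi h2
      · apply htr
        rw [eq_comm, ← eq_div_iff h2] at h1
        rw [h1]
        rw [← mem_algebraicClosure_iff]
        exact div_mem (mem_algebraicClosure_iff.2 (al _)) (mem_algebraicClosure_iff.2 (al _))
    · obtain ⟨Q, hQ, hQx⟩ := exists_xc (W := bc Ω E) ρ
      have hQa : Q ∉ algPts (E := E) (Ω := Ω) := by rw [mem_algPts, hQx]; exact ha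
      rw [← hQx, hroot Q hQa] at hρ
      have e : ∀ Q, ((q • AddMonoidHom.id _ : (bc Ω E).toAffine.Point →+ _) Q) = q • Q := fun _ => rfl
      rw [e, e] at hρ
      rw [← hQx, ← hgx]
      rcases hρ with h | h
      · rw [sub_eq_zero.1 (qt (Q - g) (by rw [smul_sub, h, sub_self]))]
      · rw [eq_neg_of_add_eq_zero_left (qt (Q + g) (by rw [smul_add, h, neg_add_cancel])), xc_neg]
  have hrep : P.roots = Multiset.replicate (q ^ 2) (TT k Ω) := by
    rw [Multiset.eq_replicate]
    refine ⟨?_, hroots⟩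
    rw [← hN, ← hPn]
    exact splits_iff_card_roots.1 (IsAlgClosed.splits P)
  have hPe : P = C P.leadingCoeff * (X ^ q ^ 2 - C (TT k Ω ^ q ^ 2)) := by
    have h1 := (IsAlgClosed.splits P).eq_prod_roots
    rw [hrep, Multiset.map_replicate, Multiset.prod_replicate] at h1
    have h2 : (X - C (TT k Ω)) ^ q ^ 2 = X ^ q ^ 2 - C (TT k Ω ^ q ^ 2) := by
      rw [hn, ← pow_mul, sub_pow_char_pow, C_pow]
    rw [h2] at h1; exact h1
  have hco : ∀ j, j ≠ 0 → j ≠ q ^ 2 → ∀ i, (v i).coeff j = 0 := by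
    intro j h0 h1
    have hj : P.coeff j = 0 := by
      rw [hPe, coeff_C_mul, coeff_sub, coeff_X_pow, coeff_C, if_neg h1, if_neg h0]; simp
    rw [hPd] at hj
    simp at hj
    have h1 : (v 1).coeff j = 0 := by
      by_contra h1
      apply htr
      have : xc (q • g) = algebraMap k Ω ((v 0).coeff j / (v 1).coeff j) := by
        rw [map_div₀, eq_div_iff (by simpa using h1)]
        linear_combination -hj
      rw [this]; exact isAlgebraic_algebraMap _
    rw [h1] at hj
    simp at hj
    intro i; fin_cases i
    · exact hj
    · exact h1
  have q2 : q ^ 2 ≠ 0 := pow_ne_zero _ Fintype.card_ne_zero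
  have hvi : ∀ i, ∃ a b : k, aeval (TT k Ω) (v i) =
      (algebraMap k Ω a * TT k Ω + algebraMap k Ω b) ^ q ^ 2 := by
    intro i
    refine ⟨(v i).coeff (q ^ 2), (v i).coeff 0, ?_⟩
    have : v i = C ((v i).coeff (q ^ 2)) * X ^ q ^ 2 + C ((v i).coeff 0) := by
      ext j
      by_cases h0 : j = 0
      · subst h0; simp [q2.symm, coeff_X_pow]
      by_cases h1 : j = q ^ 2
      · subst h1; simp only [coeff_add, coeff_C_mul, coeff_X_pow_self, mul_one, coeff_C, if_neg q2, add_zero]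
      · rw [hco j h0 h1 i]; simp [coeff_C, coeff_X_pow, h0, h1]
    conv_lhs => rw [this]
    have hf : ∀ a : k, a ^ q ^ 2 = a := by
      intro a; rw [pow_two, pow_mul, FiniteField.pow_card, FiniteField.pow_card]
    have h2 : ∀ x y : Ω, (x + y) ^ q ^ 2 = x ^ q ^ 2 + y ^ q ^ 2 := by
      intro x y; rw [hn, ← pow_mul, add_pow_char_pow]
    rw [h2, mul_pow, ← map_pow, ← map_pow, hf, hf]
    simp
  obtain ⟨ξ, hξr, hξ⟩ : ∃ ξ ∈ (algebraMap (RatFunc k) Ω).range, ξ ^ q ^ 2 = xc (q • g) := by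
    obtain ⟨a0, b0, h0⟩ := hvi 0
    obtain ⟨a1, b1, h1⟩ := hvi 1
    obtain ⟨c, cn, hc⟩ := hv.2
    have c0 := hc 0
    have c1 := hc 1
    rw [xr_of_ne hqg0] at c0 c1
    simp at c0 c1
    have mm : ∀ a b : k, algebraMap k Ω a * TT k Ω + algebraMap k Ω b ∈ (algebraMap (RatFunc k) Ω).fieldRange := by
      intro a b
      refine add_mem (mul_mem ?_ ⟨_, rfl⟩) ?_ <;>
      · rw [IsScalarTower.algebraMap_apply k (RatFunc k) Ω]; exact ⟨_, rfl⟩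
    refine ⟨(algebraMap k Ω a0 * TT k Ω + algebraMap k Ω b0) / (algebraMap k Ω a1 * TT k Ω + algebraMap k Ω b1),
      (div_mem (mm _ _) (mm _ _) : _ ∈ (algebraMap (RatFunc k) Ω).fieldRange), ?_⟩
    rw [div_pow, ← h0, ← h1, c0, c1]
    field_simp
  obtain ⟨hpt, hpt0, hptx⟩ := exists_xc (W := bc Ω E) ξ
  have hF2x : ∀ P, xc (Fb Ω E (Fb Ω E P)) = xc P ^ q ^ 2 := by
    intro P; rw [xc_Fb, xc_Fb, ← hq, ← pow_mul, pow_two]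
  have hF0 : ∀ {P}, P ≠ 0 → Fb Ω E (Fb Ω E P) ≠ 0 := fun h => mt Fb_eq_zero.1 (mt Fb_eq_zero.1 h)
  obtain ⟨h, hh0, hhx, hh⟩ : ∃ h, h ≠ 0 ∧ xc h = ξ ∧ Fb Ω E (Fb Ω E h) = q • g := by
    rcases (xc_eq_iff (hF0 hpt0) hqg0).1 (by rw [hF2x, hptx, hξ]) with h | h
    · exact ⟨hpt, hpt0, hptx, h⟩
    · exact ⟨-hpt, neg_ne_zero.2 hpt0, by rw [xc_neg, hptx], by rw [map_neg, map_neg, h, neg_neg]⟩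
  have hinj : ∀ {P Q}, Fb Ω E (Fb Ω E P) = Fb Ω E (Fb Ω E Q) → P = Q := by
    intro P Q h
    by_contra hne
    exact hF0 (sub_ne_zero.2 hne) (by rw [map_sub, map_sub, h, sub_self])
  have hhS : h ∈ SS g := by
    refine ⟨mem_sepPts_of hh0 (fun h2 => ?_) (by rw [hhx]; exact hξr), fun σ => ⟨fun hs => ?_, fun hs => ?_⟩⟩
    · have : q • g + q • g = 0 := by rw [← hh, ← map_add, ← map_add, h2]; simp
      exact htr (mem_algPts.1 (two_torsion_alg this))
    · apply hinj
      rw [← act_Fb, ← act_Fb, hh, map_nsmul, hs]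
    · apply hinj
      rw [← act_Fb, ← act_Fb, map_neg, map_neg, hh, map_nsmul, hs, smul_neg]
  have h1 := dg_F2n hg hgx q
  rw [natCast_zsmul, ← hh, ← map_add, ← map_add] at h1
  obtain ⟨w, hw⟩ := SS_Rep hg hgx (add_mem hhS hgm)
  obtain ⟨w', hw'⟩ := SS_Rep hg hgx (Fb_mem (add_mem hhS hgm))
  rw [dg_Fb hw', dg_Fb hw, ← hq] at h1
  push_cast at h1
  refine ⟨dg (h + g), ?_⟩
  have q0 : (q : ℤ) ≠ 0 := by exact_mod_cast Fintype.card_ne_zero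
  apply mul_left_cancel₀ q0
  linear_combination -h1
end setup

/-- trace statement: if the trace is divisible by `p`, its square is divisible by `q` -/
theorem trace_dvd {k : Type*} [Field k] [Fintype k] [DecidableEq k] (E : WeierstrassCurve k) [E.IsElliptic]
    (p : ℕ) [Fact p.Prime] [CharP k p] (t : ℤ) (ht : (Nat.card E.toAffine.Point : ℤ) = 1 + Fintype.card k - t)
    (h : (p : ℤ) ∣ t) : (Fintype.card k : ℤ) ∣ t ^ 2 := by
  classical
  let Ω := AlgebraicClosure (RatFunc k)
  obtain ⟨g, hg, hgx⟩ := exists_xc (W := bc Ω E) (TT k Ω)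
  have h1 := card_E hg hgx
  have : t = tr g := by rw [ht] at h1; linarith
  subst this
  exact ss_key hg hgx h
end WC

set_option linter.unusedSectionVars false
set_option linter.style.haveILetI false
namespace WC
open WeierstrassCurve WeierstrassCurve.Affine Polynomial

lemma arith (q d : ℕ) (hd : 0 < d) (hbig : 56 * d ^ 2 < q) :
    d < Nat.sqrt (4 * q) ∧ 3 * q < (Nat.sqrt (4 * q) - d) ^ 2 ∧ (Nat.sqrt (4 * q) - d) ^ 2 < 4 * q := by
  have h1 := Nat.sqrt_le' (4 * q)
  have h2 := Nat.lt_succ_sqrt' (4 * q)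
  generalize Nat.sqrt (4 * q) = s at *
  have h3 : d < s := by
    by_contra h
    push Not at h
    have : (s + 1) ^ 2 ≤ (2 * d) ^ 2 := Nat.pow_le_pow_left (by omega) 2
    rw [Nat.succ_eq_add_one] at h2
    nlinarith
  obtain ⟨t, rfl⟩ : ∃ t, s = t + d := ⟨s - d, by omega⟩
  rw [Nat.add_sub_cancel]
  refine ⟨h3, ?_, ?_⟩
  · by_contra h
    push Not at h
    have h4 : 4 * q < (t + 2 * d) ^ 2 :=
      lt_of_lt_of_le h2 (Nat.pow_le_pow_left (by omega) 2)
    zify at *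
    nlinarith [sq_nonneg (13 * (d : ℤ) - t)]
  · nlinarith

theorem forward (q d : ℕ) (hd : 0 < d) (hbig : 56 * d ^ 2 < q)
    (Fq : Type*) [Field Fq] [Fintype Fq] (hcard : Fintype.card Fq = q)
    (E : WeierstrassCurve Fq) (hE : E.IsElliptic)
      (h : Nat.card E.toAffine.Point = q + 1 + (Nat.sqrt (4 * q) - d)) :
      Nat.Coprime q (Nat.sqrt (4 * q) - d) := by
  classical
  obtain ⟨h1, h2, h3⟩ := arith q d hd hbig
  set t := Nat.sqrt (4 * q) - d
  obtain ⟨p, hp⟩ := CharP.exists Fq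
  obtain ⟨n, pp, hn⟩ := FiniteField.card Fq p
  haveI : Fact p.Prime := ⟨pp⟩
  rw [hcard] at hn
  by_contra hc
  have hpt : p ∣ t := by
    by_contra hpt
    apply hc
    rw [hn]
    exact Nat.Coprime.pow_left _ ((Nat.Prime.coprime_iff_not_dvd pp).2 hpt)
  have := trace_dvd E p (-t) (by rw [h, hcard]; push_cast; ring) (by
    rw [dvd_neg]; exact_mod_cast hpt)
  rw [neg_sq, hcard] at this
  have h5 : q ∣ t ^ 2 := by exact_mod_cast this
  obtain ⟨c, hc'⟩ := h5
  rw [hc'] at h2 h3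
  have a : 3 < c := by by_contra h; push Not at h; nlinarith
  have b : c < 4 := by by_contra h; push Not at h; nlinarith
  omega
end WC

set_option linter.unusedSectionVars false
set_option linter.style.haveILetI false
namespace WC
open WeierstrassCurve WeierstrassCurve.Affine Polynomial

section L1
variable {k : Type*} [Field k] [DecidableEq k] [IsAlgClosed k]

lemma b_eq_of_x {W1 W2 : WeierstrassCurve k} [W1.IsElliptic] [W2.IsElliptic]
    (ψ : W2.toAffine.Point →+ W1.toAffine.Point)
    (hψ : ∀ P, P ≠ 0 → ψ P ≠ 0 ∧ xc (ψ P) = xc P) :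
    W1.b₂ = W2.b₂ ∧ W1.b₄ = W2.b₄ ∧ W1.b₆ = W2.b₆ ∧ W1.b₈ = W2.b₈ := by
  have key : ∀ x x' : k, x ≠ x' →
      W1.b₂ * (x * x') + W1.b₄ * (x + x') + W1.b₆ = W2.b₂ * (x * x') + W2.b₄ * (x + x') + W2.b₆ ∧
      W1.b₄ * (x * x') + W1.b₆ * (x + x') + W1.b₈ = W2.b₄ * (x * x') + W2.b₆ * (x + x') + W2.b₈ := by
    intro x x' hx
    obtain ⟨P, hP, rfl⟩ := exists_xc (W := W2) x
    obtain ⟨Q, hQ, rfl⟩ := exists_xc (W := W2) x'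
    obtain ⟨hP1, hP2⟩ := hψ P hP
    obtain ⟨hQ1, hQ2⟩ := hψ Q hQ
    have h1 : P + Q ≠ 0 := fun h => hx (by rw [eq_neg_of_add_eq_zero_left h, xc_neg])
    have h2 : P - Q ≠ 0 := fun h => hx (by rw [sub_eq_zero.1 h])
    have e1 := addsub hP hQ hx
    have e2 := addsub hP1 hQ1 (by rwa [hP2, hQ2])
    rw [← map_add, ← map_sub, (hψ _ h1).2, (hψ _ h2).2, hP2, hQ2] at e2
    constructor
    · linear_combination e1.2 - e2.2
    · linear_combination e2.1 - e1.1
  have : Infinite k := IsAlgClosed.instInfinite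
  have lin : ∀ A B C : k, (∀ x x' : k, x ≠ x' → A * (x * x') + B * (x + x') + C = 0) →
      A = 0 ∧ B = 0 ∧ C = 0 := by
    intro A B C h
    obtain ⟨u, hu⟩ := Infinite.exists_notMem_finset ({0} : Finset k)
    obtain ⟨w, hw⟩ := Infinite.exists_notMem_finset ({0, u} : Finset k)
    simp only [Finset.mem_singleton, Finset.mem_insert, not_or] at hu hw
    have h1 := h 0 u (Ne.symm hu)
    have h2 := h 0 w (Ne.symm hw.1)
    have h3 := h u w (Ne.symm hw.2)
    have hB : B = 0 := by
      have : B * (u - w) = 0 := by linear_combination h1 - h2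
      rcases mul_eq_zero.1 this with h | h
      · exact h
      · exact absurd (sub_eq_zero.1 h).symm hw.2
    subst hB
    have hC : C = 0 := by linear_combination h1
    subst hC
    refine ⟨?_, rfl, rfl⟩
    have : A * (u * w) = 0 := by linear_combination h3
    simpa [hu, hw.1] using this
  have l1 := lin (W1.b₂ - W2.b₂) (W1.b₄ - W2.b₄) (W1.b₆ - W2.b₆) fun x x' h => by
    linear_combination (key x x' h).1
  have l2 := lin (W1.b₄ - W2.b₄) (W1.b₆ - W2.b₆) (W1.b₈ - W2.b₈) fun x x' h => by
    linear_combination (key x x' h).2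
  exact ⟨sub_eq_zero.1 l1.1, sub_eq_zero.1 l1.2.1, sub_eq_zero.1 l1.2.2, sub_eq_zero.1 l2.2.2⟩

lemma quad_root (b c : k) : ∃ s : k, s ^ 2 + b * s + c = 0 := by
  obtain ⟨y, hy⟩ := IsAlgClosed.exists_root (X ^ 2 + C b * X + C c : Polynomial k) (by
      have : (X ^ 2 + C b * X + C c : Polynomial k).degree = 2 := by compute_degree!
      rw [this]; decide)
  exact ⟨y, by simpa using hy⟩

lemma st_of_b {W1 W2 : WeierstrassCurve k} (h2 : W1.b₂ = W2.b₂) (h4 : W1.b₄ = W2.b₄)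
    (h6 : W1.b₆ = W2.b₆) (h8 : W1.b₈ = W2.b₈) :
    ∃ s t : k, (⟨1, 0, s, t⟩ : VariableChange k) • W1 = W2 := by
  suffices h : ∃ s t : k, W2.a₁ = W1.a₁ + 2 * s ∧ W2.a₂ = W1.a₂ - s * W1.a₁ - s ^ 2 ∧
      W2.a₃ = W1.a₃ + 2 * t ∧ W2.a₄ = W1.a₄ - s * W1.a₃ - t * W1.a₁ - 2 * s * t ∧
      W2.a₆ = W1.a₆ - t * W1.a₃ - t ^ 2 by
    obtain ⟨s, t, e1, e2, e3, e4, e6⟩ := h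
    refine ⟨s, t, ?_⟩
    ext
    · simp [variableChange_a₁, e1]
    · simp [variableChange_a₂, e2]
    · simp [variableChange_a₃, e3]
    · simp [variableChange_a₄, e4]
    · simp [variableChange_a₆, e6]
  unfold b₂ at h2
  unfold b₄ at h4
  unfold b₆ at h6
  unfold b₈ at h8
  by_cases c2 : (2 : k) = 0
  · have e1 : W2.a₁ = W1.a₁ := by
      have : (W2.a₁ - W1.a₁) ^ 2 = 0 := by
        linear_combination -h2 + c2 * (2 * W1.a₂ - 2 * W2.a₂ - W1.a₁ * W2.a₁ + W1.a₁ ^ 2)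
      exact sub_eq_zero.1 (pow_eq_zero_iff (by norm_num) |>.1 this)
    have e3 : W2.a₃ = W1.a₃ := by
      have : (W2.a₃ - W1.a₃) ^ 2 = 0 := by
        linear_combination -h6 + c2 * (2 * W1.a₆ - 2 * W2.a₆ - W1.a₃ * W2.a₃ + W1.a₃ ^ 2)
      exact sub_eq_zero.1 (pow_eq_zero_iff (by norm_num) |>.1 this)
    rw [e1, e3] at h8
    rw [e1, e3]
    obtain ⟨s, hs⟩ := quad_root W1.a₁ (W2.a₂ - W1.a₂)
    obtain ⟨t, ht⟩ := quad_root W1.a₃ (W2.a₆ - W1.a₆)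
    have hh : (W2.a₄ - (W1.a₄ - s * W1.a₃ - t * W1.a₁)) *
        (W2.a₄ - (W1.a₄ - s * W1.a₃ - t * W1.a₁) + W1.a₁ * W1.a₃) = 0 := by
      linear_combination h8 + W1.a₁ ^ 2 * ht + W1.a₃ ^ 2 * hs + c2 * (W1.a₄ ^ 2 - W2.a₄ * W1.a₄ +
        (W2.a₄ - W1.a₄) * (s * W1.a₃ + t * W1.a₁) + s * t * W1.a₁ * W1.a₃ -
        2 * (W1.a₂ * W1.a₆ - W2.a₂ * W2.a₆))
    rcases mul_eq_zero.1 hh with h | h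
    · refine ⟨s, t, by linear_combination -c2 * s, by linear_combination hs,
        by linear_combination -c2 * t, by linear_combination h + c2 * (s * t), by linear_combination ht⟩
    · refine ⟨s + W1.a₁, t, by linear_combination -c2 * (s + W1.a₁),
        by linear_combination hs - c2 * (- s * W1.a₁ - W1.a₁ ^ 2),
        by linear_combination -c2 * t,
        by linear_combination h + c2 * ((s + W1.a₁) * t), by linear_combination ht⟩
  · refine ⟨(W2.a₁ - W1.a₁) / 2, (W2.a₃ - W1.a₃) / 2, by field_simp; ring, ?_, by field_simp; ring,
      ?_, ?_⟩
    · field_simp; linear_combination -h2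
    · field_simp; linear_combination -h4
    · field_simp; linear_combination -h6

lemma iso_x {W1 W2 : WeierstrassCurve k} [W1.IsElliptic] [W2.IsElliptic]
    (ψ : W2.toAffine.Point →+ W1.toAffine.Point)
    (hψ : ∀ P, P ≠ 0 → ψ P ≠ 0 ∧ xc (ψ P) = xc P) :
    ∃ C : VariableChange k, C • W1 = W2 ∧ (C.u : k) ^ 2 = 1 ∧ C.r = 0 ∧
      ∀ P, P ≠ 0 → yc (ψ P) = (C.u : k) ^ 3 * yc P + (C.u : k) ^ 2 * C.s * xc P + C.t := by
  obtain ⟨h2, h4, h6, h8⟩ := b_eq_of_x ψ hψ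
  obtain ⟨s, t, hC⟩ := st_of_b h2 h4 h6 h8
  obtain ⟨C, hCdef⟩ : ∃ C : VariableChange k, C = ⟨1, 0, s, t⟩ := ⟨_, rfl⟩
  rw [← hCdef] at hC
  subst hC
  have hpm : ∀ P, ψ P = vcHom C P ∨ ψ P = - vcHom C P := by
    intro P
    by_cases hP : P = 0
    · subst hP; left; simp
    · rw [← xc_eq_iff (hψ P hP).1 (vcHom_ne_zero C hP), (hψ P hP).2, xc_vcHom C hP]
      simp [hCdef]
  have hglob : (∀ P, ψ P = vcHom C P) ∨ (∀ P, ψ P = - vcHom C P) := by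
    by_contra hcon
    push Not at hcon
    obtain ⟨⟨P, hP⟩, ⟨Q, hQ⟩⟩ := hcon
    have hP' := (hpm P).resolve_left hP
    have hQ' := (hpm Q).resolve_right hQ
    rcases hpm (P + Q) with h | h
    · rw [map_add, map_add, hQ'] at h
      exact hP (add_right_cancel h)
    · rw [map_add, map_add, hP', neg_add] at h
      exact hQ (add_left_cancel h)
  rcases hglob with h | h
  · exact ⟨C, rfl, by simp [hCdef], by rw [hCdef], fun P hP => by rw [h, yc_vcHom C hP]⟩
  · refine ⟨⟨-1, 0, -s - W1.a₁, -t - W1.a₃⟩, ?_, by simp, rfl, fun P hP => ?_⟩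
    · ext
      · simp [hCdef, variableChange_a₁]; ring
      · simp [hCdef, variableChange_a₂]; ring
      · simp [hCdef, variableChange_a₃]; ring
      · simp [hCdef, variableChange_a₄]; ring
      · simp [hCdef, variableChange_a₆]; ring
    · rw [h, yc_neg (vcHom_ne_zero C hP), yc_vcHom C hP, xc_vcHom C hP]
      simp [hCdef]; ring

lemma lin_root {n : ℕ} (hn : 1 < n) (a b : k) (ha : a ≠ 0) : ∃ r : k, r ^ n * a + b = r := by
  obtain ⟨y, hy⟩ := IsAlgClosed.exists_root (C a * X ^ n - X + C b : Polynomial k) (by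
      have : (C a * X ^ n - X + C b : Polynomial k).degree = n := by
        have h1 : (C a * X ^ n : Polynomial k).degree = n := degree_C_mul_X_pow n ha
        rw [degree_add_eq_left_of_degree_lt, degree_sub_eq_left_of_degree_lt, h1]
        · rw [h1, degree_X]; exact_mod_cast hn
        · rw [degree_sub_eq_left_of_degree_lt, h1]
          · exact lt_of_le_of_lt degree_C_le (by exact_mod_cast (by omega : 0 < n))
          · rw [h1, degree_X]; exact_mod_cast hn
      rw [this]; exact_mod_cast (by omega : n ≠ 0))
  refine ⟨y, ?_⟩
  have : a * y ^ n - y + b = 0 := by simpa using hy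
  linear_combination this

/-- Frobenius twisted form of an endomorphism. -/
theorem lang {q : ℕ} (hq1 : 1 < q) (φ : k →+* k) (hφ : ∀ x, φ x = x ^ q)
    {W : WeierstrassCurve k} [W.IsElliptic] (π : W.toAffine.Point →+ W.toAffine.Point)
    (a b : k) (ha : a ≠ 0) (hπ : ∀ P, P ≠ 0 → π P ≠ 0 ∧ xc (π P) = a * xc P ^ q + b)
    {Fq : Type*} [Field Fq] [Fintype Fq] (hFq : Fintype.card Fq = q) (f : Fq →+* k) :
    ∃ E : WeierstrassCurve Fq, E.IsElliptic ∧
      ∃ e : (E.map f).toAffine.Point ≃+ W.toAffine.Point, ∀ P P', P ≠ 0 → P' ≠ 0 →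
        xc P' = xc P ^ q → yc P' = yc P ^ q → π (e P) = e P' := by
  have hsurj : Function.Surjective φ := fun x => by
    obtain ⟨z, hz⟩ := IsAlgClosed.exists_pow_nat_eq x (by omega : 0 < q)
    exact ⟨z, by rw [hφ, hz]⟩
  have bij : Function.Bijective (pmap (W := W) φ) := by
    refine ⟨(injective_iff_map_eq_zero _).2 fun P hP => (pmap_eq_zero φ).1 hP, fun Q => ?_⟩
    by_cases hQ : Q = 0
    · exact ⟨0, by rw [hQ, map_zero]⟩
    obtain ⟨x, hx⟩ := hsurj (xc Q)
    obtain ⟨y, hy⟩ := hsurj (yc Q)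
    have hns := nonsing hQ
    rw [← hx, ← hy] at hns
    have hns' := (W.toAffine.map_nonsingular φ.injective ..).mp hns
    refine ⟨Point.some x y hns', point_ext (pmap_ne_zero φ (Point.some_ne_zero _)) hQ ?_ ?_⟩
    · rw [xc_pmap, xc_some, hx]
    · rw [yc_pmap, yc_some, hy]
  let F := AddEquiv.ofBijective (pmap (W := W) φ) bij
  obtain ⟨u, hu⟩ := IsAlgClosed.exists_pow_nat_eq a (by norm_num : 0 < 2)
  have hu0 : u ≠ 0 := by rintro rfl; simp at hu; exact ha hu.symm
  let C1 : VariableChange k := ⟨Units.mk0 u hu0, b, 0, 0⟩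
  let ψ : (W.map φ).toAffine.Point →+ (C1 • W).toAffine.Point :=
    ((vcEquiv C1).symm.toAddMonoidHom.comp π).comp F.symm.toAddMonoidHom
  have hψF : ∀ P, vcHom C1 (ψ (pmap φ P)) = π P := fun P => by
    have h1 : F.symm (pmap φ P) = P := F.symm_apply_apply P
    change vcEquiv C1 ((vcEquiv C1).symm (π (F.symm (pmap φ P)))) = π P
    rw [AddEquiv.apply_symm_apply, h1]
  have hψ : ∀ P, P ≠ 0 → ψ P ≠ 0 ∧ xc (ψ P) = xc P := by
    intro Q hQ
    obtain ⟨P, rfl⟩ := bij.2 Q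
    have hP : P ≠ 0 := by rintro rfl; simp at hQ
    have h0 : ψ (pmap φ P) ≠ 0 := fun h => (hπ P hP).1 (by rw [← hψF, h, map_zero])
    refine ⟨h0, ?_⟩
    have := xc_vcHom C1 h0
    rw [hψF, (hπ P hP).2] at this
    simp only [C1, Units.val_mk0, hu] at this
    rw [xc_pmap, hφ]
    have := mul_left_cancel₀ ha (add_right_cancel this)
    exact this.symm
  obtain ⟨C2, hC2, hu2, hr2, hy2⟩ := iso_x ψ hψ
  obtain ⟨C0, hC0⟩ : ∃ C0, C0 = C2 * C1 := ⟨_, rfl⟩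
  have hW : C0 • W = W.map φ := by rw [hC0, mul_smul, hC2]
  have hx0 : ∀ P, P ≠ 0 → xc (π P) = (C0.u : k) ^ 2 * xc P ^ q + C0.r := by
    intro P hP
    rw [(hπ P hP).2, hC0]
    simp [VariableChange.mul_def, C1, hr2, mul_pow, hu2, hu]
  have hy0 : ∀ P, P ≠ 0 → yc (π P) = (C0.u : k) ^ 3 * yc P ^ q + (C0.u : k) ^ 2 * C0.s * xc P ^ q
      + C0.t := by
    intro P hP
    have hF : pmap φ P ≠ 0 := pmap_ne_zero φ hP
    rw [← hψF, yc_vcHom C1 (hψ _ hF).1, hy2 _ hF, (hψ _ hF).2, hC0]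
    simp only [VariableChange.mul_def, C1, xc_pmap, yc_pmap, hφ, Units.val_mul, Units.val_mk0]
    ring
  obtain ⟨v, hv⟩ := IsAlgClosed.exists_pow_nat_eq ((C0.u : k)⁻¹) (by omega : 0 < q - 1)
  have hu00 : (C0.u : k) ≠ 0 := C0.u.ne_zero
  have hv0 : v ≠ 0 := by
    rintro rfl
    rw [zero_pow (by omega)] at hv
    exact inv_ne_zero hu00 hv.symm
  have hvq : v ^ q * C0.u = v := by
    rw [show q = (q - 1) + 1 by omega, pow_succ, hv]; field_simp
  obtain ⟨r, hr⟩ := lin_root hq1 ((C0.u : k) ^ 2) C0.r (pow_ne_zero _ hu00)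
  obtain ⟨s, hs⟩ := lin_root hq1 (C0.u : k) C0.s hu00
  obtain ⟨t, ht⟩ := lin_root hq1 ((C0.u : k) ^ 3) (r ^ q * C0.s * C0.u ^ 2 + C0.t)
    (pow_ne_zero _ hu00)
  let D : VariableChange k := ⟨Units.mk0 v hv0, r, s, t⟩
  have hD : D.map φ * C0 = D := by
    ext
    · simp [VariableChange.mul_def, D, hφ, hvq]
    · simp [VariableChange.mul_def, D, hφ]; linear_combination hr
    · simp [VariableChange.mul_def, D, hφ]; linear_combination hs
    · simp [VariableChange.mul_def, D, hφ]; linear_combination ht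
  have hfix : (D • W).map φ = D • W := by
    rw [← map_variableChange, ← hW, ← mul_smul, hD]
  have g : ∀ x : k, φ x = x → ∃ z, f z = x := fun x hx =>
    fix_pow_card f (by rw [hFq, ← hφ, hx])
  obtain ⟨z1, h1⟩ := g _ (congrArg WeierstrassCurve.a₁ hfix)
  obtain ⟨z2, h2⟩ := g _ (congrArg WeierstrassCurve.a₂ hfix)
  obtain ⟨z3, h3⟩ := g _ (congrArg WeierstrassCurve.a₃ hfix)
  obtain ⟨z4, h4⟩ := g _ (congrArg WeierstrassCurve.a₄ hfix)
  obtain ⟨z6, h6⟩ := g _ (congrArg WeierstrassCurve.a₆ hfix)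
  obtain ⟨E, hE⟩ : ∃ E : WeierstrassCurve Fq, E.map f = D • W :=
    ⟨⟨z1, z2, z3, z4, z6⟩, by ext <;> simp [*]⟩
  have hEll : E.IsElliptic := by
    rw [isElliptic_iff, isUnit_iff_ne_zero]
    intro h0
    have : (E.map f).Δ = 0 := by rw [map_Δ, h0, map_zero]
    rw [hE] at this
    exact (D • W).isUnit_Δ.ne_zero this
  refine ⟨E, hEll, ?_⟩
  rw [hE]
  refine ⟨vcEquiv D, fun P P' hP hP' hx hy => ?_⟩
  change π (vcHom D P) = vcHom D P'
  have hDP := vcHom_ne_zero D hP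
  refine point_ext (hπ _ hDP).1 (vcHom_ne_zero D hP') ?_ ?_
  · rw [hx0 _ hDP, xc_vcHom D hP, xc_vcHom D hP', hx, ← hφ, map_add, map_mul, map_pow, hφ, hφ, hφ]
    simp only [D, Units.val_mk0]
    linear_combination hr + xc P ^ q * (v ^ q * C0.u + v) * hvq
  · rw [hy0 _ hDP, xc_vcHom D hP, yc_vcHom D hP, yc_vcHom D hP', hx, hy]
    have hadd : ∀ x y : k, (x + y) ^ q = x ^ q + y ^ q := fun x y => by
      rw [← hφ, map_add, hφ, hφ]
    simp only [hadd, mul_pow, D, Units.val_mk0]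
    have e2 : (v ^ q) ^ 2 * (C0.u : k) ^ 2 = v ^ 2 := by rw [← mul_pow, hvq]
    have e3 : (v ^ q) ^ 3 * (C0.u : k) ^ 3 = v ^ 3 := by rw [← mul_pow, hvq]
    linear_combination ht + yc P ^ q * e3 + xc P ^ q * v ^ 2 * hs +
      xc P ^ q * (s ^ q * C0.u + C0.s) * e2

end L1
end WC

set_option linter.unusedSectionVars false
set_option linter.style.haveILetI false
namespace WC
open WeierstrassCurve WeierstrassCurve.Affine Polynomial

/-- a place: valuation with residue map (junk outside the valuation ring) -/
structure Pl (K k Γ : Type*) [Field K] [Field k] [LinearOrderedCommGroupWithZero Γ] where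
  v : Valuation K Γ
  rd : K → k
  rd_add : ∀ {x y}, v x ≤ 1 → v y ≤ 1 → rd (x + y) = rd x + rd y
  rd_mul : ∀ {x y}, v x ≤ 1 → v y ≤ 1 → rd (x * y) = rd x * rd y
  rd_one : rd 1 = 1
  rd_eq_zero : ∀ {x}, v x ≤ 1 → (rd x = 0 ↔ v x < 1)
  surj : ∀ z, ∃ x, v x ≤ 1 ∧ rd x = z

namespace Pl
variable {K k Γ : Type*} [Field K] [Field k] [LinearOrderedCommGroupWithZero Γ] (L : Pl K k Γ)

lemma rd_zero : L.rd 0 = 0 := (L.rd_eq_zero (by simp)).2 (by simp)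

lemma rd_neg {x : K} (hx : L.v x ≤ 1) : L.rd (-x) = - L.rd x := by
  have := L.rd_add hx (y := -x) (by rwa [Valuation.map_neg])
  rw [add_neg_cancel, rd_zero] at this
  exact (neg_eq_of_add_eq_zero_right this.symm).symm

lemma v_add {x y : K} {c : Γ} (hx : L.v x ≤ c) (hy : L.v y ≤ c) : L.v (x + y) ≤ c :=
  L.v.map_add_le hx hy

lemma v_sub {x y : K} {c : Γ} (hx : L.v x ≤ c) (hy : L.v y ≤ c) : L.v (x - y) ≤ c :=
  L.v.map_sub_le hx hy

lemma v_mul {x y : K} (hx : L.v x ≤ 1) (hy : L.v y ≤ 1) : L.v (x * y) ≤ 1 := by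
  rw [map_mul]; exact mul_le_one' hx hy

lemma rd_sub {x y : K} (hx : L.v x ≤ 1) (hy : L.v y ≤ 1) : L.rd (x - y) = L.rd x - L.rd y := by
  rw [sub_eq_add_neg, L.rd_add hx (by rwa [Valuation.map_neg]), L.rd_neg hy, sub_eq_add_neg]

/-- the valuation ring -/
def ring : Subring K where
  carrier := {x | L.v x ≤ 1}
  mul_mem' := fun hx hy => L.v_mul hx hy
  one_mem' := by simp
  add_mem' := fun hx hy => L.v_add hx hy
  zero_mem' := by simp
  neg_mem' := fun {x} hx => by
    change L.v (-x) ≤ 1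
    rw [Valuation.map_neg]; exact hx

lemma ring_v (x : L.ring) : L.v x.1 ≤ 1 := x.2

/-- residue homomorphism -/
def hom : L.ring →+* k where
  toFun x := L.rd x.1
  map_one' := L.rd_one
  map_mul' x y := L.rd_mul x.2 y.2
  map_zero' := L.rd_zero
  map_add' x y := L.rd_add x.2 y.2

lemma rd_pow {x : K} (hx : L.v x ≤ 1) (n : ℕ) : L.rd (x ^ n) = L.rd x ^ n :=
  map_pow L.hom ⟨x, hx⟩ n

lemma v_pow {x : K} (hx : L.v x ≤ 1) (n : ℕ) : L.v (x ^ n) ≤ 1 := by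
  rw [map_pow]; exact pow_le_one' hx n

lemma v_natCast (n : ℕ) : L.v (n : K) ≤ 1 := (n : L.ring).2
lemma v_intCast (n : ℤ) : L.v (n : K) ≤ 1 := (n : L.ring).2
lemma rd_natCast (n : ℕ) : L.rd (n : K) = n := map_natCast L.hom n
lemma rd_intCast (n : ℤ) : L.rd (n : K) = n := map_intCast L.hom n
lemma v_ofNat (n : ℕ) [n.AtLeastTwo] : L.v (OfNat.ofNat n : K) ≤ 1 := by
  exact_mod_cast L.v_natCast n
lemma rd_ofNat (n : ℕ) [n.AtLeastTwo] : L.rd (OfNat.ofNat n : K) = OfNat.ofNat n := by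
  exact_mod_cast L.rd_natCast n

lemma int_of_sum_prod {a b : K} (h1 : L.v (a + b) ≤ 1) (h2 : L.v (a * b) ≤ 1) : L.v a ≤ 1 := by
  by_contra! h
  have hb : L.v b < 1 := by
    by_contra! hb
    rw [map_mul] at h2
    exact absurd (lt_of_lt_of_le h (le_mul_of_one_le_right' hb)) (not_lt.2 h2)
  rw [L.v.map_add_eq_of_lt_left (hb.trans h)] at h1
  exact absurd h (not_lt.2 h1)

lemma small_of_sum_prod {a b : K} (h1 : L.v (a + b) < 1) (h2 : L.v (a * b) < 1) : L.v a < 1 := by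
  by_contra! h
  have hb : L.v b < 1 := by
    by_contra! hb
    rw [map_mul] at h2
    exact absurd (one_le_mul h hb) (not_le.2 h2)
  rw [L.v.map_add_eq_of_lt_left (hb.trans_le h)] at h1
  exact absurd h1 (not_lt.2 h)

lemma mul_lt_one {a b : K} (ha : L.v a < 1) (hb : L.v b ≤ 1) : L.v (a * b) < 1 := by
  rw [map_mul]; exact mul_lt_one_of_lt_of_le ha hb

lemma rd_small {a : K} (ha : L.v a < 1) : L.rd a = 0 := (L.rd_eq_zero ha.le).2 ha

lemma v_eq_one {a : K} (ha : L.v a ≤ 1) (h : L.rd a ≠ 0) : L.v a = 1 :=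
  le_antisymm ha (not_lt.1 fun h' => h (L.rd_small h'))

lemma rd_eq_iff {a b : K} (ha : L.v a ≤ 1) (hb : L.v b ≤ 1) : L.rd a = L.rd b ↔ L.v (a - b) < 1 := by
  rw [← L.rd_eq_zero (L.v_sub ha hb), L.rd_sub ha hb, sub_eq_zero]

lemma rd_inv {a : K} (h : L.v a = 1) : L.rd a⁻¹ = (L.rd a)⁻¹ := by
  have ha : a ≠ 0 := by rintro rfl; simp at h
  have h1 : L.v a⁻¹ ≤ 1 := by rw [map_inv₀, h, inv_one]
  have := L.rd_mul h.le h1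
  rw [mul_inv_cancel₀ ha, L.rd_one] at this
  exact (inv_eq_of_mul_eq_one_right this.symm).symm

section curve
variable [DecidableEq K] {W : WeierstrassCurve K}

/-- integrality of a Weierstrass curve -/
structure Int (W : WeierstrassCurve K) : Prop where
  a₁ : L.v W.a₁ ≤ 1
  a₂ : L.v W.a₂ ≤ 1
  a₃ : L.v W.a₃ ≤ 1
  a₄ : L.v W.a₄ ≤ 1
  a₆ : L.v W.a₆ ≤ 1

/-- model over the valuation ring -/
def lift (W : WeierstrassCurve K) (h : L.Int W) : WeierstrassCurve L.ring :=
  ⟨⟨W.a₁, h.a₁⟩, ⟨W.a₂, h.a₂⟩, ⟨W.a₃, h.a₃⟩, ⟨W.a₄, h.a₄⟩, ⟨W.a₆, h.a₆⟩⟩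

lemma lift_map (h : L.Int W) : (L.lift W h).map L.ring.subtype = W := rfl

variable (h : L.Int W)
include h
lemma vb₂ : L.v W.b₂ ≤ 1 := by
  have := congrArg WeierstrassCurve.b₂ (L.lift_map h); rw [map_b₂] at this
  rw [← this]; exact (L.lift W h).b₂.2
lemma vb₄ : L.v W.b₄ ≤ 1 := by
  have := congrArg WeierstrassCurve.b₄ (L.lift_map h); rw [map_b₄] at this
  rw [← this]; exact (L.lift W h).b₄.2
lemma vb₆ : L.v W.b₆ ≤ 1 := by
  have := congrArg WeierstrassCurve.b₆ (L.lift_map h); rw [map_b₆] at this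
  rw [← this]; exact (L.lift W h).b₆.2
lemma vb₈ : L.v W.b₈ ≤ 1 := by
  have := congrArg WeierstrassCurve.b₈ (L.lift_map h); rw [map_b₈] at this
  rw [← this]; exact (L.lift W h).b₈.2

/-- translating an integral point by a point of the formal group -/
lemma transl {R Q : W.toAffine.Point} (hR : R ≠ 0) (hRi : L.v (xc R) ≤ 1)
    (hQ : Q = 0 ∨ 1 < L.v (xc Q)) :
    R + Q ≠ 0 ∧ L.v (xc (R + Q)) ≤ 1 ∧ L.rd (xc (R + Q)) = L.rd (xc R) := by
  rcases hQ with rfl | hQ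
  · simpa using ⟨hR, hRi⟩
  have hQ0 : Q ≠ 0 := by
    rintro rfl
    have : L.v (xc (0 : W.toAffine.Point)) = 0 := by change L.v 0 = 0; simp
    rw [this] at hQ; exact absurd hQ (by simp)
  have hx : xc R ≠ xc Q := fun e => by rw [e] at hRi; exact absurd hQ (not_lt.2 hRi)
  have hne : R + Q ≠ 0 := fun e => hx (by rw [eq_neg_of_add_eq_zero_left e, xc_neg])
  refine ⟨hne, ?_⟩
  obtain ⟨e1, e2⟩ := addsub hR hQ0 hx
  have hb2 := L.vb₂ h
  have hb4 := L.vb₄ h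
  have hb6 := L.vb₆ h
  have hb8 := L.vb₈ h
  have hxQ : xc Q ≠ 0 := by intro e; rw [e] at hQ; simp at hQ
  set w := (xc Q)⁻¹ with hw
  set x := xc R
  have hwv : L.v w < 1 := by
    rw [hw, map_inv₀]; exact inv_lt_one_of_one_lt₀ hQ
  have hxw : xc Q = w⁻¹ := by rw [hw, inv_inv]
  have hw0 : w ≠ 0 := inv_ne_zero hxQ
  -- (1 - x w) unit
  have hun : L.v (1 - x * w) = 1 := by
    have : L.v (x * w) < 1 := by rw [mul_comm]; exact L.mul_lt_one hwv hRi
    rw [L.v.map_sub_eq_of_lt_left] <;> simpa using this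
  have hun0 : (1 - x * w) ≠ 0 := by intro e; rw [e] at hun; simp at hun
  set a := xc (R + Q)
  set b := xc (R - Q)
  rw [hxw] at e1 e2
  have f1 : a * b * (1 - x * w) ^ 2 = x ^ 2 + w * (- W.b₄ * x - W.b₆ * (x * w + 1) - W.b₈ * w) := by
    field_simp at e1; linear_combination e1
  have f2 : (a + b) * (1 - x * w) ^ 2 =
      2 * x + w * (2 * x ^ 2 + W.b₂ * x + W.b₄ * (x * w + 1) + W.b₆ * w) := by
    field_simp at e2; linear_combination e2
  have hxi : L.v x ≤ 1 := hRi
  clear_value a b x w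
  lift x to L.ring using hxi
  obtain ⟨w, rfl⟩ : ∃ w' : L.ring, w'.1 = w := ⟨⟨w, hwv.le⟩, rfl⟩
  obtain ⟨c2, k2⟩ : ∃ w' : L.ring, w'.1 = W.b₂ := ⟨⟨_, hb2⟩, rfl⟩
  obtain ⟨c4, k4⟩ : ∃ w' : L.ring, w'.1 = W.b₄ := ⟨⟨_, hb4⟩, rfl⟩
  obtain ⟨c6, k6⟩ : ∃ w' : L.ring, w'.1 = W.b₆ := ⟨⟨_, hb6⟩, rfl⟩
  obtain ⟨c8, k8⟩ : ∃ w' : L.ring, w'.1 = W.b₈ := ⟨⟨_, hb8⟩, rfl⟩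
  rw [← k4, ← k6, ← k8] at f1
  rw [← k2, ← k4, ← k6] at f2
  have g1 : a * b * (1 - x * w : L.ring).1 ^ 2 =
    (x ^ 2 + w * (- c4 * x - c6 * (x * w + 1) - c8 * w) : L.ring).1 := by
    push_cast; exact f1
  have g2 : (a + b) * (1 - x * w : L.ring).1 ^ 2 =
    (2 * x + w * (2 * x ^ 2 + c2 * x + c4 * (x * w + 1) + c6 * w) : L.ring).1 := by
    push_cast; exact f2
  have hun' : L.v (1 - x * w : L.ring).1 = 1 := by push_cast; exact hun
  have va : L.v (a + b) ≤ 1 := by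
    have := congrArg L.v g2
    rw [map_mul, map_pow, hun', one_pow, mul_one] at this
    rw [this]; exact L.ring_v _
  have vb : L.v (a * b) ≤ 1 := by
    have := congrArg L.v g1
    rw [map_mul, map_pow, hun', one_pow, mul_one] at this
    rw [this]; exact L.ring_v _
  have ha : L.v a ≤ 1 := L.int_of_sum_prod va vb
  have hb : L.v b ≤ 1 := L.int_of_sum_prod (by rwa [add_comm] at va) (by rwa [mul_comm] at vb)
  refine ⟨ha, ?_⟩
  lift a to L.ring using ha
  lift b to L.ring using hb
  have g1' : a * b * (1 - x * w) ^ 2 =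
    (x ^ 2 + w * (- c4 * x - c6 * (x * w + 1) - c8 * w) : L.ring) := Subtype.ext g1
  have g2' : (a + b) * (1 - x * w) ^ 2 =
    (2 * x + w * (2 * x ^ 2 + c2 * x + c4 * (x * w + 1) + c6 * w) : L.ring) := Subtype.ext g2
  have hw' : L.hom w = 0 := L.rd_small hwv
  have g1'' := congrArg L.hom g1'
  have g2'' := congrArg L.hom g2'
  simp only [map_mul, map_add, map_sub, map_pow, hw', map_one, mul_zero, zero_mul, sub_zero,
    one_pow, mul_one, add_zero, map_ofNat] at g1'' g2''
  change L.hom a = L.hom x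
  have : (L.hom a - L.hom x) ^ 2 = 0 := by linear_combination L.hom a * g2'' - g1''
  exact sub_eq_zero.1 (pow_eq_zero_iff (by norm_num) |>.1 this)

end curve
end Pl
end WC

set_option linter.unusedSectionVars false
set_option linter.style.haveILetI false
namespace WC
open WeierstrassCurve WeierstrassCurve.Affine Polynomial

lemma red_hom_abs {G H : Type*} [AddCommGroup G] [AddCommGroup H] (red : G → H)
    (hn : ∀ P, red (-P) = - red P)
    (hg : ∀ P Q, red P ≠ 0 → red Q ≠ 0 → red P ≠ red Q → red P ≠ - red Q →
      red (P + Q) = red P + red Q)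
    (ht : ∀ R Q, red Q = 0 → red (R + Q) = red R ∨ red (R + Q) = - red R)
    (hs : Function.Surjective red)
    (hinf : ∀ S : Set H, S.Finite → ∃ h, h ∉ S ∧ h + h ∉ S) :
    ∀ P Q, red (P + Q) = red P + red Q := by
  have hg' : ∀ P Q, red P ≠ 0 → red Q ≠ 0 → red Q ≠ red P → red Q ≠ - red P →
      red (P + Q) = red P + red Q := fun P Q h1 h2 h3 h4 =>
    hg P Q h1 h2 h3.symm (fun e => h4 (by rw [e, neg_neg]))
  have ht' : ∀ R Q, red Q = 0 → red (R + Q) = red R := by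
    intro R Q hQ
    rcases ht R Q hQ with h | h
    · exact h
    by_contra hne
    have hR : red R ≠ - red R := fun e => hne (by rw [h, ← e])
    have hR0 : red R ≠ 0 := fun e => hR (by rw [e, neg_zero])
    obtain ⟨τ, hτ, hτ2⟩ := hinf {0, red R, - red R} (by simp)
    obtain ⟨T, rfl⟩ := hs τ
    simp only [Set.mem_insert_iff, Set.mem_singleton_iff, not_or] at hτ hτ2
    have e1 := hg' R T hR0 hτ.1 hτ.2.1 hτ.2.2
    have e2 := hg' (R + Q) T (by rw [h]; simpa using hR0) hτ.1 (by rw [h]; exact hτ.2.2)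
      (by rw [h, neg_neg]; exact hτ.2.1)
    rw [add_right_comm, h] at e2
    rcases ht (R + T) Q hQ with e | e
    · rw [e2, e1] at e
      exact hR (add_right_cancel e).symm
    · rw [e2, e1, neg_add] at e
      exact hτ2.1 (by rw [add_eq_zero_iff_eq_neg]; exact add_left_cancel e)
  have hA : ∀ P Q, red P + red Q ≠ 0 → red (P + Q) = red P + red Q := by
    intro P Q h
    by_cases hP : red P = 0
    · rw [add_comm, ht' Q P hP, hP, zero_add]
    by_cases hQ : red Q = 0
    · rw [ht' P Q hQ, hQ, add_zero]
    obtain ⟨τ, hτ, hτ2⟩ := hinf {0, red P, - red P, red Q, - red Q, red Q - red P} (by simp)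
    obtain ⟨T, rfl⟩ := hs τ
    simp only [Set.mem_insert_iff, Set.mem_singleton_iff, not_or] at hτ hτ2
    obtain ⟨h0, h1, h2, h3, h4, h5⟩ := hτ
    have e1 := hg' P T hP h0 h1 h2
    have e2 := hg' Q (-T) hQ (by rw [hn]; simpa using h0)
      (by rw [hn]; exact fun e => h4 (by rw [← e, neg_neg]))
      (by rw [hn]; exact fun e => h3 (neg_injective e))
    rw [hn] at e2
    have e3 := hg (P + T) (Q + -T) (by rw [e1]; exact fun e => h2 (eq_neg_of_add_eq_zero_right e))
      (by rw [e2]; exact fun e => h3 (by rw [← sub_eq_add_neg, sub_eq_zero] at e; exact e.symm))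
      (by rw [e1, e2]; intro e; apply hτ2.2.2.2.2.2
          have : red T + red T = (red P + red T) + red T - red P := by abel
          rw [this, e]; abel)
      (by rw [e1, e2]; intro e; apply h
          have : red P + red Q = (red P + red T) + (red Q - red T) := by abel
          rw [this, e]; abel)
    rw [show P + T + (Q + -T) = P + Q by abel] at e3
    rw [e3, e1, e2]; abel
  have hB1 : ∀ X Y, red X = red Y → red X + red X ≠ 0 → red (X - Y) = 0 := by
    intro X Y h h2
    by_cases hz : red (X - Y) + red Y = 0
    · have e := hA (X - Y) (-X) (by
        rw [hn, eq_neg_of_add_eq_zero_left hz, h, ← neg_add, neg_ne_zero]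
        rwa [h] at h2)
      rw [show X - Y + -X = -Y by abel, hn, hn, h] at e
      simpa using e
    · have e := hA (X - Y) Y hz
      rw [sub_add_cancel, h] at e
      simpa using e
  have hB : ∀ X Y, red X = red Y → red (X - Y) = 0 := by
    intro X Y h
    by_cases h2 : red X + red X = 0
    · obtain ⟨τ, hτ, hτ2⟩ := hinf {0, - red X} (by simp)
      obtain ⟨T, rfl⟩ := hs τ
      simp only [Set.mem_insert_iff, Set.mem_singleton_iff, not_or] at hτ hτ2
      have h0 : red X + red T ≠ 0 := fun e => hτ.2 (eq_neg_of_add_eq_zero_right e)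
      have e1 := hA X T h0
      have e2 := hA Y T (by rwa [← h])
      have := hB1 (X + T) (Y + T) (by rw [e1, e2, h]) (by
        rw [e1, add_add_add_comm, h2, zero_add]; exact hτ2.1)
      rwa [add_sub_add_right_eq_sub] at this
    · exact hB1 X Y h h2
  intro P Q
  by_cases h : red P + red Q = 0
  · have := hB P (-Q) (by rw [hn]; exact eq_neg_of_add_eq_zero_left h)
    rw [sub_neg_eq_add] at this
    rw [this, h]
  · exact hA P Q h

section fin
variable {k : Type*} [Field k] [DecidableEq k] [IsAlgClosed k] {W : WeierstrassCurve k} [W.IsElliptic]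

lemma exists_not_two_tors : ∃ P : W.toAffine.Point, P + P ≠ 0 := by
  by_contra! h
  have : Infinite k := IsAlgClosed.instInfinite
  have hp : (C 4 * X ^ 3 + C W.b₂ * X ^ 2 + C (2 * W.b₄) * X + C W.b₆ : Polynomial k) = 0 := by
    apply Polynomial.funext
    intro x
    obtain ⟨P, hP, rfl⟩ := exists_xc (W := W) x
    simpa using (two_smul_eq_zero_iff hP).1 (h P)
  have c3 := congrArg (fun p => coeff p 3) hp
  have c2 := congrArg (fun p => coeff p 2) hp
  have c1 := congrArg (fun p => coeff p 1) hp
  have c0 := congrArg (fun p => coeff p 0) hp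
  simp [coeff_X, coeff_C] at c3 c2 c1 c0
  have hΔ : W.Δ = 0 := by
    rw [Δ, c2, c0]
    rcases c1 with c1 | c1
    · linear_combination (-4 * W.b₄ ^ 3) * c1
    · rw [c1]; ring
  exact W.isUnit_Δ.ne_zero hΔ

lemma two_fibre_finite (Z : W.toAffine.Point) : {X | X + X = Z}.Finite := by
  have key : ∀ Z : W.toAffine.Point, Z ≠ 0 → {X | X + X = Z}.Finite := by
    intro Z hZ
    let p : Polynomial k := X ^ 4 - C (4 * xc Z) * X ^ 3 - C (W.b₄ + xc Z * W.b₂) * X ^ 2 -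
      C (2 * W.b₆ + xc Z * (2 * W.b₄)) * X - C (W.b₈ + xc Z * W.b₆)
    have hp : p ≠ 0 := by
      intro h0
      have := congrArg (fun p => coeff p 4) h0
      simp only [p, coeff_sub, coeff_C_mul, coeff_X_pow, coeff_X, coeff_C, coeff_zero] at this
      norm_num at this
    refine (finite_xc_mem (W := W) (p.rootSet_finite k)).subset fun X hX => ?_
    change X + X = Z at hX
    have hX0 : X ≠ 0 := by rintro rfl; exact hZ (by rw [← hX, add_zero])
    have hd := dup hX0 (by rw [hX]; exact hZ)
    rw [hX] at hd
    change xc X ∈ p.rootSet k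
    rw [mem_rootSet]
    refine ⟨hp, ?_⟩
    simp [p]
    linear_combination -hd
  by_cases hZ : Z = 0
  · obtain ⟨P, hP⟩ := exists_not_two_tors (W := W)
    refine ((key _ hP).preimage (f := fun X => X + P) (fun a _ b _ h => add_right_cancel h)).subset ?_
    intro X hX
    change X + X = Z at hX
    change X + P + (X + P) = P + P
    rw [add_add_add_comm, hX, hZ, zero_add]
  · exact key Z hZ

lemma avoid (S : Set W.toAffine.Point) (hS : S.Finite) : ∃ h, h ∉ S ∧ h + h ∉ S := by
  have := infinite_points (W := W)
  have hf : (S ∪ ⋃ Z ∈ S, {X | X + X = Z}).Finite :=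
    hS.union (hS.biUnion fun Z _ => two_fibre_finite Z)
  obtain ⟨h, hh⟩ := hf.exists_notMem
  refine ⟨h, fun h' => hh (Or.inl h'), fun h' => hh (Or.inr ?_)⟩
  simp only [Set.mem_iUnion]
  exact ⟨_, h', rfl⟩

end fin

namespace Pl
variable {K k Γ : Type*} [Field K] [Field k] [LinearOrderedCommGroupWithZero Γ] (L : Pl K k Γ)
variable [DecidableEq K] [DecidableEq k] [IsAlgClosed K] [IsAlgClosed k]
  {W : WeierstrassCurve K} [W.IsElliptic] (h : L.Int W) [((L.lift W h).map L.hom).IsElliptic]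

/-- reduced curve -/
abbrev bar : WeierstrassCurve k := (L.lift W h).map L.hom

include h in
lemma vy {P : W.toAffine.Point} (hP : P ≠ 0) (hx : L.v (xc P) ≤ 1) : L.v (yc P) ≤ 1 := by
  have e := eqn hP
  apply L.int_of_sum_prod (b := -(yc P + W.a₁ * xc P + W.a₃))
  · rw [show yc P + -(yc P + W.a₁ * xc P + W.a₃) = -(W.a₁ * xc P + W.a₃) by ring, Valuation.map_neg]
    exact L.v_add (L.v_mul h.a₁ hx) h.a₃
  · rw [show yc P * -(yc P + W.a₁ * xc P + W.a₃) = -(xc P ^ 3 + W.a₂ * xc P ^ 2 + W.a₄ * xc P + W.a₆)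
      by linear_combination -e, Valuation.map_neg]
    exact L.v_add (L.v_add (L.v_add (L.v_pow hx 3) (L.v_mul h.a₂ (L.v_pow hx 2)))
      (L.v_mul h.a₄ hx)) h.a₆

lemma exists_red (P : W.toAffine.Point) : ∃ Q : (L.bar h).toAffine.Point,
    ((P = 0 ∨ 1 < L.v (xc P)) → Q = 0) ∧ (P ≠ 0 → L.v (xc P) ≤ 1 →
      Q ≠ 0 ∧ xc Q = L.rd (xc P) ∧ yc Q = L.rd (yc P)) := by
  by_cases hP : P = 0 ∨ 1 < L.v (xc P)
  · refine ⟨0, fun _ => rfl, fun h1 h2 => ?_⟩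
    rcases hP with hP | hP
    · exact absurd hP h1
    · exact absurd hP (not_lt.2 h2)
  · push Not at hP
    obtain ⟨hP, hx⟩ := hP
    have hy := L.vy h hP hx
    have e := eqn hP
    have : (L.bar h).toAffine.Equation (L.rd (xc P)) (L.rd (yc P)) := by
      rw [equation_iff]
      have e' : (⟨yc P, hy⟩ ^ 2 + (L.lift W h).a₁ * ⟨xc P, hx⟩ * ⟨yc P, hy⟩ +
        (L.lift W h).a₃ * ⟨yc P, hy⟩ : L.ring) =
        ⟨xc P, hx⟩ ^ 3 + (L.lift W h).a₂ * ⟨xc P, hx⟩ ^ 2 + (L.lift W h).a₄ * ⟨xc P, hx⟩ +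
        (L.lift W h).a₆ := Subtype.ext e
      have := congrArg L.hom e'
      simp only [map_add, map_mul, map_pow] at this
      exact this
    refine ⟨Point.some _ _ (equation_iff_nonsingular.1 this), fun h' => ?_,
      fun _ _ => ⟨Point.some_ne_zero _, rfl, rfl⟩⟩
    rcases h' with h' | h'
    · exact absurd h' hP
    · exact absurd h' (not_lt.2 hx)

/-- reduction on points -/
noncomputable def redF (P : W.toAffine.Point) : (L.bar h).toAffine.Point := (L.exists_red h P).choose

lemma redF_zero {P : W.toAffine.Point} (hP : P = 0 ∨ 1 < L.v (xc P)) : L.redF h P = 0 :=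
  (L.exists_red h P).choose_spec.1 hP

lemma redF_some {P : W.toAffine.Point} (hP : P ≠ 0) (hx : L.v (xc P) ≤ 1) :
    L.redF h P ≠ 0 ∧ xc (L.redF h P) = L.rd (xc P) ∧ yc (L.redF h P) = L.rd (yc P) :=
  (L.exists_red h P).choose_spec.2 hP hx

lemma redF_eq_zero {P : W.toAffine.Point} : L.redF h P = 0 ↔ P = 0 ∨ 1 < L.v (xc P) := by
  refine ⟨fun h0 => ?_, L.redF_zero h⟩
  by_contra! hc
  exact (L.redF_some h hc.1 hc.2).1 h0

lemma redF_ne_zero {P : W.toAffine.Point} : L.redF h P ≠ 0 ↔ P ≠ 0 ∧ L.v (xc P) ≤ 1 := by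
  rw [Ne, redF_eq_zero]; push Not; rfl

lemma redF_neg (P : W.toAffine.Point) : L.redF h (-P) = - L.redF h P := by
  by_cases h0 : L.redF h P = 0
  · rw [h0, neg_zero, redF_eq_zero, neg_eq_zero, xc_neg, ← L.redF_eq_zero h, h0]
  · obtain ⟨h1, h2⟩ := (L.redF_ne_zero h).1 h0
    obtain ⟨e0, e1, e2⟩ := L.redF_some h h1 h2
    obtain ⟨f0, f1, f2⟩ := L.redF_some h (neg_ne_zero.2 h1) (by rwa [xc_neg])
    have hy := L.vy h h1 h2
    refine point_ext f0 (neg_ne_zero.2 e0) ?_ ?_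
    · rw [f1, xc_neg, xc_neg, e1]
    · rw [f2, yc_neg h1, yc_neg e0, e1, e2]
      change L.hom (-⟨yc P, hy⟩ - (L.lift W h).a₁ * ⟨xc P, h2⟩ - (L.lift W h).a₃) = _
      simp only [map_sub, map_mul, map_neg]
      rfl

lemma redF_surj : Function.Surjective (L.redF h) := by
  intro Q
  by_cases hQ : Q = 0
  · exact ⟨0, by rw [hQ, L.redF_zero h (Or.inl rfl)]⟩
  obtain ⟨x, hx, hx'⟩ := L.surj (xc Q)
  obtain ⟨P, hP, rfl⟩ := exists_xc (W := W) x
  obtain ⟨e0, e1, -⟩ := L.redF_some h hP hx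
  rcases (xc_eq_iff e0 hQ).1 (by rw [e1, hx']) with e | e
  · exact ⟨P, e⟩
  · exact ⟨-P, by rw [redF_neg, e, neg_neg]⟩

lemma redF_add_gen (P Q : W.toAffine.Point) (hP : L.redF h P ≠ 0) (hQ : L.redF h Q ≠ 0)
    (h1 : L.redF h P ≠ L.redF h Q) (h2 : L.redF h P ≠ - L.redF h Q) :
    L.redF h (P + Q) = L.redF h P + L.redF h Q := by
  obtain ⟨p1, p2⟩ := (L.redF_ne_zero h).1 hP
  obtain ⟨q1, q2⟩ := (L.redF_ne_zero h).1 hQ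
  obtain ⟨-, p3, p4⟩ := L.redF_some h p1 p2
  obtain ⟨-, q3, q4⟩ := L.redF_some h q1 q2
  have p5 := L.vy h p1 p2
  have q5 := L.vy h q1 q2
  have hxb : xc (L.redF h P) ≠ xc (L.redF h Q) := by
    rw [Ne, xc_eq_iff hP hQ]; push Not; exact ⟨h1, h2⟩
  have hd : L.v (xc P - xc Q) = 1 := by
    refine L.v_eq_one (L.v_sub p2 q2) ?_
    rw [L.rd_sub p2 q2, ← p3, ← q3]
    exact sub_ne_zero.2 hxb
  have hd0 : xc P - xc Q ≠ 0 := by intro e; rw [e] at hd; simp at hd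
  have hx : xc P ≠ xc Q := sub_ne_zero.1 hd0
  set l := (yc P - yc Q) / (xc P - xc Q) with hl
  have hlv : L.v l ≤ 1 := by
    rw [hl, map_div₀, hd, div_one]; exact L.v_sub p5 q5
  have hl' : l * (xc P - xc Q) = yc P - yc Q := by rw [hl]; field_simp
  obtain ⟨e1, e2⟩ := add_formula p1 q1 hx hl'
  have hl'' : L.rd l * (xc (L.redF h P) - xc (L.redF h Q)) = yc (L.redF h P) - yc (L.redF h Q) := by
    rw [p3, q3, p4, q4, ← L.rd_sub p2 q2, ← L.rd_sub p5 q5, ← hl', L.rd_mul hlv (L.v_sub p2 q2)]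
  obtain ⟨f1, f2⟩ := add_formula hP hQ hxb hl''
  have hne : P + Q ≠ 0 := fun e => hx (by rw [eq_neg_of_add_eq_zero_left e, xc_neg])
  have hneb : L.redF h P + L.redF h Q ≠ 0 := fun e => h2 (eq_neg_of_add_eq_zero_left e)
  have e1' : xc (P + Q) = (⟨l, hlv⟩ ^ 2 + (L.lift W h).a₁ * ⟨l, hlv⟩ - (L.lift W h).a₂ - ⟨xc P, p2⟩
    - ⟨xc Q, q2⟩ : L.ring).1 := e1
  have hx3 : L.v (xc (P + Q)) ≤ 1 := by rw [e1']; exact L.ring_v _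
  have e2' : yc (P + Q) = (-(⟨l, hlv⟩ * (⟨xc (P + Q), hx3⟩ - ⟨xc P, p2⟩) + ⟨yc P, p5⟩) -
    (L.lift W h).a₁ * ⟨xc (P + Q), hx3⟩ - (L.lift W h).a₃ : L.ring).1 := e2
  obtain ⟨s0, s1, s2⟩ := L.redF_some h hne hx3
  have hX : xc (L.redF h (P + Q)) = xc (L.redF h P + L.redF h Q) := by
    rw [s1, f1, e1', p3, q3]
    change L.hom _ = _
    simp only [map_sub, map_add, map_mul, map_pow]
    rfl
  refine point_ext s0 hneb hX ?_
  rw [s2, f2, e2', ← hX, s1, p3, p4]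
  change L.hom _ = _
  simp only [map_sub, map_add, map_mul, map_neg]
  rfl

lemma E1_add {P Q : W.toAffine.Point} (hP : L.redF h P = 0) (hQ : L.redF h Q = 0) :
    L.redF h (P + Q) = 0 := by
  by_contra hc
  obtain ⟨h1, h2⟩ := (L.redF_ne_zero h).1 hc
  have hQ' : -Q = 0 ∨ 1 < L.v (xc (-Q)) := by
    rw [← L.redF_eq_zero h, redF_neg, hQ, neg_zero]
  obtain ⟨t1, t2, -⟩ := L.transl h h1 h2 hQ'
  rw [add_neg_cancel_right] at t1 t2
  exact (L.redF_ne_zero h).2 ⟨t1, t2⟩ hP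

theorem redF_add (P Q : W.toAffine.Point) : L.redF h (P + Q) = L.redF h P + L.redF h Q := by
  refine red_hom_abs (L.redF h) (L.redF_neg h) (L.redF_add_gen h) (fun R Q hQ => ?_) (L.redF_surj h)
    avoid P Q
  by_cases hR : L.redF h R = 0
  · left; rw [hR, L.E1_add h hR hQ]
  · obtain ⟨h1, h2⟩ := (L.redF_ne_zero h).1 hR
    obtain ⟨t1, t2, t3⟩ := L.transl h h1 h2 ((L.redF_eq_zero h).1 hQ)
    obtain ⟨e0, e1, -⟩ := L.redF_some h h1 h2
    obtain ⟨f0, f1, -⟩ := L.redF_some h t1 t2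
    exact (xc_eq_iff f0 e0).1 (by rw [f1, e1, t3])

/-- the reduction homomorphism -/
noncomputable def red : W.toAffine.Point →+ (L.bar h).toAffine.Point where
  toFun := L.redF h
  map_zero' := L.redF_zero h (Or.inl rfl)
  map_add' := L.redF_add h

end Pl
end WC

set_option linter.unusedSectionVars false
set_option linter.style.haveILetI false
namespace WC
open WeierstrassCurve WeierstrassCurve.Affine Polynomial

/-- model with j-invariant of the form 1728 + 1/κ -/
def tW {K : Type*} [Field K] (κ : K) : WeierstrassCurve K := ⟨1, 0, 0, -36 * κ, -κ⟩

namespace Pl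
variable {K k Γ : Type*} [Field K] [Field k] [LinearOrderedCommGroupWithZero Γ] (L : Pl K k Γ)
variable [DecidableEq K]

/-- Gauss norm behaviour of a polynomial on the unit circle and near it -/
def GQ (A : Polynomial K) (G : Γ) (m : ℕ) : Prop := ∃ (z : K) (F : Finset k), L.v z < 1 ∧
  (∀ x, L.v x = 1 → L.rd x ∉ F → L.v (A.eval x) = G) ∧
  (∀ x, L.v z < L.v x → L.v x < 1 → L.v (A.eval x) = G * L.v x ^ m)

lemma GQ_mul {A B : Polynomial K} {G H : Γ} {m n : ℕ} (hA : L.GQ A G m) (hB : L.GQ B H n) :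
    L.GQ (A * B) (G * H) (m + n) := by
  classical
  obtain ⟨z, F, hz, h1, h2⟩ := hA
  obtain ⟨w, E, hw, h3, h4⟩ := hB
  have key : ∃ u, L.v u < 1 ∧ L.v z ≤ L.v u ∧ L.v w ≤ L.v u := by
    rcases le_total (L.v z) (L.v w) with h | h
    · exact ⟨w, hw, h, le_rfl⟩
    · exact ⟨z, hz, le_rfl, h⟩
  obtain ⟨u, hu, hu1, hu2⟩ := key
  refine ⟨u, F ∪ E, hu, fun x hx hF => ?_, fun x hx hx1 => ?_⟩
  · rw [Finset.mem_union, not_or] at hF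
    rw [eval_mul, map_mul, h1 x hx hF.1, h3 x hx hF.2]
  · rw [eval_mul, map_mul, h2 x (hu1.trans_lt hx) hx1, h4 x (hu2.trans_lt hx) hx1, pow_add]
    ac_rfl

lemma GQ_C (c : K) : L.GQ (C c) (L.v c) 0 := ⟨0, ∅, by simp, by simp, by simp⟩

lemma GQ_X_sub (r : K) : ∃ (G : Γ) (m : ℕ), G ≠ 0 ∧ L.GQ (X - C r) G m := by
  rcases lt_trichotomy (L.v r) 1 with h | h | h
  · refine ⟨1, 1, one_ne_zero, r, ∅, h, fun x hx _ => ?_, fun x hx hx1 => ?_⟩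
    · simp only [eval_sub, eval_X, eval_C]
      rw [L.v.map_sub_eq_of_lt_left (by rwa [hx]), hx]
    · simp only [eval_sub, eval_X, eval_C]
      rw [L.v.map_sub_eq_of_lt_left hx]; simp
  · refine ⟨1, 0, one_ne_zero, 0, {L.rd r}, by simp, fun x hx hF => ?_, fun x hx hx1 => ?_⟩
    · simp only [eval_sub, eval_X, eval_C]
      rw [Finset.mem_singleton, L.rd_eq_iff hx.le h.le] at hF
      exact le_antisymm (L.v_sub hx.le h.le) (not_lt.1 hF)
    · simp only [eval_sub, eval_X, eval_C]
      rw [L.v.map_sub_eq_of_lt_right (by rwa [h]), h]; simp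
  · refine ⟨L.v r, 0, (zero_lt_one.trans h).ne', 0, ∅, by simp, fun x hx _ => ?_, fun x hx hx1 => ?_⟩
    · simp only [eval_sub, eval_X, eval_C]
      rw [L.v.map_sub_eq_of_lt_right (by rwa [hx])]
    · simp only [eval_sub, eval_X, eval_C]
      rw [L.v.map_sub_eq_of_lt_right (hx1.trans h)]; simp

lemma GQ_exists [IsAlgClosed K] {A : Polynomial K} (hA : A ≠ 0) : ∃ (G : Γ) (m : ℕ), G ≠ 0 ∧ L.GQ A G m := by
  have hs := (IsAlgClosed.splits A).eq_prod_roots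
  rw [hs]
  have : ∀ s : Multiset K, ∃ (G : Γ) (m : ℕ), G ≠ 0 ∧ L.GQ (s.map (X - C ·)).prod G m := by
    intro s
    induction s using Multiset.induction with
    | empty => exact ⟨1, 0, one_ne_zero, by simpa using L.GQ_C 1⟩
    | cons r s ih =>
      obtain ⟨G, m, h0, h1⟩ := ih
      obtain ⟨H, n, g0, g1⟩ := L.GQ_X_sub r
      exact ⟨H * G, n + m, mul_ne_zero g0 h0, by simpa using L.GQ_mul g1 h1⟩
  obtain ⟨G, m, h0, h1⟩ := this A.roots
  exact ⟨_, _, mul_ne_zero (by simpa using hA) h0, L.GQ_mul (L.GQ_C A.leadingCoeff) h1⟩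

variable {κ : K} (hκ : L.v κ < 1) (hκ0 : κ ≠ 0)

include hκ in
lemma tW_int : L.Int (tW κ) where
  a₁ := by simp [tW]
  a₂ := by simp [tW]
  a₃ := by simp [tW]
  a₄ := by
    change L.v (-36 * κ) ≤ 1
    rw [neg_mul, Valuation.map_neg]; exact L.v_mul (L.v_ofNat 36) hκ.le
  a₆ := by change L.v (-κ) ≤ 1; rw [Valuation.map_neg]; exact hκ.le

lemma tadd {P Q : (tW κ).toAffine.Point} (hP : P ≠ 0) (hQ : Q ≠ 0) (h : xc P ≠ xc Q) :
    xc (P + Q) * xc (P - Q) * (xc P - xc Q) ^ 2 = (xc P * xc Q) ^ 2 +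
      κ * (72 * (xc P * xc Q) + 4 * (xc P + xc Q) + 1 + 1296 * κ) ∧
    (xc (P + Q) + xc (P - Q)) * (xc P - xc Q) ^ 2 =
      xc P * xc Q + (2 * (xc P + xc Q) * (xc P * xc Q) - κ * (72 * (xc P + xc Q) + 4)) := by
  obtain ⟨e1, e2⟩ := addsub hP hQ h
  rw [e1, e2]
  simp only [b₂, b₄, b₆, b₈, tW]
  constructor <;> ring

lemma tdup {P : (tW κ).toAffine.Point} (hP : P ≠ 0) :
   (P + P = 0 ↔ xc P ^ 2 + (4 * xc P ^ 3 - κ * (144 * xc P + 4)) = 0) ∧ (P + P ≠ 0 →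
    xc (P + P) * (xc P ^ 2 + (4 * xc P ^ 3 - κ * (144 * xc P + 4))) =
      xc P ^ 4 + κ * (72 * xc P ^ 2 + 8 * xc P + 1 + 1296 * κ)) := by
  constructor
  · rw [two_smul_eq_zero_iff hP]
    simp only [b₂, b₄, b₆, tW]
    ring_nf
  · intro h
    have := dup hP h
    have h2 : (tW κ).b₂ = 1 := by simp [b₂, tW]
    have h4 : (tW κ).b₄ = -72 * κ := by simp only [b₄, tW]; ring
    have h6 : (tW κ).b₆ = -4 * κ := by simp only [b₆, tW]; ring
    have h8 : (tW κ).b₈ = -κ - 1296 * κ ^ 2 := by simp only [b₈, tW]; ring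
    rw [h2, h4, h6, h8] at this
    linear_combination this

include hκ in
/-- multiples of a small point -/
lemma tmul {P : (tW κ).toAffine.Point} (hP : P ≠ 0) (hs : L.v (xc P) < 1) (n : ℕ) (hn : 1 ≤ n)
    (hκn : L.v κ < L.v (xc P) ^ (2 * n)) :
    n • P ≠ 0 ∧ L.v (xc (n • P)) = L.v (xc P) ^ n := by
  set s := L.v (xc P) with hsdef
  have hs0 : 0 < s := by
    rw [zero_lt_iff]; intro h; rw [h, zero_pow (by omega)] at hκn; exact absurd hκn (by simp)
  have main : ∀ m, 1 ≤ m → m ≤ n → (m • P ≠ 0 ∧ L.v (xc (m • P)) = s ^ m) := by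
    intro m
    induction m using Nat.strong_induction_on with
    | _ m ih =>
    intro h1 hm
    have hκm : L.v κ < s ^ (2 * m) := hκn.trans_le (pow_le_pow_right_of_le_one' hs.le (by omega))
    rcases Nat.lt_or_ge m 3 with h3 | h3
    · obtain rfl | rfl : m = 1 ∨ m = 2 := by omega
      · exact ⟨by simpa using hP, by simp [hsdef]⟩
      · obtain ⟨d1, d2⟩ := tdup hP
        have hi : L.v (xc P) ≤ 1 := hs.le
        have hden : L.v (xc P ^ 2 + (4 * xc P ^ 3 - κ * (144 * xc P + 4))) = s ^ 2 := by
          rw [L.v.map_add_eq_of_lt_left, map_pow]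
          apply (L.v.map_sub _ _).trans_lt
          rw [max_lt_iff]
          constructor
          · rw [map_mul, map_pow, map_pow, ← hsdef]
            calc L.v 4 * s ^ 3 ≤ 1 * s ^ 3 := mul_le_mul_left (L.v_ofNat 4) _
              _ < s ^ 2 := by rw [one_mul]; exact pow_lt_pow_right_of_lt_one₀ hs0 hs (by norm_num)
          · rw [map_mul, map_pow, ← hsdef]
            calc L.v κ * _ ≤ L.v κ * 1 := mul_le_mul_right (L.v_add (L.v_mul (L.v_ofNat 144) hi)
                    (L.v_ofNat 4)) _
              _ < s ^ 2 := by
                rw [mul_one]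
                exact hκm.trans_le (pow_le_pow_right_of_le_one' hs.le (by norm_num))
        have hne : P + P ≠ 0 := by
          intro h
          rw [d1.1 h] at hden
          simp only [map_zero] at hden
          exact (pow_pos hs0 2).ne hden
        have e := congrArg L.v (d2 hne)
        rw [map_mul, hden, L.v.map_add_eq_of_lt_left, map_pow, ← hsdef] at e
        · rw [two_nsmul]
          refine ⟨hne, ?_⟩
          apply mul_right_cancel₀ (pow_pos hs0 2).ne'
          rw [e, ← pow_add]
        · rw [map_mul, map_pow, ← hsdef]
          refine lt_of_le_of_lt ?_ hκm
          rw [show L.v κ = L.v κ * 1 by rw [mul_one], mul_assoc, one_mul]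
          refine mul_le_mul_right (L.v_add (L.v_add (L.v_add (L.v_mul (L.v_ofNat 72) (L.v_pow hi 2))
            (L.v_mul (L.v_ofNat 8) hi)) (by simp)) (L.v_mul (L.v_ofNat 1296) hκ.le)) _
    · obtain ⟨m, rfl⟩ : ∃ m', m = m' + 2 := ⟨m - 2, by omega⟩
      obtain ⟨i1, i2⟩ := ih (m + 1) (by omega) (by omega) (by omega)
      obtain ⟨j1, j2⟩ := ih m (by omega) (by omega) (by omega)
      have hi : L.v (xc P) ≤ 1 := hs.le
      have hi' : L.v (xc ((m + 1) • P)) ≤ 1 := by rw [i2]; exact pow_le_one' hs.le _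
      have hlt : L.v (xc ((m + 1) • P)) < L.v (xc P) := by
        rw [i2, ← hsdef]; exact pow_lt_self_of_lt_one₀ hs0 hs (by omega)
      have hx : xc ((m + 1) • P) ≠ xc P := fun e => by rw [e] at hlt; exact lt_irrefl _ hlt
      have e := congrArg L.v (tadd i1 hP hx).1
      have s1 : (m + 1) • P + P = (m + 2) • P := (succ_nsmul P (m + 1)).symm
      have s2 : (m + 1) • P - P = m • P := by rw [succ_nsmul, add_sub_cancel_right]
      have hne : (m + 2) • P ≠ 0 := by
        rw [← s1]; intro h; exact hx (by rw [eq_neg_of_add_eq_zero_left h, xc_neg])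
      refine ⟨hne, ?_⟩
      rw [s1, s2, map_mul, map_mul, map_pow, L.v.map_sub_eq_of_lt_right hlt, ← hsdef, j2,
        L.v.map_add_eq_of_lt_left, map_pow, map_mul, i2, ← hsdef] at e
      · apply mul_right_cancel₀ (pow_pos hs0 (m + 2)).ne'
        rw [mul_assoc, ← pow_add] at e
        rw [e, ← pow_succ, ← pow_mul, ← pow_add]
        congr 1; omega
      · rw [map_pow, map_mul _ (xc ((m + 1) • P)), i2, ← hsdef, ← pow_succ, ← pow_mul, map_mul]
        refine lt_of_le_of_lt ?_ (hκm.trans_le (pow_le_pow_right_of_le_one' hs.le (by omega)))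
        rw [show L.v κ = L.v κ * 1 by rw [mul_one], mul_assoc, one_mul]
        refine mul_le_mul_right (L.v_add (L.v_add (L.v_add (L.v_mul (L.v_ofNat 72)
          (L.v_mul hi' hi)) (L.v_mul (L.v_ofNat 4) (L.v_add hi' hi))) (by simp))
          (L.v_mul (L.v_ofNat 1296) hκ.le)) _
  exact main n hn le_rfl

/-- non-small points -/
def E0 (P : (tW κ).toAffine.Point) : Prop := P = 0 ∨ 1 ≤ L.v (xc P)

lemma E0_neg {P : (tW κ).toAffine.Point} (h : L.E0 P) : L.E0 (-P) := by
  simpa [E0] using h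

include hκ in
lemma E0_aux {R Q : (tW κ).toAffine.Point} (hR : ¬ L.E0 R) (hQ : L.E0 Q) : ¬ L.E0 (R + Q) := by
  unfold E0 at hR hQ ⊢
  push Not at hR ⊢
  obtain ⟨hR, hs⟩ := hR
  by_cases hQ1 : Q = 0 ∨ 1 < L.v (xc Q)
  · obtain ⟨t1, t2, t3⟩ := L.transl (L.tW_int hκ) hR hs.le hQ1
    rw [(L.rd_eq_zero hs.le).2 hs, L.rd_eq_zero t2] at t3
    exact ⟨t1, t3⟩
  push Not at hQ1
  obtain ⟨hQ0, hQ2⟩ := hQ1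
  have hQ1 : L.v (xc Q) = 1 := le_antisymm hQ2 (hQ.resolve_left hQ0)
  have hx : xc R ≠ xc Q := fun e => by rw [e, hQ1] at hs; exact lt_irrefl _ hs
  have hd : L.v (xc R - xc Q) = 1 := by rw [L.v.map_sub_eq_of_lt_right (by rwa [hQ1]), hQ1]
  have hne : R + Q ≠ 0 := fun h => hx (by rw [eq_neg_of_add_eq_zero_left h, xc_neg])
  refine ⟨hne, ?_⟩
  obtain ⟨e1, e2⟩ := tadd hR hQ0 hx
  have e1 := congrArg L.v e1
  have e2 := congrArg L.v e2
  rw [map_mul, map_pow, hd, one_pow, mul_one] at e1 e2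
  refine L.small_of_sum_prod (b := xc (R - Q)) ?_ ?_
  · rw [e2]
    have hsum := L.v_add hs.le hQ2
    refine L.v.map_add_lt (L.mul_lt_one hs hQ2) ?_
    refine (L.v.map_sub _ _).trans_lt (max_lt ?_ (L.mul_lt_one hκ (L.v_add (L.v_mul (L.v_ofNat 72)
      hsum) (L.v_ofNat 4))))
    rw [show 2 * (xc R + xc Q) * (xc R * xc Q) = xc R * (xc Q * (2 * (xc R + xc Q))) by ring]
    exact L.mul_lt_one hs (L.v_mul hQ2 (L.v_mul (L.v_ofNat 2) hsum))
  · rw [e1]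
    refine L.v.map_add_lt ?_ (L.mul_lt_one hκ (L.v_add (L.v_add (L.v_add (L.v_mul (L.v_ofNat 72)
          (L.v_mul hs.le hQ2)) (L.v_mul (L.v_ofNat 4) (L.v_add hs.le hQ2))) (by simp))
          (L.v_mul (L.v_ofNat 1296) hκ.le)))
    rw [sq]
    exact L.mul_lt_one (L.mul_lt_one hs hQ2) (L.v_mul hs.le hQ2)

include hκ in
lemma E0_add {P Q : (tW κ).toAffine.Point} (hP : L.E0 P) (hQ : L.E0 Q) : L.E0 (P + Q) := by
  by_contra h
  have := L.E0_aux hκ h (L.E0_neg hQ)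
  rw [add_neg_cancel_right] at this
  exact this hP

end Pl
end WC

set_option linter.unusedSectionVars false
set_option linter.style.haveILetI false
namespace WC
open WeierstrassCurve WeierstrassCurve.Affine Polynomial
namespace Pl
variable {K k Γ : Type*} [Field K] [Field k] [LinearOrderedCommGroupWithZero Γ] (L : Pl K k Γ)
variable [DecidableEq K] [IsAlgClosed K] [IsAlgClosed k] {κ : K} (hκ : L.v κ < 1) (hκ0 : κ ≠ 0)
  [(tW κ).IsElliptic]

/-- generic points with respect to a finite set of residues -/
def gen (F : Finset k) (P : (tW κ).toAffine.Point) : Prop := P ≠ 0 ∧ L.v (xc P) = 1 ∧ L.rd (xc P) ∉ F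

lemma gen_neg {F : Finset k} {P : (tW κ).toAffine.Point} (h : L.gen F P) : L.gen F (-P) := by
  simpa [gen] using h

lemma exists_notMem_fin (S : Set k) (hS : S.Finite) : ∃ ξ, ξ ∉ S := by
  have : Infinite k := IsAlgClosed.instInfinite
  exact hS.exists_notMem

include hκ in
lemma tgen (F : Finset k) {Q : (tW κ).toAffine.Point} (hQ : L.E0 Q) :
    ∃ P, L.gen F P ∧ L.gen F (Q + P) ∧ L.gen F (Q - P) := by
  classical
  by_cases hQ1 : Q = 0 ∨ 1 < L.v (xc Q)
  · obtain ⟨ξ, hξ⟩ := exists_notMem_fin ((insert 0 F : Finset k) : Set k) (Finset.finite_toSet _)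
    simp only [Finset.coe_insert, Set.mem_insert_iff, Finset.mem_coe, not_or] at hξ
    obtain ⟨x, hx, rfl⟩ := L.surj ξ
    obtain ⟨P, hP, rfl⟩ := exists_xc (W := tW κ) x
    obtain ⟨t1, t2, t3⟩ := L.transl (L.tW_int hκ) hP hx hQ1
    obtain ⟨u1, u2, u3⟩ := L.transl (L.tW_int hκ) hP hx (Q := -Q) (by simpa using hQ1)
    refine ⟨P, ⟨hP, L.v_eq_one hx hξ.1, hξ.2⟩, ?_, ?_⟩
    · rw [add_comm]
      exact ⟨t1, L.v_eq_one t2 (by rw [t3]; exact hξ.1), by rw [t3]; exact hξ.2⟩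
    · rw [show Q - P = -(P + -Q) by abel]
      exact L.gen_neg ⟨u1, L.v_eq_one u2 (by rw [u3]; exact hξ.1), by rw [u3]; exact hξ.2⟩
  push Not at hQ1
  obtain ⟨hQ0, hQ2⟩ := hQ1
  have hQ1 : L.v (xc Q) = 1 := le_antisymm hQ2 (hQ.resolve_left hQ0)
  set η := L.rd (xc Q) with hη
  have hη0 : η ≠ 0 := by
    intro h; rw [L.rd_eq_zero hQ2, hQ1] at h; exact lt_irrefl _ h
  let p : k → Polynomial k := fun φ => C (φ ^ 2) * (X - C η) ^ 2 -
    C φ * (2 * (X + C η) * (X * C η) + X * C η) + (X * C η) ^ 2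
  have hp : ∀ φ, p φ ≠ 0 := by
    intro φ h
    by_cases hφ : φ = 0
    · have := congrArg (eval 1) h
      simp [p, hφ, hη0] at this
    · have := congrArg (eval 0) h
      simp [p, hφ, hη0] at this
  obtain ⟨ξ, hξ⟩ := exists_notMem_fin (((insert 0 F : Finset k) : Set k) ∪ {η} ∪
    ⋃ φ ∈ (insert 0 F : Finset k), {ξ | (p φ).IsRoot ξ})
    (((Finset.finite_toSet _).union (Set.finite_singleton _)).union
      (Set.Finite.biUnion (Finset.finite_toSet _) fun φ _ => finite_setOfPred_isRoot (hp φ)))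
  simp only [Set.mem_union, not_or, Set.mem_iUnion, Set.mem_singleton_iff] at hξ
  obtain ⟨⟨h1, h2⟩, h3⟩ := hξ
  simp only [Finset.coe_insert, Set.mem_insert_iff, Finset.mem_coe, not_or] at h1
  have h3' : ∀ φ, φ ∈ (insert 0 F : Finset k) → (p φ).eval ξ ≠ 0 := fun φ h h' => h3 ⟨φ, h, h'⟩
  obtain ⟨x, hx, rfl⟩ := L.surj ξ
  obtain ⟨P, hP, rfl⟩ := exists_xc (W := tW κ) x
  have hd : L.v (xc Q - xc P) = 1 := by
    refine L.v_eq_one (L.v_sub hQ2 hx) ?_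
    rw [L.rd_sub hQ2 hx]; exact sub_ne_zero.2 (Ne.symm h2)
  have hxx : xc Q ≠ xc P := by intro e; rw [e, sub_self] at hd; simp at hd
  obtain ⟨e1, e2⟩ := tadd hQ0 hP hxx
  have hκ' := hκ.le
  have i1 : L.v (xc (Q + P) * xc (Q - P)) ≤ 1 := by
    have := congrArg L.v e1
    rw [map_mul, map_pow, hd, one_pow, mul_one] at this
    rw [this]
    exact L.v_add (L.v_pow (L.v_mul hQ2 hx) 2) (L.v_mul hκ' (L.v_add (L.v_add (L.v_add (L.v_mul
      (L.v_ofNat 72) (L.v_mul hQ2 hx)) (L.v_mul (L.v_ofNat 4) (L.v_add hQ2 hx))) (by simp))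
          (L.v_mul (L.v_ofNat 1296) hκ.le)))
  have i2 : L.v (xc (Q + P) + xc (Q - P)) ≤ 1 := by
    have := congrArg L.v e2
    rw [map_mul, map_pow, hd, one_pow, mul_one] at this
    rw [this]
    exact L.v_add (L.v_mul hQ2 hx) (L.v_sub (L.v_mul (L.v_mul (L.v_ofNat 2) (L.v_add hQ2 hx))
      (L.v_mul hQ2 hx)) (L.v_mul hκ' (L.v_add (L.v_mul (L.v_ofNat 72) (L.v_add hQ2 hx)) (L.v_ofNat 4))))
  have ha := L.int_of_sum_prod i2 i1
  have hb := L.int_of_sum_prod (by rwa [add_comm] at i2) (by rwa [mul_comm] at i1)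
  have r1 : L.rd (xc (Q + P)) * L.rd (xc (Q - P)) * (η - L.rd (xc P)) ^ 2 = (η * L.rd (xc P)) ^ 2 := by
    have e := congrArg L.hom (Subtype.ext e1 : ((⟨_, ha⟩ * ⟨_, hb⟩ * (⟨_, hQ2⟩ - ⟨_, hx⟩) ^ 2 : L.ring)) =
      (⟨_, hQ2⟩ * ⟨_, hx⟩) ^ 2 +
      ⟨_, hκ'⟩ * (72 * (⟨_, hQ2⟩ * ⟨_, hx⟩) + 4 * (⟨_, hQ2⟩ + ⟨_, hx⟩) + 1 + 1296 * ⟨_, hκ'⟩))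
    simp only [map_mul, map_sub, map_add, map_pow, show L.hom ⟨κ, hκ'⟩ = 0 from L.rd_small hκ,
      zero_mul, add_zero] at e
    exact e
  have r2 : (L.rd (xc (Q + P)) + L.rd (xc (Q - P))) * (η - L.rd (xc P)) ^ 2 =
      η * L.rd (xc P) + 2 * (η + L.rd (xc P)) * (η * L.rd (xc P)) := by
    have e := congrArg L.hom (Subtype.ext e2 : (((⟨_, ha⟩ + ⟨_, hb⟩) * (⟨_, hQ2⟩ - ⟨_, hx⟩) ^ 2 : L.ring)) =
      ⟨_, hQ2⟩ * ⟨_, hx⟩ + (2 * (⟨_, hQ2⟩ + ⟨_, hx⟩) * (⟨_, hQ2⟩ * ⟨_, hx⟩) -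
        ⟨_, hκ'⟩ * (72 * (⟨_, hQ2⟩ + ⟨_, hx⟩) + 4)))
    simp only [map_mul, map_sub, map_add, map_pow, show L.hom ⟨κ, hκ'⟩ = 0 from L.rd_small hκ,
      zero_mul, sub_zero, map_ofNat] at e
    exact e
  have hne : Q + P ≠ 0 := fun h => hxx (by rw [eq_neg_of_add_eq_zero_left h, xc_neg])
  have hne' : Q - P ≠ 0 := fun h => hxx (by rw [sub_eq_zero.1 h])
  refine ⟨P, ⟨hP, L.v_eq_one hx h1.1, h1.2⟩, ?_, ?_⟩
  · have : L.rd (xc (Q + P)) ∉ insert 0 F := fun hm => h3' _ hm (by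
      simp only [p, eval_add, eval_sub, eval_mul, eval_pow, eval_C, eval_X, eval_ofNat]
      linear_combination L.rd (xc (Q + P)) * r2 - r1)
    rw [Finset.mem_insert, not_or] at this
    exact ⟨hne, L.v_eq_one ha this.1, this.2⟩
  · have : L.rd (xc (Q - P)) ∉ insert 0 F := fun hm => h3' _ hm (by
      simp only [p, eval_add, eval_sub, eval_mul, eval_pow, eval_C, eval_X, eval_ofNat]
      linear_combination L.rd (xc (Q - P)) * r2 - r1)
    rw [Finset.mem_insert, not_or] at this
    exact ⟨hne', L.v_eq_one hb this.1, this.2⟩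

include hκ hκ0 in
theorem no_mult_red (α : (tW κ).toAffine.Point →+ (tW κ).toAffine.Point) {A B : Polynomial K}
    (hA : A ≠ 0) (hB : B ≠ 0)
    (h1 : ∀ P, P ≠ 0 → α P ≠ 0 → xc (α P) * B.eval (xc P) = A.eval (xc P))
    (h2 : ∀ P, P ≠ 0 → α P = 0 → B.eval (xc P) = 0)
    (M : ℤ) (hM : ∀ P, α (α (α (α P))) = M • P) (hM0 : M ≠ 0) (hM4 : ∀ m : ℕ, m ^ 4 ≠ M.natAbs) :
    False := by
  classical
  obtain ⟨GA, mA, hGA, zA, FA, hzA, a1, a2⟩ := L.GQ_exists hA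
  obtain ⟨GB, mB, hGB, zB, FB, hzB, b1, b2⟩ := L.GQ_exists hB
  obtain ⟨z, hz, hz0, hzA', hzB', hzκ⟩ : ∃ z, L.v z < 1 ∧ z ≠ 0 ∧ L.v zA ≤ L.v z ∧ L.v zB ≤ L.v z ∧
      L.v κ ≤ L.v z := by
    obtain ⟨u, hu, hu1, hu2, hu0⟩ : ∃ u, L.v u < 1 ∧ L.v zA ≤ L.v u ∧ L.v κ ≤ L.v u ∧ u ≠ 0 := by
      rcases le_total (L.v zA) (L.v κ) with h | h
      · exact ⟨κ, hκ, h, le_rfl, hκ0⟩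
      · refine ⟨zA, hzA, le_rfl, h, ?_⟩
        rintro rfl
        rw [map_zero, le_zero_iff, map_eq_zero] at h; exact hκ0 h
    rcases le_total (L.v zB) (L.v u) with h | h
    · exact ⟨u, hu, hu0, hu1, h, hu2⟩
    · refine ⟨zB, hzB, ?_, hu1.trans h, le_rfl, hu2.trans h⟩
      rintro rfl
      rw [map_zero, le_zero_iff, map_eq_zero] at h; exact hu0 h
  set F := FA ∪ FB with hF
  set G := GA / GB with hG
  have hG0 : G ≠ 0 := div_ne_zero hGA hGB
  have hgen : ∀ P, L.gen F P → α P ≠ 0 ∧ L.v (xc (α P)) = G := by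
    rintro P ⟨p1, p2, p3⟩
    rw [hF, Finset.mem_union, not_or] at p3
    have hb := b1 _ p2 p3.2
    have hne : α P ≠ 0 := by
      intro h; rw [h2 P p1 h, map_zero] at hb; exact hGB hb.symm
    refine ⟨hne, ?_⟩
    rw [hG, eq_div_iff hGB, ← hb, ← a1 _ p2 p3.1, ← h1 P p1 hne, map_mul]
  have hann : ∀ P, P ≠ 0 → L.v z < L.v (xc P) → L.v (xc P) < 1 →
      α P ≠ 0 ∧ L.v (xc (α P)) * L.v (xc P) ^ mB = G * L.v (xc P) ^ mA := by
    intro P p1 p2 p3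
    have hb := b2 _ (hzB'.trans_lt p2) p3
    have hne : α P ≠ 0 := by
      intro h; rw [h2 P p1 h, map_zero] at hb
      have : L.v (xc P) ≠ 0 := (zero_le'.trans_lt p2).ne'
      exact mul_ne_zero hGB (pow_ne_zero _ this) hb.symm
    refine ⟨hne, ?_⟩
    have e := a2 _ (hzA'.trans_lt p2) p3
    rw [← h1 P p1 hne, map_mul, hb] at e
    rw [hG, div_mul_eq_mul_div, eq_div_iff hGB, ← e]
    ac_rfl
  rcases lt_or_ge G 1 with hG1 | hG1
  · -- G < 1
    have hF1 : ∃ P0, L.gen F (P0 : (tW κ).toAffine.Point) := by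
      obtain ⟨P, h, -⟩ := L.tgen hκ F (Q := 0) (Or.inl rfl)
      exact ⟨P, h⟩
    obtain ⟨Q, hQ⟩ := hF1
    obtain ⟨P, hP, hs, hd⟩ := L.tgen hκ F (Q := Q) (Or.inr hQ.2.1.ge)
    obtain ⟨q1, q2⟩ := hgen _ hQ
    obtain ⟨p1, p2⟩ := hgen _ hP
    obtain ⟨s1, s2⟩ := hgen _ hs
    obtain ⟨d1, d2⟩ := hgen _ hd
    rw [map_add] at s1 s2
    rw [map_sub] at d1 d2
    have hx : xc (α Q) ≠ xc (α P) := by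
      rw [Ne, xc_eq_iff q1 p1]
      rintro (h | h)
      · exact d1 (sub_eq_zero.2 h)
      · exact s1 (by rw [h, neg_add_cancel])
    obtain ⟨e1, e2⟩ := tadd q1 p1 hx
    have hG0' : 0 < G := zero_lt_iff.2 hG0
    have hdG : L.v ((xc (α Q) - xc (α P)) ^ 2) ≤ G ^ 2 := by
      rw [map_pow]; exact pow_le_pow_left' (L.v_sub q2.le p2.le) 2
    have hsG : L.v (xc (α Q) + xc (α P)) ≤ G := L.v_add q2.le p2.le
    have hpG : L.v (xc (α Q) * xc (α P)) = G ^ 2 := by rw [map_mul, q2, p2, sq]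
    have hp1 : L.v (xc (α Q) * xc (α P)) ≤ 1 := by rw [hpG]; exact pow_le_one' hG1.le 2
    have hs1 : L.v (xc (α Q) + xc (α P)) ≤ 1 := hsG.trans hG1.le
    rcases lt_or_ge (L.v κ) (G ^ 2) with hk | hk
    · have e := congrArg L.v e2
      rw [L.v.map_add_eq_of_lt_left, map_mul, hpG] at e
      · have : G ^ 2 ≤ G * G ^ 2 := by
          exact e.symm.le.trans (mul_le_mul' (L.v_add s2.le d2.le) hdG)
        have h' : G * G ^ 2 < 1 * G ^ 2 := (mul_lt_mul_iff_left₀ (pow_pos hG0' 2)).2 hG1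
        rw [one_mul] at h'
        exact absurd this (not_le.2 h')
      · rw [hpG]
        refine (L.v.map_sub _ _).trans_lt (max_lt ?_ ?_)
        · rw [map_mul, map_mul, hpG]
          calc _ ≤ 1 * G * G ^ 2 := mul_le_mul' (mul_le_mul' (L.v_ofNat 2) hsG) le_rfl
            _ < 1 * G ^ 2 := by rw [one_mul]; exact (mul_lt_mul_iff_left₀ (pow_pos hG0' 2)).2 hG1
            _ = G ^ 2 := one_mul _
        · rw [map_mul]
          calc _ ≤ L.v κ * 1 := mul_le_mul' le_rfl (L.v_add (L.v_mul (L.v_ofNat 72) hs1) (L.v_ofNat 4))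
            _ < _ := by rwa [mul_one]
    · have e := congrArg L.v e1
      have hκ2 : L.v κ ^ 2 < L.v κ := pow_lt_self_of_lt_one₀
        (zero_lt_iff.2 (by simpa using hκ0)) hκ (by norm_num)
      have hsq : L.v ((xc (α Q) * xc (α P)) ^ 2) < L.v κ := by
        rw [map_pow, hpG]; exact (pow_le_pow_left' hk 2).trans_lt hκ2
      have hun : L.v (72 * (xc (α Q) * xc (α P)) + 4 * (xc (α Q) + xc (α P)) + 1 + 1296 * κ) = 1 := by
        have hp1' : L.v (xc (α P) * xc (α Q)) < 1 := by
          rw [mul_comm, hpG]; exact pow_lt_one₀ zero_le' hG1 (by norm_num)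
        rw [show 72 * (xc (α Q) * xc (α P)) + 4 * (xc (α Q) + xc (α P)) + 1 + 1296 * κ =
          1 + (xc (α P) * xc (α Q) * 72 + (xc (α Q) + xc (α P)) * 4 + κ * 1296) by ring]
        apply L.v.map_one_add_of_lt
        exact L.v.map_add_lt (L.v.map_add_lt (L.mul_lt_one hp1' (L.v_ofNat 72))
          (L.mul_lt_one (hsG.trans_lt hG1) (L.v_ofNat 4))) (L.mul_lt_one hκ (L.v_ofNat 1296))
      rw [L.v.map_add_eq_of_lt_right (by rwa [map_mul L.v κ, hun, mul_one]), map_mul L.v κ, hun, mul_one,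
        map_mul, map_mul, s2, d2] at e
      have : L.v κ ≤ L.v κ ^ 2 := by
        refine e.symm.le.trans ?_
        calc G * G * _ ≤ G * G * G ^ 2 := mul_le_mul' le_rfl hdG
          _ = (G ^ 2) ^ 2 := by rw [← sq, ← sq]
          _ ≤ _ := pow_le_pow_left' hk 2
      exact absurd this (not_le.2 hκ2)
  · -- G ≥ 1
    have hE0 : ∀ Q, L.E0 Q → L.E0 (α Q) := by
      intro Q hQ
      obtain ⟨P, hP, hs, -⟩ := L.tgen hκ F hQ
      have := L.E0_add hκ (P := α (Q + P)) (Q := -α P) (Or.inr (by rw [(hgen _ hs).2]; exact hG1))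
        (L.E0_neg (Or.inr (by rw [(hgen _ hP).2]; exact hG1)))
      rwa [map_add, add_neg_cancel_right] at this
    set n := M.natAbs with hn
    have hn1 : 1 ≤ n := Int.natAbs_pos.2 hM0
    -- small points
    have small : ∀ N : ℕ, ∀ w : K, L.v w < 1 → w ≠ 0 → L.v z ≤ L.v w →
        ∃ P : (tW κ).toAffine.Point, P ≠ 0 ∧ L.v (xc P) < 1 ∧ 0 < L.v (xc P) ∧
          L.v w ≤ L.v (xc P) ^ (N + 2 * n + 1) ∧ L.v (xc (M • P)) = L.v (xc P) ^ n ∧ M • P ≠ 0 := by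
      intro N w hw hw0 hzw
      obtain ⟨x, hx⟩ := IsAlgClosed.exists_pow_nat_eq w (n := N + 2 * n + 1) (by omega)
      have hx1 : L.v x < 1 := by
        by_contra h
        have : 1 ≤ L.v w := by rw [← hx, map_pow]; exact one_le_pow_of_one_le' (not_lt.1 h) _
        exact absurd hw (not_lt.2 this)
      have hx0 : 0 < L.v x := by
        rw [zero_lt_iff, Valuation.ne_zero_iff]
        rintro rfl
        rw [zero_pow (by omega)] at hx
        exact hw0 hx.symm
      obtain ⟨P, hP, rfl⟩ := exists_xc (W := tW κ) x
      have hwx : L.v w = L.v (xc P) ^ (N + 2 * n + 1) := by rw [← hx, map_pow]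
      have hm := L.tmul hκ hP hx1 n hn1 (((hzκ.trans hzw).trans hwx.le).trans_lt
        (pow_lt_pow_right_of_lt_one₀ hx0 hx1 (by omega)))
      refine ⟨P, hP, hx1, hx0, hwx.le, ?_, ?_⟩
      · rcases Int.natAbs_eq M with h | h
        · rw [h, ← hn, natCast_zsmul, hm.2]
        · rw [h, ← hn, neg_smul, xc_neg, natCast_zsmul, hm.2]
      · rcases Int.natAbs_eq M with h | h
        · rw [h, ← hn, natCast_zsmul]; exact hm.1
        · rw [h, ← hn, neg_smul, natCast_zsmul, neg_ne_zero]; exact hm.1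
    have smallE : ∀ P : (tW κ).toAffine.Point, L.v (xc P) < 1 → L.v (xc (M • P)) = L.v (xc P) ^ n →
        M • P ≠ 0 → ¬ L.E0 (α P) := by
      intro P p1 p2 p3 h
      have := hE0 _ (hE0 _ (hE0 _ h))
      rw [hM] at this
      rcases this with h | h
      · exact p3 h
      · rw [p2] at h
        exact absurd h (not_le.2 (pow_lt_one₀ zero_le' p1 (by omega)))
    -- mB < mA and G = 1
    have hAB : mB < mA := by
      by_contra hc
      obtain ⟨P, p1, p2, p3, p4, p5, p6⟩ := small 0 z hz hz0 le_rfl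
      have pz : L.v z < L.v (xc P) := p4.trans_lt (pow_lt_self_of_lt_one₀ p3 p2 (by omega))
      obtain ⟨q1, q2⟩ := hann P p1 pz p2
      refine smallE P p2 p5 p6 (Or.inr ?_)
      by_contra hlt
      push Not at hlt
      have hsm : 0 < L.v (xc P) ^ mB := pow_pos p3 _
      have : L.v (xc (α P)) * L.v (xc P) ^ mB < 1 * L.v (xc P) ^ mB := (mul_lt_mul_iff_left₀ hsm).2 hlt
      rw [q2, one_mul] at this
      have h4 : L.v (xc P) ^ mB ≤ L.v (xc P) ^ mA := pow_le_pow_right_of_le_one' p2.le (by omega)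
      have h5 : 1 * L.v (xc P) ^ mA ≤ G * L.v (xc P) ^ mA := mul_le_mul' hG1 le_rfl
      rw [one_mul] at h5
      exact absurd (h4.trans h5) (not_le.2 this)
    obtain ⟨m, rfl⟩ : ∃ m, mA = mB + (m + 1) := ⟨mA - mB - 1, by omega⟩
    have hann' : ∀ P, P ≠ 0 → L.v z < L.v (xc P) → L.v (xc P) < 1 →
      α P ≠ 0 ∧ L.v (xc (α P)) = G * L.v (xc P) ^ (m + 1) := by
      intro P p1 p2 p3
      obtain ⟨q1, q2⟩ := hann P p1 p2 p3
      refine ⟨q1, ?_⟩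
      apply mul_right_cancel₀ (pow_ne_zero mB (zero_le'.trans_lt p2).ne')
      rw [q2, pow_add]; ac_rfl
    have hGe : G = 1 := by
      by_contra hne
      have hG1' : 1 < G := lt_of_le_of_ne hG1 (Ne.symm hne)
      obtain ⟨Q, hQ, -⟩ := L.tgen hκ F (Q := 0) (Or.inl rfl)
      obtain ⟨q1, q2⟩ := hgen Q hQ
      obtain ⟨w, w1, w2, w3, w4⟩ : ∃ w, L.v w < 1 ∧ w ≠ 0 ∧ L.v z ≤ L.v w ∧ G⁻¹ ≤ L.v w := by
        rcases le_total (L.v z) G⁻¹ with h | h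
        · refine ⟨(xc (α Q))⁻¹, ?_, ?_, ?_, ?_⟩
          · rw [map_inv₀, q2]; exact inv_lt_one_of_one_lt₀ hG1'
          · apply inv_ne_zero; intro h0; rw [h0, map_zero] at q2; exact hG0 q2.symm
          · rwa [map_inv₀, q2]
          · rw [map_inv₀, q2]
        · exact ⟨z, hz, hz0, le_rfl, h⟩
      obtain ⟨P, p1, p2, p3, p4, p5, p6⟩ := small m w w1 w2 w3
      have pz : L.v z < L.v (xc P) := (w3.trans p4).trans_lt (pow_lt_self_of_lt_one₀ p3 p2 (by omega))
      obtain ⟨r1, r2⟩ := hann' P p1 pz p2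
      refine smallE P p2 p5 p6 (Or.inr ?_)
      rw [r2]
      calc (1 : Γ) = G * G⁻¹ := (mul_inv_cancel₀ hG0).symm
        _ ≤ G * L.v (xc P) ^ (m + 1) := mul_le_mul' le_rfl ((w4.trans p4).trans
            (pow_le_pow_right_of_le_one' p2.le (by omega)))
    rw [hGe] at hann'
    simp only [one_mul] at hann'
    obtain ⟨P, p1, p2, p3, p4, p5, p6⟩ := small ((m + 1) ^ 4) z hz hz0 le_rfl
    have hzl : ∀ j, j ≤ (m + 1) ^ 4 → L.v z < L.v (xc P) ^ j := fun j hj =>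
      p4.trans_lt (pow_lt_pow_right_of_lt_one₀ p3 p2 (by omega))
    have hlt : ∀ j, j ≠ 0 → L.v (xc P) ^ j < 1 := fun j hj => pow_lt_one₀ zero_le' p2 hj
    have hp1 : (m + 1) ≤ (m + 1) ^ 4 := Nat.le_self_pow (by norm_num) _
    have hp2 : (m + 1) ^ 2 ≤ (m + 1) ^ 4 := Nat.pow_le_pow_right (by omega) (by norm_num)
    have hp3 : (m + 1) ^ 3 ≤ (m + 1) ^ 4 := Nat.pow_le_pow_right (by omega) (by norm_num)
    obtain ⟨a1, a2⟩ := hann' P p1 (by simpa using hzl 1 (by omega)) p2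
    obtain ⟨b1, b2⟩ := hann' _ a1 (by rw [a2]; exact hzl _ hp1) (by rw [a2]; exact hlt _ (by simp))
    rw [a2, ← pow_mul, ← sq] at b2
    obtain ⟨c1, c2⟩ := hann' _ b1 (by rw [b2]; exact hzl _ hp2) (by rw [b2]; exact hlt _ (by simp))
    rw [b2, ← pow_mul, ← pow_succ] at c2
    obtain ⟨d1, d2⟩ := hann' _ c1 (by rw [c2]; exact hzl _ hp3) (by rw [c2]; exact hlt _ (by simp))
    rw [c2, ← pow_mul, ← pow_succ, hM, p5] at d2
    exact hM4 (m + 1) ((pow_right_injective₀ p3 p2.ne) d2).symm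

end Pl
end WC

set_option linter.unusedSectionVars false
set_option linter.style.haveILetI false
namespace WC
open WeierstrassCurve WeierstrassCurve.Affine Polynomial

/-- the two-division polynomial -/
noncomputable def Ψ₂ {K : Type*} [CommRing K] (W : WeierstrassCurve K) : Polynomial K :=
  4 * X ^ 3 + C W.b₂ * X ^ 2 + C (2 * W.b₄) * X + C W.b₆

/-- homogenised two-division polynomial times the denominator -/
noncomputable def Ψh {R : Type*} [CommRing R] (W : WeierstrassCurve R) (A B : Polynomial R) : Polynomial R :=
  B * (4 * A ^ 3 + C W.b₂ * A ^ 2 * B + C (2 * W.b₄) * A * B ^ 2 + C W.b₆ * B ^ 3)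

lemma map_Ψ₂ {R S : Type*} [CommRing R] [CommRing S] (W : WeierstrassCurve R) (f : R →+* S) :
    (Ψ₂ W).map f = Ψ₂ (W.map f) := by
  simp [Ψ₂, map_ofNat f 2]

lemma map_Ψh {R S : Type*} [CommRing R] [CommRing S] (W : WeierstrassCurve R) (f : R →+* S)
    (A B : Polynomial R) : (Ψh W A B).map f = Ψh (W.map f) (A.map f) (B.map f) := by
  simp [Ψh, map_ofNat f 2]

/-- an endomorphism given on `x`-coordinates by a fraction `A / B` -/
structure RH {K : Type*} [Field K] [DecidableEq K] {W : WeierstrassCurve K}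
    (α : W.toAffine.Point →+ W.toAffine.Point) (A B : Polynomial K) (c : K) (N : ℕ) : Prop where
  cop : IsCoprime A B
  monic : A.Monic
  degA : A.natDegree = N
  degB : B.natDegree < N
  eq : ∀ P, P ≠ 0 → α P ≠ 0 → xc (α P) * B.eval (xc P) = A.eval (xc P)
  zero : ∀ P, P ≠ 0 → α P = 0 → B.eval (xc P) = 0
  der : (derivative A * B - A * derivative B) ^ 2 * Ψ₂ W = C (c ^ 2) * Ψh W A B
  surj : Function.Surjective α

namespace RH
variable {K : Type*} [Field K] [DecidableEq K] {W : WeierstrassCurve K}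
  {α : W.toAffine.Point →+ W.toAffine.Point} {A B : Polynomial K} {c : K} {N : ℕ} (h : RH α A B c N)
include h

lemma not_both (x : K) : ¬ (A.eval x = 0 ∧ B.eval x = 0) := by
  rintro ⟨h1, h2⟩
  obtain ⟨u, v, e⟩ := h.cop
  have := congrArg (eval x) e
  simp [h1, h2] at this

lemma zero_iff {P : W.toAffine.Point} (hP : P ≠ 0) : α P = 0 ↔ B.eval (xc P) = 0 := by
  refine ⟨h.zero P hP, fun hb => ?_⟩
  by_contra hc
  have := h.eq P hP hc
  rw [hb, mul_zero] at this
  exact h.not_both _ ⟨this.symm, hb⟩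

lemma degSub (x0 : K) : (A - C x0 * B).Monic ∧ (A - C x0 * B).natDegree = N := by
  have hlt : (C x0 * B).degree < A.degree := by
    rw [degree_eq_natDegree h.monic.ne_zero, h.degA]
    by_cases hb : C x0 * B = 0
    · rw [hb, degree_zero]; exact WithBot.bot_lt_coe _
    rw [degree_eq_natDegree hb]
    exact_mod_cast (natDegree_C_mul_le x0 B).trans_lt h.degB
  exact ⟨h.monic.sub_of_left hlt, by rw [natDegree_sub_eq_left_of_natDegree_lt, h.degA]
                                     rw [h.degA]; exact (natDegree_C_mul_le x0 B).trans_lt h.degB⟩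

lemma root_iff {P : W.toAffine.Point} (hP : P ≠ 0) (x0 : K) :
    (A - C x0 * B).eval (xc P) = 0 ↔ α P ≠ 0 ∧ xc (α P) = x0 := by
  simp only [eval_sub, eval_mul, eval_C]
  constructor
  · intro e
    have hB : B.eval (xc P) ≠ 0 := fun hb => h.not_both _ ⟨by rw [hb] at e; simpa using e, hb⟩
    have h1 : α P ≠ 0 := fun h0 => hB ((h.zero_iff hP).1 h0)
    refine ⟨h1, ?_⟩
    apply mul_right_cancel₀ hB
    rw [h.eq P hP h1, sub_eq_zero.1 e]
  · rintro ⟨h1, rfl⟩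
    rw [h.eq P hP h1, sub_self]

end RH

namespace Pl
variable {K k Γ : Type*} [Field K] [Field k] [LinearOrderedCommGroupWithZero Γ] (L : Pl K k Γ)

lemma exists_intpoly (A : Polynomial K) (hA : ∀ i, L.v (A.coeff i) ≤ 1) :
    ∃ A' : Polynomial L.ring, A'.map L.ring.subtype = A := by
  have : A ∈ lifts L.ring.subtype := by
    rw [lifts_iff_coeff_lifts]
    intro n
    exact ⟨⟨_, hA n⟩, rfl⟩
  exact (mem_lifts _).1 this

lemma eval_int (A : Polynomial L.ring) {x : K} (hx : L.v x ≤ 1) :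
    L.v ((A.map L.ring.subtype).eval x) ≤ 1 ∧
      L.rd ((A.map L.ring.subtype).eval x) = (A.map L.hom).eval (L.rd x) := by
  have e : (A.map L.ring.subtype).eval x = (A.eval ⟨x, hx⟩ : L.ring).1 := by
    rw [eval_map]; exact eval₂_hom (p := A) L.ring.subtype (⟨x, hx⟩ : L.ring)
  rw [e]
  refine ⟨L.ring_v _, ?_⟩
  change L.hom _ = _
  rw [eval_map, ← eval₂_hom (x := (⟨x, hx⟩ : L.ring)) L.hom]; rfl

/-- monic polynomial with integral roots is integral -/
lemma int_of_roots [IsAlgClosed K] {A : Polynomial K} (hm : A.Monic)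
    (hr : ∀ r, A.eval r = 0 → L.v r ≤ 1) :
    ∃ A' : Polynomial L.ring, A'.map L.ring.subtype = A := by
  have hs := (IsAlgClosed.splits A).eq_prod_roots_of_monic hm
  have key : ∀ s : Multiset K, (∀ r ∈ s, L.v r ≤ 1) →
      ∃ A' : Polynomial L.ring, A'.map L.ring.subtype = (s.map (X - C ·)).prod := by
    intro s
    induction s using Multiset.induction with
    | empty => intro _; exact ⟨1, by simp⟩
    | cons r s ih =>
      intro h
      obtain ⟨A', hA'⟩ := ih fun r hr => h r (Multiset.mem_cons_of_mem hr)
      refine ⟨(X - C ⟨r, h r (Multiset.mem_cons_self r s)⟩) * A', ?_⟩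
      rw [Polynomial.map_mul, hA']
      simp
  obtain ⟨A', hA'⟩ := key A.roots fun r h => hr r (isRoot_of_mem_roots h)
  exact ⟨A', by rw [hA', ← hs]⟩

/-- primitive scaling of a pair of polynomials -/
lemma primitive_pair (A B : Polynomial K) (hA : A ≠ 0) : ∃ (c : K) (A' B' : Polynomial L.ring), c ≠ 0 ∧
    A = C c * A'.map L.ring.subtype ∧ B = C c * B'.map L.ring.subtype ∧
    (A'.map L.hom ≠ 0 ∨ B'.map L.hom ≠ 0) := by
  classical
  let S : Finset K := A.support.image A.coeff ∪ B.support.image B.coeff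
  have hS : S.Nonempty := by
    obtain ⟨i, hi⟩ := nonempty_support_iff.2 hA
    exact ⟨A.coeff i, Finset.mem_union_left _ (Finset.mem_image_of_mem _ hi)⟩
  obtain ⟨c, hcS, hmax⟩ := S.exists_max_image L.v hS
  have hc0 : c ≠ 0 := by
    rcases Finset.mem_union.1 hcS with h | h <;>
    · obtain ⟨i, hi, rfl⟩ := Finset.mem_image.1 h
      exact mem_support_iff.1 hi
  have hvc : 0 < L.v c := by rw [zero_lt_iff, Valuation.ne_zero_iff]; exact hc0
  have aux : ∀ D : Polynomial K, (∀ i, L.v (D.coeff i) ≤ L.v c) →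
      ∃ D' : Polynomial L.ring, D'.map L.ring.subtype = C c⁻¹ * D := by
    intro D hD
    apply L.exists_intpoly
    intro i
    rw [coeff_C_mul, map_mul, map_inv₀, inv_mul_le_iff₀ hvc, mul_one]
    exact hD i
  obtain ⟨A', hA'⟩ := aux A fun i => by
    by_cases h : A.coeff i = 0
    · rw [h, map_zero]; exact hvc.le
    · exact hmax _ (Finset.mem_union_left _ (Finset.mem_image_of_mem _ (mem_support_iff.2 h)))
  obtain ⟨B', hB'⟩ := aux B fun i => by
    by_cases h : B.coeff i = 0
    · rw [h, map_zero]; exact hvc.le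
    · exact hmax _ (Finset.mem_union_right _ (Finset.mem_image_of_mem _ (mem_support_iff.2 h)))
  have fin : ∀ (D : Polynomial K) (D' : Polynomial L.ring), D'.map L.ring.subtype = C c⁻¹ * D →
      ∀ i, D.coeff i = c → D'.map L.hom ≠ 0 := by
    intro D D' e i hi h0
    have e1 := congrArg (fun p => coeff p i) e
    have e2 := congrArg (fun p => coeff p i) h0
    simp only [coeff_map, coeff_C_mul, hi, inv_mul_cancel₀ hc0, coeff_zero] at e1 e2
    have : D'.coeff i = 1 := Subtype.ext e1
    rw [this, map_one] at e2
    exact one_ne_zero e2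
  refine ⟨c, A', B', hc0, ?_, ?_, ?_⟩
  · rw [hA', ← mul_assoc, ← C_mul, mul_inv_cancel₀ hc0, C_1, one_mul]
  · rw [hB', ← mul_assoc, ← C_mul, mul_inv_cancel₀ hc0, C_1, one_mul]
  · rcases Finset.mem_union.1 hcS with h | h <;> obtain ⟨i, hi, hi'⟩ := Finset.mem_image.1 h
    · exact Or.inl (fin A A' hA' i hi')
    · exact Or.inr (fin B B' hB' i hi')

variable [DecidableEq K] [DecidableEq k] [IsAlgClosed K] [IsAlgClosed k]
  {W : WeierstrassCurve K} [W.IsElliptic] (hW : L.Int W) [((L.lift W hW).map L.hom).IsElliptic]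
  {α : W.toAffine.Point →+ W.toAffine.Point} {A B : Polynomial K} {c : K} {N : ℕ} (h : RH α A B c N)

lemma red_eq_zero {P : W.toAffine.Point} : L.red hW P = 0 ↔ P = 0 ∨ 1 < L.v (xc P) := L.redF_eq_zero hW
lemma red_ne_zero {P : W.toAffine.Point} : L.red hW P ≠ 0 ↔ P ≠ 0 ∧ L.v (xc P) ≤ 1 := L.redF_ne_zero hW
lemma red_xc {P : W.toAffine.Point} (hP : L.red hW P ≠ 0) : xc (L.red hW P) = L.rd (xc P) :=
  (L.redF_some hW ((L.red_ne_zero hW).1 hP).1 ((L.red_ne_zero hW).1 hP).2).2.1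
lemma red_surj : Function.Surjective (L.red hW) := L.redF_surj hW

include h in
/-- endomorphisms preserve the kernel of reduction -/
lemma red_ker {P1 : W.toAffine.Point} (hP1 : L.red hW P1 = 0) : L.red hW (α P1) = 0 := by
  obtain ⟨d, A', B', hd, eA, eB, hne⟩ := L.primitive_pair A B h.monic.ne_zero
  -- the bad set
  have hfin : {x : k | (A'.map L.hom).eval x = 0 ∧ (B'.map L.hom).eval x = 0}.Finite := by
    rcases hne with hne | hne
    · exact (finite_setOfPred_isRoot hne).subset fun x hx => hx.1
    · exact (finite_setOfPred_isRoot hne).subset fun x hx => hx.2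
  -- value determined up to sign
  have key : ∀ P P' : W.toAffine.Point, L.red hW P ≠ 0 → L.red hW P' = L.red hW P →
      ¬ ((A'.map L.hom).eval (xc (L.red hW P)) = 0 ∧ (B'.map L.hom).eval (xc (L.red hW P)) = 0) →
      L.red hW (α P') = L.red hW (α P) ∨ L.red hW (α P') = - L.red hW (α P) := by
    intro P P' hP hPP hbad
    have one : ∀ Q : W.toAffine.Point, L.red hW Q ≠ 0 → L.red hW Q = L.red hW P →
        ((B'.map L.hom).eval (xc (L.red hW P)) = 0 → L.red hW (α Q) = 0) ∧
        ((B'.map L.hom).eval (xc (L.red hW P)) ≠ 0 → L.red hW (α Q) ≠ 0 ∧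
          xc (L.red hW (α Q)) * (B'.map L.hom).eval (xc (L.red hW P)) =
            (A'.map L.hom).eval (xc (L.red hW P))) := by
      intro Q hQ hQP
      have hx : xc (L.red hW P) = L.rd (xc Q) := by rw [← hQP, L.red_xc hW hQ]
      obtain ⟨hQ0, hQi⟩ := (L.red_ne_zero hW).1 hQ
      obtain ⟨a1, a2⟩ := L.eval_int A' hQi
      obtain ⟨b1, b2⟩ := L.eval_int B' hQi
      rw [← hx] at a2 b2
      have eq' : α Q ≠ 0 → xc (α Q) * (B'.map L.ring.subtype).eval (xc Q) =
          (A'.map L.ring.subtype).eval (xc Q) := by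
        intro hq
        have := h.eq Q hQ0 hq
        rw [eA, eB] at this
        simp only [eval_mul, eval_C] at this
        apply mul_left_cancel₀ hd
        rw [← this]; ring
      constructor
      · intro hb
        by_contra hc
        obtain ⟨c1, c2⟩ := (L.red_ne_zero hW).1 hc
        have e := congrArg L.rd (eq' c1)
        rw [L.rd_mul c2 b1, b2, a2, hb, mul_zero] at e
        exact hbad ⟨e.symm, hb⟩
      · intro hb
        have hbv : L.v ((B'.map L.ring.subtype).eval (xc Q)) = 1 :=
          L.v_eq_one b1 (by rw [b2]; exact hb)
        have hq : α Q ≠ 0 := by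
          intro h0
          have := h.zero Q hQ0 h0
          rw [eB, eval_mul, eval_C] at this
          rcases mul_eq_zero.1 this with h' | h'
          · exact hd h'
          · rw [h', map_zero] at hbv; exact zero_ne_one hbv
        have e := eq' hq
        have hi : L.v (xc (α Q)) ≤ 1 := by
          have := congrArg L.v e
          rw [map_mul, hbv, mul_one] at this
          rw [this]; exact a1
        have hr : L.red hW (α Q) ≠ 0 := (L.red_ne_zero hW).2 ⟨hq, hi⟩
        refine ⟨hr, ?_⟩
        rw [L.red_xc hW hr, ← b2, ← L.rd_mul hi b1, e, a2]
    obtain ⟨o1, o2⟩ := one P hP rfl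
    obtain ⟨o3, o4⟩ := one P' (by rwa [hPP]) hPP
    by_cases hb : (B'.map L.hom).eval (xc (L.red hW P)) = 0
    · left; rw [o1 hb, o3 hb]
    · obtain ⟨u1, u2⟩ := o2 hb
      obtain ⟨u3, u4⟩ := o4 hb
      refine (xc_eq_iff u3 u1).1 (mul_right_cancel₀ hb (by rw [u2, u4]))
  set T : Set (L.bar hW).toAffine.Point := {0} ∪ {Q | xc Q ∈
    {x : k | (A'.map L.hom).eval x = 0 ∧ (B'.map L.hom).eval x = 0}} with hT
  have hTf : T.Finite := (Set.finite_singleton _).union (finite_xc_mem hfin)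
  by_contra hS
  have k2 : ∀ P, L.red hW P ∉ T → L.red hW (α P) + L.red hW (α P) = - L.red hW (α P1) := by
    intro P hP
    rw [hT, Set.mem_union, not_or] at hP
    have := key P (P + P1) hP.1 (by rw [map_add, hP1, add_zero]) hP.2
    rw [map_add, map_add] at this
    rcases this with e | e
    · exact absurd (by simpa using e) hS
    · rw [eq_neg_iff_add_eq_zero] at e ⊢
      rw [← e]; abel
  obtain ⟨t, t1, t2⟩ := avoid T hTf
  obtain ⟨P, rfl⟩ := L.red_surj hW t
  have e1 := k2 P t1
  have e2 := k2 (P + P) (by rw [map_add]; exact t2)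
  rw [map_add, map_add, e1] at e2
  apply hS
  have : -(L.red hW (α P1)) + -(L.red hW (α P1)) = -(L.red hW (α P1)) + 0 := by rw [e2, add_zero]
  simpa using add_left_cancel this

include h in
/-- reduction of an endomorphism -/
theorem RH_red (hc : L.v c ≤ 1) : ∃ (A' B' : Polynomial L.ring)
    (β : (L.bar hW).toAffine.Point →+ (L.bar hW).toAffine.Point),
    A'.map L.ring.subtype = A ∧ B'.map L.ring.subtype = B ∧ (∀ P, β (L.red hW P) = L.red hW (α P)) ∧
    RH β (A'.map L.hom) (B'.map L.hom) (L.rd c) N := by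
  have hsub : Function.Injective L.ring.subtype := Subtype.val_injective
  have hroot : ∀ x0, L.v x0 ≤ 1 → ∀ r, (A - C x0 * B).eval r = 0 → L.v r ≤ 1 := by
    intro x0 hx0 r hr
    obtain ⟨P, hP, rfl⟩ := exists_xc (W := W) r
    obtain ⟨h1, h2⟩ := (h.root_iff hP x0).1 hr
    by_contra! hlt
    have h3 := L.red_ker hW h ((L.red_eq_zero hW (P := P)).2 (Or.inr hlt))
    rcases (L.red_eq_zero hW).1 h3 with h4 | h4
    · exact h1 h4
    · rw [h2] at h4; exact absurd h4 (not_lt.2 hx0)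
  have hnt : ∀ x0, L.v x0 ≤ 1 → ∃ D : Polynomial L.ring, D.map L.ring.subtype = A - C x0 * B :=
    fun x0 hx0 => L.int_of_roots (h.degSub x0).1 (hroot x0 hx0)
  obtain ⟨A', hA'⟩ := hnt 0 (by simp)
  obtain ⟨D, hD⟩ := hnt 1 (by simp)
  rw [C_0, zero_mul, sub_zero] at hA'
  rw [C_1, one_mul] at hD
  have hB' : (A' - D).map L.ring.subtype = B := by rw [Polynomial.map_sub, hA', hD]; ring
  generalize A' - D = B' at hB'
  obtain ⟨β, hβ⟩ : ∃ β : (L.bar hW).toAffine.Point →+ (L.bar hW).toAffine.Point,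
      ∀ P, β (L.red hW P) = L.red hW (α P) := by
    refine ⟨(L.red hW).liftOfSurjective (L.red_surj hW) ⟨(L.red hW).comp α, ?_⟩, ?_⟩
    · intro P hP
      exact L.red_ker hW h hP
    · intro P
      exact AddMonoidHom.liftOfRightInverse_comp_apply _ _ _ _ P
  have hmem : ∀ (Q : (L.bar hW).toAffine.Point), Q ≠ 0 → ∀ x0, L.v x0 ≤ 1 →
      (A'.map L.hom).eval (xc Q) - L.rd x0 * (B'.map L.hom).eval (xc Q) = 0 →
      β Q ≠ 0 ∧ xc (β Q) = L.rd x0 := by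
    intro Q hQ x0 hx0 e
    obtain ⟨P, rfl⟩ := L.red_surj hW Q
    rw [L.red_xc hW hQ] at e
    obtain ⟨hP0, hPi⟩ := (L.red_ne_zero hW).1 hQ
    obtain ⟨a1, a2⟩ := L.eval_int A' hPi
    obtain ⟨b1, b2⟩ := L.eval_int B' hPi
    rw [hA'] at a1 a2
    rw [hB'] at b1 b2
    have hs : L.v ((A - C x0 * B).eval (xc P)) < 1 := by
      rw [eval_sub, eval_mul, eval_C, ← L.rd_eq_iff a1 (L.v_mul hx0 b1), L.rd_mul hx0 b1, a2, b2]
      exact sub_eq_zero.1 e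
    obtain ⟨r, hr, hrv⟩ : ∃ r, (A - C x0 * B).eval r = 0 ∧ L.v (xc P - r) < 1 := by
      by_contra! hcon
      have hsp := (IsAlgClosed.splits (A - C x0 * B)).eq_prod_roots_of_monic (h.degSub x0).1
      rw [hsp, eval_multiset_prod, Multiset.map_map, map_multiset_prod, Multiset.map_map] at hs
      refine absurd hs (not_lt.2 (Multiset.one_le_prod ?_))
      intro z hz
      obtain ⟨r, hr, rfl⟩ := Multiset.mem_map.1 hz
      simpa using hcon r (isRoot_of_mem_roots hr)
    have hri := hroot x0 hx0 r hr
    obtain ⟨P', hP', rfl⟩ := exists_xc (W := W) r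
    obtain ⟨h1, h2⟩ := (h.root_iff hP' x0).1 hr
    have hP'r : L.red hW P' ≠ 0 := (L.red_ne_zero hW).2 ⟨hP', hri⟩
    have hα : L.red hW (α P') ≠ 0 := (L.red_ne_zero hW).2 ⟨h1, by rw [h2]; exact hx0⟩
    have hx : xc (L.red hW P) = xc (L.red hW P') := by
      rw [L.red_xc hW hQ, L.red_xc hW hP'r, L.rd_eq_iff hPi hri]; exact hrv
    rw [← h2, ← L.red_xc hW hα, ← hβ P']
    rw [← hβ] at hα
    rcases (xc_eq_iff hQ hP'r).1 hx with e | e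
    · rw [e]; exact ⟨hα, rfl⟩
    · rw [e, map_neg]; exact ⟨neg_ne_zero.2 hα, xc_neg _⟩
  have hmA : A'.Monic := by
    apply Polynomial.monic_of_injective hsub; rw [hA']; exact h.monic
  have hdA : A'.natDegree = N := by
    rw [← natDegree_map_eq_of_injective hsub, hA', h.degA]
  have hdB : B'.natDegree < N := by
    rw [← natDegree_map_eq_of_injective hsub, hB']; exact h.degB
  refine ⟨A', B', β, hA', hB', hβ, ?_, hmA.map _, ?_, ?_, ?_, ?_, ?_, ?_⟩
  · rw [Polynomial.isCoprime_iff_aeval_ne_zero_of_isAlgClosed k k]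
    intro x
    by_contra! hx
    rw [coe_aeval_eq_eval] at hx
    obtain ⟨Q, hQ, rfl⟩ := exists_xc (W := L.bar hW) x
    have e0 := hmem Q hQ 0 (by simp) (by rw [hx.1, hx.2]; simp)
    have e1 := hmem Q hQ 1 (by simp) (by rw [hx.1, hx.2]; simp)
    rw [L.rd_zero] at e0
    rw [L.rd_one, e0.2] at e1
    exact zero_ne_one e1.2
  · rw [hmA.natDegree_map, hdA]
  · exact (natDegree_map_le).trans_lt hdB
  · intro Q hQ hβQ
    obtain ⟨P, rfl⟩ := L.red_surj hW Q
    rw [hβ] at hβQ ⊢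
    rw [L.red_xc hW hQ, L.red_xc hW hβQ]
    obtain ⟨hP0, hPi⟩ := (L.red_ne_zero hW).1 hQ
    obtain ⟨hα0, hαi⟩ := (L.red_ne_zero hW).1 hβQ
    obtain ⟨a1, a2⟩ := L.eval_int A' hPi
    obtain ⟨b1, b2⟩ := L.eval_int B' hPi
    rw [← a2, ← b2, ← L.rd_mul hαi b1, hA', hB', h.eq P hP0 hα0]
  · intro Q hQ hβQ
    by_contra hb
    obtain ⟨x0, hx0, e⟩ := L.surj ((A'.map L.hom).eval (xc Q) / (B'.map L.hom).eval (xc Q))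
    exact (hmem Q hQ x0 hx0 (by rw [e, div_mul_cancel₀ _ hb, sub_self])).1 hβQ
  · have key : (derivative A' * B' - A' * derivative B') ^ 2 * Ψ₂ (L.lift W hW) =
        C ((⟨c, hc⟩ : L.ring) ^ 2) * Ψh (L.lift W hW) A' B' := by
      apply Polynomial.map_injective _ hsub
      have := h.der
      rw [← hA', ← hB'] at this
      simp only [Polynomial.map_mul, Polynomial.map_pow, Polynomial.map_sub, map_Ψ₂, map_Ψh,
        ← derivative_map, Polynomial.map_C, L.lift_map hW]
      exact this
    have := congrArg (Polynomial.map L.hom) key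
    simp only [Polynomial.map_mul, Polynomial.map_pow, Polynomial.map_sub, map_Ψ₂, map_Ψh,
        ← derivative_map, Polynomial.map_C, map_pow] at this
    rw [C_pow]
    exact this
  · intro Q
    obtain ⟨P, rfl⟩ := L.red_surj hW Q
    obtain ⟨R, rfl⟩ := h.surj P
    exact ⟨L.red hW R, hβ R⟩

end Pl
end WC

set_option linter.unusedSectionVars false
set_option linter.style.haveILetI false
namespace WC
open WeierstrassCurve WeierstrassCurve.Affine Polynomial

lemma card_ker_comp {G : Type*} [AddCommGroup G] (f g : G →+ G) (hf : Function.Surjective f) :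
    Nat.card (g.comp f).ker = Nat.card g.ker * Nat.card f.ker := by
  have h1 : f.ker ≤ (g.comp f).ker := by
    intro x hx
    rw [AddMonoidHom.mem_ker] at hx ⊢
    simp [hx]
  have h2 := AddSubgroup.relIndex_mul_relIndex ⊥ f.ker (g.comp f).ker bot_le h1
  rw [AddSubgroup.relIndex_bot_left, AddSubgroup.relIndex_bot_left, AddSubgroup.relIndex_ker] at h2
  have h3 : (g.comp f).ker.map f = g.ker := by
    rw [← AddMonoidHom.comap_ker, AddSubgroup.map_comap_eq_self_of_surjective hf]
  rw [h3] at h2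
  rw [← h2, mul_comm]

/-- abstract group-theoretic contradiction -/
lemma ker_contra {G : Type*} [AddCommGroup G] {p e : ℕ} (hp : p.Prime) (he : e ≠ 0) (π π' : G →+ G)
    (h1 : ∀ P, π (π' P) = (p ^ e) • P) (h2 : ∀ P, π' (π P) = (p ^ e) • P) (τ : ℤ) (hτ : ¬ (p : ℤ) ∣ τ)
    (h3 : ∀ P, π P + π' P = τ • P) (hs : Function.Surjective π) (hs' : Function.Surjective π')
    (hc : p * Nat.card π.ker ≤ p ^ e) (hc' : Nat.card π'.ker ≤ p ^ e)
    (hf : Finite π.ker) (hf' : Finite π'.ker) (hk' : ∃ P, P ≠ 0 ∧ π' P = 0) : ∀ P, π P = 0 → P = 0 := by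
  by_contra! hk
  obtain ⟨P0, hP0, hP0'⟩ := hk
  have ord : ∀ f : G →+ G, (∃ P, P ≠ 0 ∧ f P = 0 ∧ (p ^ e) • P = 0) → ∃ P, P ≠ 0 ∧ f P = 0 ∧ p • P = 0 := by
    rintro f ⟨P, hP, hf, hq⟩
    have : ∀ n : ℕ, p ^ n • P = 0 → ∃ P, P ≠ 0 ∧ f P = 0 ∧ p • P = 0 := by
      intro n
      induction n with
      | zero => intro h; exact absurd (by simpa using h) hP
      | succ n ih =>
        intro h
        by_cases hn : p ^ n • P = 0
        · exact ih hn
        · exact ⟨p ^ n • P, hn, by rw [map_nsmul, hf, smul_zero], by rw [← mul_smul, ← pow_succ', h]⟩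
    exact this e hq
  obtain ⟨P1, hP1, hP1', hpP1⟩ := ord π ⟨P0, hP0', hP0, by rw [← h2, hP0, map_zero]⟩
  obtain ⟨P2, hP2, hP2', hpP2⟩ := ord π' (by
    obtain ⟨P, hP, hP'⟩ := hk'
    exact ⟨P, hP, hP', by rw [← h1, hP', map_zero]⟩)
  have ind : ∀ a b : ℤ, a • P1 + b • P2 = 0 → (p : ℤ) ∣ a ∧ (p : ℤ) ∣ b := by
    intro a b hab
    have hR : a • P1 = 0 := by
      have e1 : a • P1 = -(b • P2) := eq_neg_of_add_eq_zero_left hab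
      have k1 : π (a • P1) = 0 := by rw [map_zsmul, hP1', smul_zero]
      have k2 : π' (a • P1) = 0 := by rw [e1, map_neg, map_zsmul, hP2', smul_zero, neg_zero]
      have k3 : τ • (a • P1) = 0 := by rw [← h3, k1, k2, add_zero]
      have k4 : (p : ℤ) • (a • P1) = 0 := by rw [smul_comm, natCast_zsmul, hpP1, smul_zero]
      obtain ⟨u, v, huv⟩ := (Nat.prime_iff_prime_int.1 hp).coprime_iff_not_dvd.2 hτ
      rw [← one_smul ℤ (a • P1), ← huv, add_smul, mul_smul, mul_smul, k3, k4, smul_zero, smul_zero, add_zero]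
    have hR2 : b • P2 = 0 := by rw [hR, zero_add] at hab; exact hab
    have dv : ∀ (P : G), P ≠ 0 → p • P = 0 → ∀ a : ℤ, a • P = 0 → (p : ℤ) ∣ a := by
      intro P hP hpP a ha
      haveI := Fact.mk hp
      rw [← addOrderOf_eq_prime hpP hP]
      exact addOrderOf_dvd_iff_zsmul_eq_zero.2 ha
    exact ⟨dv P1 hP1 hpP1 a hR, dv P2 hP2 hpP2 b hR2⟩
  -- multiplication by `p`
  let m : ℕ → (G →+ G) := fun n => nsmulAddMonoidHom n
  have hm : ∀ n P, m n P = n • P := fun n P => rfl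
  have hcomp : π'.comp π = m (p ^ e) := by
    ext P; rw [hm, ← h2]; rfl
  have hker : Nat.card (m (p ^ e)).ker = Nat.card π'.ker * Nat.card π.ker := by
    rw [← hcomp, card_ker_comp π π' hs]
  have hpos : 0 < Nat.card (m (p ^ e)).ker := by
    rw [hker]; exact Nat.mul_pos Nat.card_pos Nat.card_pos
  have hms : Function.Surjective (m p) := by
    intro Q
    obtain ⟨R, hR⟩ := hs' Q
    obtain ⟨S, rfl⟩ := hs R
    rw [h2] at hR
    obtain ⟨n, rfl⟩ := Nat.exists_eq_succ_of_ne_zero he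
    exact ⟨p ^ n • S, by rw [hm, ← mul_smul, ← pow_succ']; exact hR⟩
  have hmul : ∀ n, Nat.card (m (p ^ n)).ker = Nat.card (m p).ker ^ n := by
    intro n
    induction n with
    | zero =>
      rw [pow_zero, pow_zero, Nat.card_eq_one_iff_unique]
      refine ⟨⟨fun a b => ?_⟩, ⟨0⟩⟩
      have : ∀ a : (m 1).ker, a.1 = 0 := fun a => by
        have h := a.2
        rw [AddMonoidHom.mem_ker, hm, one_smul] at h; exact h
      exact Subtype.ext (by rw [this, this])
    | succ n ih =>
      rw [pow_succ (Nat.card _), ← ih, ← card_ker_comp _ _ hms]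
      congr 2
      ext P
      rw [AddMonoidHom.mem_ker, AddMonoidHom.mem_ker, AddMonoidHom.comp_apply, hm, hm, hm, ← mul_smul, ← pow_succ]
  have hfin : Finite (m p).ker := by
    apply Nat.finite_of_card_ne_zero
    intro h0
    rw [hmul, h0, zero_pow he] at hpos
    exact lt_irrefl _ hpos
  have hp2 : p ^ 2 ≤ Nat.card (m p).ker := by
    let F : Fin p × Fin p → (m p).ker := fun x => ⟨x.1.1 • P1 + x.2.1 • P2, by
      rw [AddMonoidHom.mem_ker, hm, smul_add, smul_comm, hpP1, smul_comm p, hpP2]; simp⟩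
    have hF : Function.Injective F := by
      rintro ⟨a, b⟩ ⟨a', b'⟩ h
      have h : a.1 • P1 + b.1 • P2 = a'.1 • P1 + b'.1 • P2 := congrArg Subtype.val h
      obtain ⟨d1, d2⟩ := ind ((a.1 : ℤ) - a'.1) ((b.1 : ℤ) - b'.1) (by
        rw [sub_smul, sub_smul]
        simp only [natCast_zsmul]
        rw [← sub_eq_zero.2 h]; abel)
      have fin : ∀ a b : Fin p, (p : ℤ) ∣ (a.1 : ℤ) - b.1 → a = b := by
        intro a b hd
        have := Int.eq_zero_of_abs_lt_dvd hd (by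
          have := a.2; have := b.2; rw [abs_lt]; omega)
        exact Fin.ext (by omega)
      rw [fin _ _ d1, fin _ _ d2]
    have := Nat.card_le_card_of_injective F hF
    simpa [sq] using this
  have h4 : (p ^ 2) ^ e ≤ Nat.card π'.ker * Nat.card π.ker := by
    rw [← hker, hmul]; exact Nat.pow_le_pow_left hp2 e
  have h5 : p * (Nat.card π'.ker * Nat.card π.ker) ≤ p ^ e * p ^ e := by
    rw [mul_left_comm]; exact Nat.mul_le_mul hc' hc
  have h6 : p * (p ^ e * p ^ e) ≤ p ^ e * p ^ e := by
    refine le_trans (Nat.mul_le_mul_left p ?_) h5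
    rw [← pow_add, ← two_mul, pow_mul]; exact h4
  have : 0 < p ^ e * p ^ e := by have := hp.pos; positivity
  nlinarith [hp.two_le]

namespace RH
variable {k : Type*} [Field k] [DecidableEq k] [IsAlgClosed k] {W : WeierstrassCurve k} [W.IsElliptic]
  {α : W.toAffine.Point →+ W.toAffine.Point} {A B : Polynomial k} {c : k} {N : ℕ} (h : RH α A B c N)
include h

lemma Ψ₂_eval {P : W.toAffine.Point} (hP : P ≠ 0) : P + P = 0 ↔ (Ψ₂ W).eval (xc P) = 0 := by
  rw [two_smul_eq_zero_iff hP]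
  simp [Ψ₂]

lemma B_ne : B ≠ 0 := by
  rintro rfl
  have := h.cop
  rw [isCoprime_zero_right] at this
  have h1 := natDegree_eq_zero_of_isUnit this
  have h2 := h.degB
  rw [← h.degA, h1] at h2
  exact absurd h2 (by simp)

/-- the kernel injects in a fibre of the fraction -/
lemma ker_inj : ∃ (R : W.toAffine.Point) (x0 : k), (∀ P : α.ker, (A - C x0 * B).eval (xc (R + P.1)) = 0) ∧
    Function.Injective fun P : α.ker => xc (R + P.1) := by
  obtain ⟨Q, hQ⟩ := exists_not_two_tors (W := W)
  have hQ0 : Q ≠ 0 := by rintro rfl; simp at hQ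
  obtain ⟨R, rfl⟩ := h.surj Q
  have ha : ∀ P : α.ker, α (R + P.1) = α R := fun P => by rw [map_add, P.2, add_zero]
  have hn : ∀ P : α.ker, R + P.1 ≠ 0 := fun P h0 => hQ0 (by rw [← ha P, h0, map_zero])
  refine ⟨R, xc (α R), fun P => ?_, fun P P' e => ?_⟩
  · rw [h.root_iff (hn P), ha]; exact ⟨hQ0, rfl⟩
  · rcases (xc_eq_iff (hn P) (hn P')).1 e with e | e
    · exact Subtype.ext (add_left_cancel e)
    · have := congrArg α e
      rw [map_neg, ha, ha] at this
      exact absurd (by nth_rw 1 [this]; simp) hQ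

lemma ker_fin : Finite α.ker ∧ Nat.card α.ker ≤ N := by
  obtain ⟨R, x0, h1, h2⟩ := h.ker_inj
  obtain ⟨hm, hd⟩ := h.degSub x0
  let F : α.ker → (A - C x0 * B).roots.toFinset := fun P => ⟨xc (R + P.1), by
    rw [Multiset.mem_toFinset, mem_roots hm.ne_zero]; exact h1 P⟩
  have hF : Function.Injective F := fun P P' e => h2 (congrArg Subtype.val e)
  refine ⟨Finite.of_injective F hF, (Nat.card_le_card_of_injective F hF).trans ?_⟩
  rw [Nat.card_eq_fintype_card, Fintype.card_coe, ← hd]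
  exact (Multiset.toFinset_card_le _).trans (card_roots' _)

variable {p : ℕ} [hp : Fact p.Prime] [CharP k p]

lemma ker_insep (hc : c = 0) : p * Nat.card α.ker ≤ N := by
  have hΨ : Ψ₂ W ≠ 0 := by
    intro h0
    obtain ⟨Q, hQ⟩ := exists_not_two_tors (W := W)
    have hQ0 : Q ≠ 0 := by rintro rfl; simp at hQ
    exact hQ ((h.Ψ₂_eval hQ0).2 (by rw [h0, eval_zero]))
  have hd := h.der
  rw [hc, zero_pow two_ne_zero, C_0, zero_mul] at hd
  have hd : derivative A * B - A * derivative B = 0 := by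
    rcases mul_eq_zero.1 hd with e | e
    · exact pow_eq_zero_iff two_ne_zero |>.1 e
    · exact absurd e hΨ
  have hB' : derivative B = 0 := by
    by_contra hne
    have hdv : B ∣ derivative B := by
      have : B ∣ A * derivative B := ⟨derivative A, by rw [← sub_eq_zero.1 hd, mul_comm]⟩
      exact h.cop.symm.dvd_of_dvd_mul_left this
    have h1 := degree_le_of_dvd hdv hne
    exact absurd h1 (not_le.2 (degree_derivative_lt h.B_ne))
  have hA' : derivative A = 0 := by
    rw [hB', mul_zero, sub_zero] at hd
    exact (mul_eq_zero.1 hd).resolve_right h.B_ne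
  obtain ⟨R, x0, h1, h2⟩ := h.ker_inj
  obtain ⟨hm, hdg⟩ := h.degSub x0
  have hD : derivative (A - C x0 * B) = 0 := by
    rw [derivative_sub, derivative_C_mul, hA', hB', mul_zero, sub_zero]
  have hex := expand_contract p hD hp.out.ne_zero
  generalize contract p (A - C x0 * B) = D at hex
  have hD0 : D ≠ 0 := by rintro rfl; rw [map_zero] at hex; exact hm.ne_zero hex.symm
  let F : α.ker → D.roots.toFinset := fun P => ⟨xc (R + P.1) ^ p, by
    rw [Multiset.mem_toFinset, mem_roots hD0]
    have := h1 P
    rwa [← hex, expand_eval] at this⟩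
  have hF : Function.Injective F := fun P P' e => h2 (frobenius_inj k p (congrArg Subtype.val e))
  have h3 := (Nat.card_le_card_of_injective F hF)
  rw [Nat.card_eq_fintype_card (α := D.roots.toFinset), Fintype.card_coe] at h3
  have h4 := h3.trans ((Multiset.toFinset_card_le _).trans (card_roots' _))
  rw [← hdg, ← hex, natDegree_expand, mul_comm]
  exact Nat.mul_le_mul_right _ h4

lemma inj_form {e : ℕ} (hN : N = p ^ e) (hi : ∀ P, α P = 0 → P = 0) :
    ∃ b ξ : k, b ≠ 0 ∧ B = C b ∧ A = X ^ N - C ξ := by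
  obtain ⟨b, hb⟩ : ∃ b, B = C b := by
    have : B.natDegree = 0 := by
      by_contra hne
      obtain ⟨x, hx⟩ := IsAlgClosed.exists_root B (by
        rw [degree_eq_natDegree h.B_ne]; exact_mod_cast hne)
      obtain ⟨P, hP, rfl⟩ := exists_xc (W := W) x
      exact hP (hi P ((h.zero_iff hP).2 hx))
    exact ⟨_, eq_C_of_natDegree_eq_zero this⟩
  have hb0 : b ≠ 0 := by rintro rfl; exact h.B_ne (by rw [hb, C_0])
  have hNpos : N ≠ 0 := by rw [hN]; exact pow_ne_zero _ hp.out.ne_zero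
  obtain ⟨ξ, hξ⟩ := IsAlgClosed.exists_root A (by
    rw [degree_eq_natDegree h.monic.ne_zero, h.degA]; exact_mod_cast hNpos)
  have hall : ∀ r, A.eval r = 0 → r = ξ := by
    have aux : ∀ r, A.eval r = 0 → (A - C 0 * B).eval r = 0 := fun r hr => by simpa using hr
    intro r hr
    obtain ⟨P, hP, rfl⟩ := exists_xc (W := W) r
    obtain ⟨Q, hQ, rfl⟩ := exists_xc (W := W) ξ
    obtain ⟨u1, u2⟩ := (h.root_iff hP 0).1 (aux _ hr)
    obtain ⟨u3, u4⟩ := (h.root_iff hQ 0).1 (aux _ hξ)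
    rcases (xc_eq_iff u1 u3).1 (u2.trans u4.symm) with e | e
    · rw [sub_eq_zero.1 (hi (P - Q) (by rw [map_sub, e, sub_self]))]
    · rw [eq_neg_of_add_eq_zero_left (hi (P + Q) (by rw [map_add, e, neg_add_cancel])), xc_neg]
  refine ⟨b, ξ ^ N, hb0, hb, ?_⟩
  have hs := (IsAlgClosed.splits A).eq_prod_roots_of_monic h.monic
  have hr : A.roots = Multiset.replicate N ξ := by
    rw [Multiset.eq_replicate]
    refine ⟨?_, fun r hr => hall r (isRoot_of_mem_roots hr)⟩
    rw [splits_iff_card_roots.1 (IsAlgClosed.splits A), h.degA]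
  rw [hs, hr, Multiset.map_replicate, Multiset.prod_replicate, hN, sub_pow_char_pow, C_pow]

lemma ker_sep {e : ℕ} (hN : N = p ^ e) (he : e ≠ 0) (hc : c ≠ 0) : ∃ P, P ≠ 0 ∧ α P = 0 := by
  by_contra! hcon
  have hi : ∀ P, α P = 0 → P = 0 := fun P hP => by
    by_contra h0; exact hcon P h0 hP
  obtain ⟨b, ξ, hb, eB, eA⟩ := h.inj_form hN hi
  have hd := h.der
  have : derivative A = 0 := by
    rw [eA, hN, derivative_sub, derivative_C, sub_zero, derivative_X_pow, Nat.cast_pow,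
      CharP.cast_eq_zero, zero_pow he, C_0, zero_mul]
  rw [this, eB, derivative_C, zero_mul, mul_zero, sub_zero, zero_pow two_ne_zero, zero_mul] at hd
  obtain ⟨Q, hQ⟩ := exists_not_two_tors (W := W)
  have hQ0 : Q ≠ 0 := by rintro rfl; simp at hQ
  obtain ⟨R, rfl⟩ := h.surj Q
  have hR : R ≠ 0 := by rintro rfl; simp at hQ0
  have e := h.eq R hR hQ0
  rw [eB, eval_C] at e
  have e2 := congrArg (eval (xc R)) hd
  simp only [eval_zero, Ψh, eval_mul, eval_C, eval_add, eval_pow, ← e, eval_ofNat] at e2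
  rw [Ne, two_smul_eq_zero_iff hQ0] at hQ
  have e3 : c ^ 2 * b ^ 4 * (4 * xc (α R) ^ 3 + W.b₂ * xc (α R) ^ 2 + 2 * W.b₄ * xc (α R) + W.b₆) = 0 := by
    rw [e2]; ring
  exact mul_ne_zero (mul_ne_zero (pow_ne_zero _ hc) (pow_ne_zero _ hb)) hQ e3

end RH

/-- the reduction of the inseparable isogeny is a Frobenius -/
theorem frob_form {k : Type*} [Field k] [DecidableEq k] [IsAlgClosed k] {W : WeierstrassCurve k}
    [W.IsElliptic] {p e : ℕ} [hp : Fact p.Prime] [CharP k p] (he : e ≠ 0)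
    {π π' : W.toAffine.Point →+ W.toAffine.Point} {A B A' B' : Polynomial k} {c' : k}
    (h : RH π A B 0 (p ^ e)) (h' : RH π' A' B' c' (p ^ e)) (hc' : c' ≠ 0)
    (h1 : ∀ P, π (π' P) = (p ^ e) • P) (h2 : ∀ P, π' (π P) = (p ^ e) • P) (τ : ℤ) (hτ : ¬ (p : ℤ) ∣ τ)
    (h3 : ∀ P, π P + π' P = τ • P) :
    (∀ P, π P = 0 → P = 0) ∧ ∃ b ξ : k, b ≠ 0 ∧ B = C b ∧ A = X ^ (p ^ e) - C ξ := by
  have hi := ker_contra hp.out he π π' h1 h2 τ hτ h3 h.surj h'.surj (h.ker_insep rfl) h'.ker_fin.2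
    h.ker_fin.1 h'.ker_fin.1 (h'.ker_sep rfl he hc')
  exact ⟨hi, h.inj_form rfl hi⟩

end WC

set_option linter.unusedSectionVars false
set_option linter.style.haveILetI false
namespace WC
open WeierstrassCurve WeierstrassCurve.Affine Polynomial

/-- from a Frobenius-like endomorphism with enough fixed points to a curve with prescribed count -/
theorem frob_count {k : Type*} [Field k] [DecidableEq k] [IsAlgClosed k] {q : ℕ} (hq1 : 1 < q)
    (φ : k →+* k) (hφ : ∀ x, φ x = x ^ q)
    {W : WeierstrassCurve k} [W.IsElliptic] (π : W.toAffine.Point →+ W.toAffine.Point)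
    (a b : k) (ha : a ≠ 0) (hπ : ∀ P, P ≠ 0 → π P ≠ 0 ∧ xc (π P) = a * xc P ^ q + b)
    {Fq : Type*} [Field Fq] [Fintype Fq] (hFq : Fintype.card Fq = q) (f : Fq →+* k) (τ : ℤ)
    (S1 S2 : Finset W.toAffine.Point) (h1 : ∀ P ∈ S1, π P = P) (h2 : ∀ P ∈ S2, π P = -P)
    (c1 : (q : ℤ) + 1 - τ ≤ S1.card) (c2 : (q : ℤ) + 1 + τ ≤ S2.card) :
    ∃ E : WeierstrassCurve Fq, E.IsElliptic ∧ (Nat.card E.toAffine.Point : ℤ) = q + 1 - τ := by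
  classical
  obtain ⟨E, hE, e, he⟩ := lang hq1 φ hφ π a b ha hπ hFq f
  refine ⟨E, hE, ?_⟩
  have hmap : (E.map f).map φ = E.map f := by
    rw [WeierstrassCurve.map_map]
    have : φ.comp f = f := by
      ext x
      rw [RingHom.comp_apply, hφ, ← map_pow, ← hFq, FiniteField.pow_card]
    rw [this]
  set Fr := emap φ hmap with hFr
  have Fx : ∀ P, xc (Fr P) = xc P ^ q := fun P => by rw [hFr, xc_emap, hφ]
  have Fy : ∀ P, yc (Fr P) = yc P ^ q := fun P => by rw [hFr, yc_emap, hφ]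
  have F0 : ∀ P, P ≠ 0 → Fr P ≠ 0 := fun P hP => mt (emap_eq_zero φ hmap).1 hP
  have comm : ∀ P, π (e P) = e (Fr P) := by
    intro P
    by_cases hP : P = 0
    · rw [hP]; simp
    · exact he P (Fr P) hP (F0 P hP) (Fx P) (Fy P)
  haveI : (E.map f).IsElliptic := inferInstance
  obtain ⟨f1, f2, f3⟩ := card_Spm (W := E.map f) Fr q (fun P hP => ⟨F0 P hP, Fx P⟩)
    (Finset.univ.image f) (fun x => by
      rw [Finset.mem_image]
      constructor
      · rintro ⟨z, -, rfl⟩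
        rw [← map_pow, ← hFq, FiniteField.pow_card]
      · intro hx
        obtain ⟨z, hz⟩ := fix_pow_card f (hFq ▸ hx)
        exact ⟨z, Finset.mem_univ _, hz⟩)
    (by rw [Finset.card_image_of_injective _ f.injective, Finset.card_univ, hFq])
  have g1 : S1.card ≤ Set.ncard {P | Fr P = P} := by
    rw [← Set.ncard_coe_finset]
    refine Set.ncard_le_ncard_of_injOn e.symm ?_ (e.symm.injective.injOn) f1
    intro P hP
    have := comm (e.symm P)
    rw [e.apply_symm_apply, h1 P hP] at this
    exact e.injective (by rw [← this, e.apply_symm_apply])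
  have g2 : S2.card ≤ Set.ncard {P | Fr P = -P} := by
    rw [← Set.ncard_coe_finset]
    refine Set.ncard_le_ncard_of_injOn e.symm ?_ (e.symm.injective.injOn) f2
    intro P hP
    have := comm (e.symm P)
    rw [e.apply_symm_apply, h2 P hP] at this
    exact e.injective (by rw [← this, map_neg, e.apply_symm_apply])
  have hc : Nat.card E.toAffine.Point = Set.ncard {P | Fr P = P} := by
    rw [card_points_finite f E]
    congr 1
    ext P
    simp only [Set.mem_ofPred_eq]
    rw [hFq, ← Fx, ← Fy]
    constructor
    · rintro ⟨u1, u2⟩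
      by_cases hP : P = 0
      · rw [hP, map_zero]
      · exact point_ext (F0 P hP) hP u1 u2
    · intro h; rw [h]; exact ⟨rfl, rfl⟩
  rw [hc]
  omega

namespace Pl
variable {K k Γ : Type*} [Field K] [Field k] [LinearOrderedCommGroupWithZero Γ] (L : Pl K k Γ)

/-- value of a monic integral polynomial at a large element -/
lemma v_monic {A : Polynomial K} (hA : ∀ i, L.v (A.coeff i) ≤ 1) (hm : A.Monic) {x : K} (hx : 1 < L.v x) :
    L.v (A.eval x) = L.v x ^ A.natDegree := by
  have e : A.eval x = x ^ A.natDegree + ∑ i ∈ Finset.range A.natDegree, A.coeff i * x ^ i := by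
    conv_lhs => rw [hm.as_sum]
    simp [eval_finsetSum]
  have hlt : L.v (∑ i ∈ Finset.range A.natDegree, A.coeff i * x ^ i) < L.v (x ^ A.natDegree) := by
    have hpos : 0 < L.v x := zero_lt_one.trans hx
    apply Valuation.map_sum_lt
    · rw [map_pow]; exact pow_ne_zero _ hpos.ne'
    · intro i hi
      rw [map_mul, map_pow, map_pow]
      calc L.v (A.coeff i) * L.v x ^ i ≤ 1 * L.v x ^ i := mul_le_mul_left (hA i) _
        _ = L.v x ^ i := one_mul _
        _ < L.v x ^ A.natDegree := pow_lt_pow_right₀ hx (Finset.mem_range.1 hi)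
  rw [e, Valuation.map_add_eq_of_lt_left _ hlt, map_pow]

lemma v_small {B : Polynomial K} {n : ℕ} (h0 : L.v (B.coeff 0) ≤ 1) (hB : ∀ i, i ≠ 0 → L.v (B.coeff i) < 1)
    (hn : n ≠ 0) (hd : B.natDegree ≤ n) {x : K} (hx : 1 < L.v x) : L.v (B.eval x) < L.v x ^ n := by
  rw [eval_eq_sum_range]
  have hpos : 0 < L.v x := zero_lt_one.trans hx
  apply Valuation.map_sum_lt
  · exact pow_ne_zero _ hpos.ne'
  · intro i hi
    rw [map_mul, map_pow]
    by_cases hi0 : i = 0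
    · subst hi0
      rw [pow_zero, mul_one]
      exact h0.trans_lt (one_lt_pow₀ hx hn)
    · calc L.v (B.coeff i) * L.v x ^ i < 1 * L.v x ^ i :=
            mul_lt_mul_of_pos_right (hB i hi0) (pow_pos hpos i)
        _ = L.v x ^ i := one_mul _
        _ ≤ L.v x ^ n := pow_le_pow_right₀ hx.le (by have := Finset.mem_range.1 hi; omega)

variable [DecidableEq K] [DecidableEq k] [IsAlgClosed K] [IsAlgClosed k]
  {W : WeierstrassCurve K} [W.IsElliptic] (hW : L.Int W) [((L.lift W hW).map L.hom).IsElliptic]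

include hW in
theorem descend {p e : ℕ} [hp : Fact p.Prime] [CharP k p] (he : e ≠ 0)
    {π π' : W.toAffine.Point →+ W.toAffine.Point} {A B A' B' : Polynomial K} {c c' : K}
    (h : RH π A B c (p ^ e)) (h' : RH π' A' B' c' (p ^ e)) (hc : L.v c < 1) (hc' : L.v c' = 1)
    (h1 : ∀ P, π (π' P) = (p ^ e) • P) (h2 : ∀ P, π' (π P) = (p ^ e) • P) (τ : ℤ) (hτ : ¬ (p : ℤ) ∣ τ)
    (h3 : ∀ P, π P + π' P = τ • P)
    (S1 S2 : Finset W.toAffine.Point) (s1 : ∀ P ∈ S1, π P = P) (s2 : ∀ P ∈ S2, π P = -P)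
    (c1 : ((p ^ e : ℕ) : ℤ) + 1 - τ ≤ S1.card) (c2 : ((p ^ e : ℕ) : ℤ) + 1 + τ ≤ S2.card)
    {Fq : Type*} [Field Fq] [Fintype Fq] (hFq : Fintype.card Fq = p ^ e) (f : Fq →+* k) :
    ∃ E : WeierstrassCurve Fq, E.IsElliptic ∧
      (Nat.card E.toAffine.Point : ℤ) = ((p ^ e : ℕ) : ℤ) + 1 - τ := by
  classical
  have hq1 : 1 < p ^ e := Nat.one_lt_pow he hp.out.one_lt
  obtain ⟨A1, B1, β, rA, rB, hβ, hR⟩ := L.RH_red hW h hc.le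
  obtain ⟨A2, B2, β', -, -, hβ', hR'⟩ := L.RH_red hW h' hc'.le
  rw [L.rd_small hc] at hR
  have hc'0 : L.rd c' ≠ 0 := fun h0 => by
    have := (L.rd_eq_zero hc'.le).1 h0
    rw [hc'] at this; exact lt_irrefl _ this
  obtain ⟨hi, b, ξ, hb, eB, eA⟩ := frob_form he hR hR' hc'0
    (fun Q => by obtain ⟨P, rfl⟩ := L.red_surj hW Q; rw [hβ', hβ, h1, map_nsmul])
    (fun Q => by obtain ⟨P, rfl⟩ := L.red_surj hW Q; rw [hβ, hβ', h2, map_nsmul]) τ hτ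
    (fun Q => by obtain ⟨P, rfl⟩ := L.red_surj hW Q; rw [hβ, hβ', ← map_add, h3, map_zsmul])
  have inj0 : ∀ P : W.toAffine.Point, (π P = P ∨ π P = -P) → L.red hW P = 0 → P = 0 := by
    intro P hP hr
    rcases (L.red_eq_zero hW).1 hr with h0 | hx
    · exact h0
    by_contra hP0
    have hπ0 : π P ≠ 0 := by
      rcases hP with e | e <;> rw [e]
      · exact hP0
      · exact neg_ne_zero.2 hP0
    have hxx : xc (π P) = xc P := by
      rcases hP with e | e <;> rw [e]
      exact xc_neg _
    have e1 := h.eq P hP0 hπ0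
    rw [hxx] at e1
    have vA : L.v (A.eval (xc P)) = L.v (xc P) ^ (p ^ e) := by
      rw [← h.degA]
      refine L.v_monic (fun i => ?_) h.monic hx
      rw [← rA, coeff_map]; exact L.ring_v _
    have vB : L.v (B.eval (xc P)) < L.v (xc P) ^ (p ^ e - 1) := by
      refine L.v_small ?_ ?_ (by omega) (by have := h.degB; omega) hx
      · rw [← rB, coeff_map]; exact L.ring_v _
      · intro i hi
        rw [← rB, coeff_map]
        apply (L.rd_eq_zero (L.ring_v _)).1
        have := congrArg (fun p => coeff p i) eB
        simp only [coeff_map, coeff_C, if_neg hi] at this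
        exact this
    have e2 := congrArg L.v e1
    rw [map_mul, vA] at e2
    have hpos : 0 < L.v (xc P) := zero_lt_one.trans hx
    have : L.v (xc P) * L.v (B.eval (xc P)) < L.v (xc P) ^ (p ^ e) := by
      calc _ < L.v (xc P) * L.v (xc P) ^ (p ^ e - 1) := mul_lt_mul_of_pos_left vB hpos
        _ = _ := by rw [← pow_succ']; congr 1; omega
    exact absurd e2 this.ne
  have i1 : Set.InjOn (L.red hW) S1 := by
    intro P hP Q hQ hPQ
    refine sub_eq_zero.1 (inj0 (P - Q) (Or.inl ?_) (by rw [map_sub, hPQ, sub_self]))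
    rw [map_sub, s1 P hP, s1 Q hQ]
  have i2 : Set.InjOn (L.red hW) S2 := by
    intro P hP Q hQ hPQ
    refine sub_eq_zero.1 (inj0 (P - Q) (Or.inr ?_) (by rw [map_sub, hPQ, sub_self]))
    rw [map_sub, s2 P hP, s2 Q hQ]; abel
  refine frob_count (W := L.bar hW) hq1 (iterateFrobenius k p e) (fun x => by rw [iterateFrobenius_def]) β b⁻¹
    (-b⁻¹ * ξ) (inv_ne_zero hb) (fun P hP => ?_) hFq f τ (S1.image (L.red hW)) (S2.image (L.red hW)) ?_ ?_ ?_ ?_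
  · have h0 : β P ≠ 0 := fun h0 => hP (hi P h0)
    refine ⟨h0, ?_⟩
    have := hR.eq P hP h0
    rw [eA, eB] at this
    simp only [eval_C, eval_sub, eval_pow, eval_X] at this
    field_simp
    linear_combination this
  · intro Q hQ
    obtain ⟨P, hP, rfl⟩ := Finset.mem_image.1 hQ
    rw [hβ, s1 P hP]
  · intro Q hQ
    obtain ⟨P, hP, rfl⟩ := Finset.mem_image.1 hQ
    rw [hβ, s2 P hP, map_neg]
  · rwa [Finset.card_image_of_injOn i1]
  · rwa [Finset.card_image_of_injOn i2]

end Pl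
end WC

set_option linter.unusedSectionVars false
set_option linter.style.haveILetI false
namespace WC
open WeierstrassCurve WeierstrassCurve.Affine Polynomial

namespace RH
variable {K : Type*} [Field K] [DecidableEq K] [IsAlgClosed K] {W : WeierstrassCurve K} [W.IsElliptic]
  {α : W.toAffine.Point →+ W.toAffine.Point} {A B : Polynomial K} {c : K} {N : ℕ} (h : RH α A B c N)

include h in
/-- separable endomorphisms: degree is the order of the kernel -/
lemma card_eq (hc : c ≠ 0) : Nat.card α.ker = N := by
  refine le_antisymm h.ker_fin.2 ?_
  haveI := h.ker_fin.1
  obtain ⟨Q, hQ⟩ := exists_not_two_tors (W := W)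
  have hQ0 : Q ≠ 0 := by rintro rfl; simp at hQ
  obtain ⟨R, rfl⟩ := h.surj Q
  set x0 := xc (α R) with hx0
  obtain ⟨hm, hd⟩ := h.degSub x0
  have hsep : (A - C x0 * B).Separable := by
    rw [Polynomial.Separable, Polynomial.isCoprime_iff_aeval_ne_zero_of_isAlgClosed K K]
    intro r
    by_contra! hr
    rw [coe_aeval_eq_eval, derivative_sub, derivative_C_mul] at hr
    simp only [eval_sub, eval_mul, eval_C] at hr
    obtain ⟨r1, r2⟩ := hr
    have hB : B.eval r ≠ 0 := fun hb => h.not_both r ⟨by rw [hb] at r1; simpa using r1, hb⟩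
    have e := congrArg (eval r) h.der
    simp only [eval_sub, eval_mul, eval_C, eval_pow, Ψh, eval_add, eval_ofNat] at e
    rw [sub_eq_zero.1 r1, sub_eq_zero.1 r2] at e
    rw [Ne, two_smul_eq_zero_iff hQ0, ← hx0] at hQ
    refine mul_ne_zero (mul_ne_zero (pow_ne_zero 2 hc) (pow_ne_zero 4 hB)) hQ ?_
    linear_combination - e
  have hcard : (A - C x0 * B).roots.toFinset.card = N := by
    rw [Multiset.toFinset_card_of_nodup (nodup_roots hsep), splits_iff_card_roots.1 (IsAlgClosed.splits _), hd]
  rw [← hcard, ← Set.ncard_coe_finset, ← Nat.card_coe_set_eq]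
  have hsur : ∀ r : ((A - C x0 * B).roots.toFinset : Set K), ∃ P : α.ker, xc (R + P.1) = r.1 := by
    rintro ⟨r, hr⟩
    rw [Finset.mem_coe, Multiset.mem_toFinset] at hr
    have hr := isRoot_of_mem_roots hr
    obtain ⟨P, hP, rfl⟩ := exists_xc (W := W) r
    obtain ⟨h1, h2⟩ := (h.root_iff hP x0).1 hr
    rcases (xc_eq_iff h1 hQ0).1 h2 with e | e
    · exact ⟨⟨P - R, by rw [AddMonoidHom.mem_ker, map_sub, e, sub_self]⟩, by simp⟩
    · exact ⟨⟨-P - R, by rw [AddMonoidHom.mem_ker, map_sub, map_neg, e, neg_neg, sub_self]⟩, by simp [xc_neg]⟩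
  choose F hF using hsur
  exact Nat.card_le_card_of_injective F fun r r' e => Subtype.ext (by rw [← hF r, ← hF r', e])

end RH

section vc
variable {K : Type*} [Field K] [DecidableEq K] {W : WeierstrassCurve K} [W.IsElliptic]

/-- conjugating an endomorphism by a variable change -/
noncomputable def conj (V : VariableChange K) (α : W.toAffine.Point →+ W.toAffine.Point) :
    (V • W).toAffine.Point →+ (V • W).toAffine.Point :=
  (vcEquiv V).symm.toAddMonoidHom.comp (α.comp (vcHom V))

lemma vcHom_conj (V : VariableChange K) (α : W.toAffine.Point →+ W.toAffine.Point)
    (P : (V • W).toAffine.Point) : vcHom V (conj V α P) = α (vcHom V P) :=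
  (vcEquiv V).apply_symm_apply _

lemma vc_inj (V : VariableChange K) {P Q : (V • W).toAffine.Point} (h : vcHom V P = vcHom V Q) : P = Q :=
  (vcHom_bijective V).1 h

theorem RH.vc {α : W.toAffine.Point →+ W.toAffine.Point} {A B : Polynomial K} {c : K} {N : ℕ}
    (h : RH α A B c N) (V : VariableChange K) :
    ∃ A' B' : Polynomial K, RH (conj V α) A' B' c N := by
  obtain ⟨u, hu⟩ : ∃ u : K, u = (V.u : K) := ⟨_, rfl⟩
  have hu0 : u ≠ 0 := by rw [hu]; exact V.u.ne_zero
  obtain ⟨l, hl⟩ : ∃ l : Polynomial K, l = C (u ^ 2) * X + C V.r := ⟨_, rfl⟩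
  have hu2 : u ^ 2 ≠ 0 := pow_ne_zero 2 hu0
  have hld : l.natDegree = 1 := by rw [hl]; exact natDegree_linear hu2
  have hll : l.leadingCoeff = u ^ 2 := by rw [hl]; exact leadingCoeff_linear hu2
  have hl' : derivative l = C (u ^ 2) := by
    rw [hl, derivative_add, derivative_C_mul, derivative_X, derivative_C, mul_one, add_zero]
  obtain ⟨w, hw⟩ : ∃ w : K, w = ((u ^ 2) ^ N)⁻¹ := ⟨_, rfl⟩
  have hw0 : w ≠ 0 := by rw [hw]; exact inv_ne_zero (pow_ne_zero _ hu2)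
  have hN : N ≠ 0 := fun h0 => by have := h.degB; omega
  have hlx : ∀ x, l.eval x = u ^ 2 * x + V.r := fun x => by rw [hl]; simp
  have hlt : (C V.r * B).degree < A.degree := by
    rw [degree_eq_natDegree h.monic.ne_zero, h.degA]
    by_cases hb : C V.r * B = 0
    · rw [hb, degree_zero]; exact WithBot.bot_lt_coe _
    rw [degree_eq_natDegree hb]
    exact_mod_cast (natDegree_C_mul_le _ B).trans_lt h.degB
  obtain ⟨hm1, hd1⟩ := h.degSub V.r
  have evA : ∀ x, (C w * (A - C V.r * B).comp l).eval x =
      w * (A.eval (u ^ 2 * x + V.r) - V.r * B.eval (u ^ 2 * x + V.r)) := fun x => by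
    rw [eval_mul, eval_comp, hlx]; simp
  have evB : ∀ x, (C (w * u ^ 2) * B.comp l).eval x = w * u ^ 2 * B.eval (u ^ 2 * x + V.r) := fun x => by
    rw [eval_mul, eval_comp, hlx, eval_C]
  refine ⟨C w * (A - C V.r * B).comp l, C (w * u ^ 2) * B.comp l, ?_, ?_, ?_, ?_, ?_, ?_, ?_, ?_⟩
  · have c1 : IsCoprime (A - C V.r * B) B := by
      have := h.cop.add_mul_right_left (-C V.r)
      rwa [neg_mul, ← sub_eq_add_neg] at this
    have c2 : IsCoprime ((A - C V.r * B).comp l) (B.comp l) := c1.map (compRingHom l)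
    refine (isCoprime_mul_unit_left_left (isUnit_C.2 hw0.isUnit) _ _).2
      ((isCoprime_mul_unit_left_right (isUnit_C.2 (mul_ne_zero hw0 hu2).isUnit) _ _).2 c2)
  · rw [Monic, leadingCoeff_mul, leadingCoeff_C, leadingCoeff_comp (by rw [hld]; exact one_ne_zero),
      hm1.leadingCoeff, hll, hd1, one_mul, hw, inv_mul_cancel₀ (pow_ne_zero _ hu2)]
  · rw [natDegree_C_mul hw0, natDegree_comp, hd1, hld, mul_one]
  · rw [natDegree_C_mul (mul_ne_zero hw0 hu2), natDegree_comp, hld, mul_one]; exact h.degB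
  · intro P hP hP'
    have e1 := h.eq (vcHom V P) (vcHom_ne_zero V hP) (by rw [← vcHom_conj]; exact vcHom_ne_zero V hP')
    rw [← vcHom_conj, xc_vcHom V hP, xc_vcHom V hP', ← hu] at e1
    rw [evA, evB, ← e1]
    ring
  · intro P hP hP'
    have e1 := h.zero (vcHom V P) (vcHom_ne_zero V hP) (by rw [← vcHom_conj, hP', map_zero])
    rw [xc_vcHom V hP, ← hu] at e1
    rw [evB, e1, mul_zero]
  · have hd := congrArg (fun p => comp p l) h.der
    simp only [Ψ₂, Ψh, mul_comp, sub_comp, pow_comp, add_comp, C_comp, X_comp, ofNat_comp] at hd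
    have b2 : W.b₂ = u ^ 2 * (V • W).b₂ - 12 * V.r := by
      rw [variableChange_b₂, hu]; simp only [Units.val_inv_eq_inv_val]; field_simp; ring
    have b4 : W.b₄ = u ^ 4 * (V • W).b₄ - V.r * W.b₂ - 6 * V.r ^ 2 := by
      rw [variableChange_b₄, hu]; simp only [Units.val_inv_eq_inv_val]; field_simp; ring
    have b6 : W.b₆ = u ^ 6 * (V • W).b₆ - 2 * V.r * W.b₄ - V.r ^ 2 * W.b₂ - 4 * V.r ^ 3 := by
      rw [variableChange_b₆, hu]; simp only [Units.val_inv_eq_inv_val]; field_simp; ring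
    rw [b6, b4, b2] at hd
    simp only [derivative_mul, derivative_C, zero_mul, zero_add, derivative_comp, hl', Ψ₂, Ψh,
      derivative_sub, sub_comp, mul_comp, C_comp]
    generalize A.comp l = a at *
    generalize B.comp l = b at *
    generalize (derivative A).comp l = a' at *
    generalize (derivative B).comp l = b' at *
    rw [hl] at hd
    simp only [C_sub, C_mul, C_pow, C_ofNat] at hd ⊢
    have h6 : (C u : Polynomial K) ^ 6 ≠ 0 := pow_ne_zero _ (C_ne_zero.2 hu0)
    apply mul_left_cancel₀ h6
    linear_combination (C w) ^ 4 * (C u) ^ 8 * hd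
  · intro Q
    obtain ⟨R, hR⟩ := h.surj (vcHom V Q)
    obtain ⟨P, rfl⟩ := (vcHom_bijective V).2 R
    exact ⟨P, vc_inj V (by rw [vcHom_conj, hR])⟩

lemma conj_conj (V : VariableChange K) (α β γ : W.toAffine.Point →+ W.toAffine.Point)
    (h : ∀ P, α (β P) = γ P) (P : (V • W).toAffine.Point) : conj V α (conj V β P) = conj V γ P :=
  vc_inj V (by rw [vcHom_conj, vcHom_conj, vcHom_conj, h])

end vc

namespace Pl
variable {K k Γ : Type*} [Field K] [Field k] [LinearOrderedCommGroupWithZero Γ] (L : Pl K k Γ)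
  [DecidableEq K] [DecidableEq k] [IsAlgClosed K] [IsAlgClosed k]

lemma root_lift (A : Polynomial L.ring) (hm : A.Monic) (z : k) (hz : (A.map L.hom).eval z = 0) :
    ∃ r, L.v r ≤ 1 ∧ L.rd r = z ∧ (A.map L.ring.subtype).eval r = 0 := by
  obtain ⟨x, hx, rfl⟩ := L.surj z
  obtain ⟨a1, a2⟩ := L.eval_int A hx
  rw [hz] at a2
  have hs := (L.rd_eq_zero a1).1 a2
  have hm' : (A.map L.ring.subtype).Monic := hm.map _
  have hroot : ∀ r, (A.map L.ring.subtype).eval r = 0 → L.v r ≤ 1 := by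
    intro r hr
    by_contra! hlt
    have := L.v_monic (fun i => by rw [coeff_map]; exact L.ring_v _) hm' hlt
    rw [hr, map_zero] at this
    exact pow_ne_zero _ (zero_lt_one.trans hlt).ne' this.symm
  obtain ⟨r, hr, hrv⟩ : ∃ r, (A.map L.ring.subtype).eval r = 0 ∧ L.v (x - r) < 1 := by
    by_contra! hcon
    have hsp := (IsAlgClosed.splits (A.map L.ring.subtype)).eq_prod_roots_of_monic hm'
    rw [hsp, eval_multiset_prod, Multiset.map_map, map_multiset_prod, Multiset.map_map] at hs
    refine absurd hs (not_lt.2 (Multiset.one_le_prod ?_))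
    intro z hz
    obtain ⟨r, hr, rfl⟩ := Multiset.mem_map.1 hz
    simpa using hcon r (isRoot_of_mem_roots hr)
  exact ⟨r, hroot r hr, ((L.rd_eq_iff hx (hroot r hr)).2 hrv).symm, hr⟩

/-- generic curve with free first coefficient -/
noncomputable def gW {R : Type*} [CommRing R] (a₂ a₃ a₄ a₆ : R) : WeierstrassCurve (Polynomial R) :=
  ⟨X, C a₂, C a₃, C a₄, C a₆⟩

lemma gW_monic {R : Type*} [CommRing R] [Nontrivial R] (a₂ a₃ a₄ a₆ j : R) :
    ((gW a₂ a₃ a₄ a₆).c₄ ^ 3 - C j * (gW a₂ a₃ a₄ a₆).Δ).Monic := by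
  have e1 : (gW a₂ a₃ a₄ a₆).c₄ = X ^ 4 + C (8 * a₂) * X ^ 2 + C (-24 * a₃) * X + C (16 * a₂ ^ 2 - 48 * a₄) := by
    simp only [c₄, b₂, b₄, gW, C_mul, C_sub, C_pow, C_neg, C_ofNat]; ring
  have m1 : ((gW a₂ a₃ a₄ a₆).c₄).Monic := by rw [e1]; monicity!
  have d1 : ((gW a₂ a₃ a₄ a₆).c₄).natDegree = 4 := by rw [e1]; compute_degree!
  have d2 : (C j * (gW a₂ a₃ a₄ a₆).Δ).natDegree ≤ 11 := by
    refine (natDegree_C_mul_le _ _).trans ?_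
    simp only [WeierstrassCurve.Δ, b₂, b₄, b₆, b₈, gW]
    compute_degree!
  apply (m1.pow 3).sub_of_left
  apply degree_lt_degree
  rw [m1.natDegree_pow, d1]; omega

lemma gspec {R S : Type*} [CommRing R] [CommRing S] (G : WeierstrassCurve (Polynomial R)) (j : R)
    (f : R →+* S) (s : S) : eval s ((G.c₄ ^ 3 - C j * G.Δ).map f) =
        (G.map (eval₂RingHom f s)).c₄ ^ 3 - f j * (G.map (eval₂RingHom f s)).Δ := by
  rw [eval_map, ← coe_eval₂RingHom, map_sub, map_mul, map_pow, map_c₄, map_Δ, coe_eval₂RingHom, eval₂_C]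

/-- good model with prescribed integral `j` -/
theorem good_model {j : K} (hj : L.v j ≤ 1) : ∃ W : WeierstrassCurve K, ∃ _ : W.IsElliptic, ∃ hW : L.Int W,
    ((L.lift W hW).map L.hom).IsElliptic ∧ W.j = j := by
  obtain ⟨E, hE⟩ : ∃ E : WeierstrassCurve k, E = ofJ (L.rd j) := ⟨_, rfl⟩
  haveI hEll : E.IsElliptic := by rw [hE]; infer_instance
  have hEj : E.c₄ ^ 3 = L.rd j * E.Δ := by
    have : E.j = L.rd j := by subst hE; exact ofJ_j _
    rw [← this, WeierstrassCurve.j, ← coe_Δ']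
    have := E.Δ'.ne_zero
    simp only [Units.val_inv_eq_inv_val]
    field_simp
  obtain ⟨a₂, h₂, e₂⟩ := L.surj E.a₂
  obtain ⟨a₃, h₃, e₃⟩ := L.surj E.a₃
  obtain ⟨a₄, h₄, e₄⟩ := L.surj E.a₄
  obtain ⟨a₆, h₆, e₆⟩ := L.surj E.a₆
  set G := gW (⟨a₂, h₂⟩ : L.ring) ⟨a₃, h₃⟩ ⟨a₄, h₄⟩ ⟨a₆, h₆⟩ with hG
  have hk : G.map (eval₂RingHom L.hom E.a₁) = E := by
    rw [hG, gW, WeierstrassCurve.map]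
    ext
    · simp
    · exact (eval₂_C _ _).trans e₂
    · exact (eval₂_C _ _).trans e₃
    · exact (eval₂_C _ _).trans e₄
    · exact (eval₂_C _ _).trans e₆
  obtain ⟨r, hr, hrd, hr0⟩ := L.root_lift (G.c₄ ^ 3 - C (⟨j, hj⟩ : L.ring) * G.Δ)
    (gW_monic _ _ _ _ _) E.a₁ (by rw [gspec, hk, hEj]; exact sub_self _)
  rw [gspec] at hr0
  set W := G.map (eval₂RingHom L.ring.subtype r) with hWdef
  have hWe : W = ⟨r, a₂, a₃, a₄, a₆⟩ := by
    rw [hWdef, hG, gW, WeierstrassCurve.map]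
    ext <;> simp
  have hr0 : W.c₄ ^ 3 = j * W.Δ := sub_eq_zero.1 hr0
  clear_value W
  subst hWe
  have hW : L.Int ⟨r, a₂, a₃, a₄, a₆⟩ := ⟨hr, h₂, h₃, h₄, h₆⟩
  have hbar : (L.lift _ hW).map L.hom = E := by
    ext
    · exact hrd
    · exact e₂
    · exact e₃
    · exact e₄
    · exact e₆
  have hΔ0 : (⟨r, a₂, a₃, a₄, a₆⟩ : WeierstrassCurve K).Δ ≠ 0 := by
    intro h0
    have h1 : (L.lift _ hW).Δ = 0 := by
      have := congrArg WeierstrassCurve.Δ (L.lift_map hW)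
      rw [map_Δ, h0] at this
      exact Subtype.ext this
    have h2 := congrArg L.hom h1
    rw [← map_Δ, hbar, map_zero] at h2
    exact E.isUnit_Δ.ne_zero h2
  have hell : (⟨r, a₂, a₃, a₄, a₆⟩ : WeierstrassCurve K).IsElliptic := ⟨hΔ0.isUnit⟩
  refine ⟨_, hell, hW, by rw [hbar]; exact hEll, ?_⟩
  rw [WeierstrassCurve.j, Units.inv_mul_eq_iff_eq_mul, coe_Δ', hr0, mul_comm]

lemma tW_j {κ : K} (hκ : L.v κ < 1) (hκ0 : κ ≠ 0) : ∃ _ : (tW κ).IsElliptic, (tW κ).j = κ⁻¹ + 1728 := by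
  have h1 : (1 : K) + 1728 * κ ≠ 0 := by
    intro h0
    have h2 := L.mul_lt_one hκ (L.v_ofNat 1728)
    have h3 : (1 : K) = -(κ * 1728) := by linear_combination h0
    have := congrArg L.v h3
    rw [map_one, Valuation.map_neg] at this
    rw [← this] at h2; exact lt_irrefl _ h2
  have hΔ : (tW κ).Δ = κ * (1 + 1728 * κ) ^ 2 := by
    simp only [WeierstrassCurve.Δ, b₂, b₄, b₆, b₈, tW]; ring
  have hc : (tW κ).c₄ = 1 + 1728 * κ := by
    simp only [c₄, b₂, b₄, tW]; ring
  have he : (tW κ).IsElliptic := ⟨by rw [hΔ]; exact (mul_ne_zero hκ0 (pow_ne_zero 2 h1)).isUnit⟩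
  refine ⟨he, ?_⟩
  rw [WeierstrassCurve.j, Units.inv_mul_eq_iff_eq_mul, coe_Δ', hc, hΔ]
  field_simp

/-- a curve with complex multiplication has integral `j` -/
theorem j_int {W : WeierstrassCurve K} [W.IsElliptic] {α : W.toAffine.Point →+ W.toAffine.Point}
    {A B : Polynomial K} {c : K} {N : ℕ} (h : RH α A B c N)
    (M : ℤ) (hM : ∀ P, α (α (α (α P))) = M • P) (hM0 : M ≠ 0) (hM4 : ∀ m : ℕ, m ^ 4 ≠ M.natAbs) :
    L.v W.j ≤ 1 := by
  by_contra! hj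
  have hv : L.v (W.j - 1728) = L.v W.j :=
    Valuation.map_sub_eq_of_lt_left _ ((L.v_ofNat 1728).trans_lt hj)
  have h0 : W.j - 1728 ≠ 0 := fun h0 => by
    rw [h0, map_zero] at hv; rw [← hv] at hj; exact absurd hj (by simp)
  have hκ : L.v (W.j - 1728)⁻¹ < 1 := by
    rw [map_inv₀, hv]; exact inv_lt_one_of_one_lt₀ hj
  obtain ⟨he, hjj⟩ := L.tW_j hκ (inv_ne_zero h0)
  obtain ⟨V, hV⟩ := exists_variableChange_of_j_eq W (tW (W.j - 1728)⁻¹) (by rw [hjj, inv_inv]; ring)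
  obtain ⟨A', B', h'⟩ := h.vc V
  have hM' : ∀ P, conj V α (conj V α (conj V α (conj V α P))) = M • P := by
    intro P
    apply vc_inj V
    rw [vcHom_conj, vcHom_conj, vcHom_conj, vcHom_conj, hM, map_zsmul]
  generalize conj V α = α' at h' hM'
  revert α'
  rw [hV]
  intro α' h' hM'
  exact L.no_mult_red hκ (inv_ne_zero h0) α' h'.monic.ne_zero h'.B_ne h'.eq h'.zero M hM' hM0 hM4

end Pl
end WC

set_option linter.unusedSectionVars false
set_option linter.style.haveILetI false
namespace WC
open WeierstrassCurve WeierstrassCurve.Affine Polynomial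

lemma exists_vsub {K : Type*} [Field K] [CharZero K] (p : ℕ) (hp : p.Prime) :
    ∃ B : ValuationSubring K, (p : K) ∈ B.nonunits := by
  let A : Subring K := (Int.castRingHom K).range
  let I : Ideal A := Ideal.span {(p : A)}
  have hI : I ≠ ⊤ := by
    intro h
    rw [Ideal.eq_top_iff_one, Ideal.mem_span_singleton] at h
    obtain ⟨⟨c, n, rfl⟩, hc⟩ := h
    have h1 := congrArg (fun x : A => (x : K)) hc
    simp only [Subring.coe_one, Subring.coe_mul, Subring.coe_natCast, eq_intCast] at h1
    have h2 : (1 : ℤ) = p * n := by exact_mod_cast h1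
    have h3 : (p : ℤ) ∣ 1 := ⟨n, h2⟩
    exact hp.one_lt.ne' (by exact_mod_cast Int.eq_one_of_dvd_one (by positivity) h3)
  obtain ⟨B, -, h2⟩ := Ideal.image_subset_nonunits_valuationSubring I hI
  exact ⟨B, h2 ⟨(p : A), Ideal.subset_span rfl, by simp⟩⟩

theorem exists_place {K : Type} [Field K] [CharZero K] [IsAlgClosed K] (p : ℕ) [hp : Fact p.Prime] :
    ∃ (k Γ : Type) (_ : Field k) (_ : LinearOrderedCommGroupWithZero Γ) (_ : IsAlgClosed k) (_ : CharP k p),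
      Nonempty (Pl K k Γ) := by
  classical
  obtain ⟨B, hB⟩ := exists_vsub (K := K) p hp.out
  let k := IsLocalRing.ResidueField B
  let r : B →+* k := IsLocalRing.residue B
  have hr0 : ∀ x : B, r x = 0 ↔ B.valuation x < 1 := fun x => by
    rw [IsLocalRing.residue_eq_zero_iff, ValuationSubring.valuation_lt_one_iff]
  have hmem : ∀ {x : K}, B.valuation x ≤ 1 → x ∈ B := fun h => (B.valuation_le_one_iff _).1 h
  let L : Pl K k B.ValueGroup :=
    { v := B.valuation
      rd := fun x => if h : x ∈ B then r ⟨x, h⟩ else 0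
      rd_add := fun {x y} hx hy => by
        rw [dif_pos (hmem hx), dif_pos (hmem hy), dif_pos (B.add_mem _ _ (hmem hx) (hmem hy)), ← map_add]; rfl
      rd_mul := fun {x y} hx hy => by
        rw [dif_pos (hmem hx), dif_pos (hmem hy), dif_pos (B.mul_mem _ _ (hmem hx) (hmem hy)), ← map_mul]; rfl
      rd_one := by rw [dif_pos (B.one_mem)]; exact map_one r
      rd_eq_zero := fun {x} hx => by rw [dif_pos (hmem hx)]; exact hr0 _
      surj := fun z => by
        obtain ⟨x, rfl⟩ := IsLocalRing.residue_surjective z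
        exact ⟨x, (B.valuation_le_one_iff _).2 x.2, by rw [dif_pos x.2]⟩ }
  have hA : IsAlgClosed k := by
    refine IsAlgClosed.of_exists_root k fun f hf _ => ?_
    obtain ⟨g, hg, -, hgm⟩ := lifts_and_natDegree_eq_and_monic (f := L.hom) (p := f) (by
      rw [lifts_iff_coeff_lifts]
      intro n
      obtain ⟨x, hx, h⟩ := L.surj (f.coeff n)
      exact ⟨⟨x, hx⟩, h⟩) hf
    have hd : (g.map L.ring.subtype).degree ≠ 0 := by
      rw [Polynomial.degree_map_eq_of_injective L.ring.subtype_injective]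
      rw [← hgm.degree_map L.hom, hg]
      rename_i hirr
      exact hirr.degree_pos.ne'
    obtain ⟨x, hx⟩ := IsAlgClosed.exists_root _ hd
    have hx' : L.v x ≤ 1 := by
      by_contra! hlt
      have := L.v_monic (fun i => by rw [coeff_map]; exact L.ring_v _) (hgm.map L.ring.subtype) hlt
      rw [hx.eq_zero, map_zero] at this
      exact pow_ne_zero _ (zero_lt_one.trans hlt).ne' this.symm
    refine ⟨L.rd x, ?_⟩
    have := (L.eval_int g hx').2
    rw [hx.eq_zero, hg] at this
    rw [← this]; exact L.rd_zero
  have hc : CharP k p := by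
    have h0 : (p : k) = 0 := by
      rw [← L.rd_natCast, L.rd_eq_zero (L.v_natCast p)]
      exact hB
    obtain ⟨c, hc⟩ := CharP.exists k
    have := (CharP.cast_eq_zero_iff k c p).1 h0
    rcases (Nat.dvd_prime hp.out).1 this with h | h
    · exact absurd h (CharP.char_ne_one k c)
    · rwa [← h]
  exact ⟨k, _, inferInstance, inferInstance, hA, hc, ⟨L⟩⟩

end WC

set_option linter.unusedSectionVars false
set_option linter.style.haveILetI false
namespace WC
open WeierstrassCurve WeierstrassCurve.Affine Polynomial

/-- membership in `ℤ + ℤ ω` -/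
def InL (ω z : ℂ) : Prop := ∃ m n : ℤ, z = m + n * ω

open scoped Classical in
/-- analytic uniformisation of an elliptic curve by `ℂ / (ℤ + ℤ ω)` -/
structure Unif (ω : ℂ) (W : WeierstrassCurve ℂ) (Φ : ℂ →+ W.toAffine.Point) : Prop where
  surj : Function.Surjective Φ
  ker : ∀ z, Φ z = 0 ↔ InL ω z
  endo : ∀ α : ℂ, α ≠ 0 → (∀ z, InL ω z → InL ω (α * z)) →
    ∃ e : W.toAffine.Point →+ W.toAffine.Point, (∀ z, e (Φ z) = Φ (α * z)) ∧ ∃ A B N, RH e A B α N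

section
variable {ω : ℂ} {τ q : ℤ} (hω : ω ^ 2 = τ * ω - q) (him : ω.im ≠ 0)
include hω him

omit hω in
lemma InL_unique {x y : ℤ} (h : (x : ℂ) + y * ω = 0) : x = 0 ∧ y = 0 := by
  have h1 := congrArg Complex.im h
  simp at h1
  rcases h1 with h1 | h1
  · subst h1; simpa using h
  · exact absurd h1 him

lemma disc_neg : τ ^ 2 < 4 * q := by
  have h1 := congrArg Complex.im hω
  have h2 := congrArg Complex.re hω
  simp [sq] at h1 h2
  have h3 : (τ : ℝ) = 2 * ω.re := by
    apply mul_right_cancel₀ him; linarith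
  have : (τ : ℝ) ^ 2 < 4 * q := by
    have : 0 < ω.im ^ 2 := by positivity
    rw [h3] at h2 ⊢; nlinarith
  exact_mod_cast this

lemma InL_mul {x y : ℂ} (hx : InL ω x) (hy : InL ω y) : InL ω (x * y) := by
  obtain ⟨a, b, rfl⟩ := hx
  obtain ⟨c, d, rfl⟩ := hy
  refine ⟨a * c - b * d * q, a * d + b * c + b * d * τ, ?_⟩
  push_cast
  linear_combination (b * d : ℂ) * hω

open scoped Classical in
lemma kill {W : WeierstrassCurve ℂ} {Φ : ℂ →+ W.toAffine.Point} (hU : Unif ω W Φ)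
    (r s : ℤ) (hs : s ^ 2 = 1) (n : ℕ) (hn : (n : ℤ) = r ^ 2 + r * s * τ + q) :
    ∃ S : Finset W.toAffine.Point, S.card = n ∧ ∀ z, Φ z ∈ S ↔ Φ ((r + s * ω) * z) = 0 := by
  have hdisc := disc_neg hω him
  have hn0 : 0 < n := by
    have : (0 : ℤ) < n := by rw [hn]; nlinarith [sq_nonneg (2 * r + s * τ)]
    exact_mod_cast this
  have hsC : (s : ℂ) ^ 2 = 1 := by exact_mod_cast hs
  have hs0 : s ≠ 0 := by rintro rfl; simp at hs
  have hnC : (n : ℂ) = r ^ 2 + r * s * τ + q := by exact_mod_cast hn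
  set β : ℂ := r + s * ω with hβ
  have hβ0 : β ≠ 0 := fun h => hs0 (InL_unique him h).2
  have hnorm : β * (r + s * τ - s * ω) = n := by
    rw [hβ, hnC]; linear_combination -hω * s ^ 2 + q * hsC
  have hnt : ∀ x y : ℤ, Φ (x + y * ω) = 0 := fun x y => (hU.ker _).2 ⟨x, y, rfl⟩
  refine ⟨(Finset.range n).image (fun a : ℕ => Φ ((a : ℂ) / β)), ?_, ?_⟩
  · rw [Finset.card_image_of_injOn, Finset.card_range]
    intro a ha b hb hab
    have hab' : Φ ((a : ℂ) / β - b / β) = 0 := by rw [map_sub]; exact sub_eq_zero.2 hab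
    obtain ⟨x, y, hxy⟩ := (hU.ker _).1 hab'
    have h1 : (a : ℂ) - b = β * (x + y * ω) := by rw [← hxy]; field_simp
    have h2 : ((r * x - s * y * q - (a - b) : ℤ) : ℂ) + ((r * y + s * x + s * y * τ : ℤ) : ℂ) * ω = 0 := by
      push_cast
      rw [hβ] at h1
      linear_combination h1 * (-1 : ℂ) - (s * y : ℂ) * hω
    obtain ⟨h3, h4⟩ := InL_unique him h2
    have h5 : (a : ℤ) - b = n * (-s * y) := by
      rw [hn]; linear_combination -h3 + r * s * h4 - (r * x) * hs
    have h6 : ((a : ℤ) : ZMod n) = ((b : ℤ) : ZMod n) := by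
      rw [← sub_eq_zero, ← Int.cast_sub, h5]; simp
    simp only [Int.cast_natCast] at h6
    rw [ZMod.natCast_eq_natCast_iff'] at h6
    rwa [Nat.mod_eq_of_lt (Finset.mem_range.1 ha), Nat.mod_eq_of_lt (Finset.mem_range.1 hb)] at h6
  · intro z
    simp only [Finset.mem_image, Finset.mem_range]
    constructor
    · rintro ⟨a, -, ha⟩
      have : Φ (z - a / β) = 0 := by rw [map_sub, ha, sub_self]
      obtain ⟨x, y, hxy⟩ := (hU.ker _).1 this
      obtain rfl : z = x + y * ω + a / β := by rw [← hxy]; ring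
      rw [hU.ker]
      refine ⟨r * x - s * y * q + a, r * y + s * x + s * y * τ, ?_⟩
      have : β * (x + y * ω + a / β) = β * (x + y * ω) + a := by field_simp
      rw [this, hβ]; push_cast
      linear_combination (s * y : ℂ) * hω
    · intro h
      obtain ⟨x, y, hxy⟩ := (hU.ker _).1 h
      let m : ℤ := x - y * s * r
      have hz : z = m / β + ((y * s : ℤ) + (0 : ℤ) * ω) := by
        field_simp
        rw [mul_comm z, hxy, hβ]; push_cast [m]; linear_combination -(y * ω : ℂ) * hsC
      have hm : (m : ℂ) / β = ((m % n).toNat : ℕ) / β + ((m / n * (r + s * τ) : ℤ) + (-(m / n) * s : ℤ) * ω) := by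
        have e1 : (((m % n).toNat : ℕ) : ℤ) = m % n := Int.toNat_of_nonneg (Int.emod_nonneg _ (by omega))
        have e2 : (((m % n).toNat : ℕ) : ℂ) = ((m % n : ℤ) : ℂ) := by
          rw [← Int.cast_natCast, e1]
        have e3 : (m : ℂ) = ((m % n : ℤ) : ℂ) + n * ((m / n : ℤ) : ℂ) := by
          exact_mod_cast (Int.emod_add_mul_ediv m n).symm
        rw [e2]
        field_simp
        rw [e3, ← hnorm]
        push_cast
        ring
      refine ⟨(m % n).toNat, ?_, ?_⟩
      · have := Int.emod_lt_of_pos m (show (0 : ℤ) < n by exact_mod_cast hn0)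
        omega
      · rw [hz, map_add, hnt, add_zero, hm, map_add, hnt, add_zero]
end

open scoped Classical in
/-- the data fed into `Pl.descend` -/
def Dat (W : WeierstrassCurve ℂ) (N : ℕ) (τ : ℤ) (c c' : ℂ) : Prop :=
  ∃ (π π' : W.toAffine.Point →+ W.toAffine.Point) (A B A' B' : Polynomial ℂ)
    (S1 S2 : Finset W.toAffine.Point),
    RH π A B c N ∧ RH π' A' B' c' N ∧ (∀ P, π (π' P) = N • P) ∧ (∀ P, π' (π P) = N • P) ∧
    (∀ P, π P + π' P = τ • P) ∧ (∀ P ∈ S1, π P = P) ∧ (∀ P ∈ S2, π P = -P) ∧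
    (N : ℤ) + 1 - τ ≤ S1.card ∧ (N : ℤ) + 1 + τ ≤ S2.card

open scoped Classical in
lemma Dat.vc {W : WeierstrassCurve ℂ} [W.IsElliptic] {N : ℕ} {τ : ℤ} {c c' : ℂ} (h : Dat W N τ c c')
    (V : VariableChange ℂ) : Dat (V • W) N τ c c' := by
  obtain ⟨π, π', A, B, A', B', S1, S2, h1, h2, h3, h4, h5, h6, h7, h8, h9⟩ := h
  obtain ⟨A1, B1, k1⟩ := h1.vc V
  obtain ⟨A2, B2, k2⟩ := h2.vc V
  let g := vcEquiv (W := W) V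
  have hg : ∀ P, vcHom V (g.symm P) = P := fun P => g.apply_symm_apply P
  refine ⟨conj V π, conj V π', A1, B1, A2, B2, S1.map g.symm.toEquiv.toEmbedding,
    S2.map g.symm.toEquiv.toEmbedding, k1, k2, ?_, ?_, ?_, ?_, ?_, ?_, ?_⟩
  · intro P; apply vc_inj V; rw [vcHom_conj, vcHom_conj, h3, map_nsmul]
  · intro P; apply vc_inj V; rw [vcHom_conj, vcHom_conj, h4, map_nsmul]
  · intro P; apply vc_inj V; rw [map_add, vcHom_conj, vcHom_conj, h5, map_zsmul]
  · intro P hP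
    obtain ⟨Q, hQ, rfl⟩ := Finset.mem_map.1 hP
    apply vc_inj V; rw [vcHom_conj]
    change π (vcHom V (g.symm Q)) = vcHom V (g.symm Q)
    rw [hg, h6 Q hQ]
  · intro P hP
    obtain ⟨Q, hQ, rfl⟩ := Finset.mem_map.1 hP
    apply vc_inj V; rw [vcHom_conj, map_neg]
    change π (vcHom V (g.symm Q)) = -vcHom V (g.symm Q)
    rw [hg, h7 Q hQ]
  · rwa [Finset.card_map]
  · rwa [Finset.card_map]

open scoped Classical in
lemma Unif.dat {ω : ℂ} {τ : ℤ} {q : ℕ} (hω : ω ^ 2 = τ * ω - q) (him : ω.im ≠ 0)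
    {W : WeierstrassCurve ℂ} [W.IsElliptic] {Φ : ℂ →+ W.toAffine.Point} (hU : Unif ω W Φ) :
    Dat W q τ ω (τ - ω) := by
  have hω' : ω ^ 2 = τ * ω - ((q : ℤ) : ℂ) := by rw [hω]; simp
  have hdisc := disc_neg hω' him
  have hω0 : ω ≠ 0 := by rintro rfl; simp at him
  have hω0' : (τ - ω : ℂ) ≠ 0 := by
    intro h
    have := congrArg Complex.im h
    simp at this; exact him this
  have m1 : InL ω ω := ⟨0, 1, by simp⟩
  have m2 : InL ω (τ - ω) := ⟨τ, -1, by push_cast; ring⟩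
  obtain ⟨π, hπ, A, B, N, h1⟩ := hU.endo ω hω0 (fun z hz => InL_mul hω' him m1 hz)
  obtain ⟨π', hπ', A', B', N', h1'⟩ := hU.endo (τ - ω) hω0' (fun z hz => InL_mul hω' him m2 hz)
  have key : ∀ (β : ℂ) (r s : ℤ) (hs : s ^ 2 = 1) (hβ : β = r + s * ω) (hn : (q : ℤ) = r ^ 2 + r * s * τ + q)
      (e : W.toAffine.Point →+ W.toAffine.Point), (∀ z, e (Φ z) = Φ (β * z)) → Nat.card e.ker = q := by
    rintro β r s hs rfl hn e he
    obtain ⟨S, hS, hS'⟩ := kill hω' him hU r s hs q hn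
    have : ∀ P, P ∈ S ↔ P ∈ e.ker := by
      intro P
      obtain ⟨z, rfl⟩ := hU.surj P
      rw [hS', AddMonoidHom.mem_ker, he]
    rw [← hS, ← Nat.card_congr (Equiv.subtypeEquivRight this), Nat.card_eq_fintype_card, Fintype.card_coe]
  have eN : N = q := by
    rw [← h1.card_eq hω0]
    exact key ω 0 1 (by norm_num) (by simp) (by ring) π hπ
  have eN' : N' = q := by
    rw [← h1'.card_eq hω0']
    exact key _ τ (-1) (by norm_num) (by push_cast; ring) (by ring) π' hπ'
  subst eN
  rw [eN'] at h1'
  obtain ⟨S1, c1, hS1⟩ := kill hω' him hU 1 (-1) (by norm_num) ((N + 1 - τ : ℤ).toNat) (by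
    rw [Int.toNat_of_nonneg (by nlinarith [sq_nonneg (τ - 2)])]; ring)
  obtain ⟨S2, c2, hS2⟩ := kill hω' him hU 1 1 (by norm_num) ((N + 1 + τ : ℤ).toNat) (by
    rw [Int.toNat_of_nonneg (by nlinarith [sq_nonneg (τ + 2)])]; ring)
  refine ⟨π, π', A, B, A', B', S1, S2, h1, h1', ?_, ?_, ?_, ?_, ?_, ?_, ?_⟩
  · intro P
    obtain ⟨z, rfl⟩ := hU.surj P
    rw [hπ', hπ, ← map_nsmul]
    congr 1
    rw [nsmul_eq_mul]; linear_combination -hω * z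
  · intro P
    obtain ⟨z, rfl⟩ := hU.surj P
    rw [hπ, hπ', ← map_nsmul]
    congr 1
    rw [nsmul_eq_mul]; linear_combination -hω * z
  · intro P
    obtain ⟨z, rfl⟩ := hU.surj P
    rw [hπ, hπ', ← map_zsmul, ← map_add]
    congr 1
    rw [zsmul_eq_mul]; ring
  · intro P hP
    obtain ⟨z, rfl⟩ := hU.surj P
    rw [hS1] at hP
    rw [hπ, ← sub_eq_zero, ← neg_eq_zero, ← map_sub, ← map_neg, ← hP]
    congr 1; push_cast; ring
  · intro P hP
    obtain ⟨z, rfl⟩ := hU.surj P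
    rw [hS2] at hP
    rw [hπ, ← sub_eq_zero, ← map_neg, ← map_sub, ← hP]
    congr 1; push_cast; ring
  · rw [c1]; exact Int.self_le_toNat _
  · rw [c2]; exact Int.self_le_toNat _

open scoped Classical in
lemma Unif.j {ω : ℂ} {τ : ℤ} {q : ℕ} (hω : ω ^ 2 = τ * ω - q) (him : ω.im ≠ 0)
    {W : WeierstrassCurve ℂ} [W.IsElliptic] {Φ : ℂ →+ W.toAffine.Point} (hU : Unif ω W Φ)
    {k Γ : Type*} [Field k] [LinearOrderedCommGroupWithZero Γ] [IsAlgClosed k] (L : Pl ℂ k Γ) :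
    L.v W.j ≤ 1 := by
  have hω' : ω ^ 2 = τ * ω - ((q : ℤ) : ℂ) := by rw [hω]; simp
  have hdisc := disc_neg hω' him
  obtain ⟨D, hD⟩ : ∃ D : ℕ, (D : ℤ) = 4 * q - τ ^ 2 := ⟨(4 * q - τ ^ 2).toNat, Int.toNat_of_nonneg (by linarith)⟩
  have hD0 : 0 < D := by omega
  have hDC : (D : ℂ) = 4 * q - τ ^ 2 := by exact_mod_cast hD
  have hsq : (2 * ω - τ) ^ 2 = -(D : ℂ) := by rw [hDC]; linear_combination 4 * hω
  have key : ∀ (c : ℤ) (M : ℤ), (c + (2 * ω - τ)) ^ 4 = (M : ℂ) → M ≠ 0 → (∀ m : ℕ, m ^ 4 ≠ M.natAbs) →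
      L.v W.j ≤ 1 := by
    intro c M hM hM0 hM4
    obtain ⟨e, he, A, B, N, h⟩ := hU.endo (c + (2 * ω - τ)) (by
      intro h
      rw [h] at hM
      exact hM0 (by rw [zero_pow (by norm_num)] at hM; exact_mod_cast hM.symm)) (fun z hz =>
        InL_mul hω' him ⟨c - τ, 2, by push_cast; ring⟩ hz)
    refine L.j_int h M ?_ hM0 hM4
    intro P
    obtain ⟨z, rfl⟩ := hU.surj P
    rw [he, he, he, he, ← map_zsmul]
    congr 1
    rw [zsmul_eq_mul, ← hM]; ring
  by_cases hc : ∃ c : ℕ, c ^ 2 = D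
  · obtain ⟨c, hc⟩ := hc
    have hc0 : c ≠ 0 := by rintro rfl; simp at hc; omega
    have hcC : (c : ℂ) ^ 2 = D := by exact_mod_cast hc
    refine key c (-4 * c ^ 4) ?_ ?_ ?_
    · push_cast
      rw [← hcC] at hsq
      have : (c + (2 * ω - τ) : ℂ) ^ 2 = 2 * c * (2 * ω - τ) := by linear_combination hsq
      calc (c + (2 * ω - τ) : ℂ) ^ 4 = ((c + (2 * ω - τ)) ^ 2) ^ 2 := by ring
        _ = _ := by rw [this]; linear_combination 4 * c ^ 2 * hsq
    · simp [hc0]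
    · intro m hm
      have h1 : m ^ 4 = 4 * c ^ 4 := by rw [hm]; simp [Int.natAbs_mul, Int.natAbs_pow]
      have h2 : m ^ 2 = 2 * c ^ 2 := by
        have : (m ^ 2) ^ 2 = (2 * c ^ 2) ^ 2 := by rw [← pow_mul, h1]; ring
        exact (Nat.pow_left_injective (n := 2) (by norm_num)) this
      have h3 := congrArg (fun n : ℕ => padicValNat 2 n) h2
      have hm0 : m ≠ 0 := by rintro rfl; simp at h2; omega
      rw [padicValNat.mul (by norm_num) (by positivity), padicValNat.pow _, padicValNat.pow _,
        padicValNat_self] at h3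
      omega
  · refine key 0 (D ^ 2) ?_ (by positivity) ?_
    · push_cast
      rw [zero_add, show (2 * ω - τ : ℂ) ^ 4 = ((2 * ω - τ) ^ 2) ^ 2 by ring, hsq]; ring
    · intro m hm
      refine hc ⟨m, ?_⟩
      have : (m ^ 2) ^ 2 = D ^ 2 := by
        rw [← pow_mul, hm]; simp [Int.natAbs_pow]
      exact (Nat.pow_left_injective (n := 2) (by norm_num)) this

theorem exist_of_unif (hUn : ∀ ω : ℂ, ω.im ≠ 0 → ∃ W : WeierstrassCurve ℂ, W.IsElliptic ∧ ∃ Φ, Unif ω W Φ)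
    {p e : ℕ} [hp : Fact p.Prime] (he : e ≠ 0) (τ : ℤ) (hτ : ¬ (p : ℤ) ∣ τ) (hd : τ ^ 2 < 4 * (p ^ e : ℕ))
    {Fq : Type*} [Field Fq] [Fintype Fq] (hFq : Fintype.card Fq = p ^ e) :
    ∃ E : WeierstrassCurve Fq, E.IsElliptic ∧
      (Nat.card E.toAffine.Point : ℤ) = ((p ^ e : ℕ) : ℤ) + 1 - τ := by
  classical
  obtain ⟨k, Γ, _, _, _, _, ⟨L⟩⟩ := exists_place (K := ℂ) p
  have hp0 : L.v (p : ℂ) < 1 := by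
    rw [← L.rd_eq_zero (L.v_natCast p), L.rd_natCast]; exact CharP.cast_eq_zero k p
  have hτ1 : L.v (τ : ℂ) = 1 := by
    refine le_antisymm (L.v_intCast τ) ?_
    by_contra! h
    rw [← L.rd_eq_zero (L.v_intCast τ), L.rd_intCast, CharP.intCast_eq_zero_iff k p] at h
    exact hτ h
  obtain ⟨ω₀, hω₀, him₀⟩ : ∃ ω : ℂ, ω ^ 2 = τ * ω - (p ^ e : ℕ) ∧ ω.im ≠ 0 := by
    have hpos : (0 : ℝ) < 4 * (p ^ e : ℕ) - τ ^ 2 := by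
      have : (τ : ℝ) ^ 2 < 4 * (p ^ e : ℕ) := by exact_mod_cast hd
      linarith
    generalize p ^ e = N at hpos ⊢
    refine ⟨⟨τ / 2, Real.sqrt (4 * (N : ℝ) - τ ^ 2) / 2⟩, ?_, ?_⟩
    · have := Real.sq_sqrt hpos.le
      apply Complex.ext
      · simp [sq] at this ⊢; nlinarith
      · simp [sq]; ring
    · simp only [ne_eq, div_eq_zero_iff, not_or]
      exact ⟨(Real.sqrt_pos.2 hpos).ne', by norm_num⟩
  have hvq : L.v ((p ^ e : ℕ) : ℂ) < 1 := by
    push_cast; rw [map_pow]; exact pow_lt_one' hp0 he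
  obtain ⟨ω, hω, him, hv⟩ : ∃ ω : ℂ, ω ^ 2 = τ * ω - (p ^ e : ℕ) ∧ ω.im ≠ 0 ∧ L.v ω < 1 := by
    by_cases h : L.v ω₀ < 1
    · exact ⟨ω₀, hω₀, him₀, h⟩
    · refine ⟨τ - ω₀, by linear_combination hω₀, by simpa using him₀, ?_⟩
      have h1 : ω₀ * (τ - ω₀) = (p ^ e : ℕ) := by linear_combination -hω₀
      by_contra h2
      rw [← h1, map_mul] at hvq
      exact absurd (one_le_mul (not_lt.1 h) (not_lt.1 h2)) (not_le.2 hvq)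
  have hv' : L.v (τ - ω) = 1 := by
    rw [Valuation.map_sub_eq_of_lt_left _ (by rwa [hτ1]), hτ1]
  obtain ⟨W, hW, Φ, hU⟩ := hUn ω him
  have hdat := hU.dat hω him
  have hj := hU.j hω him L
  obtain ⟨W', hE', hI, hgood, hjj⟩ := L.good_model hj
  obtain ⟨V, hV⟩ := exists_variableChange_of_j_eq W W' hjj.symm
  have hdat' := hdat.vc V
  rw [hV] at hdat'
  obtain ⟨π, π', A, B, A', B', S1, S2, h1, h2, h3, h4, h5, h6, h7, h8, h9⟩ := hdat'
  obtain ⟨f⟩ : Nonempty (Fq →+* k) := by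
    obtain ⟨c, hc⟩ := CharP.exists Fq
    obtain ⟨n, pp, hn⟩ := FiniteField.card Fq c
    have hcp : c = p := by
      rw [hFq] at hn
      have : p ∣ c ^ (n : ℕ) := by rw [← hn]; exact dvd_pow_self _ he
      exact ((Nat.prime_dvd_prime_iff_eq hp.out pp).1 (hp.out.dvd_of_dvd_pow this)).symm
    subst hcp
    letI := ZMod.algebra Fq c
    obtain ⟨ψ, -⟩ := exists_lift (S := Fq) (ZMod.castHom (dvd_refl c) k)
    exact ⟨ψ⟩
  exact L.descend hI he h1 h2 hv hv' h3 h4 τ hτ h5 S1 S2 h6 h7 h8 h9 hFq f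
end WC

set_option linter.unusedSectionVars false
set_option linter.style.haveILetI false
namespace WC
open Filter Topology

lemma mero_zero {f : ℂ → ℂ} (hf : Meromorphic f) {z₀ : ℂ} (h : ∀ᶠ w in 𝓝[≠] z₀, f w = 0) (z : ℂ) :
    ∀ᶠ w in 𝓝[≠] z, f w = 0 := by
  rw [← meromorphicOrderAt_eq_top_iff] at h ⊢
  by_contra h1
  exact hf.meromorphicOn.meromorphicOrderAt_ne_top_of_isPreconnected (U := Set.univ) isPreconnected_univ
    (Set.mem_univ z) (Set.mem_univ z₀) h1 h

lemma mero_ne {f : ℂ → ℂ} (hf : Meromorphic f) {z₀ : ℂ} (h : ∃ᶠ w in 𝓝[≠] z₀, f w ≠ 0) (z : ℂ) :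
    ∀ᶠ w in 𝓝[≠] z, f w ≠ 0 := by
  rw [← meromorphicOrderAt_ne_top_iff_eventually_ne_zero (hf z)]
  intro h1
  rw [meromorphicOrderAt_eq_top_iff] at h1
  exact h ((mero_zero hf h1 z₀).mono fun w hw => by simpa using hw)

/-- zero derivative near one point -/
lemma mero_const {f : ℂ → ℂ} (hf : Meromorphic f) {z₀ : ℂ} (h : ∀ᶠ w in 𝓝[≠] z₀, HasDerivAt f 0 w) :
    ∃ c, ∀ z, ∀ᶠ w in 𝓝[≠] z, f w = c := by
  have h1 : ∀ᶠ y in 𝓝[≠] z₀, (∀ᶠ w in 𝓝[≠] y, HasDerivAt f 0 w) ∧ HasDerivAt f 0 y := by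
    refine Eventually.and ?_ h
    have h2 := eventually_eventually_nhdsWithin.2 h
    filter_upwards [h2, self_mem_nhdsWithin] with y hy hy0
    rw [IsOpen.nhdsWithin_eq isOpen_compl_singleton hy0] at hy
    exact hy.filter_mono nhdsWithin_le_nhds
  obtain ⟨y, hy, hy'⟩ := h1.exists
  have h3 : ∀ᶠ w in 𝓝 y, HasDerivAt f 0 w := by
    rw [eventually_nhdsWithin_iff] at hy
    filter_upwards [hy] with w hw
    by_cases hwy : w = y
    · rwa [hwy]
    · exact hw hwy
  obtain ⟨r, hr, hb⟩ := Metric.eventually_nhds_iff_ball.1 h3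
  have h4 : ∀ w ∈ Metric.ball y r, f w = f y := fun w hw =>
    Metric.isOpen_ball.is_const_of_deriv_eq_zero (convex_ball y r).isPreconnected
      (fun w hw => (hb w hw).differentiableAt.differentiableWithinAt)
      (fun w hw => (hb w hw).deriv) hw (Metric.mem_ball_self hr)
  refine ⟨f y, fun z => ?_⟩
  have := mero_zero (f := fun w => f w - f y) (hf.sub (Meromorphic.const _)) (z₀ := y) (by
    refine Eventually.filter_mono nhdsWithin_le_nhds ?_
    filter_upwards [Metric.ball_mem_nhds y hr] with w hw
    rw [h4 w hw, sub_self]) z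
  exact this.mono fun w hw => sub_eq_zero.1 hw

lemma shift_tendsto (z l : ℂ) : Tendsto (fun w => w + l) (𝓝[≠] z) (𝓝[≠] (z + l)) := by
  refine tendsto_nhdsWithin_of_tendsto_nhds_of_eventually_within _ ?_ ?_
  · exact ((continuous_add_const l).tendsto z).mono_left nhdsWithin_le_nhds
  · filter_upwards [self_mem_nhdsWithin] with w hw h
    exact hw (add_right_cancel h)

variable (L : PeriodPair)

lemma liouville {f : ℂ → ℂ} (hf : Meromorphic f) (h0 : ∀ z, 0 ≤ meromorphicOrderAt f z)
    (hper : ∀ z, ∀ l ∈ L.lattice, f (z + l) = f z) : ∃ c, ∀ z, ∀ᶠ w in 𝓝[≠] z, f w = c := by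
  have h1 : ∀ z, ∃ g : ℂ → ℂ, AnalyticAt ℂ g z ∧ ∀ᶠ w in 𝓝[≠] z, f w = g w := fun z => by
    simpa [EventuallyEq] using (hf z).meromorphicOrderAt_nonneg_iff.1 (h0 z)
  choose g hg hfg using h1
  let F : ℂ → ℂ := fun z => g z z
  have hlim : ∀ z, Tendsto f (𝓝[≠] z) (𝓝 (F z)) := fun z =>
    (((hg z).continuousAt.tendsto.mono_left nhdsWithin_le_nhds).congr'
      ((hfg z).mono fun w hw => hw.symm))
  have hF : ∀ z, F =ᶠ[𝓝 z] g z := by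
    intro z
    have h2 : ∀ᶠ y in 𝓝[≠] z, F y = g z y := by
      have h2 := eventually_eventually_nhdsWithin.2 (hfg z)
      filter_upwards [h2, self_mem_nhdsWithin,
        (hg z).eventually_analyticAt.filter_mono nhdsWithin_le_nhds] with y hy hy0 hya
      rw [IsOpen.nhdsWithin_eq isOpen_compl_singleton hy0] at hy
      refine tendsto_nhds_unique (hlim y) ?_
      exact (hya.continuousAt.tendsto.mono_left nhdsWithin_le_nhds).congr'
        ((hy.filter_mono nhdsWithin_le_nhds).mono fun w hw => hw.symm)
    rw [eventually_nhdsWithin_iff] at h2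
    filter_upwards [h2] with w hw
    by_cases hwy : w = z
    · rw [hwy]
    · exact hw hwy
  have hFd : Differentiable ℂ F := fun z => ((hg z).congr (hF z).symm).differentiableAt
  have hFper : ∀ z, ∀ l ∈ L.lattice, F (z + l) = F z := by
    intro z l hl
    refine tendsto_nhds_unique ((hlim (z + l)).comp (shift_tendsto z l)) ?_
    refine (hlim z).congr fun w => ?_
    exact (hper w l hl).symm
  have hb : Bornology.IsBounded (Set.range F) :=
    (IsZLattice.isCompact_range_of_periodic L.lattice F hFd.continuous hFper).isBounded
  refine ⟨F 0, fun z => ?_⟩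
  filter_upwards [hfg z, (hF z).filter_mono nhdsWithin_le_nhds] with w hw hw'
  rw [hw, ← hw', hFd.apply_eq_apply_of_bounded hb w 0]
end WC

set_option linter.unusedSectionVars false
set_option linter.style.haveILetI false
namespace WC
open Filter Topology

lemma mero_comp {f : ℂ → ℂ} (hf : Meromorphic f) (a b : ℂ) : Meromorphic (fun z => f (a * z + b)) :=
  fun z => (hf (a * z + b)).comp_analyticAt (g := fun z => a * z + b) (by fun_prop)

lemma ord_comp {f : ℂ → ℂ} {a : ℂ} (ha : a ≠ 0) (b z : ℂ) :
    meromorphicOrderAt (fun z => f (a * z + b)) z = meromorphicOrderAt f (a * z + b) := by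
  have hd : deriv (fun z : ℂ => a * z + b) z = a := by
    simp
  exact meromorphicOrderAt_comp_of_deriv_ne_zero (f := f) (g := fun z => a * z + b) (x := z) (by fun_prop)
    (by rw [hd]; exact ha)

lemma ord_mul_nonneg {f g : ℂ → ℂ} (hf : Meromorphic f) (hg : Meromorphic g) {z : ℂ} (n : ℤ)
    (h1 : ((-n : ℤ) : WithTop ℤ) ≤ meromorphicOrderAt f z) (h2 : ((n : ℤ) : WithTop ℤ) ≤ meromorphicOrderAt g z) :
    0 ≤ meromorphicOrderAt (f * g) z := by
  rw [meromorphicOrderAt_mul (hf z) (hg z)]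
  have := add_le_add h1 h2
  rwa [← WithTop.coe_add, neg_add_cancel, WithTop.coe_zero] at this

lemma ord_sub_const_neg {f : ℂ → ℂ} (hf : Meromorphic f) {z : ℂ} (h : meromorphicOrderAt f z < 0) (c : ℂ) :
    meromorphicOrderAt (fun w => f w - c) z = meromorphicOrderAt f z := by
  have h1 : 0 ≤ meromorphicOrderAt (fun _ : ℂ => -c) z := (analyticAt_const).meromorphicOrderAt_nonneg
  have := meromorphicOrderAt_add_eq_left_of_lt (f₁ := f) (f₂ := fun _ => -c) (x := z)
    (Meromorphic.const _ z) (h.trans_le h1)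
  rw [← this]
  congr 1

variable (L : PeriodPair)

lemma p_per (z : ℂ) {l : ℂ} (hl : l ∈ L.lattice) : L.weierstrassP (z + l) = L.weierstrassP z :=
  L.weierstrassP_add_coe z ⟨l, hl⟩
lemma p'_per (z : ℂ) {l : ℂ} (hl : l ∈ L.lattice) : L.derivWeierstrassP (z + l) = L.derivWeierstrassP z :=
  L.derivWeierstrassP_add_coe z ⟨l, hl⟩

lemma p_an {z : ℂ} (hz : z ∉ L.lattice) : AnalyticAt ℂ L.weierstrassP z := L.analyticOnNhd_weierstrassP z hz
lemma p'_an {z : ℂ} (hz : z ∉ L.lattice) : AnalyticAt ℂ L.derivWeierstrassP z :=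
  L.analyticOnNhd_derivWeierstrassP z hz

lemma p_deriv {z : ℂ} (hz : z ∉ L.lattice) : HasDerivAt L.weierstrassP (L.derivWeierstrassP z) z := by
  have := (p_an L hz).differentiableAt.hasDerivAt
  rwa [L.deriv_weierstrassP] at this

lemma ev_notMem (z : ℂ) : ∀ᶠ w in 𝓝[≠] z, w ∉ L.lattice := by
  rw [eventually_nhdsWithin_iff]
  filter_upwards [L.compl_lattice_sdiff_singleton_mem_nhds z] with w hw hwz h
  exact hw ⟨h, hwz⟩

lemma ev_notMem_nhds {z : ℂ} (hz : z ∉ L.lattice) : ∀ᶠ w in 𝓝 z, w ∉ L.lattice :=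
  L.isClosed_lattice.isOpen_compl.mem_nhds hz

lemma ord_p {l : ℂ} (hl : l ∈ L.lattice) : meromorphicOrderAt L.weierstrassP l = ((-2 : ℤ) : WithTop ℤ) := by
  rw [L.order_weierstrassP l hl]; rfl

lemma neg_two_lt : ((-2 : ℤ) : WithTop ℤ) < 0 := by
  rw [← WithTop.coe_zero, WithTop.coe_lt_coe]; norm_num

lemma ord_p' {l : ℂ} (hl : l ∈ L.lattice) : meromorphicOrderAt L.derivWeierstrassP l = ((-3 : ℤ) : WithTop ℤ) := by
  rw [← L.deriv_weierstrassP, meromorphicOrderAt_deriv_eq_sub_one (n := -2) (by norm_num) (ord_p L hl)]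
  norm_num

lemma p_inf {l : ℂ} (hl : l ∈ L.lattice) : Tendsto L.weierstrassP (𝓝[≠] l) (Bornology.cobounded ℂ) :=
  tendsto_cobounded_of_meromorphicOrderAt_neg (by rw [ord_p L hl]; exact neg_two_lt)

lemma p'_ne (z : ℂ) : ∀ᶠ w in 𝓝[≠] z, L.derivWeierstrassP w ≠ 0 := by
  have h : ∀ᶠ w in 𝓝[≠] (0 : ℂ), L.derivWeierstrassP w ≠ 0 := by
    rw [← meromorphicOrderAt_ne_top_iff_eventually_ne_zero (L.meromorphic_derivWeierstrassP 0),
      ord_p' L (zero_mem _)]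
    exact WithTop.coe_ne_top
  exact mero_ne L.meromorphic_derivWeierstrassP h.frequently z

lemma p_sub_ne (c z : ℂ) : ∀ᶠ w in 𝓝[≠] z, L.weierstrassP w ≠ c := by
  have h : ∀ᶠ w in 𝓝[≠] (0 : ℂ), L.weierstrassP w - c ≠ 0 := by
    have hm : Meromorphic (fun w => L.weierstrassP w - c) :=
      L.meromorphic_weierstrassP.sub (Meromorphic.const c)
    rw [← meromorphicOrderAt_ne_top_iff_eventually_ne_zero (hm 0),
      ord_sub_const_neg L.meromorphic_weierstrassP (by rw [ord_p L (zero_mem _)]; exact neg_two_lt),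
      ord_p L (zero_mem _)]
    exact WithTop.coe_ne_top
  have := mero_ne (f := fun w => L.weierstrassP w - c) (L.meromorphic_weierstrassP.sub (Meromorphic.const c))
    h.frequently z
  exact this.mono fun w hw => sub_ne_zero.1 hw

/-- second order equation -/
lemma p'_deriv {z : ℂ} (hz : z ∉ L.lattice) :
    HasDerivAt L.derivWeierstrassP (6 * L.weierstrassP z ^ 2 - L.g₂ / 2) z := by
  have h1 : ∀ᶠ w in 𝓝[≠] z, deriv L.derivWeierstrassP w = 6 * L.weierstrassP w ^ 2 - L.g₂ / 2 := by
    filter_upwards [p'_ne L z, (ev_notMem_nhds L hz).filter_mono nhdsWithin_le_nhds] with w hw hwL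
    have e1 := (p_deriv L hwL)
    have e2 := (p'_an L hwL).differentiableAt.hasDerivAt
    have e3 := (e2.pow 2)
    have e4 := (((e1.pow 3).const_mul 4).sub (e1.const_mul L.g₂)).sub_const L.g₃
    have e5 : (L.derivWeierstrassP ^ 2) =ᶠ[𝓝 w] fun x => 4 * (L.weierstrassP ^ 3) x - L.g₂ * L.weierstrassP x - L.g₃ := by
      filter_upwards [ev_notMem_nhds L hwL] with x hx
      simpa using L.derivWeierstrassP_sq x hx
    have e6 := (e3.congr_of_eventuallyEq e5.symm).unique e4
    norm_num at e6
    apply mul_left_cancel₀ hw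
    linear_combination e6 / 2
  have h2 := (p'_an L hz)
  have h3 : deriv L.derivWeierstrassP z = 6 * L.weierstrassP z ^ 2 - L.g₂ / 2 := by
    refine tendsto_nhds_unique ((h2.deriv.continuousAt.tendsto).mono_left (nhdsWithin_le_nhds (s := {z}ᶜ))) ?_
    have c : ContinuousAt (fun w => 6 * L.weierstrassP w ^ 2 - L.g₂ / 2) z := by
      have := (p_an L hz).continuousAt
      fun_prop
    exact (c.tendsto.mono_left nhdsWithin_le_nhds).congr' (h1.mono fun w hw => hw.symm)
  rw [← h3]
  exact h2.differentiableAt.hasDerivAt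

lemma p_surj (c : ℂ) : ∃ z, z ∉ L.lattice ∧ L.weierstrassP z = c := by
  by_contra! hcon
  have hm : Meromorphic (fun w => L.weierstrassP w - c) :=
    L.meromorphic_weierstrassP.sub (Meromorphic.const c)
  obtain ⟨k, hk⟩ := liouville L (f := (fun w => L.weierstrassP w - c)⁻¹) hm.inv (by
    intro z
    rw [meromorphicOrderAt_inv]
    by_cases hz : z ∈ L.lattice
    · rw [ord_sub_const_neg L.meromorphic_weierstrassP (by rw [ord_p L hz]; exact neg_two_lt), ord_p L hz]
      change ((0 : ℤ) : WithTop ℤ) ≤ ((2 : ℤ) : WithTop ℤ)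
      rw [WithTop.coe_le_coe]; norm_num
    · have ha : AnalyticAt ℂ (fun w => L.weierstrassP w - c) z := (p_an L hz).sub analyticAt_const
      rw [ha.meromorphicOrderAt_eq, ha.analyticOrderAt_eq_zero.2 (sub_ne_zero.2 (hcon z hz))]
      simp) (by
    intro z l hl
    simp [p_per L z hl])
  have h1 : ∀ᶠ w in 𝓝[≠] (0 : ℂ), L.weierstrassP w - c = k⁻¹ := by
    filter_upwards [hk 0] with w hw
    rw [← hw]; simp
  obtain ⟨w, hw, hw'⟩ := (h1.and (p_sub_ne L (k⁻¹ + c) 0)).exists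
  exact hw' (by rw [← hw]; ring)

lemma half_ne {h h' : ℂ} (hh : h ∉ L.lattice) (hh2 : 2 * h ∈ L.lattice) (hh' : h' ∉ L.lattice)
    (hd : h' - h ∉ L.lattice) : L.weierstrassP h' ≠ L.weierstrassP h := by
  intro heq
  have hp' : L.derivWeierstrassP h = 0 := by
    have h1 := p'_per L (-h) hh2
    rw [L.derivWeierstrassP_neg, show -h + 2 * h = h by ring] at h1
    exact self_eq_neg.1 h1
  set e := L.weierstrassP h with he
  have hm : Meromorphic (fun w => L.weierstrassP w - e) :=
    L.meromorphic_weierstrassP.sub (Meromorphic.const e)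
  have hm2 : Meromorphic (fun w => L.weierstrassP (1 * w + -h) - e) := mero_comp hm 1 (-h)
  have hneg : ∀ l ∈ L.lattice, meromorphicOrderAt (fun w => L.weierstrassP w - e) l = ((-2 : ℤ) : WithTop ℤ) := by
    intro l hl
    rw [ord_sub_const_neg L.meromorphic_weierstrassP (by rw [ord_p L hl]; exact neg_two_lt), ord_p L hl]
  have han : ∀ z, z ∉ L.lattice → AnalyticAt ℂ (fun w => L.weierstrassP w - e) z := fun z hz =>
    (p_an L hz).sub analyticAt_const
  have hpos : ∀ z, z - h ∈ L.lattice → ((2 : ℤ) : WithTop ℤ) ≤ meromorphicOrderAt (fun w => L.weierstrassP w - e) z := by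
    intro z hz
    have hzL : z ∉ L.lattice := fun h1 => hh (by simpa using sub_mem h1 hz)
    have ev : L.weierstrassP z = e := by
      have := p_per L h hz
      rwa [add_sub_cancel] at this
    have ev' : L.derivWeierstrassP z = 0 := by
      have := p'_per L h hz
      rwa [add_sub_cancel, hp'] at this
    rw [(han z hzL).meromorphicOrderAt_eq]
    have h2 : ((2 : ℕ) : ℕ∞) ≤ analyticOrderAt (fun w => L.weierstrassP w - e) z := by
      rw [natCast_le_analyticOrderAt_iff_iteratedDeriv_eq_zero (han z hzL)]
      intro i hi
      interval_cases i
      · simp [ev]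
      · simp [iteratedDeriv_one, ev']
    cases hn : analyticOrderAt (fun w => L.weierstrassP w - e) z with
    | top => simp
    | coe n =>
      rw [hn] at h2
      have : 2 ≤ n := by exact_mod_cast h2
      change ((2 : ℤ) : WithTop ℤ) ≤ ((n : ℤ) : WithTop ℤ)
      rw [WithTop.coe_le_coe]; exact_mod_cast this
  have hnn : ∀ z, z ∉ L.lattice → ((0 : ℤ) : WithTop ℤ) ≤ meromorphicOrderAt (fun w => L.weierstrassP w - e) z :=
    fun z hz => (han z hz).meromorphicOrderAt_nonneg
  have hper : ∀ z l, l ∈ L.lattice → L.weierstrassP (z + l) - e = L.weierstrassP z - e := fun z l hl => by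
    rw [p_per L z hl]
  obtain ⟨k, hk⟩ := liouville L (f := (fun w => L.weierstrassP w - e) * (fun w => L.weierstrassP (1 * w + -h) - e))
    (hm.mul hm2) (by
      intro z
      have hz2 := ord_comp (f := fun w => L.weierstrassP w - e) (one_ne_zero) (-h) z
      by_cases hz : z ∈ L.lattice
      · refine ord_mul_nonneg hm hm2 2 (hneg z hz).ge ?_
        rw [hz2]
        refine hpos _ ?_
        have := sub_mem hz hh2
        rwa [show 1 * z + -h - h = z - 2 * h by ring]
      · by_cases hzh : z - h ∈ L.lattice
        · refine ord_mul_nonneg hm hm2 (-2) ?_ ?_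
          · simpa using hpos z hzh
          · rw [hz2, hneg _ (by rwa [one_mul, ← sub_eq_add_neg])]
        · refine ord_mul_nonneg hm hm2 0 (by simpa using hnn z hz) ?_
          rw [hz2]
          exact hnn _ (by rwa [one_mul, ← sub_eq_add_neg])) (by
      intro z l hl
      simp only [Pi.mul_apply]
      rw [p_per L z hl, show 1 * (z + l) + -h = (1 * z + -h) + l by ring, p_per L _ hl])
  have hk0 : k = 0 := by
    have a1 := (han h' hh').continuousAt
    have a2 : ContinuousAt (fun w => L.weierstrassP (1 * w + -h) - e) h' := by
      have := (han (1 * h' + -h) (by rwa [one_mul, ← sub_eq_add_neg])).continuousAt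
      exact ContinuousAt.comp (f := fun w => 1 * w + -h) (g := fun w => L.weierstrassP w - e) this (by fun_prop)
    have a3 := ((a1.mul a2).tendsto.mono_left (nhdsWithin_le_nhds (s := {h'}ᶜ)))
    have a4 := tendsto_nhds_unique (a3.congr' (hk h')) tendsto_const_nhds
    rw [← a4]
    change (L.weierstrassP h' - e) * _ = 0
    rw [heq, sub_self, zero_mul]
  subst hk0
  have b1 : ∀ᶠ w in 𝓝[≠] (0 : ℂ), L.weierstrassP (w + -h) ≠ e := (shift_tendsto 0 (-h)).eventually (p_sub_ne L e _)
  obtain ⟨w, ⟨hw1, hw2⟩, hw3⟩ := ((b1.and (p_sub_ne L e 0)).and (hk 0)).exists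
  rcases mul_eq_zero.1 hw3 with h5 | h5
  · exact hw2 (sub_eq_zero.1 h5)
  · simp only [one_mul] at h5
    exact hw1 (sub_eq_zero.1 h5)
end WC

set_option linter.unusedSectionVars false
set_option linter.style.haveILetI false
namespace WC
open Filter Topology

section
variable {l : Filter ℂ} {x y u v : ℂ → ℂ} {a b U V : ℂ}

lemma lim_aux (hx : Tendsto x l (Bornology.cobounded ℂ)) (hu : Tendsto u l (𝓝 U)) (hv : Tendsto v l (𝓝 V))
    (he : ∀ᶠ z in l, y z ^ 2 = x z ^ 3 + a * x z + b) :
    Tendsto (fun z => ((y z - v z) / (x z - u z)) ^ 2 - x z - u z) l (𝓝 U) ∧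
    Tendsto (fun z => -(((y z - v z) / (x z - u z)) *
      (((y z - v z) / (x z - u z)) ^ 2 - x z - u z - x z) + y z)) l (𝓝 V) := by
  have hs : Tendsto (fun z => (x z)⁻¹) l (𝓝 0) := tendsto_inv₀_cobounded.comp hx
  have hx0 : ∀ᶠ z in l, x z ≠ 0 := hx.eventually (Bornology.eventually_ne_cobounded 0)
  have h1 : Tendsto (fun z => 1 - (x z)⁻¹ * u z) l (𝓝 1) := by
    simpa using (tendsto_const_nhds (x := (1 : ℂ))).sub (hs.mul hu)
  have h10 : ∀ᶠ z in l, 1 - (x z)⁻¹ * u z ≠ 0 := h1.eventually_ne one_ne_zero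
  have ht : Tendsto (fun z => y z * (x z)⁻¹ ^ 2) l (𝓝 0) := by
    have h2 : Tendsto (fun z => (x z)⁻¹ + a * (x z)⁻¹ ^ 3 + b * (x z)⁻¹ ^ 4) l (𝓝 0) := by
      have : Tendsto (fun w : ℂ => w + a * w ^ 3 + b * w ^ 4) (𝓝 0) (𝓝 0) := by
        have : Continuous (fun w : ℂ => w + a * w ^ 3 + b * w ^ 4) := by fun_prop
        simpa using this.tendsto 0
      exact this.comp hs
    have h3 : Tendsto (fun z => (y z * (x z)⁻¹ ^ 2) ^ 2) l (𝓝 0) := by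
      refine h2.congr' ?_
      filter_upwards [he, hx0] with z h h'
      rw [mul_pow, h]
      field_simp
    rw [tendsto_zero_iff_norm_tendsto_zero] at h3 ⊢
    have h4 := (Real.continuous_sqrt.tendsto 0).comp h3
    rw [Real.sqrt_zero] at h4
    refine h4.congr fun z => ?_
    simp only [Function.comp, norm_pow]
    rw [Real.sqrt_sq (by positivity)]
  have H : Tendsto (fun z => ((x z)⁻¹, y z * (x z)⁻¹ ^ 2, u z, v z)) l (𝓝 (0, 0, U, V)) :=
    hs.prodMk_nhds (ht.prodMk_nhds (hu.prodMk_nhds hv))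
  have hne : ∀ᶠ z in l, x z - u z ≠ 0 := by
    filter_upwards [hx0, h10] with z h h' h2
    apply h'
    rw [← sub_eq_zero.1 h2, inv_mul_cancel₀ h, sub_self]
  constructor
  · have c1 : Continuous (fun p : ℂ × ℂ × ℂ × ℂ => a * p.1 + b * p.1 ^ 2 - 2 * p.2.1 * p.2.2.2 + p.2.2.2 ^ 2 * p.1 ^ 2
      + p.2.2.1 + p.2.2.1 ^ 2 * p.1 - p.2.2.1 ^ 3 * p.1 ^ 2) := by fun_prop
    have c2 := ((c1.tendsto (0, 0, U, V)).comp H).div (h1.pow 2) (by simp)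
    simp only [mul_zero, zero_pow two_ne_zero, zero_add, zero_mul, add_zero, sub_zero, one_pow, div_one] at c2
    refine c2.congr' ?_
    filter_upwards [he, hx0, h10, hne] with z h h' h2 h3
    have e2 : (1 - (x z)⁻¹ * u z) = (x z - u z) / x z := by field_simp
    simp only [Pi.div_apply, Function.comp]
    rw [e2, div_pow, div_pow]
    field_simp
    linear_combination -h
  · have c1 : Continuous (fun p : ℂ × ℂ × ℂ × ℂ => p.2.1 * (a + b * p.1 + p.2.2.2 ^ 2 * p.1 + 3 * p.2.2.1 ^ 2
        - 2 * p.2.2.1 ^ 3 * p.1) - 2 * p.2.2.2 * (1 + a * p.1 ^ 2 + b * p.1 ^ 3) - p.2.2.2 * (a * p.1 ^ 2 + b * p.1 ^ 3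
        - 2 * p.2.2.2 * p.2.1 * p.1 + p.2.2.2 ^ 2 * p.1 ^ 3 + 3 * p.2.2.1 ^ 2 * p.1 ^ 2 - 2 * p.2.2.1 ^ 3 * p.1 ^ 3)) := by
      fun_prop
    have c2 := (hv.add (((c1.tendsto (0, 0, U, V)).comp H).div (h1.pow 3) (by simp))).neg
    have e0 : ∀ V : ℂ, -(V + -(2 * V)) = V := fun V => by ring
    simp only [mul_zero, zero_pow two_ne_zero, zero_pow three_ne_zero, zero_add, zero_mul, add_zero, sub_zero, one_pow,
      div_one, mul_one, zero_sub, e0] at c2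
    refine c2.congr' ?_
    filter_upwards [he, hx0, h10, hne] with z h h' h2 h3
    have e2 : (1 - (x z)⁻¹ * u z) = (x z - u z) / x z := by field_simp
    simp only [Pi.div_apply, Function.comp]
    rw [e2, div_pow, div_pow]
    field_simp
    linear_combination (y z - 3 * v z) * h
end
variable (L : PeriodPair)

/-- The Weierstrass curve of a lattice. -/
noncomputable def crv : WeierstrassCurve ℂ := ⟨0, 0, 0, -(L.g₂ / 4), -(L.g₃ / 4)⟩

lemma crv_eq {z : ℂ} (hz : z ∉ L.lattice) : (L.derivWeierstrassP z / 2) ^ 2 =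
    L.weierstrassP z ^ 3 + -(L.g₂ / 4) * L.weierstrassP z + -(L.g₃ / 4) := by
  have := L.derivWeierstrassP_sq z hz
  linear_combination this / 4

lemma half_root {h : ℂ} (hh : h ∉ L.lattice) (hh2 : 2 * h ∈ L.lattice) :
    L.weierstrassP h ^ 3 + -(L.g₂ / 4) * L.weierstrassP h + -(L.g₃ / 4) = 0 := by
  have h1 : L.derivWeierstrassP h = 0 := by
    have := p'_per L (-h) hh2
    rw [show -h + 2 * h = h by ring, L.derivWeierstrassP_neg] at this
    linear_combination this / 2
  rw [← crv_eq L hh, h1]; simp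

instance crv_ell : (crv L).IsElliptic := by
  have m1 := L.ω₁_div_two_notMem_lattice
  have m2 := L.ω₂_div_two_notMem_lattice
  have m3 : L.ω₁ / 2 + L.ω₂ / 2 ∉ L.lattice := by
    have := PeriodPair.mul_ω₁_add_mul_ω₂_mem_lattice (L := L) (α := 1 / 2) (β := 1 / 2)
    intro h
    have h2 := (this.1 (by push_cast; convert h using 1; ring)).1
    norm_num at h2
  have m4 : L.ω₂ / 2 - L.ω₁ / 2 ∉ L.lattice := fun h => m3 (by
    have := add_mem h L.ω₁_mem_lattice
    convert this using 1; ring)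
  have d1 : 2 * (L.ω₁ / 2) ∈ L.lattice := by rw [mul_div_cancel₀ _ two_ne_zero]; exact L.ω₁_mem_lattice
  have d2 : 2 * (L.ω₂ / 2) ∈ L.lattice := by rw [mul_div_cancel₀ _ two_ne_zero]; exact L.ω₂_mem_lattice
  have d3 : 2 * (L.ω₁ / 2 + L.ω₂ / 2) ∈ L.lattice := by rw [mul_add]; exact add_mem d1 d2
  have r1 := half_root L m1 d1
  have r2 := half_root L m2 d2
  have r3 := half_root L m3 d3
  have n12 := half_ne L m1 d1 m2 m4
  have n13 := half_ne L m1 d1 m3 (by rwa [add_sub_cancel_left])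
  have n23 := half_ne L m2 d2 m3 (by rwa [add_sub_cancel_right])
  generalize L.weierstrassP (L.ω₁ / 2) = e1 at *
  generalize L.weierstrassP (L.ω₂ / 2) = e2 at *
  generalize L.weierstrassP (L.ω₁ / 2 + L.ω₂ / 2) = e3 at *
  refine ⟨IsUnit.mk0 _ ?_⟩
  simp only [WeierstrassCurve.Δ, crv, WeierstrassCurve.b₂, WeierstrassCurve.b₄, WeierstrassCurve.b₆, WeierstrassCurve.b₈]
  generalize -(L.g₂ / 4) = a at *
  generalize -(L.g₃ / 4) = b at *
  have k1 : e1 ^ 2 + e1 * e2 + e2 ^ 2 + a = 0 :=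
    mul_left_cancel₀ (sub_ne_zero.2 n12) (by linear_combination r2 - r1)
  have k2 : e1 ^ 2 + e1 * e3 + e3 ^ 2 + a = 0 :=
    mul_left_cancel₀ (sub_ne_zero.2 n13) (by linear_combination r3 - r1)
  have k3 : e1 + e2 + e3 = 0 :=
    mul_left_cancel₀ (sub_ne_zero.2 n23) (by linear_combination k2 - k1)
  have ha : a = -(e1 ^ 2 + e1 * e2 + e2 ^ 2) := by linear_combination k1
  have hb : b = -(e1 ^ 3 + a * e1) := by linear_combination r1
  have h3 : e3 = -(e1 + e2) := by linear_combination k3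
  have : (16 : ℂ) * ((e2 - e1) * (e3 - e1) * (e3 - e2)) ^ 2 ≠ 0 := by
    have := sub_ne_zero.2 n12
    have := sub_ne_zero.2 n13
    have := sub_ne_zero.2 n23
    simp only [ne_eq, mul_eq_zero, pow_eq_zero_iff two_ne_zero, OfNat.ofNat_ne_zero, false_or]
    tauto
  convert this using 1
  rw [hb, ha, h3]; ring

end WC

set_option linter.unusedSectionVars false
set_option linter.style.haveILetI false
namespace WC
open Filter Topology

lemma ev_hasDeriv {f g : ℂ → ℂ} {z : ℂ} {d e : ℂ} (h : HasDerivAt f d z) (hg : f = g) (hd : d = e) : HasDerivAt g e z := by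
  rw [← hg, ← hd]; exact h

lemma add_deriv {x y u v : ℂ → ℂ} {a b z : ℂ} (hx : HasDerivAt x (2 * y z) z) (hy : HasDerivAt y (3 * x z ^ 2 + a) z)
    (hu : HasDerivAt u (-(2 * v z)) z) (hv : HasDerivAt v (-(3 * u z ^ 2 + a)) z) (hne : x z ≠ u z)
    (e1 : y z ^ 2 = x z ^ 3 + a * x z + b) (e2 : v z ^ 2 = u z ^ 3 + a * u z + b) :
    HasDerivAt (fun z => ((y z - v z) / (x z - u z)) ^ 2 - x z - u z) 0 z ∧
    HasDerivAt (fun z => -(((y z - v z) / (x z - u z)) *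
      (((y z - v z) / (x z - u z)) ^ 2 - x z - u z - x z) + y z)) 0 z := by
  have hne' := sub_ne_zero.2 hne
  have hl : HasDerivAt (fun z => (y z - v z) / (x z - u z)) (x z - u z) z := by
    refine ((hy.sub hv).div (hx.sub hu) hne').congr_deriv ?_
    simp only [Pi.sub_apply]
    rw [div_eq_iff (pow_ne_zero 2 hne')]
    linear_combination -2 * e1 + 2 * e2
  set l : ℂ → ℂ := fun z => (y z - v z) / (x z - u z) with hl'
  have hlz : l z * (x z - u z) = y z - v z := by simp only [hl']; field_simp
  have hX : HasDerivAt (fun z => l z ^ 2 - x z - u z) 0 z := by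
    refine (((hl.pow 2).sub hx).sub hu).congr_deriv ?_
    linear_combination 2 * hlz
  refine ⟨hX, ?_⟩
  refine ((hl.mul (hX.sub hx)).add hy).neg.congr_deriv ?_
  simp only [Pi.sub_apply]
  apply mul_left_cancel₀ hne'
  have := e1
  linear_combination (l z * (x z - u z) + 2 * y z - (y z - v z) - l z * (x z - u z) - l z * (x z-u z)) * hlz + e1 - e2

variable (L : PeriodPair)

lemma add_thm {c z : ℂ} (hc : c ∉ L.lattice) (hz : z ∉ L.lattice) (hcz : c - z ∉ L.lattice)
    (hne : L.weierstrassP z ≠ L.weierstrassP (c - z)) :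
    ((L.derivWeierstrassP z / 2 - L.derivWeierstrassP (c - z) / 2) / (L.weierstrassP z - L.weierstrassP (c - z))) ^ 2
      - L.weierstrassP z - L.weierstrassP (c - z) = L.weierstrassP c ∧
    -(((L.derivWeierstrassP z / 2 - L.derivWeierstrassP (c - z) / 2) / (L.weierstrassP z - L.weierstrassP (c - z))) *
      (((L.derivWeierstrassP z / 2 - L.derivWeierstrassP (c - z) / 2) / (L.weierstrassP z - L.weierstrassP (c - z))) ^ 2
      - L.weierstrassP z - L.weierstrassP (c - z) - L.weierstrassP z) + L.derivWeierstrassP z / 2) =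
      L.derivWeierstrassP c / 2 := by
  set x : ℂ → ℂ := L.weierstrassP
  set y : ℂ → ℂ := fun z => L.derivWeierstrassP z / 2
  set u : ℂ → ℂ := fun z => L.weierstrassP (c - z)
  set v : ℂ → ℂ := fun z => L.derivWeierstrassP (c - z) / 2
  have mx : Meromorphic x := L.meromorphic_weierstrassP
  have my : Meromorphic y := L.meromorphic_derivWeierstrassP.div (Meromorphic.const _)
  have mu : Meromorphic u := by
    have := mero_comp mx (-1) c
    convert this using 2
    simp only [u, x]; congr 1; ring
  have mv : Meromorphic v := by
    have := mero_comp my (-1) c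
    convert this using 2
    simp only [v, y]; congr 2; ring
  set X : ℂ → ℂ := fun z => ((y z - v z) / (x z - u z)) ^ 2 - x z - u z with hX
  set Y : ℂ → ℂ := fun z => -(((y z - v z) / (x z - u z)) *
      (((y z - v z) / (x z - u z)) ^ 2 - x z - u z - x z) + y z) with hY
  have ml : Meromorphic (fun z => (y z - v z) / (x z - u z)) := (my.sub mv).div (mx.sub mu)
  have mX : Meromorphic X := ((ml.pow (n := 2)).sub mx).sub mu
  have mY : Meromorphic Y := ((ml.mul (mX.sub mx)).add my).neg
  have D : ∀ w, w ∉ L.lattice → c - w ∉ L.lattice → x w ≠ u w → HasDerivAt X 0 w ∧ HasDerivAt Y 0 w := by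
    intro w hw hcw hn
    have hs : HasDerivAt (fun w : ℂ => c - w) (-1) w := by simpa using (hasDerivAt_id w).const_sub c
    refine add_deriv (a := -(L.g₂ / 4)) (b := -(L.g₃ / 4)) ?_ ?_ ?_ ?_ hn (crv_eq L hw) (crv_eq L hcw)
    · refine (p_deriv L hw).congr_deriv ?_
      simp only [y]; ring
    · refine ((p'_deriv L hw).div_const 2).congr_deriv ?_
      simp only [x]; ring
    · refine ((p_deriv L hcw).comp w hs).congr_deriv ?_
      simp only [v]; ring
    · refine (((p'_deriv L hcw).comp w hs).div_const 2).congr_deriv ?_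
      simp only [u]; ring
  have e0 : ∀ᶠ w in 𝓝[≠] (0 : ℂ), w ∉ L.lattice := ev_notMem L 0
  have hcont : Tendsto (fun w : ℂ => c - w) (𝓝[≠] 0) (𝓝 c) := by
    have : Continuous (fun w : ℂ => c - w) := by fun_prop
    have := this.tendsto 0
    rw [sub_zero] at this
    exact this.mono_left nhdsWithin_le_nhds
  have e1 : ∀ᶠ w in 𝓝[≠] (0 : ℂ), c - w ∉ L.lattice := hcont.eventually (ev_notMem_nhds L hc)
  have hxi : Tendsto x (𝓝[≠] 0) (Bornology.cobounded ℂ) := p_inf L (zero_mem _)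
  have hu : Tendsto u (𝓝[≠] 0) (𝓝 (x c)) := (p_an L hc).continuousAt.tendsto.comp hcont
  have hv : Tendsto v (𝓝[≠] 0) (𝓝 (y c)) := ((p'_an L hc).continuousAt.tendsto.comp hcont).div_const 2
  have e2 : ∀ᶠ w in 𝓝[≠] (0 : ℂ), x w ≠ u w := by
    have h1 := hu.norm.eventually (gt_mem_nhds (lt_add_one ‖x c‖))
    have h2 := (tendsto_norm_atTop_iff_cobounded.2 hxi).eventually (eventually_ge_atTop (‖x c‖ + 1))
    filter_upwards [h1, h2] with w h1 h2 h3
    rw [h3] at h2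
    linarith
  obtain ⟨c1, hc1⟩ := mero_const mX (z₀ := 0) (by
    filter_upwards [e0, e1, e2] with w a1 a2 a3 using (D w a1 a2 a3).1)
  obtain ⟨c2, hc2⟩ := mero_const mY (z₀ := 0) (by
    filter_upwards [e0, e1, e2] with w a1 a2 a3 using (D w a1 a2 a3).2)
  obtain ⟨l1, l2⟩ := lim_aux (y := y) (a := -(L.g₂ / 4)) (b := -(L.g₃ / 4)) hxi hu hv (by
    filter_upwards [e0] with w hw using crv_eq L hw)
  have f1 := tendsto_nhds_unique (l1.congr' (hc1 0)) tendsto_const_nhds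
  have f2 := tendsto_nhds_unique (l2.congr' (hc2 0)) tendsto_const_nhds
  have g1 := ((D z hz hcz hne).1.continuousAt.tendsto.mono_left (nhdsWithin_le_nhds (s := {z}ᶜ)))
  have g2 := ((D z hz hcz hne).2.continuousAt.tendsto.mono_left (nhdsWithin_le_nhds (s := {z}ᶜ)))
  have h1 := tendsto_nhds_unique (g1.congr' (hc1 z)) tendsto_const_nhds
  have h2 := tendsto_nhds_unique (g2.congr' (hc2 z)) tendsto_const_nhds
  exact ⟨h1.trans f1.symm, h2.trans f2.symm⟩

end WC

set_option linter.unusedSectionVars false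
set_option linter.style.haveILetI false
namespace WC
open Filter Topology WeierstrassCurve WeierstrassCurve.Affine

section
open scoped Classical

lemma crv_nonsing (L : PeriodPair) {x y : ℂ} (h : y ^ 2 = x ^ 3 + -(L.g₂ / 4) * x + -(L.g₃ / 4)) :
    (crv L).toAffine.Nonsingular x y := by
  refine (crv L).toAffine.equation_iff_nonsingular.1 ?_
  rw [WeierstrassCurve.Affine.equation_iff]
  simp only [crv]
  linear_combination h

/-- The uniformisation map. -/
noncomputable def phi (L : PeriodPair) (z : ℂ) : (crv L).toAffine.Point :=
  if hz : z ∈ L.lattice then 0 else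
    Point.some (L.weierstrassP z) (L.derivWeierstrassP z / 2) (crv_nonsing L (crv_eq L hz))

variable (L : PeriodPair)

lemma phi_mem {z : ℂ} (hz : z ∈ L.lattice) : phi L z = 0 := by simp [phi, hz]

lemma phi_notMem {z : ℂ} (hz : z ∉ L.lattice) : phi L z =
    Point.some (L.weierstrassP z) (L.derivWeierstrassP z / 2) (crv_nonsing L (crv_eq L hz)) := by simp [phi, hz]

lemma phi_eq_zero {z : ℂ} : phi L z = 0 ↔ z ∈ L.lattice := by
  refine ⟨fun h => ?_, phi_mem L⟩
  by_contra hz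
  rw [phi_notMem L hz] at h
  exact Point.some_ne_zero _ h

lemma phi_ne {z : ℂ} (hz : z ∉ L.lattice) : phi L z ≠ 0 := fun h => hz ((phi_eq_zero L).1 h)

lemma xc_phi {z : ℂ} (hz : z ∉ L.lattice) : xc (phi L z) = L.weierstrassP z := by rw [phi_notMem L hz, xc_some]
lemma yc_phi {z : ℂ} (hz : z ∉ L.lattice) : yc (phi L z) = L.derivWeierstrassP z / 2 := by
  rw [phi_notMem L hz, yc_some]

lemma phi_neg (z : ℂ) : phi L (-z) = -phi L z := by
  by_cases hz : z ∈ L.lattice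
  · rw [phi_mem L hz, phi_mem L (neg_mem hz), neg_zero]
  · have hz' : -z ∉ L.lattice := fun h => hz (by simpa using neg_mem h)
    refine point_ext (phi_ne L hz') (neg_ne_zero.2 (phi_ne L hz)) ?_ ?_
    · rw [xc_neg, xc_phi L hz, xc_phi L hz', L.weierstrassP_neg]
    · rw [yc_neg (phi_ne L hz), yc_phi L hz, yc_phi L hz', L.derivWeierstrassP_neg]
      simp only [crv]; ring

lemma phi_per (z : ℂ) {l : ℂ} (hl : l ∈ L.lattice) : phi L (z + l) = phi L z := by
  by_cases hz : z ∈ L.lattice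
  · rw [phi_mem L hz, phi_mem L (add_mem hz hl)]
  · have hz' : z + l ∉ L.lattice := fun h => hz (by simpa using sub_mem h hl)
    refine point_ext (phi_ne L hz') (phi_ne L hz) ?_ ?_
    · rw [xc_phi L hz, xc_phi L hz', p_per L z hl]
    · rw [yc_phi L hz, yc_phi L hz', p'_per L z hl]

lemma phi_add_gen {a b : ℂ} (ha : a ∉ L.lattice) (hb : b ∉ L.lattice) (hab : a + b ∉ L.lattice)
    (hne : L.weierstrassP a ≠ L.weierstrassP b) : phi L (a + b) = phi L a + phi L b := by
  have e : a + b - a = b := by ring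
  obtain ⟨h1, h2⟩ := add_thm L hab ha (by rwa [e]) (by rwa [e])
  rw [e] at h1 h2
  have hxne : xc (phi L a) ≠ xc (phi L b) := by rwa [xc_phi L ha, xc_phi L hb]
  obtain ⟨f1, f2⟩ := add_formula (phi_ne L ha) (phi_ne L hb) hxne
    (l := (L.derivWeierstrassP a / 2 - L.derivWeierstrassP b / 2) / (L.weierstrassP a - L.weierstrassP b)) (by
      rw [xc_phi L ha, xc_phi L hb, yc_phi L ha, yc_phi L hb]
      rw [div_mul_cancel₀ _ (sub_ne_zero.2 hne)])
  have g1 : xc (phi L a + phi L b) = L.weierstrassP (a + b) := by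
    rw [f1, ← h1, xc_phi L ha, xc_phi L hb]
    simp only [crv]; ring
  refine point_ext (phi_ne L hab) ?_ ?_ ?_
  · intro h0
    apply hxne
    rw [eq_neg_of_add_eq_zero_left h0, xc_neg]
  · rw [g1, xc_phi L hab]
  · rw [f2, g1, yc_phi L hab, ← h2, h1, xc_phi L ha, yc_phi L ha]
    simp only [crv]; ring

lemma phi_add (a b : ℂ) : phi L (a + b) = phi L a + phi L b := by
  by_cases ha : a ∈ L.lattice
  · rw [phi_mem L ha, zero_add, add_comm, phi_per L _ ha]
  by_cases hb : b ∈ L.lattice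
  · rw [phi_mem L hb, add_zero, phi_per L _ hb]
  by_cases hab : a + b ∈ L.lattice
  · rw [phi_mem L hab]
    have : phi L b = phi L (-a) := by
      have := phi_per L (-a) hab
      rwa [neg_add_cancel_left] at this
    rw [this, phi_neg, add_neg_cancel]
  by_cases hne : L.weierstrassP a = L.weierstrassP b
  swap
  · exact phi_add_gen L ha hb hab hne
  -- generic perturbation
  have t1 : Tendsto (fun w : ℂ => a - w) (𝓝[≠] 0) (𝓝 a) := by
    have : Continuous (fun w : ℂ => a - w) := by fun_prop
    have := this.tendsto 0
    rw [sub_zero] at this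
    exact this.mono_left nhdsWithin_le_nhds
  have t2 : Tendsto (fun w : ℂ => w + b) (𝓝[≠] 0) (𝓝 b) := by
    have : Continuous (fun w : ℂ => w + b) := by fun_prop
    have := this.tendsto 0
    rw [zero_add] at this
    exact this.mono_left nhdsWithin_le_nhds
  have e0 := ev_notMem L 0
  have e1 : ∀ᶠ w in 𝓝[≠] (0 : ℂ), a - w ∉ L.lattice := t1.eventually (ev_notMem_nhds L ha)
  have e2 : ∀ᶠ w in 𝓝[≠] (0 : ℂ), w + b ∉ L.lattice := t2.eventually (ev_notMem_nhds L hb)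
  have hxi := tendsto_norm_atTop_iff_cobounded.2 (p_inf L (zero_mem L.lattice))
  have e3 : ∀ᶠ w in 𝓝[≠] (0 : ℂ), L.weierstrassP (a - w) ≠ L.weierstrassP w := by
    have hu := (p_an L ha).continuousAt.tendsto.comp t1
    have h1 := hu.norm.eventually (gt_mem_nhds (lt_add_one ‖L.weierstrassP a‖))
    filter_upwards [h1, hxi.eventually (eventually_ge_atTop (‖L.weierstrassP a‖ + 1))] with w h1 h2 h3
    rw [← h3] at h2
    simp only [Function.comp] at h1
    linarith
  have e4 : ∀ᶠ w in 𝓝[≠] (0 : ℂ), L.weierstrassP w ≠ L.weierstrassP b := p_sub_ne L _ 0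
  have e5 : ∀ᶠ w in 𝓝[≠] (0 : ℂ), L.weierstrassP (a - w) ≠ L.weierstrassP (w + b) := by
    have m1 := mero_comp L.meromorphic_weierstrassP (-1) a
    have m2 := mero_comp L.meromorphic_weierstrassP 1 b
    have t3 : Tendsto (fun w : ℂ => -1 * w + a) (𝓝[≠] (-b)) (𝓝 (a + b)) := by
      have : Continuous (fun w : ℂ => -1 * w + a) := by fun_prop
      have := this.tendsto (-b)
      rw [show -1 * -b + a = a + b by ring] at this
      exact this.mono_left nhdsWithin_le_nhds
    have t4 := shift_tendsto (-b) b
    rw [neg_add_cancel] at t4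
    have hu := (p_an L hab).continuousAt.tendsto.comp t3
    have h1 := hu.norm.eventually (gt_mem_nhds (lt_add_one ‖L.weierstrassP (a + b)‖))
    have := mero_ne (m1.sub m2) (z₀ := -b) (by
      refine Filter.Eventually.frequently ?_
      filter_upwards [h1, t4.eventually (hxi.eventually (eventually_ge_atTop (‖L.weierstrassP (a + b)‖ + 1)))]
        with w h1 h2 h3
      simp only [Pi.sub_apply, one_mul] at h3
      rw [← sub_eq_zero.1 h3] at h2
      simp only [Function.comp] at h1
      linarith) 0
    filter_upwards [this] with w hw h
    apply hw
    simp only [Pi.sub_apply, one_mul]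
    rw [show -1 * w + a = a - w by ring, h, sub_self]
  obtain ⟨w, h0, h1, h2, h3, h4, h5⟩ := (e0.and (e1.and (e2.and (e3.and (e4.and e5))))).exists
  have k1 := phi_add_gen L h1 h0 (by rwa [sub_add_cancel]) h3
  have k2 := phi_add_gen L h0 hb h2 h4
  have k3 := phi_add_gen L h1 h2 (by rwa [show a - w + (w + b) = a + b by ring]) h5
  rw [show a - w + (w + b) = a + b by ring] at k3
  rw [sub_add_cancel] at k1
  rw [k3, k1, k2, add_assoc]

lemma phi_surj : Function.Surjective (phi L) := by
  intro P
  by_cases hP : P = 0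
  · exact ⟨0, by rw [hP]; exact phi_mem L (zero_mem _)⟩
  · obtain ⟨z, hz, h⟩ := p_surj L (xc P)
    rw [← xc_phi L hz] at h
    rcases (xc_eq_iff (phi_ne L hz) hP).1 h with h | h
    · exact ⟨z, h⟩
    · exact ⟨-z, by rw [phi_neg, h, neg_neg]⟩

/-- Uniformisation as a homomorphism. -/
noncomputable def Phi : ℂ →+ (crv L).toAffine.Point := AddMonoidHom.mk' (phi L) (phi_add L)

end
end WC

set_option linter.unusedSectionVars false
set_option linter.style.haveILetI false
namespace WC
open Filter Topology Polynomial

lemma ord_even {f : ℂ → ℂ} (hf : Meromorphic f) (he : ∀ z, f (-z) = f z) (h : 0 < meromorphicOrderAt f 0) :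
    ((2 : ℤ) : WithTop ℤ) ≤ meromorphicOrderAt f 0 := by
  cases hn : meromorphicOrderAt f 0 with
  | top => exact le_top
  | coe n =>
    rw [hn, ← WithTop.coe_zero, WithTop.coe_lt_coe] at h
    rw [WithTop.coe_le_coe]
    by_contra h2
    have h1 : n = 1 := by omega
    subst h1
    obtain ⟨g, hg, hg0, hfg⟩ := (meromorphicOrderAt_eq_int_iff (hf 0)).1 hn
    have hneg : Tendsto (fun z : ℂ => -z) (𝓝[≠] 0) (𝓝[≠] 0) := by
      refine tendsto_nhdsWithin_iff.2 ⟨?_, ?_⟩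
      · have : Continuous (fun z : ℂ => -z) := by fun_prop
        simpa using (this.tendsto 0).mono_left nhdsWithin_le_nhds
      · filter_upwards [self_mem_nhdsWithin] with z hz
        simpa using hz
    have hgt : Tendsto g (𝓝[≠] 0) (𝓝 (g 0)) := hg.continuousAt.tendsto.mono_left nhdsWithin_le_nhds
    have h3 : Tendsto (fun z => -g (-z)) (𝓝[≠] 0) (𝓝 (-g 0)) := (hgt.comp hneg).neg
    have h4 := tendsto_nhds_unique (h3.congr' (f₂ := g) (by
      filter_upwards [hfg, hneg.eventually hfg, self_mem_nhdsWithin] with z h5 h6 hz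
      rw [he, h5] at h6
      simp only [sub_zero, zpow_one, smul_eq_mul] at h6
      have hz : z ≠ 0 := hz
      apply mul_left_cancel₀ hz
      linear_combination -h6)) hgt
    apply hg0
    linear_combination -h4 / 2

variable (L : PeriodPair)

lemma poly_mero (P : Polynomial ℂ) {f : ℂ → ℂ} (hf : Meromorphic f) : Meromorphic (fun z => P.eval (f z)) := by
  induction P using Polynomial.induction_on' with
  | add p q hp hq =>
    simp only [eval_add]
    exact hp.add hq
  | monomial n a =>
    simp only [eval_monomial]
    exact (Meromorphic.const a).mul (hf.pow (n := n))

lemma poly_ne {P : Polynomial ℂ} (hP : P ≠ 0) (z : ℂ) : ∀ᶠ w in 𝓝[≠] z, P.eval (L.weierstrassP w) ≠ 0 := by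
  have : ∀ᶠ w in 𝓝[≠] z, ∀ r ∈ P.roots.toFinset, L.weierstrassP w ≠ r :=
    (Filter.eventually_all_finset _).2 fun r _ => p_sub_ne L r z
  filter_upwards [this] with w hw h0
  exact hw _ (by rw [Multiset.mem_toFinset, mem_roots hP]; exact h0) rfl

lemma poly_zero {P : Polynomial ℂ} {z : ℂ} (h : ∀ᶠ w in 𝓝[≠] z, P.eval (L.weierstrassP w) = 0) : P = 0 := by
  by_contra hP
  obtain ⟨w, h1, h2⟩ := ((poly_ne L hP z).and h).exists
  exact h1 h2

lemma poly_ord : ∀ (n : ℕ) (P : Polynomial ℂ), P ≠ 0 → P.natDegree = n →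
    meromorphicOrderAt (fun z => P.eval (L.weierstrassP z)) 0 = ((-2 * n : ℤ) : WithTop ℤ) := by
  intro n
  induction n with
  | zero =>
    intro P hP hn
    rw [eq_C_of_natDegree_eq_zero hn] at hP ⊢
    have hc : P.coeff 0 ≠ 0 := fun h => hP (by rw [h, C_0])
    simp only [eval_C]
    have := meromorphicOrderAt_const (0 : ℂ) (P.coeff 0)
    rw [this, if_neg hc]; rfl
  | succ n ih =>
    intro P hP hn
    have hd : P.divX.natDegree = n := by rw [natDegree_divX_eq_natDegree_tsub_one, hn]; rfl
    have hd0 : P.divX ≠ 0 := by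
      intro h
      have := divX_mul_X_add P
      rw [h, zero_mul, zero_add] at this
      rw [← this, natDegree_C] at hn
      omega
    have h1 := ih P.divX hd0 hd
    have m1 := poly_mero P.divX L.meromorphic_weierstrassP
    have h2 : meromorphicOrderAt (fun z => P.divX.eval (L.weierstrassP z) * L.weierstrassP z) 0 =
        ((-2 * (n + 1 : ℕ) : ℤ) : WithTop ℤ) := by
      have := meromorphicOrderAt_mul (m1 0) (L.meromorphic_weierstrassP 0)
      rw [h1, ord_p L (zero_mem _), ← WithTop.coe_add] at this
      refine this.trans ?_
      congr 1; push_cast; ring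
    have h3 := ord_sub_const_neg (m1.mul L.meromorphic_weierstrassP) (z := 0) (by
      refine h2.trans_lt ?_
      rw [← WithTop.coe_zero, WithTop.coe_lt_coe]; omega) (-P.coeff 0)
    rw [← h2]
    refine Eq.trans ?_ h3
    congr 1
    funext z
    conv_lhs => rw [← divX_mul_X_add P]
    simp

lemma even_poly_aux : ∀ (k : ℕ) (f : ℂ → ℂ), Meromorphic f → (∀ z, ∀ l ∈ L.lattice, f (z + l) = f z) →
    (∀ z, f (-z) = f z) → (∀ z, z ∉ L.lattice → 0 ≤ meromorphicOrderAt f z) →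
    ((-2 * k : ℤ) : WithTop ℤ) ≤ meromorphicOrderAt f 0 →
    ∃ P : Polynomial ℂ, ∀ z, ∀ᶠ w in 𝓝[≠] z, f w = P.eval (L.weierstrassP w) := by
  intro k
  induction k with
  | zero =>
    intro f hf hper _ h0 h1
    obtain ⟨c, hc⟩ := liouville L hf (fun z => by
      by_cases hz : z ∈ L.lattice
      · have h2 := ord_comp (f := f) (one_ne_zero) z 0
        simp only [one_mul, zero_add, mul_zero] at h2
        rw [← h2]
        have : (fun w => f (w + z)) = f := funext fun w => hper w z hz
        rw [this]
        simpa using h1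
      · exact h0 z hz) hper
    exact ⟨C c, fun z => by simpa using hc z⟩
  | succ k ih =>
    intro f hf hper heven h0 h1
    have mp := L.meromorphic_weierstrassP
    have mk : Meromorphic (fun z => L.weierstrassP z ^ (k + 1)) := mp.pow
    have ok : meromorphicOrderAt (fun z => L.weierstrassP z ^ (k + 1)) 0 = ((-2 * (k + 1 : ℕ) : ℤ) : WithTop ℤ) := by
      have := poly_ord L (k + 1) (X ^ (k + 1)) (pow_ne_zero _ X_ne_zero) (natDegree_X_pow _)
      simpa using this
    set g : ℂ → ℂ := fun z => f z / L.weierstrassP z ^ (k + 1) with hg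
    have mg : Meromorphic g := hf.div mk
    have hgp : ∀ z, ∀ᶠ w in 𝓝[≠] z, g w * L.weierstrassP w ^ (k + 1) = f w := fun z => by
      filter_upwards [p_sub_ne L 0 z] with w hw
      simp only [hg]; field_simp
    have hadd : meromorphicOrderAt f 0 = meromorphicOrderAt g 0 + ((-2 * (k + 1 : ℕ) : ℤ) : WithTop ℤ) := by
      rw [← ok, ← meromorphicOrderAt_mul (mg 0) (mk 0)]
      exact meromorphicOrderAt_congr ((hgp 0).mono fun w hw => hw.symm)
    have og : 0 ≤ meromorphicOrderAt g 0 := by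
      rw [hadd] at h1
      cases hn : meromorphicOrderAt g 0 with
      | top => exact le_top
      | coe n =>
        rw [hn, ← WithTop.coe_add, WithTop.coe_le_coe] at h1
        rw [← WithTop.coe_zero, WithTop.coe_le_coe]; omega
    obtain ⟨c, hc⟩ := (tendsto_nhds_iff_meromorphicOrderAt_nonneg (mg 0)).2 og
    have mgc : Meromorphic (fun z => g z - c) := mg.sub (Meromorphic.const c)
    have h2 : 0 < meromorphicOrderAt (fun z => g z - c) 0 :=
      (tendsto_zero_iff_meromorphicOrderAt_pos (mgc 0)).1 (by simpa using hc.sub_const c)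
    have h3 := ord_even mgc (fun z => by simp only [hg, heven, L.weierstrassP_neg]) h2
    have mF : Meromorphic (fun z => f z - c * L.weierstrassP z ^ (k + 1)) := hf.sub ((Meromorphic.const c).mul mk)
    obtain ⟨P, hP⟩ := ih (fun z => f z - c * L.weierstrassP z ^ (k + 1)) mF
      (fun z l hl => by simp only [hper z l hl, p_per L z hl])
      (fun z => by simp only [heven, L.weierstrassP_neg]) (fun z hz => by
        have a1 := h0 z hz
        have a2 : 0 ≤ meromorphicOrderAt (fun z => -(c * L.weierstrassP z ^ (k + 1))) z :=
          ((analyticAt_const.mul ((p_an L hz).pow _)).neg).meromorphicOrderAt_nonneg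
        have a3 := meromorphicOrderAt_add (hf z) (((Meromorphic.const c).mul mk).neg z)
        refine (le_min a1 a2).trans (a3.trans_eq ?_)
        congr 1) (by
        have a1 : meromorphicOrderAt (fun z => f z - c * L.weierstrassP z ^ (k + 1)) 0 =
          meromorphicOrderAt ((fun z => g z - c) * (fun z => L.weierstrassP z ^ (k + 1))) 0 :=
          meromorphicOrderAt_congr ((hgp 0).mono fun w hw => by
            simp only [Pi.mul_apply]; rw [← hw]; ring)
        rw [a1, meromorphicOrderAt_mul (mgc 0) (mk 0), ok]
        refine le_trans ?_ (add_le_add h3 le_rfl)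
        rw [← WithTop.coe_add, WithTop.coe_le_coe]; push_cast; omega)
    refine ⟨P + C c * X ^ (k + 1), fun z => ?_⟩
    filter_upwards [hP z] with w hw
    simp only [eval_add, eval_mul, eval_C, eval_pow, eval_X, ← hw]; ring

lemma even_poly {f : ℂ → ℂ} (hf : Meromorphic f) (hper : ∀ z, ∀ l ∈ L.lattice, f (z + l) = f z)
    (heven : ∀ z, f (-z) = f z) (h0 : ∀ z, z ∉ L.lattice → 0 ≤ meromorphicOrderAt f z) :
    ∃ P : Polynomial ℂ, ∀ z, ∀ᶠ w in 𝓝[≠] z, f w = P.eval (L.weierstrassP w) := by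
  cases hn : meromorphicOrderAt f 0 with
  | top => exact even_poly_aux L 0 f hf hper heven h0 (by rw [hn]; exact le_top)
  | coe n =>
    refine even_poly_aux L n.natAbs f hf hper heven h0 ?_
    rw [hn, WithTop.coe_le_coe]; omega

lemma finite_vals {α : ℂ} (hα : α ≠ 0) (hαL : ∀ l ∈ L.lattice, α * l ∈ L.lattice) :
    {c : ℂ | ∃ a, a ∉ L.lattice ∧ α * a ∈ L.lattice ∧ c = L.weierstrassP a}.Finite := by
  have hb := ZSpan.fundamentalDomain_isBounded L.basis
  obtain ⟨R, hR⟩ := hb.exists_norm_le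
  have hD : DiscreteTopology L.lattice := inferInstance
  have h1 : ((Metric.closedBall (0 : ℂ) (‖α‖ * R)) ∩ (L.lattice : Set ℂ)).Finite :=
    Metric.finite_isBounded_inter_isClosed (isDiscrete_iff_discreteTopology.2 hD) Metric.isBounded_closedBall L.isClosed_lattice
  refine (h1.image (fun w => L.weierstrassP (α⁻¹ * w))).subset ?_
  rintro c ⟨a, ha, hαa, rfl⟩
  have hfl : (ZSpan.floor L.basis a : ℂ) ∈ L.lattice := by
    rw [L.lattice_eq_span_range_basis]
    exact (ZSpan.floor L.basis a).2
  have hfr : ZSpan.fract L.basis a = a - (ZSpan.floor L.basis a : ℂ) := rfl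
  refine ⟨α * ZSpan.fract L.basis a, ⟨?_, ?_⟩, ?_⟩
  · rw [mem_closedBall_zero_iff, norm_mul]
    exact mul_le_mul_of_nonneg_left (hR _ (ZSpan.fract_mem_fundamentalDomain L.basis a)) (norm_nonneg _)
  · rw [hfr, mul_sub]
    exact sub_mem hαa (hαL _ hfl)
  · simp only
    rw [inv_mul_cancel_left₀ hα, hfr, sub_eq_add_neg, p_per L _ (neg_mem hfl)]
end WC

set_option linter.unusedSectionVars false
set_option linter.style.haveILetI false
namespace WC
open Filter Topology Polynomial

lemma rat_rep (L : PeriodPair) {α : ℂ} (hα : α ≠ 0) (hαL : ∀ l ∈ L.lattice, α * l ∈ L.lattice) :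
    ∃ A B : Polynomial ℂ, IsCoprime A B ∧ A.Monic ∧ B ≠ 0 ∧ A.natDegree = B.natDegree + 1 ∧
      ∀ z, ∀ᶠ w in 𝓝[≠] z, L.weierstrassP (α * w) * B.eval (L.weierstrassP w) = A.eval (L.weierstrassP w) := by
  have mp := L.meromorphic_weierstrassP
  have mα : Meromorphic (fun z => L.weierstrassP (α * z)) := by simpa using mero_comp mp α 0
  have oα : ∀ z, meromorphicOrderAt (fun z => L.weierstrassP (α * z)) z = meromorphicOrderAt L.weierstrassP (α * z) := by
    intro z
    simpa using ord_comp (f := L.weierstrassP) hα 0 z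
  set S := (finite_vals L hα hαL).toFinset with hS
  set B0 : Polynomial ℂ := ∏ c ∈ S, (X - C c) ^ 2 with hB0
  have hB00 : B0 ≠ 0 := (monic_prod_of_monic _ _ fun c _ => (monic_X_sub_C c).pow 2).ne_zero
  have mB := poly_mero B0 mp
  obtain ⟨A0, hA0⟩ := even_poly L (f := fun z => L.weierstrassP (α * z) * B0.eval (L.weierstrassP z)) (mα.mul mB)
    (fun z l hl => by simp only [mul_add, p_per L _ (hαL l hl), p_per L _ hl])
    (fun z => by simp only [mul_neg, L.weierstrassP_neg]) (by
      intro z hz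
      have hpoly : ∀ P : Polynomial ℂ, 0 ≤ meromorphicOrderAt (fun z => P.eval (L.weierstrassP z)) z := fun P =>
        (tendsto_nhds_iff_meromorphicOrderAt_nonneg (poly_mero P mp z)).1
          ⟨_, (P.continuous.continuousAt.tendsto.comp (p_an L hz).continuousAt.tendsto).mono_left nhdsWithin_le_nhds⟩
      by_cases hαz : α * z ∈ L.lattice
      · have hmem : L.weierstrassP z ∈ S := by
          rw [hS, Set.Finite.mem_toFinset]
          exact ⟨z, hz, hαz, rfl⟩
        refine ord_mul_nonneg mα mB 2 ?_ ?_
        · rw [oα z, ord_p L hαz]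
        · obtain ⟨B1, hB1⟩ : (X - C (L.weierstrassP z)) ^ 2 ∣ B0 := Finset.dvd_prod_of_mem _ hmem
          have m1 := poly_mero (X - C (L.weierstrassP z)) mp
          have e1 : (fun z => B0.eval (L.weierstrassP z)) =
            ((fun w => (X - C (L.weierstrassP z)).eval (L.weierstrassP w)) ^ 2) * (fun w => B1.eval (L.weierstrassP w)) := by
            funext w
            simp [hB1]
          rw [e1, meromorphicOrderAt_mul (m1.pow z) (poly_mero B1 mp z), pow_two, meromorphicOrderAt_mul (m1 z) (m1 z)]
          have h1 : 0 < meromorphicOrderAt (fun w => (X - C (L.weierstrassP z)).eval (L.weierstrassP w)) z := by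
            refine (tendsto_zero_iff_meromorphicOrderAt_pos (m1 z)).1 ?_
            have := ((p_an L hz).continuousAt.tendsto.sub_const (L.weierstrassP z)).mono_left
              (nhdsWithin_le_nhds (s := {z}ᶜ))
            simpa using this
          have h2 : ((1 : ℤ) : WithTop ℤ) ≤
              meromorphicOrderAt (fun w => (X - C (L.weierstrassP z)).eval (L.weierstrassP w)) z := by
            revert h1
            cases meromorphicOrderAt (fun w => (X - C (L.weierstrassP z)).eval (L.weierstrassP w)) z with
            | top => intro _; exact le_top
            | coe n =>
              rw [← WithTop.coe_zero, WithTop.coe_lt_coe, WithTop.coe_le_coe]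
              intro h; omega
          have h3 := add_le_add (add_le_add h2 h2) (hpoly B1)
          rw [add_zero] at h3
          exact h3
      · have := ord_mul_nonneg mα mB (z := z) 0 (by
          rw [oα z]; simpa using (p_an L hαz).meromorphicOrderAt_nonneg) (by simpa using hpoly B0)
        exact this)
  have ordeq : ∀ {A B : Polynomial ℂ}, B ≠ 0 →
      (∀ z, ∀ᶠ w in 𝓝[≠] z, L.weierstrassP (α * w) * B.eval (L.weierstrassP w) = A.eval (L.weierstrassP w)) →
      A ≠ 0 ∧ A.natDegree = B.natDegree + 1 := by
    intro A B hB h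
    have h1 : meromorphicOrderAt ((fun z => L.weierstrassP (α * z)) * (fun z => B.eval (L.weierstrassP z))) 0 =
      meromorphicOrderAt (fun z => A.eval (L.weierstrassP z)) 0 := meromorphicOrderAt_congr (h 0)
    rw [meromorphicOrderAt_mul (mα 0) (poly_mero B mp 0), oα, mul_zero, ord_p L (zero_mem _),
      poly_ord L _ B hB rfl, ← WithTop.coe_add] at h1
    have hA : A ≠ 0 := by
      intro h0
      rw [h0] at h1
      simp only [eval_zero] at h1
      rw [meromorphicOrderAt_const, if_pos rfl] at h1
      exact WithTop.coe_ne_top h1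
    refine ⟨hA, ?_⟩
    rw [poly_ord L _ A hA rfl, WithTop.coe_eq_coe] at h1
    omega
  obtain ⟨hA00, -⟩ := ordeq hB00 hA0
  obtain ⟨G, A1, B1, hA1, hB1, a, b, hab⟩ : ∃ G A1 B1 : Polynomial ℂ, A0 = G * A1 ∧ B0 = G * B1 ∧
      ∃ a b, G = A0 * a + B0 * b := by
    obtain ⟨A1, hA1⟩ := EuclideanDomain.gcd_dvd_left A0 B0
    obtain ⟨B1, hB1⟩ := EuclideanDomain.gcd_dvd_right A0 B0
    exact ⟨_, A1, B1, hA1, hB1, _, _, EuclideanDomain.gcd_eq_gcd_ab A0 B0⟩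
  have hG0 : G ≠ 0 := fun h => hB00 (by rw [hB1, h, zero_mul])
  have hcop : IsCoprime A1 B1 := by
    refine ⟨a, b, mul_left_cancel₀ hG0 ?_⟩
    linear_combination -hab - a * hA1 - b * hB1
  have hB10 : B1 ≠ 0 := fun h => hB00 (by rw [hB1, h, mul_zero])
  have h1 : ∀ z, ∀ᶠ w in 𝓝[≠] z, L.weierstrassP (α * w) * B1.eval (L.weierstrassP w) = A1.eval (L.weierstrassP w) := by
    intro z
    filter_upwards [hA0 z, poly_ne L hG0 z] with w hw hw'
    rw [hA1, hB1, eval_mul, eval_mul] at hw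
    apply mul_left_cancel₀ hw'
    linear_combination hw
  obtain ⟨hA10, hdeg⟩ := ordeq hB10 h1
  have hlc : A1.leadingCoeff⁻¹ ≠ 0 := inv_ne_zero (leadingCoeff_ne_zero.2 hA10)
  have hu : IsUnit (C A1.leadingCoeff⁻¹) := isUnit_C.2 (IsUnit.mk0 _ hlc)
  refine ⟨A1 * C A1.leadingCoeff⁻¹, B1 * C A1.leadingCoeff⁻¹, ?_, monic_mul_leadingCoeff_inv hA10,
    mul_ne_zero hB10 hu.ne_zero, ?_, fun z => ?_⟩
  · exact (isCoprime_mul_unit_right hu A1 B1).2 hcop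
  · rw [natDegree_mul_C hlc, natDegree_mul_C hlc, hdeg]
  · filter_upwards [h1 z] with w hw
    rw [eval_mul, eval_mul, ← hw]; ring
end WC

set_option linter.unusedSectionVars false
set_option linter.style.haveILetI false
namespace WC
open Filter Topology Polynomial

section
open scoped Classical
variable (L : PeriodPair)

lemma endo_der {α : ℂ} (hα : α ≠ 0) {A B : Polynomial ℂ}
    (h : ∀ z, ∀ᶠ w in 𝓝[≠] z, L.weierstrassP (α * w) * B.eval (L.weierstrassP w) = A.eval (L.weierstrassP w)) :
    (derivative A * B - A * derivative B) ^ 2 * Ψ₂ (crv L) = C (α ^ 2) * Ψh (crv L) A B := by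
  rw [← sub_eq_zero]
  refine poly_zero L (z := 0) ?_
  have e1 : ∀ᶠ w in 𝓝[≠] (0 : ℂ), α * w ∉ L.lattice := by
    have : Tendsto (fun w : ℂ => α * w) (𝓝[≠] 0) (𝓝[≠] 0) := by
      refine tendsto_nhdsWithin_iff.2 ⟨?_, ?_⟩
      · have : Continuous (fun z : ℂ => α * z) := by fun_prop
        simpa using (this.tendsto 0).mono_left nhdsWithin_le_nhds
      · filter_upwards [self_mem_nhdsWithin] with z hz
        have hz : z ≠ 0 := hz
        simpa using ⟨hα, hz⟩
    exact this.eventually (ev_notMem L 0)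
  filter_upwards [eventually_eventually_nhdsWithin.2 (h 0), h 0, self_mem_nhdsWithin, e1, ev_notMem L 0]
    with w hw h1 hw0 hαw hwL
  rw [IsOpen.nhdsWithin_eq isOpen_compl_singleton hw0] at hw
  have hs : HasDerivAt (fun w : ℂ => α * w) α w := by simpa using (hasDerivAt_id w).const_mul α
  have d0 := p_deriv L hwL
  have d1 : HasDerivAt (fun w => L.weierstrassP (α * w)) (L.derivWeierstrassP (α * w) * α) w :=
    (p_deriv L hαw).comp w hs
  have d2 : ∀ P : Polynomial ℂ, HasDerivAt (fun w => P.eval (L.weierstrassP w))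
      ((derivative P).eval (L.weierstrassP w) * L.derivWeierstrassP w) w := fun P =>
    (P.hasDerivAt _).comp w d0
  have d3 := ((d1.mul (d2 B)).congr_of_eventuallyEq
    (f₁ := fun w => A.eval (L.weierstrassP w)) (hw.mono fun _ h => h.symm)).unique (d2 A)
  have o1 := crv_eq L hwL
  have o2 := crv_eq L hαw
  simp only [Ψ₂, Ψh, eval_sub, eval_mul, eval_pow, eval_add, eval_C, eval_X, eval_ofNat, crv, WeierstrassCurve.b₂,
    WeierstrassCurve.b₄, WeierstrassCurve.b₆]
  generalize eval (L.weierstrassP w) (derivative A) = A' at *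
  generalize eval (L.weierstrassP w) (derivative B) = B' at *
  generalize eval (L.weierstrassP w) A = A0 at *
  generalize eval (L.weierstrassP w) B = B0 at *
  generalize L.weierstrassP (α * w) = x1 at *
  generalize L.weierstrassP w = x at *
  generalize L.derivWeierstrassP (α * w) = y1 at *
  generalize L.derivWeierstrassP w = y at *
  generalize L.g₂ = g2 at *
  generalize L.g₃ = g3 at *
  have d4 : y1 * α * B0 ^ 2 = (A' * B0 - A0 * B') * y := by
    linear_combination B0 * d3 - y * B' * h1
  have d5 : (y1 * α * B0 ^ 2) ^ 2 = ((A' * B0 - A0 * B') * y) ^ 2 := by rw [d4]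
  subst h1
  linear_combination -d5 - 4 * (A' * B0 - (x1 * B0) * B') ^ 2 * o1 + 4 * α ^ 2 * B0 ^ 4 * o2

lemma endo_RH {α : ℂ} (hα : α ≠ 0) (hαL : ∀ l ∈ L.lattice, α * l ∈ L.lattice) :
    ∃ e : (crv L).toAffine.Point →+ (crv L).toAffine.Point, (∀ z, e (Phi L z) = Phi L (α * z)) ∧
      ∃ A B N, RH e A B α N := by
  obtain ⟨A, B, hcop, hmon, hB0, hdeg, h⟩ := rat_rep L hα hαL
  have hsurj : Function.Surjective (Phi L) := phi_surj L
  obtain ⟨e, he⟩ : ∃ e : (crv L).toAffine.Point →+ (crv L).toAffine.Point, ∀ z, e (Phi L z) = Phi L (α * z) := by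
    have hker : (Phi L).ker ≤ ((Phi L).comp (AddMonoidHom.mulLeft α)).ker := by
      intro z hz
      rw [AddMonoidHom.mem_ker] at hz ⊢
      exact phi_mem L (hαL z ((phi_eq_zero L).1 hz))
    refine ⟨(Phi L).liftOfRightInverse _ (Function.rightInverse_surjInv hsurj)
      ⟨(Phi L).comp (AddMonoidHom.mulLeft α), hker⟩, fun z => ?_⟩
    rw [AddMonoidHom.liftOfRightInverse_comp_apply]
    rfl
  refine ⟨e, he, A, B, A.natDegree, hcop, hmon, rfl, by omega, ?_, ?_, endo_der L hα h, ?_⟩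
  · intro P hP heP
    obtain ⟨z, rfl⟩ := hsurj P
    rw [he] at heP ⊢
    have hz : z ∉ L.lattice := fun h => hP (phi_mem L h)
    have hαz : α * z ∉ L.lattice := fun h => heP (phi_mem L h)
    change xc (phi L (α * z)) * B.eval (xc (phi L z)) = A.eval (xc (phi L z))
    rw [xc_phi L hz, xc_phi L hαz]
    have c0 : ContinuousAt (fun w => L.weierstrassP (α * w)) z :=
      ContinuousAt.comp (f := fun w => α * w) (p_an L hαz).continuousAt (by fun_prop)
    have c1 : ∀ P : Polynomial ℂ, ContinuousAt (fun w => P.eval (L.weierstrassP w)) z := fun P =>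
      ContinuousAt.comp P.continuous.continuousAt (p_an L hz).continuousAt
    exact tendsto_nhds_unique_of_eventuallyEq
      ((c0.mul (c1 B)).tendsto.mono_left nhdsWithin_le_nhds)
      ((c1 A).tendsto.mono_left nhdsWithin_le_nhds) (h z)
  · intro P hP heP
    obtain ⟨z, rfl⟩ := hsurj P
    rw [he] at heP
    have hz : z ∉ L.lattice := fun h => hP (phi_mem L h)
    have hαz : α * z ∈ L.lattice := (phi_eq_zero L).1 heP
    change B.eval (xc (phi L z)) = 0
    rw [xc_phi L hz]
    have c1 : ∀ P : Polynomial ℂ, Tendsto (fun w => P.eval (L.weierstrassP w)) (𝓝[≠] z)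
        (𝓝 (P.eval (L.weierstrassP z))) := fun P =>
      (ContinuousAt.comp P.continuous.continuousAt (p_an L hz).continuousAt).tendsto.mono_left nhdsWithin_le_nhds
    have t0 : Tendsto (fun w : ℂ => α * w) (𝓝[≠] z) (𝓝[≠] (α * z)) := by
      refine tendsto_nhdsWithin_iff.2 ⟨?_, ?_⟩
      · have : Continuous (fun z : ℂ => α * z) := by fun_prop
        exact (this.tendsto z).mono_left nhdsWithin_le_nhds
      · filter_upwards [self_mem_nhdsWithin] with w hw
        have hw : w ≠ z := hw
        simpa using ⟨hw, hα⟩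
    have t1 := (p_inf L hαz).comp t0
    have t2 := tendsto_inv₀_cobounded.comp t1
    have t3 := (c1 A).mul t2
    rw [mul_zero] at t3
    refine tendsto_nhds_unique_of_eventuallyEq (c1 B) t3 ?_
    filter_upwards [h z, t1.eventually (Bornology.eventually_ne_cobounded 0)] with w h1 h2
    simp only [Function.comp] at h2 ⊢
    rw [← h1]; field_simp
  · intro P
    obtain ⟨z, rfl⟩ := hsurj P
    exact ⟨Phi L (α⁻¹ * z), by rw [he, mul_inv_cancel_left₀ hα]⟩

theorem unif_all (ω : ℂ) (hω : ω.im ≠ 0) : ∃ W : WeierstrassCurve ℂ, W.IsElliptic ∧ ∃ Φ, Unif ω W Φ := by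
  let L : PeriodPair := ⟨1, ω, by
    rw [LinearIndependent.pair_iff]
    intro s t hst
    have h1 := congrArg Complex.im hst
    have h2 := congrArg Complex.re hst
    simp at h1 h2
    have ht : t = 0 := by tauto
    subst ht
    simpa using h2⟩
  have hL : ∀ z, z ∈ L.lattice ↔ InL ω z := fun z => by
    rw [PeriodPair.mem_lattice]
    simp only [InL, L, mul_one, eq_comm]
  refine ⟨crv L, inferInstance, Phi L, phi_surj L, fun z => (phi_eq_zero L).trans (hL z), fun α hα h => ?_⟩
  exact endo_RH L hα fun l hl => (hL _).2 (h l ((hL l).1 hl))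
end

theorem backward (q d : ℕ) (hd : 0 < d) (hq : IsPrimePow q) (hbig : 56 * d ^ 2 < q)
    (Fq : Type*) [Field Fq] [Fintype Fq] (hcard : Fintype.card Fq = q) (hc : Nat.Coprime q (Nat.sqrt (4 * q) - d)) :
    ∃ E : WeierstrassCurve Fq, E.IsElliptic ∧
      Nat.card E.toAffine.Point = q + 1 + (Nat.sqrt (4 * q) - d) := by
  classical
  obtain ⟨-, -, h3⟩ := arith q d hd hbig
  rw [isPrimePow_nat_iff] at hq
  obtain ⟨p, e, hp, he, rfl⟩ := hq
  haveI : Fact p.Prime := ⟨hp⟩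
  set t := Nat.sqrt (4 * p ^ e) - d with ht
  obtain ⟨E, hE, hn⟩ := exist_of_unif unif_all (p := p) (e := e) he.ne' (-(t : ℤ)) (by
    rw [dvd_neg, Int.natCast_dvd_natCast]
    intro hpt
    have := Nat.dvd_gcd (dvd_pow_self p he.ne') hpt
    rw [hc] at this
    exact hp.one_lt.ne' (Nat.dvd_one.1 this)) (by rw [neg_sq]; exact_mod_cast h3) hcard
  refine ⟨E, hE, ?_⟩
  zify
  rw [hn]; push_cast; ring
end WC

theorem stmt15 (q d : ℕ) (hd : 0 < d) (hq : IsPrimePow q) (hbig : 56 * d ^ 2 < q)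
    (Fq : Type*) [Field Fq] [Fintype Fq] (hcard : Fintype.card Fq = q) :
    (∃ E : WeierstrassCurve Fq, E.IsElliptic ∧
      Nat.card E.toAffine.Point = q + 1 + (Nat.sqrt (4 * q) - d)) ↔
      Nat.Coprime q (Nat.sqrt (4 * q) - d) := by
  refine ⟨?_, WC.backward q d hd hq hbig Fq hcard⟩
  rintro ⟨E, hE, h⟩
  exact WC.forward q d hd hbig Fq hcard E hE h
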